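/- Assume 0 ∈ Σf, assume f satisfies central isolation (0 is an isolated point of {z ∈ U : z_0 = ⋯ = z_{s−1} = 0 and ∂f/∂z_j(z) = 0 for all s ≤ j ≤ n}), and assume f satisfies the Jacobian set equality near 0 (there is an open neighborhood W₀ ⊆ U of 0 with Σf ∩ W₀ = {z ∈ W₀ : ∂f/∂z_j(z) = 0 for all s ≤ j ≤ n}). Then there is an open neighborhood W ⊆ U of 0 such that for every p = (p', p'') ∈ Σf ∩ W, the point p is the unique point z ∈ W with z_j = p_j for all 0 ≤ j ≤ s−1 and ∂f/∂z_j(z) = 0 for all s ≤ j ≤ n. That is, each nearby slice function f_{p'} has exactly one critical point in W, and that critical point lies on Σf. -/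

import Mathlib

/-- ℂ^{n+1} identified with ℂ^s × ℂ^{n+1-s}. -/
abbrev Csp (n s : ℕ) : Type := (Fin s → ℂ) × (Fin (n + 1 - s) → ℂ)

/-- The critical locus Σf = {z ∈ U : Df(z) = 0}. -/
def SigmaF (n s : ℕ) (f : Csp n s → ℂ) (U : Set (Csp n s)) : Set (Csp n s) :=
  {z ∈ U | fderiv ℂ f z = 0}

/-- The partial derivatives ∂f/∂z_j for s ≤ j ≤ n all vanish at z. -/
def PartialsVanish (n s : ℕ) (f : Csp n s → ℂ) (z : Csp n s) : Prop :=
  ∀ j : Fin (n + 1 - s), fderiv ℂ f z (0, Pi.single j 1) = 0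

/-- Central isolation: 0 is an isolated point of
{z ∈ U : z' = 0 and ∂f/∂z_j(z) = 0 for all s ≤ j ≤ n}. -/
def CentralIsolation (n s : ℕ) (f : Csp n s → ℂ) (U : Set (Csp n s)) : Prop :=
  ∃ W : Set (Csp n s), IsOpen W ∧ (0 : Csp n s) ∈ W ∧
    ∀ z ∈ U ∩ W, z.1 = 0 → PartialsVanish n s f z → z = 0

/-- Jacobian set equality near 0: on some open neighborhood W' ⊆ U of 0,
Σf ∩ W' = {z ∈ W' : ∂f/∂z_j(z) = 0 for all s ≤ j ≤ n}. -/
def JacobianEq (n s : ℕ) (f : Csp n s → ℂ) (U : Set (Csp n s)) : Prop :=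
  ∃ W' : Set (Csp n s), IsOpen W' ∧ (0 : Csp n s) ∈ W' ∧ W' ⊆ U ∧
    SigmaF n s f U ∩ W' = {z ∈ W' | PartialsVanish n s f z}

open Finset (mem_univ mul_sum ne_of_mem_erase single_le_sum sum_add_distrib sum_comm sum_congr sum_eq_single sum_eq_zero sum_insert sum_mul sum_sub_distrib)
open Ideal (mem_span_range_iff_exists_fun mul_mem_left mul_mem_mul mul_mem_right span subset_span)
open Function (Injective iterate_succ_apply')
open ENNReal (coe_le_coe coe_lt_top mul_lt_top)
open LinearMap (mem_ker mulLeft range)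
open Finsupp (single)
open Submodule (mem_sup_left mem_sup_right mkQ_apply)
open Derivation (leibniz)
open MvPowerSeries (pderiv)

local notation:max "𝒪" m:max => MvPowerSeries (Fin m)

namespace NonSplit

open Module (End)

section Pole
variable {G : Type*} [AddCommGroup G] [Module ℚ G]

theorem end_pow_comm {f g : End ℚ G} (h : ∀ x, f (g x) = g (f x)) (n : ℕ) (x : G) :
    f ((g ^ n) x) = (g ^ n) (f x) := by
  have : Commute f g := LinearMap.ext h
  exact LinearMap.congr_fun (this.pow_right n) x

/-- The largest sublattice stable under all powers of `θ⁻¹ D`. -/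
def stableLattice (θ D : End ℚ G) : Submodule ℚ G where
  carrier := {x | ∀ n, ∃ z, (D ^ n) x = (θ ^ n) z}
  add_mem' := by
    intro a b ha hb n
    obtain ⟨z, hz⟩ := ha n
    obtain ⟨w, hw⟩ := hb n
    exact ⟨z + w, by simp [hz, hw]⟩
  zero_mem' := fun n => ⟨0, by simp⟩
  smul_mem' := by
    intro c a ha n
    obtain ⟨z, hz⟩ := ha n
    exact ⟨c • z, by simp [hz]⟩

variable {θ D y E : End ℚ G}

theorem stableLattice_step (hθ : Injective θ) (hD : ∀ x, D (θ x) = θ (D x)) {x : G}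
    (hx : x ∈ stableLattice θ D) : ∃ x' ∈ stableLattice θ D, D x = θ x' := by
  obtain ⟨x', hx'⟩ := hx 1
  simp only [pow_one] at hx'
  refine ⟨x', fun n => ?_, hx'⟩
  obtain ⟨z, hz⟩ := hx (n + 1)
  refine ⟨z, hθ ?_⟩
  rw [pow_succ, End.mul_apply, hx', ← end_pow_comm (fun x => (hD x).symm)] at hz
  rw [hz, pow_succ', End.mul_apply]

theorem stableLattice_of_comm (hD : ∀ x, D (E x) = E (D x)) (hθE : ∀ x, θ (E x) = E (θ x)) {x : G}
    (hx : x ∈ stableLattice θ D) : E x ∈ stableLattice θ D := by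
  intro n
  obtain ⟨z, hz⟩ := hx n
  refine ⟨E z, ?_⟩
  rw [← end_pow_comm (fun x => (hD x).symm), hz, end_pow_comm (fun x => (hθE x).symm)]

theorem derivation_pow_apply (hD : ∀ x, D (y x) = y (D x) + θ x) (hθy : ∀ x, θ (y x) = y (θ x))
    (n : ℕ) (x : G) : D ((y ^ (n + 1)) x) = (y ^ (n + 1)) (D x) + (n + 1 : ℚ) • θ ((y ^ n) x) := by
  induction n with
  | zero => simp [hD]
  | succ n ih =>
    rw [pow_succ', End.mul_apply, hD, ih, map_add, map_smul, ← hθy, ← End.mul_apply y,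
      ← End.mul_apply y, ← pow_succ', ← pow_succ', add_assoc]
    congr 1
    push_cast
    module

theorem pow_derivation_apply (hD : ∀ x, D (y x) = y (D x) + θ x) (hDθ : ∀ x, D (θ x) = θ (D x))
    (n : ℕ) (x : G) : (D ^ (n + 1)) (y x) = y ((D ^ (n + 1)) x) + (n + 1 : ℚ) • θ ((D ^ n) x) := by
  induction n with
  | zero => simp [hD]
  | succ n ih =>
    rw [pow_succ', End.mul_apply, ih, map_add, map_smul, hD, hDθ, ← End.mul_apply D,
      ← End.mul_apply D, ← pow_succ', ← pow_succ', add_assoc]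
    congr 1
    push_cast
    module

theorem stableLattice_mul (hD : ∀ x, D (y x) = y (D x) + θ x) (hDθ : ∀ x, D (θ x) = θ (D x))
    (hθy : ∀ x, θ (y x) = y (θ x)) {x : G}
    (hx : x ∈ stableLattice θ D) : y x ∈ stableLattice θ D := by
  rintro (_ | n)
  · exact ⟨y x, rfl⟩
  obtain ⟨z, hz⟩ := hx (n + 1)
  obtain ⟨w, hw⟩ := hx n
  refine ⟨y z + (n + 1 : ℚ) • w, ?_⟩
  rw [pow_derivation_apply hD hDθ, hz, hw, map_add, map_smul,
    end_pow_comm (fun x => (hθy x).symm), pow_succ', End.mul_apply, End.mul_apply]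

theorem pole_argument (hθ : Injective θ)
    (hDθ : ∀ x, D (θ x) = θ (D x)) (hD : ∀ x, D (y x) = y (D x) + θ x)
    (hθy : ∀ x, θ (y x) = y (θ x)) (hDE : ∀ x, D (E x) = E (D x))
    (hθE : ∀ x, θ (E x) = E (θ x))
    (R : Submodule ℚ G) (hRθ : ∀ x ∈ R, θ x ∈ R) (hRD : ∀ x ∈ R, D x ∈ R)
    (hsat : ∀ x, θ x ∈ R → x ∈ R) (d : ℕ)
    (hreg : ∀ n x, ∃ z, (D ^ n) ((θ ^ d) x) = (θ ^ n) z)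
    (hdens : ∀ M : ℕ, ∃ ν : ℕ, ∀ x ∈ R, ∃ g ∈ R, ∃ l, (y ^ ν) (E x) = g + (θ ^ M) l)
    {x : G} (hx : x ∈ R) : ∃ g ∈ R, ∃ l, E x = g + θ l := by
  have hsat' : ∀ n x, (θ ^ n) x ∈ R → x ∈ R := by
    intro n
    induction n with
    | zero => intro x h; simpa using h
    | succ n ih =>
      intro x h
      rw [pow_succ', End.mul_apply] at h
      exact ih x (hsat _ h)
  have hRθ' : ∀ n, ∀ x ∈ R, (θ ^ n) x ∈ R := by
    intro n
    induction n with
    | zero => intro x h; simpa using h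
    | succ n ih =>
      intro x h
      rw [pow_succ', End.mul_apply]
      exact hRθ _ (ih x h)
  set H := stableLattice θ D with hH
  have hdH : ∀ x, (θ ^ d) x ∈ H := fun x n => hreg n x
  have key : ∀ N ν : ℕ, (∀ x ∈ H ⊓ R, ∃ g ∈ H ⊓ R, ∃ l ∈ H, (y ^ ν) (E x) = g + (θ ^ N) l) →
      ∀ x ∈ H ⊓ R, ∃ g ∈ H ⊓ R, ∃ l ∈ H, E x = g + (θ ^ N) l := by
    intro N ν
    induction ν with
    | zero => intro h; simpa using h
    | succ ν ih =>
      intro h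
      apply ih
      rintro x ⟨hxH, hxR⟩
      obtain ⟨x', hx'H, hx'⟩ := stableLattice_step hθ hDθ hxH
      have hx'R : x' ∈ R := hsat _ (hx' ▸ hRD _ hxR)
      obtain ⟨g, ⟨hgH, hgR⟩, l, hlH, hgl⟩ := h x ⟨hxH, hxR⟩
      obtain ⟨g2, ⟨hg2H, hg2R⟩, l2, hl2H, hgl2⟩ := h x' ⟨hx'H, hx'R⟩
      obtain ⟨g', hg'H, hg'⟩ := stableLattice_step hθ hDθ hgH
      have hg'R : g' ∈ R := hsat _ (hg' ▸ hRD _ hgR)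
      obtain ⟨l', hl'H, hl'⟩ := stableLattice_step hθ hDθ hlH
      have h1 : (y ^ (ν + 1)) (E x') + (ν + 1 : ℚ) • (y ^ ν) (E x) = g' + (θ ^ N) l' := by
        apply hθ
        have := congrArg D hgl
        rw [derivation_pow_apply hD hθy, hDE, hx', map_add, hg', end_pow_comm hDθ, hl',
          ← hθE, ← end_pow_comm hθy, ← end_pow_comm (fun _ => rfl)] at this
        rw [map_add, map_add, map_smul]
        exact this
      have hν : (ν + 1 : ℚ) ≠ 0 := by positivity
      refine ⟨(ν + 1 : ℚ)⁻¹ • (g' - g2), Submodule.smul_mem _ _ (Submodule.sub_mem _ ⟨hg'H, hg'R⟩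
        ⟨hg2H, hg2R⟩), (ν + 1 : ℚ)⁻¹ • (l' - l2), Submodule.smul_mem _ _
        (Submodule.sub_mem _ hl'H hl2H), ?_⟩
      have h2 : (ν + 1 : ℚ) • (y ^ ν) (E x) = (g' - g2) + (θ ^ N) (l' - l2) := by
        rw [map_sub]
        rw [hgl2] at h1
        rw [eq_sub_of_add_eq' h1]
        abel
      rw [map_smul, ← smul_add, ← h2, smul_smul, inv_mul_cancel₀ hν, one_smul]
  obtain ⟨ν, hν⟩ := hdens (d + 1 + d)
  obtain ⟨g, ⟨hgH, hgR⟩, l, hlH, hgl⟩ := key (d + 1) ν (by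
    rintro x ⟨hxH, hxR⟩
    obtain ⟨g, hg, l, hgl⟩ := hν x hxR
    rw [pow_add, End.mul_apply] at hgl
    have hyE : (y ^ ν) (E x) ∈ H := by
      have : ∀ n, (y ^ n) (E x) ∈ H := by
        intro n
        induction n with
        | zero => simpa using stableLattice_of_comm hDE hθE hxH
        | succ n ih =>
          rw [pow_succ', End.mul_apply]
          exact stableLattice_mul hD hDθ hθy ih
      exact this ν
    refine ⟨g, ⟨?_, hg⟩, (θ ^ d) l, hdH l, hgl⟩
    have hθH : ∀ n, ∀ z ∈ H, (θ ^ n) z ∈ H := fun n z hz =>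
      stableLattice_of_comm (E := θ ^ n) (fun x => end_pow_comm hDθ n x)
        (fun x => end_pow_comm (fun _ => rfl) n x) hz
    have : g = (y ^ ν) (E x) - (θ ^ (d + 1)) ((θ ^ d) l) := by rw [hgl]; abel
    rw [this]
    exact Submodule.sub_mem _ hyE (hθH _ _ (hdH l))) ((θ ^ d) x) ⟨hdH x, hRθ' d x hx⟩
  have h3 : g = (θ ^ d) (E x - θ l) := by
    rw [end_pow_comm (f := E) (g := θ) (fun x => (hθE x).symm), pow_succ, End.mul_apply] at hgl
    rw [map_sub, hgl]; abel
  exact ⟨E x - θ l, hsat' d _ (h3 ▸ hgR), l, by abel⟩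

end Pole
end NonSplit

namespace NonSplit

section Koszul
variable {O : Type*} [CommRing O]

/-- The exterior algebra on `m` generators, as an iterated product. -/
def Ext (O : Type*) : ℕ → Type _
  | 0 => O
  | m + 1 => Ext O m × Ext O m

instance Ext.instAddCommGroup : ∀ m, AddCommGroup (Ext O m)
  | 0 => inferInstanceAs (AddCommGroup O)
  | m + 1 => @Prod.instAddCommGroup _ _ (Ext.instAddCommGroup m) (Ext.instAddCommGroup m)

instance Ext.instModule : ∀ m, Module O (Ext O m)
  | 0 => inferInstanceAs (Module O O)
  | m + 1 => @Prod.instModule O _ _ _ _ _ (Ext.instModule m) (Ext.instModule m)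

/-- The Koszul differential: contraction with `f`. -/
def kd : ∀ {m : ℕ}, (Fin m → O) → Ext O m →ₗ[O] Ext O m
  | 0, _ => 0
  | m + 1, f => LinearMap.prod
      ((kd (Fin.tail f)).comp (LinearMap.fst O (Ext O m) (Ext O m)) +
        f 0 • LinearMap.snd O (Ext O m) (Ext O m))
      (-(kd (Fin.tail f)).comp (LinearMap.snd O (Ext O m) (Ext O m)))

/-- Exterior multiplication by the vector `c`. -/
def ke : ∀ {m : ℕ}, (Fin m → O) → Ext O m →ₗ[O] Ext O m
  | 0, _ => 0
  | m + 1, c => LinearMap.prod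
      ((ke (Fin.tail c)).comp (LinearMap.fst O (Ext O m) (Ext O m)))
      (c 0 • LinearMap.fst O (Ext O m) (Ext O m) -
        (ke (Fin.tail c)).comp (LinearMap.snd O (Ext O m) (Ext O m)))

theorem kd_succ {m : ℕ} (f : Fin (m + 1) → O) (a b : Ext O m) :
    kd (m := m + 1) f (a, b) = (kd (Fin.tail f) a + f 0 • b, -kd (Fin.tail f) b) := rfl

theorem kd_ke {m : ℕ} (f c : Fin m → O) (z : Ext O m) :
    kd f (ke c z) + ke c (kd f z) = (∑ i, c i * f i) • z := by
  induction m with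
  | zero => simp [kd, ke]
  | succ m ih =>
    obtain ⟨a, b⟩ := z
    have ha := ih (Fin.tail f) (Fin.tail c) a
    have hb := ih (Fin.tail f) (Fin.tail c) b
    have hs : ∑ i, c i * f i = c 0 * f 0 + ∑ i, Fin.tail c i * Fin.tail f i :=
      Fin.sum_univ_succ _
    refine Prod.ext ?_ ?_
    · change kd _ (ke _ a) + f 0 • (c 0 • a - ke _ b) + ke _ (kd _ a + f 0 • b) =
        (∑ i, c i * f i) • a
      rw [hs, add_smul, ← ha, map_add, map_smul]
      module
    · change -kd _ (c 0 • a - ke _ b) + (c 0 • (kd _ a + f 0 • b) - ke _ (-kd _ b)) =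
        (∑ i, c i * f i) • b
      rw [hs, add_smul, ← hb, map_sub, map_smul, map_neg]
      module

theorem kd_kd {m : ℕ} (f : Fin m → O) (z : Ext O m) : kd f (kd f z) = 0 := by
  induction m with
  | zero => simp [kd]
  | succ m ih =>
    obtain ⟨a, b⟩ := z
    rw [kd_succ, kd_succ]
    refine Prod.ext ?_ ?_
    · change kd _ (kd _ a + f 0 • b) + f 0 • -kd _ b = 0
      rw [map_add, map_smul, ih]
      module
    · change -kd _ (-kd _ b) = 0
      rw [map_neg, ih]; simp

/-- Elements all of whose components lie in the ideal `I`. -/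
def compIn (I : Ideal O) : ∀ m : ℕ, Submodule O (Ext O m)
  | 0 => I
  | m + 1 => (compIn I m).prod (compIn I m)

theorem kd_compIn (I : Ideal O) {m : ℕ} (f : Fin m → O) {z : Ext O m} (hz : z ∈ compIn I m) :
    kd f z ∈ compIn I m := by
  induction m with
  | zero => simp [kd]
  | succ m ih =>
    obtain ⟨a, b⟩ := z
    exact ⟨add_mem (ih _ hz.1) (Submodule.smul_mem _ _ hz.2), neg_mem (ih _ hz.2)⟩

theorem ke_compIn (I : Ideal O) {m : ℕ} (f : Fin m → O) {z : Ext O m} (hz : z ∈ compIn I m) :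
    ke f z ∈ compIn I m := by
  induction m with
  | zero => simp [ke]
  | succ m ih =>
    obtain ⟨a, b⟩ := z
    exact ⟨ih _ hz.1, sub_mem (Submodule.smul_mem _ _ hz.1) (ih _ hz.2)⟩

theorem smul_compIn {I : Ideal O} {x : O} (hx : ∀ g, x * g ∈ I → g ∈ I) {m : ℕ} {z : Ext O m}
    (hz : x • z ∈ compIn I m) : z ∈ compIn I m := by
  induction m with
  | zero => exact hx _ hz
  | succ m ih => exact ⟨ih hz.1, ih hz.2⟩

theorem compIn_sup {I : Ideal O} {x : O} {m : ℕ} {z : Ext O m}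
    (hz : z ∈ compIn (I ⊔ span {x}) m) : ∃ v, ∃ w ∈ compIn I m, z = x • v + w := by
  induction m with
  | zero =>
    have hz' : (show O from z) ∈ I ⊔ span {x} := hz
    obtain ⟨w, hw, v', hv, h⟩ := Submodule.mem_sup.1 hz'
    obtain ⟨v, rfl⟩ := Ideal.mem_span_singleton'.1 hv
    exact ⟨v, w, hw, h.symm.trans (by change w + v * x = x * v + w; ring)⟩
  | succ m ih =>
    obtain ⟨a, b⟩ := z
    obtain ⟨v1, w1, h1, e1⟩ := ih hz.1
    obtain ⟨v2, w2, h2, e2⟩ := ih hz.2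
    exact ⟨(v1, v2), (w1, w2), ⟨h1, h2⟩, Prod.ext e1 e2⟩

theorem compIn_mono {I J : Ideal O} (h : I ≤ J) (m : ℕ) : compIn I m ≤ compIn J m := by
  induction m with
  | zero => exact h
  | succ m ih => exact fun z hz => ⟨ih hz.1, ih hz.2⟩

theorem compIn_bot {m : ℕ} {z : Ext O m} : z ∈ compIn (⊥ : Ideal O) m ↔ z = 0 := by
  induction m with
  | zero => exact Iff.rfl
  | succ m ih => 
    refine ⟨fun hz => Prod.ext (ih.1 hz.1) (ih.1 hz.2), ?_⟩
    rintro rfl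
    exact ⟨ih.2 rfl, ih.2 rfl⟩

/-- The degree filtration. -/
def degFil : ∀ m : ℕ, ℕ → Submodule O (Ext O m)
  | _, 0 => ⊤
  | 0, _ + 1 => ⊥
  | m + 1, r + 1 => (degFil m (r + 1)).prod (degFil m r)

theorem ke_degFil {m r : ℕ} (c : Fin m → O) {z : Ext O m} (hz : z ∈ degFil m r) :
    ke c z ∈ degFil m (r + 1) := by
  induction m generalizing r with
  | zero => simp [ke]
  | succ m ih =>
    obtain ⟨a, b⟩ := z
    cases r with
    | zero => 
      have : ∀ z, z ∈ degFil (O := O) m 0 := by cases m <;> exact fun z => trivial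
      exact ⟨ih _ (r := 0) (this _), this _⟩
    | succ r =>
      exact ⟨ih _ hz.1, sub_mem (Submodule.smul_mem _ _ hz.1) (ih _ hz.2)⟩

theorem degFil_eq_bot {m r : ℕ} (h : m < r) : degFil (O := O) m r = ⊥ := by
  induction m generalizing r with
  | zero => cases r with
    | zero => omega
    | succ r => rfl
  | succ m ih =>
    cases r with
    | zero => omega
    | succ r => 
      rw [eq_bot_iff]
      intro z hz
      have h1 := hz.1
      have h2 := hz.2
      rw [ih (by omega)] at h1 h2
      exact Prod.ext h1 h2

/-- The ideal generated by the first `r` members of a sequence. -/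
def initSpan (x : ℕ → O) : ℕ → Ideal O
  | 0 => ⊥
  | r + 1 => initSpan x r ⊔ span {x r}

theorem kd_exact_mod {m : ℕ} {f : Fin m → O} {x : ℕ → O}
    (hreg : ∀ r < m, ∀ g, x r * g ∈ initSpan x r → g ∈ initSpan x r)
    (hx : ∀ r < m, ∃ c : Fin m → O, x r = ∑ i, c i * f i) {r : ℕ} (hr : r ≤ m) {z : Ext O m}
    (hz : z ∈ degFil m (r + 1)) (hdz : kd f z ∈ compIn (initSpan x r) m) :
    ∃ u, z - kd f u ∈ compIn (initSpan x r) m := by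
  induction hk : m - r generalizing r z with
  | zero =>
    rw [degFil_eq_bot (by omega)] at hz
    exact ⟨0, by rw [(Submodule.mem_bot O).1 hz]; simp⟩
  | succ k ih =>
    obtain ⟨c, hc⟩ := hx r (by omega)
    have key := kd_ke f c z
    rw [← hc] at key
    obtain ⟨u, hu⟩ := ih (r := r + 1) (by omega) (z := ke c z) (ke_degFil c hz) (by
      rw [eq_sub_of_add_eq key]
      refine sub_mem ?_ (compIn_mono le_sup_left m (ke_compIn _ c hdz))
      have : ∀ (m : ℕ) (z : Ext O m), x r • z ∈ compIn (initSpan x (r + 1)) m := by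
        intro m z
        induction m with
        | zero =>
          have h (a : O) : x r * a ∈ initSpan x (r + 1) := Ideal.mem_sup_right
            (mul_mem_right _ _ (Ideal.mem_span_singleton_self _))
          exact h z
        | succ m ih => exact ⟨ih _, ih _⟩
      exact this _ _) (by omega)
    obtain ⟨v, w, hw, hvw⟩ := compIn_sup hu
    refine ⟨v, smul_compIn (hreg r (by omega)) ?_⟩
    have h1 : kd f (ke c z) = x r • kd f v + kd f w := by
      rw [sub_eq_iff_eq_add.1 hvw, map_add, map_add, kd_kd, map_smul, add_zero]
    rw [smul_sub, ← key, h1]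
    have : x r • kd f v + kd f w + ke c (kd f z) - x r • kd f v = kd f w + ke c (kd f z) := by abel
    rw [this]
    exact add_mem (kd_compIn _ f hw) (ke_compIn _ c hdz)

/-- The degree-one element with given components. -/
def ofVec : ∀ {m : ℕ}, (Fin m → O) → Ext O m
  | 0, _ => (0 : O)
  | m + 1, h => ((ofVec (Fin.tail h), (unit (h 0) m)) : Ext O m × Ext O m)
where
  /-- The degree-zero element. -/
  unit (a : O) : ∀ m, Ext O m
  | 0 => a
  | m + 1 => ((unit a m, 0) : Ext O m × Ext O m)

/-- The degree-zero component. -/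
def proj0 : ∀ {m : ℕ}, Ext O m → O
  | 0, z => z
  | _ + 1, z => proj0 z.1

/-- The degree-one component. -/
def proj1 : ∀ {m : ℕ}, Ext O m → Fin m → O
  | 0, _ => Fin.elim0
  | _ + 1, z => Fin.cons (proj0 z.2) (proj1 z.1)

theorem proj0_add_smul {m : ℕ} (a : Ext O m) (c : O) (b : Ext O m) :
    proj0 (a + c • b) = proj0 a + c * proj0 b := by
  induction m with
  | zero => rfl
  | succ m ih => exact ih a.1 b.1

theorem proj1_add_smul {m : ℕ} (a : Ext O m) (c : O) (b : Ext O m) (i : Fin m) :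
    proj1 (a + c • b) i = proj1 a i + c * proj1 b i := by
  induction m with
  | zero => exact i.elim0
  | succ m ih =>
    refine Fin.cases ?_ (fun i => ?_) i
    · exact proj0_add_smul a.2 c b.2
    · exact ih a.1 b.1 i

theorem proj0_neg {m : ℕ} (a : Ext O m) : proj0 (-a) = -proj0 a := by
  induction m with
  | zero => rfl
  | succ m ih => exact ih a.1

theorem proj0_unit (a : O) (m : ℕ) : proj0 (ofVec.unit a m) = a := by
  induction m with
  | zero => rfl
  | succ m ih => exact ih

theorem proj1_ofVec {m : ℕ} (h : Fin m → O) : proj1 (ofVec h) = h := by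
  induction m with
  | zero => ext i; exact i.elim0
  | succ m ih =>
    ext i
    refine Fin.cases (proj0_unit _ _) (fun i => ?_) i
    exact congrFun (ih (Fin.tail h)) i

theorem kd_unit {m : ℕ} (f : Fin m → O) (a : O) : kd f (ofVec.unit a m) = 0 := by
  induction m with
  | zero => rfl
  | succ m ih =>
    have : ofVec.unit a (m + 1) = ((ofVec.unit a m, 0) : Ext O m × Ext O m) := rfl
    rw [this, kd_succ, ih, map_zero, smul_zero, neg_zero, add_zero]
    rfl

theorem smul_unit (c a : O) (m : ℕ) : c • ofVec.unit a m = ofVec.unit (c * a) m := by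
  induction m with
  | zero => rfl
  | succ m ih => exact Prod.ext ih (smul_zero _)

theorem unit_add (c a : O) (m : ℕ) :
    ofVec.unit c m + ofVec.unit a m = ofVec.unit (c + a) m := by
  induction m with
  | zero => rfl
  | succ m ih => exact Prod.ext ih (add_zero _)

theorem unit_zero (m : ℕ) : ofVec.unit (0 : O) m = 0 := by
  induction m with
  | zero => rfl
  | succ m ih => exact Prod.ext ih rfl

theorem kd_ofVec {m : ℕ} (f h : Fin m → O) :
    kd f (ofVec h) = ofVec.unit (∑ i, f i * h i) m := by
  induction m with
  | zero => simp [kd, unit_zero]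
  | succ m ih =>
    have : ofVec h = ((ofVec (Fin.tail h), (ofVec.unit (h 0) m)) : Ext O m × Ext O m) := rfl
    have hs : ∑ i, f i * h i = (∑ i, Fin.tail f i * Fin.tail h i) + f 0 * h 0 :=
      (Fin.sum_univ_succ _).trans (add_comm _ _)
    rw [this, kd_succ, ih, kd_unit, smul_unit, unit_add, neg_zero, hs]
    rfl

theorem ofVec_degFil {m : ℕ} (h : Fin m → O) : ofVec h ∈ degFil m 1 := by
  induction m with
  | zero => exact rfl
  | succ m ih =>
    have : ∀ z, z ∈ degFil (O := O) m 0 := by cases m <;> exact fun z => trivial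
    exact ⟨ih _, this _⟩

theorem proj0_kd {m : ℕ} (f : Fin m → O) (u : Ext O m) :
    proj0 (kd f u) = ∑ i, f i * proj1 u i := by
  induction m with
  | zero => simp [kd]; rfl
  | succ m ih =>
    rw [Fin.sum_univ_succ]
    obtain ⟨a, b⟩ := u
    refine (proj0_add_smul (kd (Fin.tail f) a) (f 0) b).trans ?_
    rw [ih, add_comm]
    rfl

/-- The components of `kd f u` in degree one form an alternating combination of the `f i`. -/
theorem proj1_kd {m : ℕ} (f : Fin m → O) (u : Ext O m) :
    ∃ a : Fin m → Fin m → O, (∀ i, a i i = 0) ∧ (∀ i j, a i j = -a j i) ∧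
      ∀ i, proj1 (kd f u) i = ∑ j, a i j * f j := by
  induction m with
  | zero => exact ⟨fun i => i.elim0, fun i => i.elim0, fun i => i.elim0, fun i => i.elim0⟩
  | succ m ih =>
    obtain ⟨a, b⟩ := u
    obtain ⟨A, hA0, hA, hA'⟩ := ih (Fin.tail f) a
    refine ⟨Fin.cons (Fin.cons 0 fun j => -proj1 b j) fun i => Fin.cons (proj1 b i) (A i),
      ?_, ?_, ?_⟩
    · exact Fin.cases (by simp) (fun i => by simpa using hA0 i)
    · intro i j
      refine Fin.cases ?_ (fun i => ?_) i <;> refine Fin.cases ?_ (fun j => ?_) j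
      · simp
      · simp
      · simp
      · simpa using hA i j
    · intro i
      rw [Fin.sum_univ_succ]
      refine Fin.cases ?_ (fun i => ?_) i
      · refine (proj0_neg (kd (Fin.tail f) b)).trans ?_
        rw [proj0_kd]
        simp [Fin.tail, mul_comm]
      · refine (proj1_add_smul (kd (Fin.tail f) a) (f 0) b i).trans ?_
        rw [hA']
        simp [Fin.tail, mul_comm, add_comm]

theorem koszul_exact {m : ℕ} {f : Fin m → O} {x : ℕ → O}
    (hreg : ∀ r < m, ∀ g, x r * g ∈ initSpan x r → g ∈ initSpan x r)
    (hx : ∀ r < m, ∃ c : Fin m → O, x r = ∑ i, c i * f i) {h : Fin m → O}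
    (hh : ∑ i, f i * h i = 0) : ∃ a : Fin m → Fin m → O, (∀ i, a i i = 0) ∧ (∀ i j, a i j = -a j i) ∧
      ∀ i, h i = ∑ j, a i j * f j := by
  obtain ⟨u, hu⟩ := kd_exact_mod hreg hx (Nat.zero_le m) (ofVec_degFil h) (by
    rw [kd_ofVec, hh, unit_zero]; exact zero_mem _)
  have := sub_eq_zero.1 (compIn_bot.1 hu)
  obtain ⟨a, ha0, ha, ha'⟩ := proj1_kd f u
  refine ⟨a, ha0, ha, fun i => ?_⟩
  rw [← ha', ← this, proj1_ofVec]

end Koszul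

section PowerSeriesSequence
variable {R : Type*} [CommRing R] {m : ℕ}

open MvPowerSeries

theorem mem_initSpan_X_pow {x : ℕ → 𝒪 m R} {N : ℕ}
    (hx : ∀ i : Fin m, x i = X i ^ N) {r : ℕ} (hr : r ≤ m) (g : 𝒪 m R) :
    g ∈ initSpan x r ↔ ∀ c : Fin m →₀ ℕ, (∀ i : Fin m, i < r → c i < N) → coeff c g = 0 := by
  induction r generalizing g with
  | zero =>
    simp only [initSpan, Ideal.mem_bot, not_lt_zero, false_imp_iff, implies_true, true_imp_iff]
    exact MvPowerSeries.ext_iff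
  | succ r ih =>
    have hxr : x r = X (⟨r, hr⟩ : Fin m) ^ N := hx ⟨r, hr⟩
    constructor
    · intro hg c hc
      obtain ⟨w, hw, v', hv, rfl⟩ := Submodule.mem_sup.1 hg
      obtain ⟨v, rfl⟩ := Ideal.mem_span_singleton'.1 hv
      rw [map_add, (ih (by omega) w).1 hw c (fun i hi => hc i (by omega)), zero_add, hxr, X_pow_eq,
        coeff_mul_monomial, if_neg]
      intro h
      have := h ⟨r, hr⟩
      have := hc ⟨r, hr⟩ (by simp)
      simp at *
      omega
    · intro h
      let v : 𝒪 m R := fun c => coeff (c + single ⟨r, hr⟩ N) g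
      have hv : ∀ c, coeff c v = coeff (c + single ⟨r, hr⟩ N) g := fun c => rfl
      have : g = (g - v * x r) + v * x r := by ring
      rw [this]
      refine add_mem (Ideal.mem_sup_left ((ih (by omega) _).2 fun c hc => ?_))
        (Ideal.mem_sup_right (mul_mem_left _ _ (Ideal.mem_span_singleton_self _)))
      rw [map_sub, hxr, X_pow_eq, coeff_mul_monomial]
      split_ifs with hle
      · rw [hv, tsub_add_cancel_of_le hle]; simp
      · rw [sub_zero]
        refine h c fun i hi => ?_
        rcases Nat.lt_succ_iff_lt_or_eq.1 hi with hi | hi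
        · exact hc i hi
        · by_contra hcon
          apply hle
          intro j
          by_cases hj : j = ⟨r, hr⟩
          · subst hj
            have : i = ⟨r, hr⟩ := Fin.ext hi
            subst this
            simpa using hcon
          · simp [Ne.symm hj]

theorem powerSeries_koszul {f : Fin m → 𝒪 m R} {N : ℕ}
    (hN : ∀ i, X i ^ N ∈ span (Set.range f)) {h : Fin m → 𝒪 m R}
    (hh : ∑ i, f i * h i = 0) : ∃ a : Fin m → Fin m → 𝒪 m R,
      (∀ i, a i i = 0) ∧ (∀ i j, a i j = -a j i) ∧ ∀ i, h i = ∑ j, a i j * f j := by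
  let x : ℕ → 𝒪 m R := fun i => if h : i < m then X ⟨i, h⟩ ^ N else 0
  have hx : ∀ i : Fin m, x i = X i ^ N := fun i => by simp [x]
  refine koszul_exact (x := x) (fun r hr g hg => ?_) (fun r hr => ?_) hh
  · rw [mem_initSpan_X_pow hx hr.le] at hg ⊢
    intro c hc
    have := hg (c + single ⟨r, hr⟩ N) fun i hi => by
      have : (⟨r, hr⟩ : Fin m) ≠ i := by rintro rfl; simp at hi
      simpa [Finsupp.single_apply, this] using hc i hi
    rw [hx ⟨r, hr⟩, X_pow_eq, add_comm, coeff_add_monomial_mul, one_mul] at this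
    exact this
  · obtain ⟨c, hc⟩ := (mem_span_range_iff_exists_fun).1 (hN ⟨r, hr⟩)
    exact ⟨c, by rw [hx ⟨r, hr⟩, hc]⟩

end PowerSeriesSequence

end NonSplit

namespace NonSplit

open PowerSeries (C X X_dvd_iff coeff coeff_C coeff_X coeff_derivative coeff_mk coeff_mul coeff_one constantCoeff_C derivative derivative_C derivative_X mk)

section Twist
variable {k A ι : Type*} [CommRing k] [CommRing A] [Algebra k A] [Fintype ι]

/-- The twisted derivation `g ↦ θ D g + f g`. -/
noncomputable def tw (θ : A) (D : Derivation k A A) (f : A) : A →ₗ[k] A :=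
  (mulLeft k θ).comp (D : A →ₗ[k] A) + mulLeft k f

theorem tw_apply (θ : A) (D : Derivation k A A) (f g : A) : tw θ D f g = θ * D g + f * g := rfl

theorem tw_mul (θ : A) (D : Derivation k A A) (f g h : A) :
    tw θ D f (g * h) = g * tw θ D f h + θ * (D g * h) := by
  simp only [tw_apply, D.leibniz, smul_eq_mul]; ring

/-- The image of the twisted de Rham differential in top degree. -/
noncomputable def imTw (θ : A) (δ : ι → Derivation k A A) (f : ι → A) : Submodule k A :=
  range (∑ j, (tw θ (δ j) (f j)).comp (LinearMap.proj (R := k) (φ := fun _ : ι => A) j))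

theorem mem_imTw {θ : A} {δ : ι → Derivation k A A} {f : ι → A} {g : A} :
    g ∈ imTw θ δ f ↔ ∃ h : ι → A, ∑ j, tw θ (δ j) (f j) (h j) = g := by
  simp [imTw]

theorem tw_mem_imTw (θ : A) (δ : ι → Derivation k A A) (f : ι → A) (j : ι) (g : A) :
    tw θ (δ j) (f j) g ∈ imTw θ δ f := by
  classical
  refine mem_imTw.2 ⟨Pi.single j g, ?_⟩
  rw [sum_eq_single j (fun i _ hi => by rw [Pi.single_eq_of_ne hi, map_zero]) (by simp),
    Pi.single_eq_same]

theorem imTw_le {θ : A} {δ : ι → Derivation k A A} {f : ι → A} {S : Submodule k A}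
    (h : ∀ j g, tw θ (δ j) (f j) g ∈ S) : imTw θ δ f ≤ S := by
  intro g hg
  obtain ⟨a, rfl⟩ := mem_imTw.1 hg
  exact Submodule.sum_mem _ fun j _ => h j _

theorem mul_mem_imTw {θ c : A} {δ : ι → Derivation k A A} {f : ι → A} (hc : ∀ j, δ j c = 0) {g : A}
    (hg : g ∈ imTw θ δ f) : c * g ∈ imTw θ δ f := by
  obtain ⟨h, rfl⟩ := mem_imTw.1 hg
  refine mem_imTw.2 ⟨fun j => c * h j, ?_⟩
  rw [mul_sum]
  refine sum_congr rfl fun j _ => ?_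
  rw [tw_mul, hc]
  simp

theorem sum_alternating_eq_zero {a s : ι → ι → A} (h0 : ∀ i, a i i = 0)
    (ha : ∀ i j, a i j = -a j i) (hs : ∀ i j, s i j = s j i) : ∑ i, ∑ j, a i j * s i j = 0 := by
  classical
  rw [← Fintype.sum_prod_type']
  refine Finset.sum_involution (fun p _ => p.swap) ?_ ?_ (by simp) (by simp)
  · rintro ⟨i, j⟩ -
    simp only [Prod.swap_prod_mk]
    rw [ha i j, hs i j]; ring
  · rintro ⟨i, j⟩ - h
    simp only [Prod.swap_prod_mk, ne_eq, Prod.mk.injEq, not_and]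
    rintro rfl
    simp [h0] at h

/-- Torsion-freeness of the cokernel of the twisted differential. -/
theorem imTw_saturated {θ : A} {δ : ι → Derivation k A A} {f : ι → A}
    (hθ : ∀ g, θ * g = 0 → g = 0) (hδθ : ∀ j, δ j θ = 0)
    (hδ : ∀ i j g, δ i (δ j g) = δ j (δ i g)) (hf : ∀ i j, δ i (f j) = δ j (f i))
    (hK : ∀ h : ι → A, θ ∣ ∑ j, f j * h j → ∃ a : ι → ι → A, (∀ i, a i i = 0) ∧
      (∀ i j, a i j = -a j i) ∧ ∀ i, θ ∣ h i - ∑ j, a i j * f j)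
    {g : A} (hg : θ * g ∈ imTw θ δ f) : g ∈ imTw θ δ f := by
  obtain ⟨h, hh⟩ := mem_imTw.1 hg
  obtain ⟨a, ha0, ha, hah⟩ := hK h ⟨g - ∑ j, δ j (h j), by
    rw [mul_sub, ← hh, mul_sum, ← sum_sub_distrib]
    exact sum_congr rfl fun j _ => by rw [tw_apply]; ring⟩
  choose h' hh' using hah
  refine mem_imTw.2 ⟨fun j => h' j + ∑ i, δ i (a i j), ?_⟩
  rw [← sub_eq_zero]
  apply hθ
  have e1 : ∑ i, ∑ j, a i j * (θ * δ i (f j) + f i * f j) = 0 :=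
    sum_alternating_eq_zero ha0 ha fun i j => by rw [hf i j]; ring
  have e2 : ∑ i, ∑ j, δ j (δ i (a i j)) = 0 := by
    rw [← Fintype.sum_prod_type']
    refine Finset.sum_involution (fun p _ => p.swap) ?_ ?_ (by simp) (by simp)
    · rintro ⟨i, j⟩ -
      simp only [Prod.swap_prod_mk]
      rw [hδ, ha i j]; simp
    · rintro ⟨i, j⟩ - h
      simp only [Prod.swap_prod_mk, ne_eq, Prod.mk.injEq, not_and]
      rintro rfl
      simp [ha0] at h
  have e3 : ∀ i, h i = θ * h' i + ∑ j, a i j * f j := fun i => by rw [← hh' i]; ring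
  rw [mul_sub, ← hh, sub_eq_zero]
  have e4 : ∀ i, tw θ (δ i) (f i) (h i) = θ * tw θ (δ i) (f i) (h' i) +
      (θ * ∑ j, f j * δ i (a i j) + ∑ j, a i j * (θ * δ i (f j) + f i * f j)) := by
    intro i
    rw [e3, map_add, tw_mul, hδθ, map_sum, mul_sum, ← sum_add_distrib]
    simp only [zero_mul, mul_zero, add_zero]
    congr 1
    refine sum_congr rfl fun j _ => ?_
    rw [tw_apply, (δ i).leibniz]
    simp only [smul_eq_mul]; ring
  simp only [e4, sum_add_distrib, e1, add_zero]
  simp only [map_add, sum_add_distrib, mul_add, mul_sum]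
  congr 1
  have e5 : ∀ j, tw θ (δ j) (f j) (∑ i, δ i (a i j)) =
      θ * ∑ i, δ j (δ i (a i j)) + ∑ i, f j * δ i (a i j) := by
    intro j
    rw [tw_apply, map_sum, mul_sum _ _ (f j)]
  simp only [e5, sum_add_distrib, mul_add, ← mul_sum]
  rw [sum_comm (f := fun j i => δ j (δ i (a i j))), e2, mul_zero, mul_zero, zero_add]
  rw [sum_comm]
  simp only [mul_sum]

end Twist

section Lift
variable {k O : Type*} [CommRing k] [CommRing O] [Algebra k O]

/-- The coefficientwise extension of a derivation to power series. -/
noncomputable def liftD (D : Derivation k O O) : Derivation k (PowerSeries O) (PowerSeries O) where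
  toFun g := mk fun n => D (coeff n g)
  map_add' g h := by ext; simp
  map_smul' c g := by ext; simp
  map_one_eq_zero' := by ext n; simp [coeff_one]; split_ifs <;> simp
  leibniz' g h := by
    ext n
    simp only [LinearMap.coe_mk, AddHom.coe_mk, coeff_mk, coeff_mul,
      map_sum, leibniz, smul_eq_mul, map_add, sum_add_distrib]
    congr 1
    rw [← Finset.Nat.sum_antidiagonal_swap]
    rfl

@[simp] theorem coeff_liftD (D : Derivation k O O) (g : PowerSeries O) (n : ℕ) :
    coeff n (liftD D g) = D (coeff n g) :=
  coeff_mk n fun n => D (coeff n g)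

@[simp] theorem liftD_C (D : Derivation k O O) (g : O) :
    liftD D (C g) = C (D g) := by
  ext n
  simp only [coeff_liftD, coeff_C]
  split_ifs <;> simp

@[simp] theorem liftD_X (D : Derivation k O O) : liftD D X = 0 := by
  ext n
  simp only [coeff_liftD, coeff_X]
  split_ifs <;> simp

end Lift

section Brieskorn
variable {L : Type*} [CommRing L] {m : ℕ}

theorem pderiv_comm (i j : Fin m) (g : 𝒪 m L) :
    pderiv L i (pderiv L j g) = pderiv L j (pderiv L i g) := by
  ext n
  simp only [MvPowerSeries.coeff_pderiv]
  rw [add_right_comm]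
  by_cases h : i = j
  · subst h; rfl
  · simp [h, Ne.symm h]; ring

/-- `θ ∂_j + ∂_j F` on power series in `θ`. -/
noncomputable def twF (F : 𝒪 m L) (j : Fin m) :
    PowerSeries (𝒪 m L) →ₗ[L] PowerSeries (𝒪 m L) :=
  tw X (liftD (pderiv L j)) (C (pderiv L j F))

/-- The relations of the formal Brieskorn lattice of `F`. -/
noncomputable def imF (F : 𝒪 m L) :
    Submodule L (PowerSeries (𝒪 m L)) :=
  imTw X (fun j => liftD (pderiv L j)) (fun j => C (pderiv L j F))

theorem X_mul_mem_imF {F : 𝒪 m L} {g : PowerSeries (𝒪 m L)}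
    (hg : g ∈ imF F) : X * g ∈ imF F := mul_mem_imTw (fun _ => liftD_X _) hg

/-- The Jacobian ideal. -/
noncomputable def jac (F : 𝒪 m L) : Ideal (𝒪 m L) :=
  span (Set.range fun j => pderiv L j F)

theorem imF_saturated {F : 𝒪 m L} {N : ℕ}
    (hN : ∀ i, (MvPowerSeries.X i : 𝒪 m L) ^ N ∈ jac F)
    {g : PowerSeries (𝒪 m L)}
    (hg : X * g ∈ imF F) : g ∈ imF F := by
  refine imTw_saturated (fun g hg => ?_) (fun j => liftD_X _) (fun i j g => ?_) (fun i j => ?_)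
    (fun h hh => ?_) hg
  · exact PowerSeries.X_mul_cancel (by rw [hg, mul_zero])
  · ext n : 1
    simp [pderiv_comm i j]
  · simp [pderiv_comm i j]
  · rw [X_dvd_iff] at hh
    simp only [map_sum, map_mul, constantCoeff_C] at hh
    obtain ⟨a, ha0, ha, hah⟩ := powerSeries_koszul hN hh
    refine ⟨fun i j => C (a i j), by simp [ha0], fun i j => by
      rw [← map_neg, ← ha], fun i => ?_⟩
    rw [X_dvd_iff]
    simp [hah i]

/-- The action of `θ² ∂_θ - F`. -/
noncomputable def omF (F : 𝒪 m L) :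
    PowerSeries (𝒪 m L) →ₗ[L] PowerSeries (𝒪 m L) :=
  (mulLeft L (X ^ 2)).comp
    ((derivative (𝒪 m L)).restrictScalars L :
      PowerSeries (𝒪 m L) →ₗ[L] PowerSeries (𝒪 m L)) -
    mulLeft L (C F)

theorem omF_apply (F : 𝒪 m L) (g) : omF F g =
    X ^ 2 * derivative (𝒪 m L) g -
      C F * g := rfl

theorem liftD_derivative {O : Type*} [CommRing O] [Algebra L O] (D : Derivation L O O)
    (g : PowerSeries O) : liftD D (derivative O g) =
      derivative O (liftD D g) := by
  ext n
  simp only [coeff_liftD, coeff_derivative, leibniz, smul_eq_mul]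
  rw [show D (n + 1 : O) = 0 by simp]
  ring

theorem omF_twF (F : 𝒪 m L) (j : Fin m) (g) :
    omF F (twF F j g) = twF F j (omF F g) + X * twF F j g := by
  have h2 : liftD (pderiv L j) (X ^ 2 : PowerSeries (𝒪 m L)) = 0 := by
    rw [Derivation.leibniz_pow]; simp
  simp only [omF_apply, twF, tw_apply, map_add, map_sub, leibniz, smul_eq_mul,
    liftD_derivative, derivative_X, derivative_C, h2, liftD_C]
  ring

theorem omF_mem_imF {F : 𝒪 m L} {g : PowerSeries (𝒪 m L)}
    (hg : g ∈ imF F) : omF F g ∈ imF F := by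
  have : imF F ≤ (imF F).comap (omF F) := imTw_le fun j g => by
    change omF F (twF F j g) ∈ imF F
    rw [omF_twF]
    exact add_mem (tw_mem_imTw _ _ _ j _) (X_mul_mem_imF (tw_mem_imTw _ _ _ j _))
  exact this hg

theorem omF_X_mul (F : 𝒪 m L) (g) :
    omF F (X * g) = X * omF F g + X * (X * g) := by
  simp only [omF_apply, leibniz, smul_eq_mul, derivative_X]
  ring

end Brieskorn
end NonSplit

namespace NonSplit

open Module (End)

section Degree
variable {L : Type*} [CommRing L] {m : ℕ}

open MvPowerSeries (X coeff)

/-- Power series without terms of degree less than `a`. -/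
noncomputable def degGE (m : ℕ) (L : Type*) [CommRing L] (a : ℕ) : Ideal (𝒪 m L) where
  carrier := {g | ∀ c : Fin m →₀ ℕ, c.degree < a → coeff c g = 0}
  add_mem' hf hg c hc := by rw [map_add, hf c hc, hg c hc, add_zero]
  zero_mem' c _ := by simp
  smul_mem' h g hg c hc := by
    classical
    rw [smul_eq_mul, MvPowerSeries.coeff_mul]
    refine sum_eq_zero fun p hp => ?_
    rw [Finset.HasAntidiagonal.mem_antidiagonal] at hp
    rw [hg p.2 (by rw [← hp, map_add] at hc; omega), mul_zero]

theorem mem_degGE {a : ℕ} {g : 𝒪 m L} :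
    g ∈ degGE m L a ↔ ∀ c : Fin m →₀ ℕ, c.degree < a → coeff c g = 0 := Iff.rfl

theorem mul_mem_degGE {a b : ℕ} {g h : 𝒪 m L} (hg : g ∈ degGE m L a)
    (hh : h ∈ degGE m L b) : g * h ∈ degGE m L (a + b) := by
  classical
  intro c hc
  rw [MvPowerSeries.coeff_mul]
  refine sum_eq_zero fun p hp => ?_
  rw [Finset.HasAntidiagonal.mem_antidiagonal] at hp
  rw [← hp, map_add] at hc
  by_cases h1 : p.1.degree < a
  · rw [hg p.1 h1, zero_mul]
  · rw [hh p.2 (by omega), mul_zero]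

theorem degGE_anti {a b : ℕ} (h : a ≤ b) : degGE m L b ≤ degGE m L a :=
  fun _ hg c hc => hg c (by omega)

theorem mem_degGE_zero (g : 𝒪 m L) : g ∈ degGE m L 0 := fun c hc => by omega

theorem mem_degGE_one {g : 𝒪 m L} :
    g ∈ degGE m L 1 ↔ MvPowerSeries.constantCoeff g = 0 := by
  constructor
  · intro h
    rw [← MvPowerSeries.coeff_zero_eq_constantCoeff_apply]
    exact h 0 (by simp)
  · intro h c hc
    have : c = 0 := by rw [← Finsupp.degree_eq_zero_iff]; omega
    rw [this]; simpa using h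

theorem X_mem_degGE (i : Fin m) : (X i : 𝒪 m L) ∈ degGE m L 1 :=
  mem_degGE_one.2 (by simp)

theorem pderiv_mem_degGE {a : ℕ} {g : 𝒪 m L} (hg : g ∈ degGE m L (a + 1))
    (i : Fin m) : pderiv L i g ∈ degGE m L a := by
  intro c hc
  rw [MvPowerSeries.coeff_pderiv, hg _ (by simp [map_add]; omega), zero_mul]

/-- The part of a power series whose exponents have `i` as first nonzero index, divided by `X i`. -/
noncomputable def part (i : Fin m) (g : 𝒪 m L) : 𝒪 m L :=
  open Classical in
  fun e => if ∀ j < i, e j = 0 then coeff (e + single i 1) g else 0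

open Classical in
theorem coeff_part (i : Fin m) (g : 𝒪 m L) (e : Fin m →₀ ℕ) :
    coeff e (part i g) = if ∀ j < i, e j = 0 then coeff (e + single i 1) g else 0 := rfl

theorem part_mem_degGE {a : ℕ} {g : 𝒪 m L} (hg : g ∈ degGE m L (a + 1))
    (i : Fin m) : part i g ∈ degGE m L a := by
  classical
  intro c hc
  rw [coeff_part]
  split_ifs
  · exact hg _ (by simp [map_add]; omega)
  · rfl

theorem sum_X_mul_part {g : 𝒪 m L} (hg : g ∈ degGE m L 1) :
    ∑ i, X i * part i g = g := by
  classical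
  ext c
  rw [map_sum]
  by_cases hc : c = 0
  · subst hc
    rw [hg 0 (by simp)]
    exact sum_eq_zero fun i _ => by simp
  obtain ⟨i, hi, hmin⟩ : ∃ i, c i ≠ 0 ∧ ∀ j < i, c j = 0 := by
    have hne : ∃ i, c i ≠ 0 := by
      by_contra h
      push Not at h
      exact hc (Finsupp.ext h)
    obtain ⟨i, hi, hm⟩ := WellFounded.has_min (wellFounded_lt (α := Fin m)) {i | c i ≠ 0} hne
    exact ⟨i, hi, fun j hj => by by_contra h; exact hm j h hj⟩
  have hle : ∀ j, c j ≠ 0 → single j 1 ≤ c := fun j hj => by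
    rw [Finsupp.single_le_iff]; omega
  rw [sum_eq_single i]
  · rw [MvPowerSeries.X, MvPowerSeries.coeff_monomial_mul, if_pos (hle i hi), one_mul, coeff_part,
      if_pos, tsub_add_cancel_of_le (hle i hi)]
    intro j hj
    simp [hmin j hj]
  · intro j _ hj
    rw [MvPowerSeries.X, MvPowerSeries.coeff_monomial_mul]
    split_ifs with h
    · have hcj : c j ≠ 0 := by rw [Finsupp.single_le_iff] at h; omega
      rw [one_mul, coeff_part, if_neg]
      intro h'
      have hij : i < j := lt_of_le_of_ne (by
        by_contra hlt
        exact hcj (hmin j (not_le.1 hlt))) (Ne.symm hj)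
      have := h' i hij
      simp [hj] at this
      exact hi this
    · rfl
  · simp

/-- The ideal generated by the variables. -/
noncomputable def maxId (m : ℕ) (L : Type*) [CommRing L] : Ideal (𝒪 m L) :=
  span (Set.range X)

theorem X_mem_maxId (i : Fin m) : (X i : 𝒪 m L) ∈ maxId m L :=
  subset_span ⟨i, rfl⟩

theorem maxId_fg : (maxId m L).FG := by
  rw [maxId]; exact Submodule.fg_span (Set.finite_range X)

theorem maxId_pow (a : ℕ) : maxId m L ^ a = degGE m L a := by
  apply le_antisymm
  · induction a with
    | zero => exact fun g _ => mem_degGE_zero g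
    | succ a ih =>
      rw [pow_succ]
      refine Ideal.mul_le.2 fun g hg h hh => mul_mem_degGE (ih hg) ?_
      exact (Ideal.span_le.2 (by rintro _ ⟨i, rfl⟩; exact X_mem_degGE i) :
        maxId m L ≤ degGE m L 1) hh
  · induction a with
    | zero => intro g _; simp
    | succ a ih =>
      intro g hg
      rw [← sum_X_mul_part (degGE_anti (by omega) hg), pow_succ']
      exact Ideal.sum_mem _ fun i _ => mul_mem_mul (X_mem_maxId i) (ih (part_mem_degGE hg i))

/-- Series in `θ` all of whose coefficients have no terms of degree less than `a`. -/
noncomputable def degGEθ (m : ℕ) (L : Type*) [CommRing L] (a : ℕ) : Ideal (PowerSeries (𝒪 m L)) where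
  carrier := {g | ∀ n, PowerSeries.coeff n g ∈ degGE m L a}
  add_mem' hf hg n := by rw [map_add]; exact add_mem (hf n) (hg n)
  zero_mem' n := by simp
  smul_mem' h g hg n := by
    rw [smul_eq_mul, PowerSeries.coeff_mul]
    exact Ideal.sum_mem _ fun p _ => mul_mem_left _ _ (hg _)

theorem C_mul_mem_degGEθ {a b : ℕ} {f : 𝒪 m L} (hf : f ∈ degGE m L a)
    {g : PowerSeries (𝒪 m L)} (hg : g ∈ degGEθ m L b) :
    PowerSeries.C f * g ∈ degGEθ m L (a + b) := by
  intro n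
  rw [PowerSeries.coeff_C_mul]
  exact mul_mem_degGE hf (hg n)

theorem C_mem_degGEθ {a : ℕ} {f : 𝒪 m L} (hf : f ∈ degGE m L a) :
    PowerSeries.C f ∈ degGEθ m L a := by
  simpa using C_mul_mem_degGEθ hf (b := 0) (g := 1) (fun n => mem_degGE_zero _)

theorem degGEθ_eq (a : ℕ) : degGEθ m L a = (maxId m L).map PowerSeries.C ^ a := by
  apply le_antisymm
  · induction a with
    | zero => intro g _; simp
    | succ a ih =>
      intro g hg
      have : g = ∑ i, PowerSeries.C (X i) * PowerSeries.mk fun n => part i (PowerSeries.coeff n g) := by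
        ext n : 1
        rw [map_sum]
        simp only [PowerSeries.coeff_C_mul, PowerSeries.coeff_mk]
        rw [sum_X_mul_part (degGE_anti (by omega) (hg n))]
      rw [this, pow_succ']
      exact Ideal.sum_mem _ fun i _ => mul_mem_mul (Ideal.mem_map_of_mem _ (X_mem_maxId i))
        (ih fun n => by rw [PowerSeries.coeff_mk]; exact part_mem_degGE (hg n) i)
  · rw [← Ideal.map_pow, Ideal.map_le_iff_le_comap, maxId_pow]
    exact fun g hg => C_mem_degGEθ hg

end Degree

section Chain
variable {k G : Type*} [Field k] [AddCommGroup G] [Module k G]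

theorem finite_quotient_of_fg {S W : Submodule k G} (hW : W.FG) (h : W ⊔ S = ⊤) :
    Module.Finite k (G ⧸ S) := by
  have := Module.Finite.iff_fg.2 hW
  refine Module.Finite.of_surjective (S.mkQ.comp W.subtype) fun x => ?_
  obtain ⟨x, rfl⟩ := S.mkQ_surjective x
  obtain ⟨w, hw, s, hs, rfl⟩ := Submodule.mem_sup.1 (h ▸ Submodule.mem_top : x ∈ W ⊔ S)
  refine ⟨⟨w, hw⟩, ?_⟩
  simp [(Submodule.Quotient.mk_eq_zero S).2 hs]

theorem pow_range_finite_quotient {θ : End k G}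
    [Module.Finite k (G ⧸ range θ)] (n : ℕ) :
    Module.Finite k (G ⧸ range (θ ^ n)) := by
  obtain ⟨V, hV⟩ := (range θ).exists_isCompl
  have hVfin : V.FG := Module.Finite.iff_fg.1
    (Module.Finite.equiv (Submodule.quotientEquivOfIsCompl _ _ hV))
  suffices ∃ W : Submodule k G, W.FG ∧ W ⊔ range (θ ^ n) = ⊤ by
    obtain ⟨W, h1, h2⟩ := this
    exact finite_quotient_of_fg h1 h2
  induction n with
  | zero => exact ⟨⊥, Submodule.fg_bot, by
      rw [bot_sup_eq, LinearMap.range_eq_top]; exact fun x => ⟨x, rfl⟩⟩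
  | succ n ih =>
    obtain ⟨W, h1, h2⟩ := ih
    refine ⟨W ⊔ V.map (θ ^ n), h1.sup (hVfin.map _), ?_⟩
    have : range (θ ^ n) = V.map (θ ^ n) ⊔ range (θ ^ (n + 1)) := by
      rw [pow_succ, End.mul_eq_comp, LinearMap.range_comp, ← Submodule.map_sup,
        sup_comm, hV.sup_eq_top, LinearMap.range_eq_map]
    rw [sup_assoc, ← this, h2]

/-- A lattice and a commensurable sublattice have the same generic rank. -/
theorem finrank_map_mkQ {θ : End k G} (hθ : Injective θ)
    [Module.Finite k (G ⧸ range θ)] {H : Submodule k G} {T : ℕ}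
    (hH : range (θ ^ T) ≤ H) (hHθ : H.map θ ≤ H) :
    Module.Finite k (G ⧸ H.map θ) ∧ Module.finrank k (H.map (H.map θ).mkQ) =
      Module.finrank k (G ⧸ range θ) := by
  set S := H.map θ with hS
  have hST : range (θ ^ (T + 1)) ≤ S := by
    rw [pow_succ', End.mul_eq_comp, LinearMap.range_comp]
    exact Submodule.map_mono hH
  have hfin : Module.Finite k (G ⧸ S) := by
    have := pow_range_finite_quotient (θ := θ) (T + 1)
    exact Module.Finite.of_surjective (Submodule.factor hST) (Submodule.factor_surjective hST)
  refine ⟨hfin, ?_⟩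
  have hSr : S ≤ range θ := LinearMap.map_le_range
  have e1 := (Submodule.quotientQuotientEquivQuotient S H hHθ).finrank_eq
  have e2 := (Submodule.quotientQuotientEquivQuotient S (range θ) hSr).finrank_eq
  have e3 := Submodule.finrank_quotient_add_finrank (H.map S.mkQ)
  have e4 := Submodule.finrank_quotient_add_finrank ((range θ).map S.mkQ)
  have e5 : LinearMap.ker (S.mkQ.comp θ) = H := by
    rw [LinearMap.ker_comp, Submodule.ker_mkQ, hS, Submodule.comap_map_eq_of_injective hθ]
  have e6 := (LinearMap.quotKerEquivRange (S.mkQ.comp θ)).finrank_eq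
  rw [e5, LinearMap.range_comp] at e6
  omega

/-- The lattice generated by `θ ^ (T - i) Ω ^ i G` for `i ≤ j`. -/
def chainN (θ Ω : End k G) (T j : ℕ) : Submodule k G :=
  ⨆ i ∈ Finset.range (j + 1), range (θ ^ (T - i) * Ω ^ i)

variable {θ Ω : End k G}

theorem mem_chainN {T j i : ℕ} (hi : i ≤ j) (x : G) :
    (θ ^ (T - i)) ((Ω ^ i) x) ∈ chainN θ Ω T j :=
  Submodule.mem_iSup_of_mem i (Submodule.mem_iSup_of_mem (by simp; omega) ⟨x, rfl⟩)

theorem chainN_le {T j : ℕ} {S : Submodule k G}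
    (h : ∀ i ≤ j, ∀ x, (θ ^ (T - i)) ((Ω ^ i) x) ∈ S) : chainN θ Ω T j ≤ S := by
  refine iSup₂_le fun i hi => ?_
  rintro _ ⟨x, rfl⟩
  exact h i (by simp at hi; omega) x

theorem chainN_mono {T j j' : ℕ} (h : j ≤ j') : chainN θ Ω T j ≤ chainN θ Ω T j' :=
  chainN_le fun _ hi x => mem_chainN (hi.trans h) x

theorem om_pow_theta (hΩ : ∀ x, Ω (θ x) = θ (Ω x) + θ (θ x)) (n : ℕ) (x : G) :
    Ω ((θ ^ n) x) = (θ ^ n) (Ω x) + (n : k) • θ ((θ ^ n) x) := by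
  induction n with
  | zero => simp
  | succ n ih =>
    rw [pow_succ', End.mul_apply, hΩ, ih, End.mul_apply, map_add, map_smul]
    push_cast
    module

theorem map_chainN_le {T T' j j' : ℕ} {φ : End k G}
    (h : ∀ i ≤ j, ∀ x, φ ((θ ^ (T - i)) ((Ω ^ i) x)) ∈ chainN θ Ω T' j') {x : G}
    (hx : x ∈ chainN θ Ω T j) : φ x ∈ chainN θ Ω T' j' :=
  chainN_le (S := (chainN θ Ω T' j').comap φ) h hx

theorem theta_om_pow (hΩ : ∀ x, Ω (θ x) = θ (Ω x) + θ (θ x)) (i : ℕ) (x : G) :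
    θ ((Ω ^ i) x) ∈ chainN θ Ω i i := by
  induction i with
  | zero => exact mem_chainN (θ := θ) (Ω := Ω) (T := 0) le_rfl (θ x)
  | succ i ih =>
    have e : θ ((Ω ^ (i + 1)) x) = Ω (θ ((Ω ^ i) x)) - θ (θ ((Ω ^ i) x)) := by
      rw [hΩ, pow_succ', End.mul_apply]; abel
    have h2 : ∀ l ≤ i, ∀ y, θ ((θ ^ (i - l)) ((Ω ^ l) y)) ∈ chainN θ Ω (i + 1) (i + 1) := by
      intro l hl y
      have := mem_chainN (θ := θ) (Ω := Ω) (T := i + 1) (hl.trans i.le_succ) y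
      rwa [Nat.succ_sub hl, pow_succ', End.mul_apply] at this
    rw [e]
    refine sub_mem (map_chainN_le (fun l hl y => ?_) ih) (map_chainN_le h2 ih)
    rw [om_pow_theta hΩ]
    refine add_mem ?_ (Submodule.smul_mem _ _ (h2 l hl y))
    have := mem_chainN (θ := θ) (Ω := Ω) (T := i + 1) (Nat.succ_le_succ hl) y
    rwa [Nat.add_sub_add_right, pow_succ', End.mul_apply] at this

theorem theta_mem_chainN (hΩ : ∀ x, Ω (θ x) = θ (Ω x) + θ (θ x)) {T j : ℕ} (hj : j ≤ T) {x : G}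
    (hx : x ∈ chainN θ Ω T j) : θ x ∈ chainN θ Ω T j := by
  refine map_chainN_le (fun i hi y => ?_) hx
  rw [← End.mul_apply, ← pow_succ', pow_succ, End.mul_apply]
  refine map_chainN_le (fun l hl z => ?_) (theta_om_pow hΩ i y)
  rw [← End.mul_apply, ← pow_add, show T - i + (i - l) = T - l by omega]
  exact mem_chainN (hl.trans hi) z

theorem om_mem_chainN (hΩ : ∀ x, Ω (θ x) = θ (Ω x) + θ (θ x)) {T : ℕ} (hT : Ω ^ T = 0) {j : ℕ}
    {x : G} (hx : x ∈ chainN θ Ω T j) : Ω x ∈ (chainN θ Ω T (j + 1)).map θ := by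
  refine chainN_le (S := ((chainN θ Ω T (j + 1)).map θ).comap Ω) (fun i hi y => ?_) hx
  rw [Submodule.mem_comap, om_pow_theta hΩ]
  refine add_mem ?_ (Submodule.smul_mem _ _ (Submodule.mem_map_of_mem
    (mem_chainN (hi.trans j.le_succ) y)))
  rcases lt_or_ge i T with h | h
  · refine ⟨_, mem_chainN (Nat.succ_le_succ hi) y, ?_⟩
    rw [show T - i = T - (i + 1) + 1 by omega, pow_succ', pow_succ', End.mul_apply,
      End.mul_apply]
  · have : Ω ((Ω ^ i) y) = (Ω ^ (i + 1)) y := by rw [pow_succ', End.mul_apply]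
    rw [this, show i + 1 = (i + 1 - T) + T by omega, pow_add, hT]
    simp

theorem chainN_le_top {T : ℕ} (hT : Ω ^ T = 0) (j : ℕ) : chainN θ Ω T j ≤ chainN θ Ω T T := by
  refine chainN_le fun i hi x => ?_
  rcases le_or_gt i T with h | h
  · exact mem_chainN h x
  · rw [show i = (i - T) + T by omega, pow_add Ω, hT]
    simp

theorem chainN_succ_le (hθ : Injective θ) (hΩ : ∀ x, Ω (θ x) = θ (Ω x) + θ (θ x)) {T : ℕ}
    (hT : Ω ^ T = 0) {j : ℕ}
    (h : chainN θ Ω T (j + 1) ≤ chainN θ Ω T j ⊔ (chainN θ Ω T T).map θ) :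
    chainN θ Ω T (j + 2) ≤ chainN θ Ω T (j + 1) ⊔ (chainN θ Ω T T).map θ := by
  refine chainN_le fun i hi x => ?_
  rcases Nat.lt_or_ge i (j + 2) with hi' | hi'
  · exact mem_sup_left (mem_chainN (by omega) x)
  obtain rfl : i = j + 2 := by omega
  rcases Nat.lt_or_ge T (j + 2) with hjT | hjT
  · rw [show j + 2 = (j + 2 - T) + T by omega, pow_add Ω, hT]
    simp
  set v := (θ ^ (T - (j + 1))) ((Ω ^ (j + 1)) x) with hv
  have hvN : v ∈ chainN θ Ω T (j + 1) := mem_chainN le_rfl x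
  obtain ⟨u, hu, _, ⟨g, hg, rfl⟩, huv⟩ := Submodule.mem_sup.1 (h hvN)
  have e1 := om_pow_theta hΩ (T - (j + 1)) ((Ω ^ (j + 1)) x)
  rw [← hv, ← huv, map_add, hΩ, huv] at e1
  obtain ⟨u', hu', eu⟩ := om_mem_chainN hΩ hT hu
  obtain ⟨g', hg', eg⟩ := om_mem_chainN hΩ hT hg
  have hg'' := chainN_le_top hT _ hg'
  have e2 : θ ((θ ^ (T - (j + 2))) ((Ω ^ (j + 2)) x)) =
      (θ ^ (T - (j + 1))) (Ω ((Ω ^ (j + 1)) x)) := by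
    rw [show T - (j + 1) = T - (j + 2) + 1 by omega, pow_succ' θ, pow_succ' Ω (j + 1),
      End.mul_apply, End.mul_apply]
  rw [← eu, ← eg] at e1
  have e3 : θ ((θ ^ (T - (j + 2))) ((Ω ^ (j + 2)) x)) =
      θ (u' - ((T - (j + 1) : ℕ) : k) • v + θ (g' + g)) := by
    rw [e2]
    simp only [map_add, map_sub, map_smul] at e1 ⊢
    rw [eq_sub_of_add_eq e1.symm]
    abel
  rw [hθ e3]
  exact Submodule.add_mem_sup (sub_mem hu' (Submodule.smul_mem _ _ hvN))
    (Submodule.mem_map_of_mem (add_mem hg'' hg))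

/-- If a nilpotent operator `Ω` satisfies `Ω θ = θ Ω + θ²` on a torsion free module of rank at
most `D`, its powers lose at most `D` powers of `θ`. -/
theorem om_pow_mem_range (hθ : Injective θ) (hΩ : ∀ x, Ω (θ x) = θ (Ω x) + θ (θ x))
    [Module.Finite k (G ⧸ range θ)] {D : ℕ}
    (hD : Module.finrank k (G ⧸ range θ) ≤ D) (hnil : IsNilpotent Ω) {n : ℕ}
    (hn : D ≤ n) (x : G) : (Ω ^ n) x ∈ range (θ ^ (n - D)) := by
  obtain ⟨P, hP⟩ := hnil
  set T := P + n with hTdef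
  have hT : Ω ^ T = 0 := by rw [hTdef, pow_add, hP, zero_mul]
  set H := chainN θ Ω T T with hH
  have hN0 : range (θ ^ T) ≤ H := by
    rintro _ ⟨y, rfl⟩
    exact mem_chainN (θ := θ) (Ω := Ω) (T := T) (Nat.zero_le T) y
  obtain ⟨hfin, hrank⟩ := finrank_map_mkQ hθ hN0 (H := H)
    (Submodule.map_le_iff_le_comap.2 fun y hy => theta_mem_chainN hΩ le_rfl hy)
  have key : ∃ j ≤ D, chainN θ Ω T (j + 1) ≤ chainN θ Ω T j ⊔ H.map θ := by
    by_contra! hcon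
    have : ∀ j ≤ D + 1, j ≤ Module.finrank k ((chainN θ Ω T j).map (H.map θ).mkQ) := by
      intro j
      induction j with
      | zero => intro _; exact Nat.zero_le _
      | succ j ih =>
        intro hj
        refine (ih (by omega)).trans_lt (Submodule.finrank_lt_finrank_of_lt
          (lt_of_le_not_ge (Submodule.map_mono (chainN_mono j.le_succ)) fun hle => ?_))
        refine hcon j (by omega) ?_
        rw [Submodule.map_le_iff_le_comap, Submodule.comap_map_mkQ, sup_comm] at hle
        exact hle
    have h1 := this (D + 1) le_rfl
    have h2 := Submodule.finrank_mono (Submodule.map_mono (f := (H.map θ).mkQ)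
      (chainN_le_top (θ := θ) hT (D + 1)))
    rw [hrank] at h2
    omega
  obtain ⟨j, hjD, hj⟩ := key
  have hstep : ∀ i, chainN θ Ω T (j + i + 1) ≤ chainN θ Ω T (j + i) ⊔ H.map θ := by
    intro i
    induction i with
    | zero => exact hj
    | succ i ih => exact chainN_succ_le hθ hΩ hT ih
  have hall : ∀ i, chainN θ Ω T (j + i) ≤ chainN θ Ω T j ⊔ H.map θ := by
    intro i
    induction i with
    | zero => exact le_sup_left
    | succ i ih => exact (hstep i).trans (sup_le ih le_sup_right)
  have hHD : H ≤ chainN θ Ω T D ⊔ H.map θ :=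
    ((chainN_mono (by omega)).trans (hall T)).trans (sup_le_sup_right (chainN_mono hjD) _)
  have hstab : (chainN θ Ω T D).map θ ≤ chainN θ Ω T D :=
    Submodule.map_le_iff_le_comap.2 fun y hy => theta_mem_chainN hΩ (by omega) hy
  have hk : ∀ i, H ≤ chainN θ Ω T D ⊔ H.map (θ ^ i) := by
    intro i
    induction i with
    | zero => exact le_sup_of_le_right fun y hy => ⟨y, hy, rfl⟩
    | succ i ih =>
      refine hHD.trans (sup_le le_sup_left ?_)
      refine (Submodule.map_mono ih).trans ?_
      rw [Submodule.map_sup, pow_succ', End.mul_eq_comp, Submodule.map_comp]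
      exact sup_le_sup_right hstab _
  have hHN : H ≤ chainN θ Ω T D := by
    refine (hk T).trans (sup_le le_rfl ?_)
    refine LinearMap.map_le_range.trans ?_
    rintro _ ⟨y, rfl⟩
    exact mem_chainN (θ := θ) (Ω := Ω) (T := T) (Nat.zero_le D) y
  have hNr : chainN θ Ω T D ≤ range (θ ^ (T - D)) := by
    refine chainN_le fun i hi y => ?_
    rw [show T - i = (T - D) + (D - i) by omega, pow_add, End.mul_apply]
    exact ⟨_, rfl⟩
  obtain ⟨z, hz⟩ := hNr (hHN (mem_chainN (θ := θ) (Ω := Ω) (T := T) (show n ≤ T by omega) x))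
  refine ⟨z, ?_⟩
  have hinj : Injective (θ ^ (T - n)) := by
    rw [End.coe_pow]; exact hθ.iterate _
  apply hinj
  rw [← hz, ← End.mul_apply, ← pow_add]
  congr 2
  omega

end Chain
end NonSplit

namespace NonSplit

open PowerSeries (C X coeff coeff_C coeff_C_mul coeff_derivative coeff_mk coeff_one coeff_succ_X_mul coeff_zero_X_mul constantCoeff derivative mk)
open Module (End)

section CharP
variable {L A : Type*} [Field L] [CommRing A] [Algebra L A] {p : ℕ}

open TensorProduct in
theorem pow_char_mul [Fact p.Prime] [CharP L p] {Ω d : End L A}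
    (h : ∀ a b, Ω (a * b) = d a * b + a * Ω b) (a b : A) :
    (Ω ^ p) (a * b) = (d ^ p) a * b + a * (Ω ^ p) b := by
  set x : End L (A ⊗[L] A) := d.rTensor A
  set y : End L (A ⊗[L] A) := Ω.lTensor A
  have hxy : Commute x y := by
    change x.comp y = y.comp x
    rw [LinearMap.rTensor_comp_lTensor, LinearMap.lTensor_comp_rTensor]
  obtain ⟨r, hr⟩ := hxy.exists_add_pow_prime_eq (Fact.out : p.Prime)
  have hp : ((p : ℕ) : End L (A ⊗[L] A)) = 0 := by
    rw [← map_natCast (algebraMap L (End L (A ⊗[L] A))), CharP.cast_eq_zero, map_zero]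
  rw [hp, zero_mul, zero_mul, zero_mul, add_zero] at hr
  have hμ : ∀ n (t : A ⊗[L] A), (Ω ^ n) (LinearMap.mul' L A t) =
      LinearMap.mul' L A (((x + y) ^ n) t) := by
    intro n
    induction n with
    | zero => intro t; rfl
    | succ n ih =>
      intro t
      rw [pow_succ', pow_succ', End.mul_apply, End.mul_apply, ih]
      generalize ((x + y) ^ n) t = u
      induction u with
      | zero => simp
      | tmul a b => simp [x, y, h]
      | add u v hu hv => simp only [map_add, hu, hv]
  have := hμ p (a ⊗ₜ b)
  rw [hr, LinearMap.rTensor_pow, LinearMap.lTensor_pow] at this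
  simpa using this

end CharP

section BrieskornCharP
variable {L : Type*} [Field L] {m : ℕ} {p : ℕ}

theorem cast_ascFactorial_eq_zero [Fact p.Prime] [CharP L p] (n : ℕ) :
    ((n.ascFactorial p : ℕ) : L) = 0 := by
  rw [CharP.cast_eq_zero_iff L p]
  exact (Nat.dvd_factorial (Fact.out : p.Prime).pos le_rfl).trans
    (Nat.factorial_dvd_ascFactorial n p)

theorem ascFactorial_succ_left (a n : ℕ) :
    a.ascFactorial (n + 1) = a * (a + 1).ascFactorial n := by
  rw [Nat.ascFactorial_succ, ← Nat.succ_ascFactorial]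

theorem pderiv_iterate_char [Fact p.Prime] [CharP L p] (j : Fin m) (g : 𝒪 m L) :
    (pderiv L j)^[p] g = 0 := by
  have : ∀ n c, MvPowerSeries.coeff c ((pderiv L j)^[n] g) =
      MvPowerSeries.coeff (c + single j n) g * (((c j + 1).ascFactorial n : ℕ) : L) := by
    intro n
    induction n with
    | zero => intro c; simp
    | succ n ih =>
      intro c
      rw [iterate_succ_apply', MvPowerSeries.coeff_pderiv, ih, add_assoc,
        ← Finsupp.single_add, add_comm 1 n, ascFactorial_succ_left]
      simp only [Finsupp.add_apply, Finsupp.single_eq_same]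
      push_cast
      ring
  ext c
  rw [this, cast_ascFactorial_eq_zero]
  simp

/-- The `L`-linear derivation `θ D_j`. -/
noncomputable def thetaD (L : Type*) [CommRing L] {m : ℕ} (j : Fin m) :
    End L (PowerSeries (𝒪 m L)) :=
  (mulLeft L X).comp (liftD (pderiv L j) : _ →ₗ[L] _)

theorem thetaD_pow_char [Fact p.Prime] [CharP L p] (j : Fin m) : thetaD L j ^ p = 0 := by
  have : ∀ n g, (thetaD L j ^ n) g =
      X ^ n * mk fun i => (pderiv L j)^[n] (coeff i g) := by
    intro n
    induction n with
    | zero => intro g; ext : 1; simp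
    | succ n ih =>
      intro g
      rw [pow_succ', End.mul_apply, ih]
      change X * liftD (pderiv L j) _ = _
      rw [leibniz, Derivation.leibniz_pow, liftD_X, pow_succ']
      have : liftD (pderiv L j) (mk fun i => (pderiv L j)^[n] (coeff i g)) =
          mk fun i => (pderiv L j)^[n + 1] (coeff i g) := by
        ext i : 1
        rw [coeff_liftD, coeff_mk, coeff_mk, iterate_succ_apply']
      rw [this]
      simp only [smul_eq_mul]
      ring
  ext g : 1
  rw [this]
  simp only [pderiv_iterate_char]
  rw [show (mk fun _ => (0 : 𝒪 m L)) = 0 from by ext : 1; simp]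
  simp

/-- The `L`-linear derivation `θ² ∂_θ`. -/
noncomputable def thetaSqD (L : Type*) [CommRing L] (m : ℕ) :
    End L (PowerSeries (𝒪 m L)) :=
  (mulLeft L (X ^ 2)).comp
    ((derivative (𝒪 m L)).restrictScalars L :
      PowerSeries (𝒪 m L) →ₗ[L] PowerSeries (𝒪 m L))

theorem thetaSqD_apply (g : PowerSeries (𝒪 m L)) : thetaSqD L m g =
    X ^ 2 * derivative (𝒪 m L) g := rfl

theorem coeff_thetaSqD (g : PowerSeries (𝒪 m L)) (n : ℕ) :
    coeff (n + 1) (thetaSqD L m g) = n * coeff n g := by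
  rw [thetaSqD_apply, pow_succ, pow_one, mul_assoc, coeff_succ_X_mul]
  cases n with
  | zero => simp
  | succ n =>
    rw [coeff_succ_X_mul, coeff_derivative]
    push_cast; ring

theorem coeff_zero_thetaSqD (g : PowerSeries (𝒪 m L)) :
    coeff 0 (thetaSqD L m g) = 0 := by
  rw [thetaSqD_apply, pow_succ, mul_comm _ X, mul_assoc,
    coeff_zero_X_mul]

theorem thetaSqD_pow_char [Fact p.Prime] [CharP L p] : thetaSqD L m ^ p = 0 := by
  have h0 : ∀ n g i, i < n → coeff i ((thetaSqD L m ^ n) g) = 0 := by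
    intro n
    induction n with
    | zero => intro g i hi; omega
    | succ n ih =>
      intro g i hi
      rw [pow_succ', End.mul_apply]
      cases i with
      | zero => exact coeff_zero_thetaSqD _
      | succ i => rw [coeff_thetaSqD, ih g i (by omega), mul_zero]
  have h1 : ∀ n g i, coeff (i + n) ((thetaSqD L m ^ n) g) =
      ((i.ascFactorial n : ℕ) : 𝒪 m L) * coeff i g := by
    intro n
    induction n with
    | zero => intro g i; simp
    | succ n ih =>
      intro g i
      rw [pow_succ', End.mul_apply, ← add_assoc, coeff_thetaSqD, ih, Nat.ascFactorial_succ]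
      push_cast; ring
  ext g i : 2
  rw [LinearMap.zero_apply, map_zero]
  rcases lt_or_ge i p with h | h
  · exact h0 p g i h
  · rw [show i = (i - p) + p by omega, h1,
      ← map_natCast (MvPowerSeries.C : L →+* 𝒪 m L), cast_ascFactorial_eq_zero,
      map_zero, zero_mul]

theorem omF_mul (F : 𝒪 m L) (a b) :
    omF F (a * b) = thetaSqD L m a * b + a * omF F b := by
  rw [omF_apply, omF_apply, thetaSqD_apply, leibniz, smul_eq_mul, smul_eq_mul]
  ring

theorem twF_mul (F : 𝒪 m L) (j : Fin m) (a b) :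
    twF F j (a * b) = thetaD L j a * b + a * twF F j b := by
  rw [twF, tw_mul]
  change _ = X * liftD (pderiv L j) a * b + _
  ring_nf

theorem omF_pow_char [Fact p.Prime] [CharP L p] (F : 𝒪 m L) (g) :
    ((omF F : End L _) ^ p) g = g * ((omF F : End L _) ^ p) 1 := by
  have := pow_char_mul (omF_mul F) g 1 (p := p)
  rwa [thetaSqD_pow_char, mul_one, LinearMap.zero_apply, zero_mul, zero_add] at this

theorem twF_pow_char [Fact p.Prime] [CharP L p] (F : 𝒪 m L) (j : Fin m) (g) :
    ((twF F j : End L _) ^ p) g = g * ((twF F j : End L _) ^ p) 1 := by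
  have := pow_char_mul (twF_mul F j) g 1 (p := p)
  rwa [thetaD_pow_char, mul_one, LinearMap.zero_apply, zero_mul, zero_add] at this

theorem twF_X_mul (F : 𝒪 m L) (j : Fin m) (g) :
    twF F j (X * g) = X * twF F j g := by
  rw [twF, tw_mul, liftD_X]; ring

theorem coeff_twF_succ (F : 𝒪 m L) (j : Fin m) (g) (i : ℕ) :
    coeff (i + 1) (twF F j g) = pderiv L j (coeff i g) +
      pderiv L j F * coeff (i + 1) g := by
  rw [twF, tw_apply, map_add, coeff_succ_X_mul, coeff_liftD, coeff_C_mul]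

theorem coeff_twF_zero (F : 𝒪 m L) (j : Fin m) (g) :
    coeff 0 (twF F j g) = pderiv L j F * coeff 0 g := by
  rw [twF, tw_apply, map_add, coeff_zero_X_mul, coeff_C_mul, zero_add]

theorem twF_pow_char_one [Fact p.Prime] [CharP L p] (F : 𝒪 m L) (j : Fin m) :
    ((twF F j : End L _) ^ p) 1 = C (pderiv L j F ^ p) := by
  set Y := ((twF F j : End L _) ^ p) 1 with hY
  have hdeg : ∀ n i, n ≤ i → 0 < i →
      coeff i (((twF F j : End L _) ^ n) 1) = 0 := by
    intro n
    induction n with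
    | zero =>
      intro i _ hi0
      rw [pow_zero, End.one_apply, coeff_one, if_neg (by omega)]
    | succ n ih =>
      intro i hi _
      obtain ⟨i, rfl⟩ : ∃ i', i = i' + 1 := ⟨i - 1, by omega⟩
      rw [pow_succ', End.mul_apply, coeff_twF_succ, ih (i + 1) (by omega) (by omega),
        mul_zero, add_zero]
      rcases Nat.eq_zero_or_pos i with rfl | h
      · obtain rfl : n = 0 := by omega
        simp
      · rw [ih i (by omega) h, map_zero]
  have hzero : ∀ n, coeff 0 (((twF F j : End L _) ^ n) 1) =
      pderiv L j F ^ n := by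
    intro n
    induction n with
    | zero => simp
    | succ n ih => rw [pow_succ', End.mul_apply, coeff_twF_zero, ih, pow_succ']
  have hX : ∀ (n : ℕ) (g), omF F (((twF F j : End L _) ^ n) g) =
      ((twF F j : End L _) ^ n) (omF F g) +
        (n : PowerSeries (𝒪 m L)) *
          (X * ((twF F j : End L _) ^ n) g) := by
    intro n
    induction n with
    | zero => intro g; simp
    | succ n ih =>
      intro g
      rw [pow_succ, End.mul_apply, ih, End.mul_apply, omF_twF, map_add]
      have : ∀ h, ((twF F j : End L _) ^ n) (X * h) =
          X * ((twF F j : End L _) ^ n) h := by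
        intro h
        have := LinearMap.congr_fun ((show Commute (mulLeft L X :
          End L (PowerSeries (𝒪 m L))) (twF F j) from
          LinearMap.ext fun h => (twF_X_mul F j h).symm).pow_right n) h
        exact this.symm
      rw [this]
      push_cast; ring
  have hd : thetaSqD L m Y = 0 := by
    have h1 := hX p 1
    have h2 : ((p : ℕ) : PowerSeries (𝒪 m L)) = 0 := by
      rw [← map_natCast (algebraMap L (PowerSeries (𝒪 m L))),
        CharP.cast_eq_zero, map_zero]
    rw [h2, zero_mul, add_zero, ← hY, twF_pow_char F j (omF F 1), ← hY] at h1
    have h3 := omF_mul F Y 1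
    rw [mul_one, mul_one, h1, mul_comm] at h3
    exact (right_eq_add.1 h3)
  ext i : 1
  rw [coeff_C]
  split_ifs with hi
  · rw [hi]; exact hzero p
  · rcases lt_or_ge i p with h | h
    · have h1 := coeff_thetaSqD Y i
      rw [hd, map_zero, ← map_natCast (MvPowerSeries.C : L →+* 𝒪 m L)] at h1
      have h2 : (i : L) ≠ 0 := fun h0 => hi (Nat.eq_zero_of_dvd_of_lt
        ((CharP.cast_eq_zero_iff L p i).1 h0) h)
      have h3 : MvPowerSeries.C (i : L)⁻¹ * (MvPowerSeries.C (i : L) * coeff i Y) = 0 := by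
        rw [← h1, mul_zero]
      rwa [← mul_assoc, ← map_mul, inv_mul_cancel₀ h2, map_one, one_mul] at h3
    · exact hdeg p i h (by omega)

theorem coeff_smul_base {R : Type*} [CommRing R] (c : R) (g : PowerSeries (𝒪 m R))
    (n : ℕ) : coeff n (c • g) = c • coeff n g := rfl

theorem exists_sub_X_mul_mem_imF {R : Type*} [CommRing R] {F h : 𝒪 m R}
    (hh : h ∈ jac F) : ∃ g, C h - X * g ∈ imF F := by
  obtain ⟨a, rfl⟩ := (mem_span_range_iff_exists_fun).1 hh
  refine ⟨-∑ j, liftD (pderiv R j) (C (a j)), ?_⟩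
  have : C (∑ j, a j * pderiv R j F) -
      X * -∑ j, liftD (pderiv R j) (C (a j)) =
      ∑ j, twF F j (C (a j)) := by
    rw [map_sum, mul_neg, sub_neg_eq_add, mul_sum, ← sum_add_distrib]
    refine sum_congr rfl fun j _ => ?_
    rw [twF, tw_apply, map_mul]; ring
  rw [this]
  exact Submodule.sum_mem _ fun j _ => tw_mem_imTw _ _ _ j _

/-- The number of monomials of degree less than `N`. -/
noncomputable def numMon (m N : ℕ) : ℕ := Nat.card {c : Fin m →₀ ℕ // c.degree < N}

theorem finite_mon (m N : ℕ) : Finite {c : Fin m →₀ ℕ // c.degree < N} :=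
  ((Finsupp.finite_of_degree_le N).subset fun c (hc : c.degree < N) => hc.le).to_subtype

theorem finite_quotient_theta {R : Type*} [Field R] {F : 𝒪 m R} {N : ℕ}
    (hN : maxId m R ^ N ≤ jac F)
    (Q : Submodule R (PowerSeries (𝒪 m R)))
    (hQ : imF F ≤ Q) (hQθ : ∀ g, X * g ∈ Q) :
    Module.Finite R (_ ⧸ Q) ∧ Module.finrank R (_ ⧸ Q) ≤ numMon m N := by
  classical
  have := finite_mon m N
  have := Fintype.ofFinite {c : Fin m →₀ ℕ // c.degree < N}
  let φ : ({c : Fin m →₀ ℕ // c.degree < N} → R) →ₗ[R] (_ ⧸ Q) :=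
    Fintype.linearCombination R fun c => Q.mkQ (C (MvPowerSeries.monomial c.1 1))
  have hφ : Function.Surjective φ := by
    intro x
    obtain ⟨g, rfl⟩ := Q.mkQ_surjective x
    refine ⟨fun c => MvPowerSeries.coeff c.1 (constantCoeff g), ?_⟩
    simp only [φ, Fintype.linearCombination_apply, ← map_smul, ← map_sum]
    rw [← sub_eq_zero, ← map_sub, ← mem_ker, Submodule.ker_mkQ]
    set g0 := constantCoeff g
    set t : 𝒪 m R := ∑ c : {c : Fin m →₀ ℕ // c.degree < N},
      MvPowerSeries.coeff c.1 g0 • MvPowerSeries.monomial c.1 1 with ht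
    have h1 : (∑ c : {c : Fin m →₀ ℕ // c.degree < N},
        MvPowerSeries.coeff c.1 g0 • (C (MvPowerSeries.monomial c.1 (1 : R)) :
          PowerSeries (𝒪 m R))) = C t := by
      rw [ht, map_sum]
      refine sum_congr rfl fun c _ => ?_
      ext n : 1
      rw [coeff_smul_base, coeff_C, coeff_C]
      split_ifs <;> simp
    rw [h1]
    have h2 : t - g0 ∈ jac F := by
      refine hN ?_
      rw [maxId_pow]
      intro e he
      rw [map_sub, ht, map_sum, sub_eq_zero, sum_eq_single ⟨e, he⟩]
      · simp
      · intro c _ hc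
        rw [map_smul, MvPowerSeries.coeff_monomial_ne, smul_zero]
        intro h; exact hc (Subtype.ext h.symm)
      · simp
    obtain ⟨u, hu⟩ := exists_sub_X_mul_mem_imF h2
    have h4 : C t - g = C (t - g0) - X * u +
        X * (u - mk fun p => coeff (p + 1) g) := by
      conv_lhs => rw [PowerSeries.eq_X_mul_shift_add_const g]
      rw [map_sub]
      ring
    rw [h4]
    exact add_mem (hQ hu) (hQθ _)
  exact ⟨Module.Finite.of_surjective φ hφ, (LinearMap.finrank_le_finrank_of_surjective hφ).trans
    (by rw [Module.finrank_fintype_fun_eq_card, numMon, Nat.card_eq_fintype_card])⟩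

theorem thetaSqD_mem_degGEθ {R : Type*} [Field R] {a : ℕ} {g : PowerSeries (𝒪 m R)}
    (hg : g ∈ degGEθ m R a) : thetaSqD R m g ∈ degGEθ m R a := by
  intro n
  cases n with
  | zero => rw [coeff_zero_thetaSqD]; exact zero_mem _
  | succ n => rw [coeff_thetaSqD]; exact mul_mem_left _ _ (hg n)

theorem omF_mem_degGEθ {R : Type*} [Field R] {F : 𝒪 m R} {a : ℕ}
    {g : PowerSeries (𝒪 m R)}
    (hg : g ∈ degGEθ m R a) : omF F g ∈ degGEθ m R a :=
  sub_mem (thetaSqD_mem_degGEθ hg) (mul_mem_left _ _ hg)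

/-- In positive characteristic `Ω` is nilpotent on the Brieskorn lattice. -/
theorem exists_omF_pow_mem [Fact p.Prime] [CharP L p] {F : 𝒪 m L} {N : ℕ}
    (hF0 : MvPowerSeries.constantCoeff F = 0) (hN : maxId m L ^ N ≤ jac F) :
    ∃ P, ∀ g, ((omF F : End L _) ^ P) g ∈ imF F := by
  have hp := (Fact.out : p.Prime).pos
  set Y := ((omF F : End L _) ^ p) 1 with hY
  have hY1 : Y ∈ degGEθ m L 1 := by
    have h1 : omF F 1 ∈ degGEθ m L 1 := by
      rw [omF_apply]
      simp only [Derivation.map_one_eq_zero, mul_zero, mul_one, zero_sub]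
      exact neg_mem (C_mem_degGEθ (mem_degGE_one.2 hF0))
    have : ∀ n, ((omF F : End L _) ^ (n + 1)) 1 ∈ degGEθ m L 1 := by
      intro n
      induction n with
      | zero => simpa using h1
      | succ n ih => rw [pow_succ', End.mul_apply]; exact omF_mem_degGEθ ih
    rw [hY, show p = p - 1 + 1 by omega]
    exact this _
  have hYN : Y ^ N ∈ (jac F).map C := by
    refine Ideal.map_mono hN ?_
    rw [Ideal.map_pow]
    have : degGEθ m L 1 = (maxId m L).map C := by rw [degGEθ_eq, pow_one]
    exact Ideal.pow_mem_pow (this ▸ hY1) N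
  have : (jac F).map C =
      span (Set.range fun j => C (pderiv L j F)) := by
    rw [jac, Ideal.map_span, ← Set.range_comp]; rfl
  rw [this] at hYN
  obtain ⟨a, ha⟩ := (mem_span_range_iff_exists_fun).1 hYN
  have hchar : CharP (PowerSeries (𝒪 m L)) p :=
    charP_of_injective_algebraMap (algebraMap L _).injective p
  have hYNp : Y ^ (N * p) = ∑ j, a j ^ p * C (pderiv L j F ^ p) := by
    rw [pow_mul, ← ha, sum_pow_char]
    simp only [mul_pow, map_pow]
  have hmem : ∀ h, h * Y ^ (N * p) ∈ imF F := by
    intro h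
    rw [hYNp, mul_sum]
    refine Submodule.sum_mem _ fun j _ => ?_
    rw [← mul_assoc, ← twF_pow_char_one, ← twF_pow_char, show p = p - 1 + 1 by omega, pow_succ',
      End.mul_apply]
    exact tw_mem_imTw _ _ _ j _
  refine ⟨p * (N * p), fun g => ?_⟩
  have hpow : ∀ n g, ((omF F : End L _) ^ (p * n)) g = g * Y ^ n := by
    intro n
    induction n with
    | zero => intro g; simp
    | succ n ih =>
      intro g
      rw [mul_add, mul_one, pow_add, End.mul_apply, ih, omF_pow_char (p := p) F g, pow_succ', mul_assoc]
  rw [hpow]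
  exact hmem g

theorem omF_pow_mem_of_charP [Fact p.Prime] [CharP L p] {F : 𝒪 m L} {N : ℕ}
    (hF0 : MvPowerSeries.constantCoeff F = 0) (hN : maxId m L ^ N ≤ jac F) {n : ℕ}
    (hn : numMon m N ≤ n) (g) :
    ∃ z, ((omF F : End L _) ^ n) g - X ^ (n - numMon m N) * z ∈ imF F := by
  set I := imF F with hI
  let θ0 : End L (PowerSeries (𝒪 m L)) := mulLeft L X
  let θ : End L (_ ⧸ I) := I.mapQ I θ0 fun g hg => X_mul_mem_imF hg
  let Ω : End L (_ ⧸ I) := I.mapQ I (omF F) fun g hg => omF_mem_imF hg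
  have hθ : Injective θ := by
    rw [injective_iff_map_eq_zero]
    intro x hx
    obtain ⟨x, rfl⟩ := I.mkQ_surjective x
    have hx' : I.mkQ (X * x) = 0 := hx
    rw [← mem_ker, Submodule.ker_mkQ] at hx' ⊢
    refine imF_saturated (N := N) (fun i => hN ?_) hx'
    exact Ideal.pow_mem_pow (X_mem_maxId i) N
  have hΩ : ∀ x, Ω (θ x) = θ (Ω x) + θ (θ x) := by
    intro x
    obtain ⟨x, rfl⟩ := I.mkQ_surjective x
    exact congrArg I.mkQ (omF_X_mul F x)
  have hpΩ : ∀ n x, (Ω ^ n) (I.mkQ x) = I.mkQ (((omF F : End L _) ^ n) x) := by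
    intro n
    induction n with
    | zero => intro x; rfl
    | succ n ih => intro x; rw [pow_succ', End.mul_apply, ih, pow_succ']; rfl
  have hpθ : ∀ n x, (θ ^ n) (I.mkQ x) = I.mkQ (X ^ n * x) := by
    intro n
    induction n with
    | zero => intro x; simp
    | succ n ih => intro x; rw [pow_succ', End.mul_apply, ih, pow_succ', mul_assoc]; rfl
  have hnil : IsNilpotent Ω := by
    obtain ⟨P, hP⟩ := exists_omF_pow_mem hF0 hN
    refine ⟨P, LinearMap.ext fun x => ?_⟩
    obtain ⟨x, rfl⟩ := I.mkQ_surjective x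
    rw [hpΩ, LinearMap.zero_apply, ← mem_ker, Submodule.ker_mkQ]
    exact hP x
  obtain ⟨h1, h2⟩ := finite_quotient_theta hN (I ⊔ range θ0) le_sup_left
    (fun g => mem_sup_right ⟨g, rfl⟩)
  let e : (_ ⧸ (I ⊔ range θ0)) ≃ₗ[L] ((_ ⧸ I) ⧸ range θ) := by
    refine ((Submodule.quotientQuotientEquivQuotientSup I (range θ0)).symm).trans
      (Submodule.quotEquivOfEq _ _ ?_)
    ext x
    constructor
    · rintro ⟨_, ⟨y, rfl⟩, rfl⟩
      exact ⟨I.mkQ y, rfl⟩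
    · rintro ⟨y, rfl⟩
      obtain ⟨y, rfl⟩ := I.mkQ_surjective y
      exact ⟨_, ⟨y, rfl⟩, rfl⟩
  have := Module.Finite.equiv e
  obtain ⟨z, hz⟩ := om_pow_mem_range hθ hΩ (e.finrank_eq ▸ h2) hnil hn (I.mkQ g)
  obtain ⟨z, rfl⟩ := I.mkQ_surjective z
  refine ⟨z, ?_⟩
  rw [hpΩ, hpθ] at hz
  rw [← Submodule.ker_mkQ I, mem_ker, map_sub, hz, sub_self]

end BrieskornCharP
end NonSplit

namespace NonSplit

open PowerSeries (C X coeff coeff_X_pow_mul' coeff_derivative coeff_mk coeff_monomial coeff_monomial_same mk)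
open Module (End)

theorem Derivation_mem_pow {k A : Type*} [CommRing k] [CommRing A] [Algebra k A]
    (D : Derivation k A A) (I : Ideal A) (n : ℕ) {x : A} (hx : x ∈ I ^ (n + 1)) : D x ∈ I ^ n := by
  induction n generalizing x with
  | zero => simp
  | succ n ih =>
    rw [pow_succ] at hx
    refine Submodule.mul_induction_on hx (fun a ha b hb => ?_) fun a b ha hb => ?_
    · rw [leibniz, smul_eq_mul, smul_eq_mul]
      refine add_mem (mul_mem_right _ _ ha) ?_
      rw [pow_succ, mul_comm b]
      exact mul_mem_mul (ih ha) hb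
    · rw [map_add]; exact add_mem ha hb

section Transfer
variable {m : ℕ}

theorem exists_sub_X_pow_mul_mem_imF {L : Type*} [CommRing L] {F : 𝒪 m L}
    (e : ℕ) {h : PowerSeries (𝒪 m L)}
    (hh : h ∈ (jac F).map C ^ (2 * e)) :
    ∃ z, h - X ^ e * z ∈ imF F := by
  have hI : (jac F).map C =
      span (Set.range fun j => C (pderiv L j F)) := by
    rw [jac, Ideal.map_span, ← Set.range_comp]; rfl
  set I := (jac F).map C
  have step : ∀ a, ∀ h ∈ I ^ (a + 2), ∃ z ∈ I ^ a, h - X * z ∈ imF F := by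
    intro a h hh
    have : ∃ g : Fin m → PowerSeries (𝒪 m L), (∀ j, g j ∈ I ^ (a + 1)) ∧
        h = ∑ j, C (pderiv L j F) * g j := by
      rw [show a + 2 = a + 1 + 1 from rfl, pow_succ'] at hh
      refine Submodule.mul_induction_on hh (fun x hx y hy => ?_) ?_
      · rw [hI] at hx
        obtain ⟨b, rfl⟩ := (mem_span_range_iff_exists_fun).1 hx
        refine ⟨fun j => b j * y, fun j => mul_mem_left _ _ hy, ?_⟩
        rw [sum_mul]
        exact sum_congr rfl fun j _ => by ring
      · rintro _ _ ⟨g, hg, rfl⟩ ⟨g', hg', rfl⟩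
        refine ⟨g + g', fun j => add_mem (hg j) (hg' j), ?_⟩
        rw [← sum_add_distrib]
        exact sum_congr rfl fun j _ => by rw [Pi.add_apply]; ring
    obtain ⟨g, hg, rfl⟩ := this
    refine ⟨-∑ j, liftD (pderiv L j) (g j),
      neg_mem (Ideal.sum_mem _ fun j _ => Derivation_mem_pow _ _ _ (hg j)), ?_⟩
    have : ∑ j, C (pderiv L j F) * g j -
        X * -∑ j, liftD (pderiv L j) (g j) = ∑ j, twF F j (g j) := by
      rw [mul_neg, sub_neg_eq_add, mul_sum, ← sum_add_distrib]
      exact sum_congr rfl fun j _ => by rw [twF, tw_apply]; ring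
    rw [this]
    exact Submodule.sum_mem _ fun j _ => tw_mem_imTw _ _ _ j _
  induction e generalizing h with
  | zero => exact ⟨h, by simp⟩
  | succ e ih =>
    obtain ⟨z, hz, h1⟩ := step (2 * e) h (by rwa [mul_add] at hh)
    obtain ⟨w, h2⟩ := ih hz
    refine ⟨w, ?_⟩
    have : h - X ^ (e + 1) * w =
        h - X * z + X * (z - X ^ e * w) := by ring
    rw [this]
    exact add_mem h1 (X_mul_mem_imF h2)

/-- A functional given by finitely many coefficients. -/
noncomputable def coeffSum {R : Type*} [CommRing R] (B : Finset ((Fin m →₀ ℕ) × ℕ))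
    (a : (Fin m →₀ ℕ) × ℕ → R) : PowerSeries (𝒪 m R) →ₗ[R] R where
  toFun h := ∑ x ∈ B, a x * MvPowerSeries.coeff x.1 (coeff x.2 h)
  map_add' g h := by simp only [map_add, mul_add, sum_add_distrib]
  map_smul' c h := by
    simp only [coeff_smul_base, map_smul, smul_eq_mul, RingHom.id_apply, mul_sum]
    exact sum_congr rfl fun x _ => by ring

theorem coeffSum_apply {R : Type*} [CommRing R] (B : Finset ((Fin m →₀ ℕ) × ℕ))
    (a : (Fin m →₀ ℕ) × ℕ → R) (h) : coeffSum B a h =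
    ∑ x ∈ B, a x * MvPowerSeries.coeff x.1 (coeff x.2 h) := rfl

/-- The power series with given coefficients. -/
def mvMk {R : Type*} (f : (Fin m →₀ ℕ) → R) : 𝒪 m R := f

theorem coeff_mvMk {R : Type*} [CommRing R] (f : (Fin m →₀ ℕ) → R) (c : Fin m →₀ ℕ) :
    MvPowerSeries.coeff c (mvMk f) = f c := rfl

section Map
variable {R S : Type*} [CommRing R] [CommRing S] (φ : R →+* S)

/-- Coefficientwise change of rings. -/
noncomputable def mapA : PowerSeries (𝒪 m R) →+* PowerSeries (𝒪 m S) :=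
  PowerSeries.map (MvPowerSeries.map φ)

theorem coeff_mapA (h : PowerSeries (𝒪 m R)) (n : ℕ) :
    coeff n (mapA φ h) = MvPowerSeries.map φ (coeff n h) := by
  simp [mapA]

theorem mapA_C (f : 𝒪 m R) :
    mapA φ (C f) = C (MvPowerSeries.map φ f) := PowerSeries.map_C ..

theorem mapA_X : mapA φ (X : PowerSeries (𝒪 m R)) = X :=
  PowerSeries.map_X ..

theorem map_pderiv (f : 𝒪 m R) (j : Fin m) :
    MvPowerSeries.map φ (pderiv R j f) = pderiv S j (MvPowerSeries.map φ f) := by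
  ext c
  simp [MvPowerSeries.coeff_pderiv]

theorem mapA_twF (F : 𝒪 m R) (j : Fin m) (h) :
    mapA φ (twF F j h) = twF (MvPowerSeries.map φ F) j (mapA φ h) := by
  simp only [twF, tw_apply, map_add, map_mul, mapA_X, mapA_C, map_pderiv]
  congr 2
  ext n : 1
  rw [coeff_mapA, coeff_liftD, coeff_liftD, coeff_mapA, map_pderiv]

theorem mapA_omF (F : 𝒪 m R) (h) :
    mapA φ (omF F h) = omF (MvPowerSeries.map φ F) (mapA φ h) := by
  simp only [omF_apply, map_sub, map_mul, map_pow, mapA_X, mapA_C]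
  congr 2
  ext n : 1
  rw [coeff_mapA, coeff_derivative, coeff_derivative, coeff_mapA]
  simp

theorem mapA_omF_pow (F : 𝒪 m R) (n : ℕ) (h) :
    mapA φ (((omF F : End R _) ^ n) h) =
      ((omF (MvPowerSeries.map φ F) : End S _) ^ n) (mapA φ h) := by
  induction n with
  | zero => rfl
  | succ n ih => rw [pow_succ', End.mul_apply, mapA_omF, ih, pow_succ', End.mul_apply]

theorem map_coeffSum (B : Finset ((Fin m →₀ ℕ) × ℕ)) (a : (Fin m →₀ ℕ) × ℕ → R) (h) :
    φ (coeffSum B a h) = coeffSum B (fun x => φ (a x)) (mapA φ h) := by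
  simp only [coeffSum_apply, map_sum, map_mul, coeff_mapA, MvPowerSeries.coeff_map]

theorem exists_mapA_eq {h : PowerSeries (𝒪 m S)}
    (hh : ∀ c i, MvPowerSeries.coeff c (coeff i h) ∈ φ.range) :
    ∃ h', mapA φ h' = h := by
  choose f hf using hh
  refine ⟨mk fun i => mvMk fun c => f c i, ?_⟩
  ext i c
  rw [coeff_mapA, MvPowerSeries.coeff_map, coeff_mk, coeff_mvMk]
  exact hf c i

theorem exists_map_eq {h : 𝒪 m S}
    (hh : ∀ c, MvPowerSeries.coeff c h ∈ φ.range) :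
    ∃ h', MvPowerSeries.map φ h' = h := by
  choose f hf using hh
  refine ⟨mvMk f, ?_⟩
  ext c
  rw [MvPowerSeries.coeff_map, coeff_mvMk]
  exact hf c

end Map

/-- Data witnessing that `Ω ^ n g` does not lie in `imF F + θ ^ e A`. -/
def IsWitness {R : Type*} [CommRing R] (N n e : ℕ) (F : 𝒪 m R)
    (g : PowerSeries (𝒪 m R)) (B : Finset ((Fin m →₀ ℕ) × ℕ))
    (a : (Fin m →₀ ℕ) × ℕ → R) (q : (Fin m →₀ ℕ) → Fin m → 𝒪 m R) : Prop :=
  MvPowerSeries.constantCoeff F = 0 ∧ (∀ x ∈ B, x.2 < e) ∧ (∀ j h, coeffSum B a (twF F j h) = 0) ∧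
    coeffSum B a (((omF F : End R _) ^ n) g) = 1 ∧
    ∀ c : Fin m →₀ ℕ, c.degree = N →
      MvPowerSeries.monomial c 1 - ∑ j, q c j * pderiv R j F ∈ degGE m R (N + 1)

theorem maxId_pow_le_of_monomial {L : Type*} [Field L] {N : ℕ} {J : Ideal (𝒪 m L)}
    (h : ∀ c : Fin m →₀ ℕ, c.degree = N →
      MvPowerSeries.monomial c 1 ∈ J ⊔ degGE m L (N + 1)) : maxId m L ^ N ≤ J := by
  classical
  have hloc : maxId m L ≤ (⊥ : Ideal (𝒪 m L)).jacobson := by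
    rw [IsLocalRing.jacobson_eq_maximalIdeal _ bot_ne_top, maxId, Ideal.span_le]
    rintro _ ⟨i, rfl⟩
    rw [SetLike.mem_coe, IsLocalRing.mem_maximalIdeal, mem_nonunits_iff,
      MvPowerSeries.isUnit_iff_constantCoeff]
    simp
  refine Submodule.le_of_le_smul_of_le_jacobson_bot (maxId_fg.pow) hloc ?_
  rw [smul_eq_mul, ← pow_succ', maxId_pow, maxId_pow]
  intro g hg
  have := finite_mon m (N + 1)
  have := Fintype.ofFinite {c : Fin m →₀ ℕ // c.degree < N + 1}
  set t : 𝒪 m L := ∑ c : {c : Fin m →₀ ℕ // c.degree < N + 1},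
      MvPowerSeries.coeff c.1 g • MvPowerSeries.monomial c.1 1 with ht
  have h1 : t ∈ J ⊔ degGE m L (N + 1) := by
    refine Ideal.sum_mem _ fun c _ => ?_
    rw [MvPowerSeries.smul_eq_C_mul]
    rcases Nat.lt_or_ge c.1.degree N with h' | h'
    · rw [hg _ h', map_zero, zero_mul]; exact zero_mem _
    · exact mul_mem_left _ _ (h _ (by have := c.2; omega))
  have h2 : g - t ∈ degGE m L (N + 1) := by
    intro e he
    rw [map_sub, ht, map_sum, sub_eq_zero, sum_eq_single ⟨e, he⟩]
    · simp
    · intro c _ hc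
      rw [map_smul, MvPowerSeries.coeff_monomial_ne, smul_zero]
      intro h; exact hc (Subtype.ext h.symm)
    · simp
  rw [← sub_add_cancel g t]
  exact add_mem (mem_sup_right h2) h1

theorem not_isWitness_of_charP {L : Type*} [Field L] {p : ℕ} [Fact p.Prime] [CharP L p] {N n : ℕ}
    (hn : numMon m N ≤ n) {F : 𝒪 m L} {g B a q} :
    ¬ IsWitness N n (n - numMon m N) F g B a q := by
  rintro ⟨hF, hB, htw, hone, hq⟩
  have hN : maxId m L ^ N ≤ jac F := maxId_pow_le_of_monomial fun c hc => by
    rw [← sub_add_cancel (MvPowerSeries.monomial c 1) (∑ j, q c j * pderiv L j F)]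
    exact add_mem (mem_sup_right (hq c hc)) (mem_sup_left
      (Ideal.mem_span_range_iff_exists_fun.2 ⟨_, rfl⟩))
  obtain ⟨z, hz⟩ := omF_pow_mem_of_charP (p := p) hF hN hn g
  have h1 : imF F ≤ LinearMap.ker (coeffSum B a) := imTw_le fun j h => htw j h
  have h2 := h1 hz
  rw [mem_ker, map_sub, hone, sub_eq_zero] at h2
  refine one_ne_zero (h2.trans ?_)
  rw [coeffSum_apply]
  refine sum_eq_zero fun x hx => ?_
  rw [coeff_X_pow_mul', if_neg (by have := hB x hx; omega), map_zero, mul_zero]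

theorem IsWitness.map {R S : Type*} [CommRing R] [CommRing S] (φ : R →+* S)
    (hφ : Function.Surjective φ) {N n e : ℕ} {F : 𝒪 m R} {g B a q}
    (h : IsWitness N n e F g B a q) :
    IsWitness N n e (MvPowerSeries.map φ F) (mapA φ g) B (fun x => φ (a x))
      (fun c j => MvPowerSeries.map φ (q c j)) := by
  obtain ⟨hF, hB, htw, hone, hq⟩ := h
  refine ⟨by simp [hF], hB, fun j h => ?_, ?_, fun c hc => ?_⟩
  · obtain ⟨h, rfl⟩ := exists_mapA_eq φ (h := h) (fun c i => hφ _)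
    rw [← mapA_twF, ← map_coeffSum, htw, map_zero]
  · rw [← mapA_omF_pow, ← map_coeffSum, hone, map_one]
  · intro d hd
    have := congrArg φ (hq c hc d hd)
    rw [← MvPowerSeries.coeff_map, map_zero] at this
    simpa [map_pderiv] using this

theorem IsWitness.of_map {R S : Type*} [CommRing R] [CommRing S] (φ : R →+* S)
    (hφ : Injective φ) {N n e : ℕ} {F : 𝒪 m R} {g B a q}
    (h : IsWitness N n e (MvPowerSeries.map φ F) (mapA φ g) B (fun x => φ (a x))
      (fun c j => MvPowerSeries.map φ (q c j))) :
    IsWitness N n e F g B a q := by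
  obtain ⟨hF, hB, htw, hone, hq⟩ := h
  refine ⟨hφ (by simpa using hF), hB, fun j h => hφ ?_, hφ ?_, fun c hc d hd => hφ ?_⟩
  · rw [map_coeffSum, mapA_twF, htw, map_zero]
  · rw [map_coeffSum, mapA_omF_pow, hone, map_one]
  · have := hq c hc d hd
    rw [← MvPowerSeries.coeff_map, map_zero]
    simpa [map_pderiv] using this

theorem isJacobsonRing_int : IsJacobsonRing ℤ := by
  rw [isJacobsonRing_iff_prime_eq]
  intro P hP
  by_cases h : P = ⊥
  · subst h
    refine le_antisymm (fun x hx => ?_) Ideal.le_jacobson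
    have h1 := Ideal.mem_jacobson_bot.1 hx x
    rw [Int.isUnit_iff] at h1
    rw [Ideal.mem_bot]
    rcases h1 with h1 | h1
    · simpa using h1
    · nlinarith [mul_self_nonneg x]
  · have := hP.isMaximal h
    exact Ideal.jacobson_eq_self_of_isMaximal

/-- A finitely generated ring over `ℤ` has a residue field of positive characteristic. -/
theorem exists_residue_charP (S : Type*) [CommRing S] [Nontrivial S] [Algebra.FiniteType ℤ S] :
    ∃ (I : Ideal S) (_ : I.IsMaximal) (p : ℕ), p.Prime ∧ CharP (S ⧸ I) p := by
  have := isJacobsonRing_int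
  obtain ⟨I, hI⟩ := Ideal.exists_maximal S
  let := Ideal.Quotient.field I
  have : Algebra.FiniteType ℤ (S ⧸ I) :=
    Algebra.FiniteType.of_surjective (Ideal.Quotient.mkₐ ℤ I) Ideal.Quotient.mk_surjective
  have := finite_of_finite_type_of_isJacobsonRing ℤ (S ⧸ I)
  obtain ⟨p, hp⟩ := CharP.exists (S ⧸ I)
  refine ⟨I, hI, p, ?_, hp⟩
  rcases CharP.char_is_prime_or_zero (S ⧸ I) p with h | rfl
  · exact h
  · have : CharZero (S ⧸ I) := CharP.charP_to_charZero _
    exact absurd (isField_of_isIntegral_of_isField (R := ℤ) (S := S ⧸ I)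
      (RingHom.injective_int _) (Field.toIsField _)) Int.not_isField

theorem finite_range_of_support {α K : Type*} [Zero K] {f : α → K} {s : Set α} (hs : s.Finite)
    (h : ∀ x ∉ s, f x = 0) : (Set.range f).Finite := by
  refine ((hs.image f).insert 0).subset ?_
  rintro _ ⟨x, rfl⟩
  by_cases hx : x ∈ s
  · exact Or.inr ⟨x, hx, rfl⟩
  · exact Or.inl (h x hx)

theorem not_isWitness_of_finite {K : Type*} [Field K] {N n : ℕ}
    (hn : numMon m N ≤ n) {F : 𝒪 m K} {g B a}
    {q : (Fin m →₀ ℕ) → Fin m → 𝒪 m K}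
    (hF : (Set.range fun c => MvPowerSeries.coeff c F).Finite)
    (hg : (Set.range fun x : (Fin m →₀ ℕ) × ℕ =>
      MvPowerSeries.coeff x.1 (coeff x.2 g)).Finite)
    (ha : (Set.range a).Finite)
    (hq : (Set.range fun x : (Fin m →₀ ℕ) × Fin m × (Fin m →₀ ℕ) =>
      MvPowerSeries.coeff x.2.2 (q x.1 x.2.1)).Finite) :
    ¬ IsWitness N n (n - numMon m N) F g B a q := by
  intro h
  obtain ⟨Z, hZ, hFZ, hgZ, haZ, hqZ⟩ : ∃ Z : Set K, Z.Finite ∧ (∀ c, MvPowerSeries.coeff c F ∈ Z) ∧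
      (∀ c i, MvPowerSeries.coeff c (coeff i g) ∈ Z) ∧ (∀ x, a x ∈ Z) ∧
      ∀ c j d, MvPowerSeries.coeff d (q c j) ∈ Z :=
    ⟨_, ((hF.union hg).union ha).union hq, fun c => Or.inl (Or.inl (Or.inl ⟨c, rfl⟩)),
      fun c i => Or.inl (Or.inl (Or.inr ⟨(c, i), rfl⟩)), fun x => Or.inl (Or.inr ⟨x, rfl⟩),
      fun c j d => Or.inr ⟨(c, j, d), rfl⟩⟩
  clear hF hg ha hq
  set S := Algebra.adjoin ℤ Z
  have hS : ∀ z ∈ Z, z ∈ (algebraMap S K).range := fun z hz =>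
    ⟨⟨z, Algebra.subset_adjoin hz⟩, rfl⟩
  have : Algebra.FiniteType ℤ S :=
    (Subalgebra.fg_iff_finiteType S).1 (Subalgebra.fg_def.2 ⟨Z, hZ, rfl⟩)
  obtain ⟨F', rfl⟩ := exists_map_eq (algebraMap S K) (h := F) fun c =>
    hS _ (hFZ c)
  obtain ⟨g', rfl⟩ := exists_mapA_eq (algebraMap S K) (h := g) fun c i =>
    hS _ (hgZ c i)
  have h1 : ∀ x, a x ∈ (algebraMap S K).range := fun x => hS _ (haZ x)
  choose a' ha' using h1
  obtain rfl : (fun x => algebraMap S K (a' x)) = a := funext ha'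
  have h2 : ∀ c j, ∃ q', MvPowerSeries.map (algebraMap S K) q' = q c j := fun c j =>
    exists_map_eq (algebraMap S K) (h := q c j) fun d => hS _ (hqZ c j d)
  choose q' hq' using h2
  obtain rfl : (fun c j => MvPowerSeries.map (algebraMap S K) (q' c j)) = q :=
    funext fun c => funext fun j => hq' c j
  have h3 := h.of_map (algebraMap S K) Subtype.val_injective
  obtain ⟨I, hI, p, hp, hchar⟩ := exists_residue_charP S
  let := Ideal.Quotient.field I
  have := Fact.mk hp
  exact not_isWitness_of_charP (p := p) hn
    (h3.map (Ideal.Quotient.mk I) Ideal.Quotient.mk_surjective)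

/-- The truncation of a power series below degree `a`. -/
noncomputable def truncMv {K : Type*} [CommRing K] (a : ℕ) (F : 𝒪 m K) :
    𝒪 m K :=
  mvMk fun c => if c.degree < a then MvPowerSeries.coeff c F else 0

theorem sub_truncMv_mem {K : Type*} [CommRing K] (a : ℕ) (F : 𝒪 m K) :
    F - truncMv a F ∈ degGE m K a := fun c hc => by
  rw [map_sub, truncMv, coeff_mvMk, if_pos hc, sub_self]

theorem coeff_truncMv_of_le {K : Type*} [CommRing K] {a : ℕ} (F : 𝒪 m K)
    {c : Fin m →₀ ℕ} (hc : a ≤ c.degree) : MvPowerSeries.coeff c (truncMv a F) = 0 := by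
  rw [truncMv, coeff_mvMk, if_neg (by omega)]

theorem finite_degree_lt (a : ℕ) : {c : Fin m →₀ ℕ | c.degree < a}.Finite :=
  (Finsupp.finite_of_degree_le a).subset fun c (hc : c.degree < a) => hc.le

theorem exists_sub_X_pow_mul_mem_degGEθ {K : Type*} [CommRing K] {l e : ℕ}
    {h : PowerSeries (𝒪 m K)}
    (hh : ∀ (c : Fin m →₀ ℕ) i, c.degree < l → i < e →
      MvPowerSeries.coeff c (coeff i h) = 0) :
    ∃ z, h - X ^ e * z ∈ degGEθ m K l := by
  refine ⟨mk fun i => coeff (i + e) h, fun i c hc => ?_⟩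
  rw [map_sub, coeff_X_pow_mul']
  split_ifs with hi
  · rw [coeff_mk, Nat.sub_add_cancel hi, sub_self, map_zero]
  · rw [sub_zero]; exact hh c i hc (not_le.1 hi)

theorem omF_X_pow_mul {K : Type*} [CommRing K] (F : 𝒪 m K) (e : ℕ) (h) :
    ∃ z, omF F (X ^ e * h) = X ^ e * z := by
  induction e generalizing h with
  | zero => exact ⟨omF F h, by simp⟩
  | succ e ih =>
    obtain ⟨z, hz⟩ := ih h
    refine ⟨z + X * h, ?_⟩
    rw [pow_succ', mul_assoc, omF_X_mul, hz]; ring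

/-- The powers of `Ω` lose at most a bounded power of `θ` on the Brieskorn lattice. -/
theorem omF_pow_mem {K : Type*} [Field K] {F : 𝒪 m K} {N : ℕ}
    (hF0 : MvPowerSeries.constantCoeff F = 0) (hN : maxId m K ^ N ≤ jac F) {n : ℕ}
    (hn : numMon m N ≤ n) (g) :
    ∃ z, ((omF F : End K _) ^ n) g - X ^ (n - numMon m N) * z ∈ imF F := by
  classical
  set e := n - numMon m N with he
  by_contra hcon
  set Q : Submodule K (PowerSeries (𝒪 m K)) :=
    imF F ⊔ range (mulLeft K (X ^ e)) with hQ
  have hXQ : ∀ z, X ^ e * z ∈ Q := fun z => mem_sup_right ⟨z, rfl⟩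
  have hgQ : ((omF F : End K _) ^ n) g ∉ Q := by
    intro h
    obtain ⟨y, hy, _, ⟨z, rfl⟩, hyz⟩ := Submodule.mem_sup.1 h
    refine hcon ⟨z, ?_⟩
    rw [← hyz, LinearMap.mulLeft_apply, add_sub_cancel_right]
    exact hy
  obtain ⟨l, hl⟩ : ∃ l, l = N + 2 * e * N := ⟨_, rfl⟩
  have hdeg : ∀ h ∈ degGEθ m K l, h ∈ Q := by
    intro h hh
    have : h ∈ (jac F).map C ^ (2 * e) := by
      rw [degGEθ_eq] at hh
      have h1 : (maxId m K).map C ^ N ≤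
          (jac F).map (C : _ →+* PowerSeries (𝒪 m K)) := by
        rw [← Ideal.map_pow]; exact Ideal.map_mono hN
      refine Ideal.pow_right_mono h1 (2 * e) ?_
      rw [← pow_mul]
      exact Ideal.pow_le_pow_right (by rw [hl, mul_comm N]; omega) hh
    obtain ⟨z, hz⟩ := exists_sub_X_pow_mul_mem_imF e this
    rw [← sub_add_cancel h (X ^ e * z)]
    exact add_mem (mem_sup_left hz) (hXQ z)
  set V : Submodule K (PowerSeries (𝒪 m K)) :=
    (degGEθ m K l).restrictScalars K ⊔ range (mulLeft K (X ^ e))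
    with hV
  have hVQ : V ≤ Q := sup_le hdeg le_sup_right
  have hΩV : ∀ h ∈ V, omF F h ∈ V := by
    intro h hh
    obtain ⟨y, hy, _, ⟨z, rfl⟩, rfl⟩ := Submodule.mem_sup.1 hh
    rw [map_add]
    refine add_mem (mem_sup_left (omF_mem_degGEθ hy)) (mem_sup_right ?_)
    obtain ⟨w, hw⟩ := omF_X_pow_mul F e z
    exact ⟨w, hw.symm⟩
  obtain ⟨π, hπ0, hπQ⟩ := Submodule.exists_le_ker_of_notMem hgQ
  have hπQ' : ∀ h ∈ Q, π h = 0 := fun h hh => hπQ hh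
  set c0 := π (((omF F : End K _) ^ n) g)
  set F0 := truncMv (l + 2) F with hF0def
  set g0 : PowerSeries (𝒪 m K) :=
    mk fun i => if i < e then truncMv l (coeff i g) else 0 with hg0
  set B : Finset ((Fin m →₀ ℕ) × ℕ) := (finite_degree_lt l).toFinset ×ˢ Finset.range e with hB
  set a : (Fin m →₀ ℕ) × ℕ → K := fun x => if x ∈ B then
    c0⁻¹ * π (PowerSeries.monomial x.2 (MvPowerSeries.monomial x.1 1)) else 0 with ha
  have hmemB : ∀ x, x ∈ B ↔ x.1.degree < l ∧ x.2 < e := by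
    intro x; simp [hB, Finset.mem_product]
  have hδ : F - F0 ∈ degGE m K (l + 2) := sub_truncMv_mem _ _
  have hfδ : ∀ j, pderiv K j F - pderiv K j F0 ∈ degGE m K (l + 1) := fun j => by
    rw [← map_sub]; exact pderiv_mem_degGE hδ j
  have hzeroV : ∀ h : PowerSeries (𝒪 m K), (∀ (c : Fin m →₀ ℕ) i, c.degree < l →
      i < e → MvPowerSeries.coeff c (coeff i h) = 0) → h ∈ V := by
    intro h hh
    obtain ⟨z, hz⟩ := exists_sub_X_pow_mul_mem_degGEθ hh
    rw [← sub_add_cancel h (X ^ e * z)]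
    exact add_mem (mem_sup_left hz) (mem_sup_right ⟨z, rfl⟩)
  have hmodV : ∀ h : PowerSeries (𝒪 m K), h - (∑ x ∈ B,
      MvPowerSeries.coeff x.1 (coeff x.2 h) •
        PowerSeries.monomial x.2 (MvPowerSeries.monomial x.1 1)) ∈ V := by
    intro h
    refine hzeroV _ fun c i hc hi => ?_
    have hmem := (hmemB (c, i)).2 ⟨hc, hi⟩
    rw [map_sub, map_sub, map_sum, map_sum, sum_eq_single (c, i), sub_eq_zero]
    · rw [coeff_smul_base, map_smul, coeff_monomial_same,
        MvPowerSeries.coeff_monomial_same, smul_eq_mul, mul_one]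
    · intro x _ hx
      rw [coeff_smul_base, map_smul, coeff_monomial]
      split_ifs with h1
      · rw [MvPowerSeries.coeff_monomial_ne, smul_zero]
        rintro rfl
        exact hx (Prod.ext rfl h1.symm)
      · rw [map_zero, smul_zero]
    · exact fun h => absurd hmem h
  have hπ : ∀ h, coeffSum B a h = c0⁻¹ * π h := by
    intro h
    have := hπQ' _ (hVQ (hmodV h))
    rw [map_sub, sub_eq_zero] at this
    rw [this, coeffSum_apply, map_sum, mul_sum]
    refine sum_congr rfl fun x hx => ?_
    rw [map_smul, ha]
    simp only [if_pos hx, smul_eq_mul]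
    ring
  have hg0V : g - g0 ∈ V := by
    refine hzeroV _ fun c i hc hi => ?_
    rw [map_sub, hg0, coeff_mk, if_pos hi]
    exact sub_truncMv_mem _ _ c hc
  have hn0 : ∀ i, ((omF F : End K _) ^ i) g - ((omF F0 : End K _) ^ i) g0 ∈ V := by
    intro i
    induction i with
    | zero => exact hg0V
    | succ i ih =>
      rw [pow_succ', pow_succ', End.mul_apply, End.mul_apply]
      set u := ((omF F : End K _) ^ i) g
      set v := ((omF F0 : End K _) ^ i) g0
      have : omF F u - omF F0 v = omF F (u - v) - C (F - F0) * v := by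
        rw [map_sub, omF_apply F v, omF_apply F0 v, map_sub]; ring
      rw [this]
      refine sub_mem (hΩV _ ih) (mem_sup_left ?_)
      exact mul_mem_right _ _ (C_mem_degGEθ (degGE_anti (by omega) hδ))
  have hmon : ∀ c : Fin m →₀ ℕ, ∃ q : Fin m → 𝒪 m K, c.degree = N →
      ∑ j, q j * pderiv K j F = MvPowerSeries.monomial c 1 := by
    intro c
    by_cases hc : c.degree = N
    · have : MvPowerSeries.monomial c (1 : K) ∈ jac F := by
        refine hN ?_
        rw [maxId_pow]
        intro d hd
        rw [MvPowerSeries.coeff_monomial_ne]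
        rintro rfl; omega
      obtain ⟨q, hq⟩ := Ideal.mem_span_range_iff_exists_fun.1 this
      exact ⟨q, fun _ => hq⟩
    · exact ⟨0, fun h => absurd h hc⟩
  choose q0 hq0 using hmon
  set q : (Fin m →₀ ℕ) → Fin m → 𝒪 m K := fun c j =>
    if c.degree = N then truncMv (N + 1) (q0 c j) else 0 with hq
  refine not_isWitness_of_finite hn (F := F0) (g := g0) (B := B) (a := a) (q := q) ?_ ?_ ?_ ?_
    ⟨?_, fun x hx => ((hmemB x).1 hx).2, fun j h => ?_, ?_, fun c hc => ?_⟩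
  · exact finite_range_of_support (finite_degree_lt (l + 2)) fun c hc =>
      coeff_truncMv_of_le F (not_lt.1 hc)
  · refine finite_range_of_support B.finite_toSet fun x hx => ?_
    rw [Finset.mem_coe, hmemB] at hx
    simp only [hg0, coeff_mk]
    split_ifs with h
    · exact coeff_truncMv_of_le _ (by omega)
    · simp
  · exact finite_range_of_support B.finite_toSet fun x hx => if_neg hx
  · refine finite_range_of_support ((finite_degree_lt (N + 1)).prod (Set.finite_univ.prod
      (finite_degree_lt (N + 1)))) fun x hx => ?_
    simp only [hq]
    split_ifs with h
    · refine coeff_truncMv_of_le _ (not_lt.1 fun h' => hx ⟨?_, Set.mem_univ _, h'⟩)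
      show x.1.degree < N + 1
      omega
    · simp
  · rw [hF0def, ← MvPowerSeries.coeff_zero_eq_constantCoeff_apply, truncMv, coeff_mvMk]
    split_ifs
    · simpa using hF0
    · rfl
  · rw [hπ]
    have : twF F0 j h = twF F j h - C (pderiv K j F - pderiv K j F0) * h := by
      rw [twF, twF, tw_apply, tw_apply, map_sub]; ring
    rw [this, map_sub, hπQ' (twF F j h) (mem_sup_left (show twF F j h ∈ imF F from tw_mem_imTw _ _ _ j h)),
      hπQ' _ (hdeg _ (mul_mem_right _ _ (C_mem_degGEθ (degGE_anti (by omega) (hfδ j)))))]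
    simp
  · rw [hπ]
    have := hπQ' _ (hVQ (hn0 n))
    rw [map_sub, sub_eq_zero] at this
    rw [← this]
    exact inv_mul_cancel₀ hπ0
  · rw [← hq0 c hc, ← sum_sub_distrib]
    refine Ideal.sum_mem _ fun j _ => ?_
    have : q0 c j * pderiv K j F - q c j * pderiv K j F0 =
        (q0 c j - q c j) * pderiv K j F + q c j * (pderiv K j F - pderiv K j F0) := by ring
    rw [this]
    refine add_mem (mul_mem_right _ _ ?_) (mul_mem_left _ _
      (degGE_anti (by omega) (hfδ j)))
    simp only [hq, if_pos hc]
    exact sub_truncMv_mem _ _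

end Transfer
end NonSplit

namespace NonSplit

open Module (End)

open Polynomial in
theorem exists_isCoprime_shift {K : Type*} [Field K] [CharZero K] {χ : K[X]} (hχ : χ ≠ 0) :
    ∃ k₀ : ℕ, ∀ k ≥ k₀, IsCoprime χ (χ.comp (X - C (k : K))) := by
  classical
  set S := (χ.aroots (AlgebraicClosure K)).toFinset with hS
  have hfin : {k : ℕ | ∃ a ∈ S, ∃ b ∈ S, a - b = k}.Finite := by
    have := S.finite_toSet.image2 (fun a b => a - b) S.finite_toSet
    refine (this.preimage (Nat.cast_injective (R := AlgebraicClosure K)).injOn).subset ?_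
    rintro k ⟨a, ha, b, hb, hab⟩
    exact ⟨a, ha, b, hb, hab⟩
  obtain ⟨k₀, hk₀⟩ := hfin.bddAbove
  refine ⟨k₀ + 1, fun k hk => ?_⟩
  rw [Polynomial.isCoprime_iff_aeval_ne_zero_of_isAlgClosed K (AlgebraicClosure K)]
  intro a
  by_contra! h
  have hmem : ∀ b : AlgebraicClosure K, aeval b χ = 0 → b ∈ S := fun b hb => by
    rw [hS, Multiset.mem_toFinset, mem_aroots]; exact ⟨hχ, hb⟩
  have h1 : k ∈ {k : ℕ | ∃ a ∈ S, ∃ b ∈ S, a - b = k} := by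
    refine ⟨a, hmem _ h.1, a - k, hmem _ ?_, by ring⟩
    have := h.2
    rw [aeval_comp] at this
    simpa using this
  have := hk₀ h1
  omega

open PowerSeries (C X coeff_C_mul derivative derivative_C derivative_X)

section VLemma
variable {K H : Type*} [Field K] [AddCommGroup H] [Module K H] (θ ϑ : H →ₗ[K] H) (nab : H →+ H)
  (δ : K → K)

theorem aeval_theta_comm (hϑθ : ∀ x, ϑ (θ x) = θ (ϑ x + x)) (p : Polynomial K) (x : H) :
    Polynomial.aeval ϑ p (θ x) =
      θ (Polynomial.aeval ϑ (p.comp (Polynomial.X + Polynomial.C 1)) x) := by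
  induction p using Polynomial.induction_on' generalizing x with
  | add p q hp hq => simp [hp, hq]
  | monomial n c =>
    have : ∀ x, (ϑ ^ n) (θ x) = θ (((ϑ + 1) ^ n : End K H) x) := by
      induction n with
      | zero => simp
      | succ n ih =>
        intro x
        rw [pow_succ, End.mul_apply, hϑθ, ih, pow_succ, End.mul_apply]; rfl
    rw [Polynomial.aeval_monomial, Polynomial.monomial_comp]
    simp [this]

theorem aeval_nab_comm (hϑn : ∀ x, ϑ (nab x) = nab (ϑ x + x))
    (hδ : ∀ (c : K) x, nab (c • x) = c • nab x + θ (δ c • x))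
    {W : Submodule K H} (hW : ∀ x ∈ W, ϑ x ∈ W) (p : Polynomial K) {x : H} (hx : x ∈ W) :
    ∃ w ∈ W, Polynomial.aeval ϑ p (nab x) =
      nab (Polynomial.aeval ϑ (p.comp (Polynomial.X + Polynomial.C 1)) x) + θ w := by
  induction p using Polynomial.induction_on' with
  | add p q hp hq =>
    obtain ⟨v, hv, h1⟩ := hp
    obtain ⟨w, hw, h2⟩ := hq
    refine ⟨v + w, add_mem hv hw, ?_⟩
    simp only [Polynomial.add_comp, map_add, LinearMap.add_apply, h1, h2]
    abel
  | monomial n c =>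
    have : ∀ x, (ϑ ^ n) (nab x) = nab (((ϑ + 1) ^ n : End K H) x) := by
      induction n with
      | zero => simp
      | succ n ih =>
        intro x
        rw [pow_succ, End.mul_apply, hϑn, ih, pow_succ, End.mul_apply]; rfl
    have h2 : ∀ n : ℕ, ((ϑ + 1) ^ n : End K H) x ∈ W := by
      intro n
      induction n with
      | zero => simpa
      | succ n ih =>
        rw [pow_succ', End.mul_apply]
        exact add_mem (hW _ ih) ih
    refine ⟨-(δ c • ((ϑ + 1) ^ n : End K H) x), neg_mem (W.smul_mem _ (h2 n)), ?_⟩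
    rw [Polynomial.aeval_monomial, Polynomial.monomial_comp]
    simp [this, hδ]

/-- The filtration `N₀ = H`, `N_{n+1} = ∇ N_n + θ N_n`. -/
def nabFil (hδ : ∀ (c : K) x, nab (c • x) = c • nab x + θ (δ c • x)) : ℕ → Submodule K H
  | 0 => ⊤
  | n + 1 =>
    { carrier := {y | ∃ x ∈ nabFil hδ n, ∃ z ∈ nabFil hδ n, y = nab x + θ z}
      zero_mem' := ⟨0, zero_mem _, 0, zero_mem _, by simp⟩
      add_mem' := by
        rintro _ _ ⟨x, hx, z, hz, rfl⟩ ⟨x', hx', z', hz', rfl⟩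
        exact ⟨x + x', add_mem hx hx', z + z', add_mem hz hz', by simp only [map_add]; abel⟩
      smul_mem' := by
        rintro c _ ⟨x, hx, z, hz, rfl⟩
        refine ⟨c • x, Submodule.smul_mem _ _ hx, c • z - δ c • x,
          sub_mem (Submodule.smul_mem _ _ hz) (Submodule.smul_mem _ _ hx), ?_⟩
        rw [hδ, map_sub, smul_add, map_smul, map_smul]; abel }

variable {θ ϑ nab δ}

theorem aeval_mem_of_stable {W : Submodule K H} (hW : ∀ x ∈ W, ϑ x ∈ W) (p : Polynomial K) {x : H}
    (hx : x ∈ W) : Polynomial.aeval ϑ p x ∈ W := by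
  induction p using Polynomial.induction_on' with
  | add p q hp hq => rw [map_add]; exact add_mem hp hq
  | monomial n c =>
    rw [Polynomial.aeval_monomial, End.mul_apply, Module.algebraMap_end_apply]
    refine W.smul_mem _ ?_
    induction n with
    | zero => simpa
    | succ n ih => rw [pow_succ', End.mul_apply]; exact hW _ ih

theorem nabFil_stable (hϑθ : ∀ x, ϑ (θ x) = θ (ϑ x + x)) (hϑn : ∀ x, ϑ (nab x) = nab (ϑ x + x))
    (hδ : ∀ (c : K) x, nab (c • x) = c • nab x + θ (δ c • x)) (n : ℕ) :
    ∀ x ∈ nabFil θ nab δ hδ n, ϑ x ∈ nabFil θ nab δ hδ n := by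
  induction n with
  | zero => intro x _; trivial
  | succ n ih =>
    rintro _ ⟨x, hx, z, hz, rfl⟩
    refine ⟨ϑ x + x, add_mem (ih _ hx) hx, ϑ z + z, add_mem (ih _ hz) hz, ?_⟩
    rw [map_add, hϑn, hϑθ]

theorem aeval_nabFil (hϑθ : ∀ x, ϑ (θ x) = θ (ϑ x + x)) (hϑn : ∀ x, ϑ (nab x) = nab (ϑ x + x))
    (hnθ : ∀ x, nab (θ x) = θ (nab x))
    (hδ : ∀ (c : K) x, nab (c • x) = c • nab x + θ (δ c • x)) {χ : Polynomial K}
    (hχ : ∀ x, ∃ z, Polynomial.aeval ϑ χ x = θ z) (n : ℕ) :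
    ∀ x ∈ nabFil θ nab δ hδ (n + 1), ∃ z ∈ nabFil θ nab δ hδ n,
      Polynomial.aeval ϑ (χ.comp (Polynomial.X - Polynomial.C (n : K))) x = θ z := by
  induction n with
  | zero =>
    intro x _
    obtain ⟨z, hz⟩ := hχ x
    exact ⟨z, trivial, by simpa using hz⟩
  | succ n ih =>
    have hshift : (χ.comp (Polynomial.X - Polynomial.C ((n + 1 : ℕ) : K))).comp
        (Polynomial.X + Polynomial.C 1) = χ.comp (Polynomial.X - Polynomial.C (n : K)) := by
      rw [Polynomial.comp_assoc]
      congr 1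
      simp
    rintro _ ⟨x, hx, z, hz, rfl⟩
    obtain ⟨w, hw, h1⟩ := aeval_nab_comm θ ϑ nab δ hϑn hδ
      (nabFil_stable hϑθ hϑn hδ (n + 1)) (χ.comp (Polynomial.X - Polynomial.C ((n + 1 : ℕ) : K))) hx
    obtain ⟨v, hv, h2⟩ := ih x hx
    rw [hshift, h2] at h1
    refine ⟨nab v + w + Polynomial.aeval ϑ (χ.comp (Polynomial.X - Polynomial.C (n : K))) z,
      add_mem (add_mem ⟨v, hv, 0, zero_mem _, by simp⟩ hw)
        (aeval_mem_of_stable (nabFil_stable hϑθ hϑn hδ (n + 1)) _ hz), ?_⟩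
    rw [map_add, h1, aeval_theta_comm θ ϑ hϑθ, hshift, hnθ, map_add, map_add]

theorem aeval_pow_nabFil (hϑθ : ∀ x, ϑ (θ x) = θ (ϑ x + x)) (hϑn : ∀ x, ϑ (nab x) = nab (ϑ x + x))
    (hnθ : ∀ x, nab (θ x) = θ (nab x))
    (hδ : ∀ (c : K) x, nab (c • x) = c • nab x + θ (δ c • x)) {χ : Polynomial K}
    (hχ : ∀ x, ∃ z, Polynomial.aeval ϑ χ x = θ z) (n : ℕ) :
    ∀ x ∈ nabFil θ nab δ hδ n, ∃ z,
      Polynomial.aeval ϑ ((χ.comp (Polynomial.X - Polynomial.C (n - 1 : K))) ^ n) x = (θ ^ n) z := by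
  induction n with
  | zero => intro x _; exact ⟨x, by simp⟩
  | succ n ih =>
    intro x hx
    obtain ⟨z, hz, h1⟩ := aeval_nabFil hϑθ hϑn hnθ hδ hχ n x hx
    obtain ⟨w, hw⟩ := ih z hz
    refine ⟨w, ?_⟩
    have hc : ((n + 1 : ℕ) : K) - 1 = n := by push_cast; ring
    rw [hc, pow_succ, map_mul, End.mul_apply, h1, aeval_theta_comm θ ϑ hϑθ,
      Polynomial.pow_comp, Polynomial.comp_assoc, pow_succ', End.mul_apply, ← hw]
    congr 4
    simp only [Polynomial.sub_comp, Polynomial.X_comp, Polynomial.C_comp, map_sub, map_one]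
    ring_nf

theorem nab_pow_mem [CharZero K] (hθ : Injective θ) (hϑθ : ∀ x, ϑ (θ x) = θ (ϑ x + x))
    (hϑn : ∀ x, ϑ (nab x) = nab (ϑ x + x)) (hnθ : ∀ x, nab (θ x) = θ (nab x))
    (hδ : ∀ (c : K) x, nab (c • x) = c • nab x + θ (δ c • x))
    [Module.Finite K (H ⧸ range θ)] :
    ∃ k₀ : ℕ, ∀ n x, ∃ z, nab^[n] x = (θ ^ (n - k₀)) z := by
  have hle : range θ ≤ (range θ).comap ϑ := by
    rintro _ ⟨x, rfl⟩
    exact ⟨_, (hϑθ x).symm⟩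
  set ϑ' := (range θ).mapQ (range θ) ϑ hle with hϑ'
  set χ := ϑ'.charpoly with hχdef
  have hχ : ∀ x, ∃ z, Polynomial.aeval ϑ χ x = θ z := by
    intro x
    have h1 : ∀ p : Polynomial K, Polynomial.aeval ϑ' p ((range θ).mkQ x) =
        (range θ).mkQ (Polynomial.aeval ϑ p x) := by
      intro p
      induction p using Polynomial.induction_on' with
      | add p q hp hq => simp only [map_add, LinearMap.add_apply, hp, hq]
      | monomial n c =>
        have : ∀ n : ℕ, (ϑ' ^ n) ((range θ).mkQ x) = (range θ).mkQ ((ϑ ^ n) x) := by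
          intro n
          induction n with
          | zero => rfl
          | succ n ih => rw [pow_succ', End.mul_apply, ih, pow_succ', End.mul_apply]; rfl
        rw [Polynomial.aeval_monomial, Polynomial.aeval_monomial, End.mul_apply,
          End.mul_apply, this, Module.algebraMap_end_apply, Module.algebraMap_end_apply,
          map_smul]
    have h2 := h1 χ
    rw [hχdef, LinearMap.aeval_self_charpoly, LinearMap.zero_apply, eq_comm,
      mkQ_apply, Submodule.Quotient.mk_eq_zero] at h2
    obtain ⟨z, hz⟩ := h2
    exact ⟨z, hz.symm⟩
  obtain ⟨k₀, hk₀⟩ := exists_isCoprime_shift (ϑ'.charpoly_monic.ne_zero)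
  refine ⟨k₀, fun n x => ?_⟩
  have hx : nab^[n] x ∈ nabFil θ nab δ hδ n := by
    induction n with
    | zero => trivial
    | succ n ih =>
      rw [iterate_succ_apply']
      exact ⟨_, ih, 0, zero_mem _, by simp⟩
  generalize nab^[n] x = y at hx
  have key : ∀ j, j ≤ n - k₀ → ∃ z, y = (θ ^ j) z := by
    intro j
    induction j with
    | zero => intro _; exact ⟨y, rfl⟩
    | succ j ih =>
      intro hj
      obtain ⟨z, rfl⟩ := ih (by omega)
      suffices ∃ w, z = θ w by
        obtain ⟨w, rfl⟩ := this
        exact ⟨w, by rw [pow_succ, End.mul_apply]⟩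
      obtain ⟨w, hw⟩ := aeval_pow_nabFil hϑθ hϑn hnθ hδ hχ n _ hx
      have hcomm : ∀ (j : ℕ) (p : Polynomial K) (z : H), Polynomial.aeval ϑ p ((θ ^ j) z) =
          (θ ^ j) (Polynomial.aeval ϑ (p.comp (Polynomial.X + Polynomial.C (j : K))) z) := by
        intro j
        induction j with
        | zero => intro p z; simp
        | succ j ih =>
          intro p z
          rw [pow_succ, End.mul_apply, ih, aeval_theta_comm θ ϑ hϑθ, Polynomial.comp_assoc,
            End.mul_apply]
          congr 4
          simp only [Polynomial.add_comp, Polynomial.X_comp, Polynomial.C_comp, Nat.cast_add, Nat.cast_one, map_add]; ring_nf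
      have hinj : ∀ j, Injective (θ ^ j : End K H) := fun j => by
        rw [End.coe_pow]; exact hθ.iterate j
      have hwn : (θ ^ n) w = (θ ^ j) (θ ((θ ^ (n - 1 - j)) w)) := by
        calc (θ ^ n) w = (θ ^ (j + (n - 1 - j + 1))) w := by congr 2; omega
          _ = _ := by rw [pow_add, pow_succ', End.mul_apply, End.mul_apply]
      rw [hcomm, hwn] at hw
      have hw' := hinj _ hw
      rw [Polynomial.pow_comp, Polynomial.comp_assoc] at hw'
      have hsh : (Polynomial.X - Polynomial.C ((n : K) - 1)).comp
          (Polynomial.X + Polynomial.C (j : K)) =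
          Polynomial.X - Polynomial.C ((n - 1 - j : ℕ) : K) := by
        have : ((n - 1 - j : ℕ) : K) = n - 1 - j := by
          rw [Nat.cast_sub (by omega), Nat.cast_sub (by omega)]; simp
        rw [this]; simp; ring
      rw [hsh] at hw'
      obtain ⟨a, b, hab⟩ := (hk₀ (n - 1 - j) (by omega)).pow_right (n := n)
      have h1 : ∀ p : Polynomial K, ∀ x, x ∈ range θ →
          Polynomial.aeval ϑ p x ∈ range θ := fun p x hx =>
        aeval_mem_of_stable (W := range θ) hle p hx
      have h2 : z ∈ range θ := by
        have : z = Polynomial.aeval ϑ (a * χ + b * (χ.comp (Polynomial.X -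
            Polynomial.C ((n - 1 - j : ℕ) : K))) ^ n) z := by rw [hab, map_one]; rfl
        rw [this, map_add, map_mul, map_mul, LinearMap.add_apply, End.mul_apply,
          End.mul_apply]
        obtain ⟨v, hv⟩ := hχ z
        exact add_mem (h1 _ _ ⟨v, hv.symm⟩) (h1 _ _ ⟨_, hw'.symm⟩)
      obtain ⟨w, hw⟩ := h2
      exact ⟨w, hw.symm⟩
  exact key _ le_rfl

end VLemma

section GLemma
variable {K G : Type*} [Field K] [AddCommGroup G] [Module K G]

theorem nab_iterate_theta_pow {θ : End K G} {nab : G →+ G}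
    (hnθ : ∀ x, nab (θ x) = θ (nab x)) (D n : ℕ) (x : G) :
    nab^[n] ((θ ^ D) x) = (θ ^ D) (nab^[n] x) := by
  have h1 : ∀ x, nab ((θ ^ D) x) = (θ ^ D) (nab x) := by
    induction D with
    | zero => intro x; rfl
    | succ D ih => intro x; rw [pow_succ', End.mul_apply, hnθ, ih, End.mul_apply]
  induction n with
  | zero => rfl
  | succ n ih => rw [iterate_succ_apply', iterate_succ_apply', ih, h1]

theorem nab_pow_mem_of_om_pow [CharZero K] {θ Ω : End K G} {nab : G →+ G} {δ : K → K}
    (hθ : Injective θ) (hΩ : ∀ x, Ω (θ x) = θ (Ω x) + θ (θ x))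
    (hΩn : ∀ x, Ω (nab x) = nab (Ω x) + θ (nab x)) (hnθ : ∀ x, nab (θ x) = θ (nab x))
    (hδ : ∀ (c : K) x, nab (c • x) = c • nab x + θ (δ c • x))
    [Module.Finite K (G ⧸ range θ)] {D : ℕ}
    (hD : ∀ n ≥ D, ∀ x, ∃ y, (Ω ^ n) x = (θ ^ (n - D)) y) :
    ∃ C : ℕ, ∀ n x, ∃ z, nab^[n] x = (θ ^ (n - C)) z := by
  have hinj : ∀ j, Injective (θ ^ j : End K G) := fun j => by
    rw [End.coe_pow]; exact hθ.iterate j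
  let Φ : Submodule K G →o Submodule K G :=
    ⟨fun W => (W.map θ).comap Ω, fun W W' h => Submodule.comap_mono (Submodule.map_mono h)⟩
  obtain ⟨H, hH⟩ : ∃ H, H = OrderHom.gfp Φ := ⟨_, rfl⟩
  have hΦ : ∀ W : Submodule K G, (∀ x ∈ W, ∃ y ∈ W, θ y = Ω x) → W ≤ H := fun W hW =>
    hH ▸ OrderHom.le_gfp Φ fun x hx => hW x hx
  have hHΩ : ∀ x ∈ H, ∃ y ∈ H, θ y = Ω x := fun x hx => by
    have : H ≤ Φ H := by rw [hH]; exact (OrderHom.map_gfp Φ).ge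
    exact this hx
  have hHθ : H.map θ ≤ H := hΦ _ (by
    rintro _ ⟨x, hx, rfl⟩
    obtain ⟨y, hy, h⟩ := hHΩ x hx
    exact ⟨θ (y + x), ⟨y + x, add_mem hy hx, rfl⟩, by rw [hΩ, ← h, map_add, map_add]⟩)
  have hHθ' : ∀ x ∈ H, θ x ∈ H := fun x hx => hHθ ⟨x, hx, rfl⟩
  let W : Submodule K G :=
    { carrier := {y | ∃ x ∈ H, ∃ z ∈ H, y = nab x + z}
      zero_mem' := ⟨0, zero_mem _, 0, zero_mem _, by simp⟩
      add_mem' := by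
        rintro _ _ ⟨x, hx, z, hz, rfl⟩ ⟨x', hx', z', hz', rfl⟩
        exact ⟨x + x', add_mem hx hx', z + z', add_mem hz hz', by simp only [map_add]; abel⟩
      smul_mem' := by
        rintro c _ ⟨x, hx, z, hz, rfl⟩
        refine ⟨c • x, Submodule.smul_mem _ _ hx, c • z - θ (δ c • x),
          sub_mem (Submodule.smul_mem _ _ hz) (hHθ' _ (Submodule.smul_mem _ _ hx)), ?_⟩
        rw [hδ, smul_add]; abel }
  have hHn : ∀ x ∈ H, nab x ∈ H := by
    have : W ≤ H := hΦ _ (by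
      rintro _ ⟨x, hx, z, hz, rfl⟩
      obtain ⟨x', hx', h1⟩ := hHΩ x hx
      obtain ⟨z', hz', h2⟩ := hHΩ z hz
      refine ⟨nab (x' + x) + z', ⟨x' + x, add_mem hx' hx, z', hz', rfl⟩, ?_⟩
      rw [map_add Ω, hΩn, ← h1, ← h2, hnθ]
      simp only [map_add])
    exact fun x hx => this ⟨x, hx, 0, zero_mem _, by simp⟩
  have hDH : range (θ ^ D) ≤ H := by
    have hS : ∀ y, (∃ n x, (θ ^ n) y = (θ ^ D) ((Ω ^ n) x)) →
        y ∈ Submodule.span K {y | ∃ n x, (θ ^ n) y = (θ ^ D) ((Ω ^ n) x)} := fun y hy =>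
      Submodule.subset_span hy
    have : Submodule.span K {y | ∃ n x, (θ ^ n) y = (θ ^ D) ((Ω ^ n) x)} ≤ H := by
      refine hΦ _ fun y hy => ?_
      have : Submodule.span K {y | ∃ n x, (θ ^ n) y = (θ ^ D) ((Ω ^ n) x)} ≤
          ((Submodule.span K {y | ∃ n x, (θ ^ n) y = (θ ^ D) ((Ω ^ n) x)}).map θ).comap Ω := by
        rw [Submodule.span_le]
        rintro y ⟨n, x, hy⟩
        obtain ⟨y', hy'⟩ : ∃ y', (θ ^ (n + 1)) y' = (θ ^ D) ((Ω ^ (n + 1)) x) := by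
          rcases Nat.lt_or_ge (n + 1) D with h | h
          · refine ⟨(θ ^ (D - (n + 1))) ((Ω ^ (n + 1)) x), ?_⟩
            rw [← End.mul_apply, ← pow_add]
            congr 2; omega
          · obtain ⟨z, hz⟩ := hD (n + 1) h x
            refine ⟨z, ?_⟩
            rw [hz, ← End.mul_apply (θ ^ D), ← pow_add]
            congr 2; omega
        refine ⟨y' + ((D : K) - n) • y, add_mem (hS _ ⟨_, _, hy'⟩)
          (Submodule.smul_mem _ _ (hS _ ⟨_, _, hy⟩)), hinj n ?_⟩
        have e1 := om_pow_theta (k := K) hΩ n y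
        rw [hy, om_pow_theta (k := K) hΩ D, ← End.mul_apply Ω, ← pow_succ', ← hy', ← hy] at e1
        rw [← sub_eq_iff_eq_add] at e1
        rw [← e1, ← End.mul_apply (θ ^ n) θ, ← pow_succ, map_add, map_smul, pow_succ',
          End.mul_apply, End.mul_apply]
        module
      exact this hy
    rintro _ ⟨x, rfl⟩
    exact this (hS _ ⟨0, x, rfl⟩)
  choose! t htH ht using hHΩ
  let θ' : H →ₗ[K] H := θ.restrict hHθ'
  let ϑ : H →ₗ[K] H :=
    { toFun := fun x => ⟨t x, htH _ x.2⟩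
      map_add' := fun x y => Subtype.ext (hθ (by
        simp only [Submodule.coe_add, map_add]
        rw [ht _ x.2, ht _ y.2, ← map_add]; exact ht _ (add_mem x.2 y.2)))
      map_smul' := fun c x => Subtype.ext (hθ (by
        simp only [RingHom.id_apply, Submodule.coe_smul, map_smul]
        rw [ht _ x.2, ← map_smul]; exact ht _ (H.smul_mem c x.2))) }
  have hϑ : ∀ x : H, θ (ϑ x : G) = Ω x := fun x => ht _ x.2
  let nab' : H →+ H := (nab.comp H.subtype.toAddMonoidHom).codRestrict H fun x => hHn _ x.2
  have hfin := (finrank_map_mkQ hθ hDH hHθ).1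
  have hfin' : Module.Finite K (H ⧸ range θ') := by
    have hle : range θ' ≤ (H.map θ).comap H.subtype := by
      rintro _ ⟨x, rfl⟩
      exact ⟨x, x.2, rfl⟩
    refine Module.Finite.of_injective ((range θ').mapQ (H.map θ) H.subtype hle) ?_
    rw [← LinearMap.ker_eq_bot, Submodule.ker_mapQ, eq_bot_iff, Submodule.map_le_iff_le_comap]
    rintro x ⟨y, hy, hyx⟩
    rw [Submodule.mem_comap, Submodule.mem_bot, mkQ_apply, Submodule.Quotient.mk_eq_zero]
    exact ⟨⟨y, hy⟩, Subtype.ext hyx⟩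
  obtain ⟨k₀, hk₀⟩ := nab_pow_mem (θ := θ') (ϑ := ϑ) (nab := nab') (δ := δ)
    (fun x y h => Subtype.ext (hθ (congrArg Subtype.val h)))
    (fun x => Subtype.ext (hθ (by
      rw [hϑ]; show Ω (θ x) = θ (θ (ϑ x + x)); rw [hΩ, ← hϑ]; simp)))
    (fun x => Subtype.ext (hθ (by
      rw [hϑ]; show Ω (nab x) = θ (nab (ϑ x + x)); rw [hΩn, ← hϑ, hnθ]; simp)))
    (fun x => Subtype.ext (hnθ x)) (fun c x => Subtype.ext (hδ c x))
  refine ⟨k₀ + D, fun n x => ?_⟩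
  obtain ⟨z, hz⟩ := hk₀ n ⟨(θ ^ D) x, hDH ⟨x, rfl⟩⟩
  have h1 : ∀ (n : ℕ) (x : H), ((nab'^[n] x : H) : G) = nab^[n] x := fun n x => by
    induction n with
    | zero => rfl
    | succ n ih => rw [iterate_succ_apply', iterate_succ_apply', ← ih]; rfl
  have h2 : ∀ (n : ℕ) (x : H), (((θ' ^ n : End K H) x : H) : G) = (θ ^ n) x := fun n x => by
    induction n with
    | zero => rfl
    | succ n ih =>
      rw [pow_succ', End.mul_apply, pow_succ', End.mul_apply, ← ih]; rfl
  have h3 := congrArg Subtype.val hz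
  rw [h1, h2, nab_iterate_theta_pow hnθ] at h3
  rcases Nat.lt_or_ge n (k₀ + D) with h | h
  · exact ⟨nab^[n] x, by rw [Nat.sub_eq_zero_of_le h.le]; rfl⟩
  · refine ⟨z, hinj D ?_⟩
    rw [h3, ← End.mul_apply, ← pow_add]
    congr 2; omega

end GLemma

section Concrete
variable {m : ℕ} {k K : Type*} [CommRing k] [Field K] [Algebra k K]

/-- The coefficientwise extension of a derivation. -/
noncomputable def coeffD {L : Type*} [CommRing L] [Algebra k L] (δ : Derivation k L L) :
    Derivation k (𝒪 m L) (𝒪 m L) where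
  toFun g := mvMk fun c => δ (MvPowerSeries.coeff c g)
  map_add' g h := by ext c; simp [coeff_mvMk]
  map_smul' a g := by
    ext c
    have : ∀ g : 𝒪 m L, MvPowerSeries.coeff c (a • g) = a • MvPowerSeries.coeff c g :=
      fun _ => rfl
    simp only [coeff_mvMk, RingHom.id_apply, this]
    exact δ.map_smul _ _
  map_one_eq_zero' := by
    classical
    ext c
    simp only [LinearMap.coe_mk, AddHom.coe_mk, coeff_mvMk, MvPowerSeries.coeff_one, map_zero]
    split_ifs <;> simp
  leibniz' g h := by
    classical
    ext c
    simp only [LinearMap.coe_mk, AddHom.coe_mk, coeff_mvMk, smul_eq_mul, map_add,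
      MvPowerSeries.coeff_mul, map_sum, leibniz, sum_add_distrib]
    congr 1
    exact Finset.sum_equiv (Equiv.prodComm _ _) (by simp [add_comm]) (by simp)

theorem coeff_coeffD {L : Type*} [CommRing L] [Algebra k L] (δ : Derivation k L L)
    (g : 𝒪 m L) (c : Fin m →₀ ℕ) :
    MvPowerSeries.coeff c (coeffD δ g) = δ (MvPowerSeries.coeff c g) := rfl

theorem pderiv_coeffD {L : Type*} [CommRing L] [Algebra k L] (δ : Derivation k L L) (j : Fin m)
    (g : 𝒪 m L) :
    pderiv L j (coeffD δ g) = coeffD δ (pderiv L j g) := by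
  ext c
  rw [coeff_coeffD, MvPowerSeries.coeff_pderiv, MvPowerSeries.coeff_pderiv, coeff_coeffD,
    leibniz]
  have : δ ((c j : L) + 1) = 0 := by
    rw [map_add, Derivation.map_natCast, Derivation.map_one_eq_zero, add_zero]
  rw [this, smul_zero, zero_add, smul_eq_mul, mul_comm]

/-- The connection `θ δ + δ F`. -/
noncomputable def nabF (δ : Derivation k K K) (F : 𝒪 m K) :
    PowerSeries (𝒪 m K) →ₗ[k] PowerSeries (𝒪 m K) :=
  tw X (liftD (coeffD δ)) (C (coeffD δ F))

theorem nabF_apply (δ : Derivation k K K) (F : 𝒪 m K) (g) : nabF δ F g =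
    X * liftD (coeffD δ) g + C (coeffD δ F) * g := rfl

theorem nabF_twF (δ : Derivation k K K) (F : 𝒪 m K) (j : Fin m) (g) :
    nabF δ F (twF F j g) = twF F j (nabF δ F g) := by
  have hc : liftD (coeffD δ) (liftD (pderiv K j) g) =
      liftD (pderiv K j) (liftD (coeffD δ) g) := by
    ext n : 1
    simp only [coeff_liftD, pderiv_coeffD]
  simp only [nabF_apply, twF, tw_apply, map_add, leibniz, smul_eq_mul, liftD_X, liftD_C,
    hc, pderiv_coeffD]
  ring

theorem nabF_mem_imF {δ : Derivation k K K} {F : 𝒪 m K} {g}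
    (hg : g ∈ imF F) : nabF δ F g ∈ imF F := by
  obtain ⟨h, rfl⟩ := mem_imTw.1 hg
  rw [map_sum]
  refine Submodule.sum_mem _ fun j _ => ?_
  have := nabF_twF δ F j (h j)
  rw [twF] at this
  rw [this]
  exact tw_mem_imTw _ _ _ _ _

theorem nabF_X_mul (δ : Derivation k K K) (F : 𝒪 m K) (g) :
    nabF δ F (X * g) = X * nabF δ F g := by
  simp only [nabF_apply, leibniz, smul_eq_mul, liftD_X]; ring

theorem omF_nabF (δ : Derivation k K K) (F : 𝒪 m K) (g) :
    omF F (nabF δ F g) = nabF δ F (omF F g) + X * nabF δ F g := by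
  have hc : derivative _ (liftD (coeffD δ) g) =
      liftD (coeffD δ) (derivative (𝒪 m K) g) :=
    (liftD_derivative _ g).symm
  have hX : liftD (coeffD δ) (X ^ 2 : PowerSeries (𝒪 m K)) = 0 := by
    rw [Derivation.leibniz_pow]; simp
  simp only [nabF_apply, omF_apply, map_add, map_sub, leibniz, smul_eq_mul, liftD_C, hc,
    hX, derivative_X, derivative_C]
  ring

theorem nabF_smul (δ : Derivation k K K) (F : 𝒪 m K) (c : K) (g) :
    nabF δ F (c • g) = c • nabF δ F g + X * (δ c • g) := by
  have hs : ∀ (c : K) (g : PowerSeries (𝒪 m K)),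
      c • g = C (MvPowerSeries.C c) * g := fun c g => by
    ext n d
    rw [coeff_smul_base, map_smul, coeff_C_mul, MvPowerSeries.coeff_C_mul, smul_eq_mul]
  have hC : coeffD δ (MvPowerSeries.C c : 𝒪 m K) = MvPowerSeries.C (δ c) := by
    classical
    ext d
    rw [coeff_coeffD, MvPowerSeries.coeff_C, MvPowerSeries.coeff_C]
    split_ifs <;> simp
  simp only [hs, nabF_apply, leibniz, smul_eq_mul, liftD_C, hC]
  ring

/-- Regularity of the Gauss-Manin connection: bounded loss of powers of `θ`. -/
theorem nabF_pow_mem [CharZero K] {F : 𝒪 m K} {N : ℕ}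
    (hF0 : MvPowerSeries.constantCoeff F = 0) (hN : maxId m K ^ N ≤ jac F)
    (δ : Derivation k K K) : ∃ C : ℕ, ∀ (n : ℕ) g,
      ∃ z, (nabF δ F)^[n] g - X ^ (n - C) * z ∈ imF F := by
  set A := PowerSeries (𝒪 m K)
  set Q := imF F with hQ
  let θ₀ : A →ₗ[K] A := mulLeft K X
  have hθ₀ : Q ≤ Q.comap θ₀ := fun g hg => X_mul_mem_imF hg
  have hΩ₀ : Q ≤ Q.comap (omF F) := fun g hg => omF_mem_imF hg
  let θ : End K (A ⧸ Q) := Q.mapQ Q θ₀ hθ₀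
  let Ω : End K (A ⧸ Q) := Q.mapQ Q (omF F) hΩ₀
  let nab : (A ⧸ Q) →+ (A ⧸ Q) := QuotientAddGroup.map Q.toAddSubgroup Q.toAddSubgroup
    (nabF δ F).toAddMonoidHom fun g hg => nabF_mem_imF hg
  have hθ : ∀ g, θ (Q.mkQ g) = Q.mkQ (X * g) := fun g => rfl
  have hΩ : ∀ g, Ω (Q.mkQ g) = Q.mkQ (omF F g) := fun g => rfl
  have hn : ∀ g, nab (Q.mkQ g) = Q.mkQ (nabF δ F g) := fun g => rfl
  have hθn : ∀ (n : ℕ) g, (θ ^ n) (Q.mkQ g) = Q.mkQ (X ^ n * g) := fun n g => by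
    induction n with
    | zero => simp
    | succ n ih => rw [pow_succ', End.mul_apply, ih, hθ, pow_succ', mul_assoc]
  have hΩn : ∀ (n : ℕ) g, (Ω ^ n) (Q.mkQ g) = Q.mkQ (((omF F : End K A) ^ n) g) := fun n g => by
    induction n with
    | zero => simp
    | succ n ih => rw [pow_succ', End.mul_apply, ih, hΩ, pow_succ', End.mul_apply]
  have hnn : ∀ (n : ℕ) g, nab^[n] (Q.mkQ g) = Q.mkQ ((nabF δ F)^[n] g) := fun n g => by
    induction n with
    | zero => rfl
    | succ n ih => rw [iterate_succ_apply', ih, hn, iterate_succ_apply']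
  have hXN : ∀ i, (MvPowerSeries.X i : 𝒪 m K) ^ N ∈ jac F := fun i =>
    hN (Ideal.pow_mem_pow (X_mem_maxId i) N)
  have hinj : Injective θ := by
    rw [← LinearMap.ker_eq_bot, eq_bot_iff]
    intro x hx
    obtain ⟨g, rfl⟩ := Q.mkQ_surjective x
    rw [mem_ker, hθ, mkQ_apply, Submodule.Quotient.mk_eq_zero] at hx
    rw [Submodule.mem_bot, mkQ_apply, Submodule.Quotient.mk_eq_zero]
    exact imF_saturated hXN hx
  have hfin : Module.Finite K ((A ⧸ Q) ⧸ range θ) := by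
    have := (finite_quotient_theta hN (Q ⊔ range θ₀) le_sup_left
      fun g => mem_sup_right ⟨g, rfl⟩).1
    have hle : Q ⊔ range θ₀ ≤ (range θ).comap Q.mkQ := by
      refine sup_le (fun g hg => ?_) ?_
      · rw [Submodule.mem_comap, mkQ_apply, (Submodule.Quotient.mk_eq_zero Q).2 hg]
        exact zero_mem _
      · rintro _ ⟨g, rfl⟩
        exact ⟨Q.mkQ g, rfl⟩
    refine Module.Finite.of_surjective (Submodule.mapQ _ _ Q.mkQ hle) fun x => ?_
    obtain ⟨x, rfl⟩ := (range θ).mkQ_surjective x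
    obtain ⟨x, rfl⟩ := Q.mkQ_surjective x
    exact ⟨Submodule.mkQ _ x, rfl⟩
  obtain ⟨C, hC⟩ := nab_pow_mem_of_om_pow (θ := θ) (Ω := Ω) (nab := nab) (δ := δ)
    (D := numMon m N) hinj
    (fun x => by
      obtain ⟨g, rfl⟩ := Q.mkQ_surjective x
      rw [hθ, hΩ, hΩ, hθ, hθ, ← map_add, omF_X_mul])
    (fun x => by
      obtain ⟨g, rfl⟩ := Q.mkQ_surjective x
      rw [hn, hΩ, hΩ, hn, hθ, ← map_add, omF_nabF])
    (fun x => by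
      obtain ⟨g, rfl⟩ := Q.mkQ_surjective x
      rw [hθ, hn, hn, hθ, nabF_X_mul])
    (fun c x => by
      obtain ⟨g, rfl⟩ := Q.mkQ_surjective x
      rw [← Q.mkQ.map_smul, hn, hn, ← Q.mkQ.map_smul, ← Q.mkQ.map_smul, hθ, ← map_add, nabF_smul])
    (fun n hn x => by
      obtain ⟨g, rfl⟩ := Q.mkQ_surjective x
      obtain ⟨z, hz⟩ := omF_pow_mem hF0 hN hn g
      refine ⟨Q.mkQ z, ?_⟩
      rw [hΩn, hθn, ← sub_eq_zero, ← map_sub, mkQ_apply, Submodule.Quotient.mk_eq_zero]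
      exact hz)
  refine ⟨C, fun n g => ?_⟩
  obtain ⟨x, hx⟩ := hC n (Q.mkQ g)
  obtain ⟨z, rfl⟩ := Q.mkQ_surjective x
  refine ⟨z, ?_⟩
  rwa [hnn, hθn, ← sub_eq_zero, ← map_sub, mkQ_apply, Submodule.Quotient.mk_eq_zero] at hx

end Concrete
end NonSplit

namespace NonSplit

open PowerSeries (C X X_dvd_iff X_pow_dvd_iff coeff coeff_X_pow_mul' coeff_derivative coeff_map coeff_mk coeff_zero_eq_constantCoeff_apply constantCoeff derivative derivative_C mk)

section Gen

theorem exists_hsum {O : Type*} [CommRing O] (h : ℕ → PowerSeries O) :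
    ∃ H : PowerSeries O, ∀ n,
      (X : PowerSeries O) ^ n ∣ H - ∑ i ∈ Finset.range n, X ^ i * h i := by
  refine ⟨mk fun N => ∑ i ∈ Finset.range (N + 1), coeff (N - i) (h i),
    fun n => ?_⟩
  rw [X_pow_dvd_iff]
  intro N hN
  simp only [map_sub, coeff_mk, map_sum, coeff_X_pow_mul', sub_eq_zero]
  rw [← Finset.sum_filter]
  refine sum_congr ?_ fun _ _ => rfl
  ext i
  simp only [Finset.mem_range, Finset.mem_filter]
  omega

theorem eq_zero_of_X_pow_dvd {O : Type*} [CommRing O] {g : PowerSeries O}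
    (h : ∀ n, (X : PowerSeries O) ^ n ∣ g) : g = 0 := by
  ext n
  have := h (n + 1)
  rw [X_pow_dvd_iff] at this
  simpa using this n (Nat.lt_succ_self n)

variable {k O : Type*} [CommRing k] [CommRing O]

/-- Lifting generators through a formal parameter. -/
theorem exists_gen {ι κ : Type*} [Fintype ι] [Fintype κ] (e : k →+* O) (b : ι → PowerSeries O)
    (x : κ → PowerSeries O)
    (hb : ∀ g : PowerSeries O, ∃ (c : ι → k) (h : κ → PowerSeries O) (g' : PowerSeries O),
      g = ∑ a, C (e (c a)) * b a + ∑ j, x j * h j + X * g')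
    (g : PowerSeries O) : ∃ (c : ι → PowerSeries k) (h : κ → PowerSeries O),
      g = ∑ a, PowerSeries.map e (c a) * b a + ∑ j, x j * h j := by
  choose c h r hr using hb
  let s : ℕ → PowerSeries O := fun n => r^[n] g
  choose cc hcc using fun a => exists_hsum fun n => C (c (s n) a)
  choose hh hhh using fun j => exists_hsum fun n => h (s n) j
  refine ⟨cc, hh, sub_eq_zero.1 (eq_zero_of_X_pow_dvd fun n => ?_)⟩
  have key : ∀ n, g = ∑ i ∈ Finset.range n, X ^ i *
      (∑ a, C (e (c (s i) a)) * b a + ∑ j, x j * h (s i) j) +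
        X ^ n * s n := by
    intro n
    induction n with
    | zero => simp [s]
    | succ n ih =>
      rw [Finset.sum_range_succ]
      nth_rewrite 1 [ih]
      have : s (n + 1) = r (s n) := iterate_succ_apply' r n g
      rw [this]
      have h3 := congrArg (X ^ n * ·) (hr (s n))
      rw [h3]
      ring
  have h1 : ∀ a, (X : PowerSeries O) ^ n ∣ PowerSeries.map e (cc a) -
      ∑ i ∈ Finset.range n, X ^ i * C (e (c (s i) a)) := by
    intro a
    have := map_dvd (PowerSeries.map e) (hcc a n)
    simpa using this
  have h2 : g - (∑ a, PowerSeries.map e (cc a) * b a + ∑ j, x j * hh j) =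
      X ^ n * s n - ∑ a, (PowerSeries.map e (cc a) -
        ∑ i ∈ Finset.range n, X ^ i * C (e (c (s i) a))) * b a -
      ∑ j, x j * (hh j - ∑ i ∈ Finset.range n, X ^ i * h (s i) j) := by
    nth_rewrite 1 [key n]
    simp only [sub_mul, mul_sub, sum_sub_distrib, mul_add, sum_add_distrib,
      mul_sum, sum_mul]
    rw [sum_comm (s := Finset.range n), sum_comm (s := Finset.range n)]
    simp only [mul_assoc, mul_left_comm]
    ring
  rw [h2]
  exact dvd_sub (dvd_sub (dvd_mul_right _ _) (Finset.dvd_sum fun a _ => (h1 a).mul_right _))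
    (Finset.dvd_sum fun j _ => (hhh j n).mul_left _)

end Gen

section Ring
variable (k : Type*) [Field k] (m : ℕ)

/-- Formal power series in a parameter over formal power series in `m` variables. -/
abbrev BR : Type _ := PowerSeries (𝒪 m k)

/-- The inclusion of the parameter ring. -/
noncomputable def iota : PowerSeries k →+* BR k m :=
  PowerSeries.map (MvPowerSeries.C (σ := Fin m) (R := k))

/-- The fibre coordinates. -/
noncomputable def wv (j : Fin m) : BR k m := C (MvPowerSeries.X j)

/-- Restriction to the closed point. -/
noncomputable def resk : BR k m →+* k :=
  (MvPowerSeries.constantCoeff (σ := Fin m) (R := k)).comp constantCoeff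

variable {k m}

@[simp] theorem iota_X : iota k m X = X := PowerSeries.map_X _

@[simp] theorem iota_C (c : k) : iota k m (C c) =
    C (MvPowerSeries.C c) := PowerSeries.map_C _ _

theorem coeff_iota (r : PowerSeries k) (n : ℕ) : coeff n (iota k m r) =
    MvPowerSeries.C (coeff n r) := coeff_map _ _ _

@[simp] theorem resk_iota (r : PowerSeries k) : resk k m (iota k m r) =
    constantCoeff r := by
  simp only [resk, RingHom.comp_apply]
  rw [← coeff_zero_eq_constantCoeff_apply, coeff_iota,
    MvPowerSeries.constantCoeff_C, coeff_zero_eq_constantCoeff_apply]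

@[simp] theorem resk_wv (j : Fin m) : resk k m (wv k m j) = 0 := by
  simp [resk, wv]

theorem isUnit_of_resk {g : BR k m} (h : resk k m g ≠ 0) : IsUnit g := by
  rw [PowerSeries.isUnit_iff_constantCoeff, MvPowerSeries.isUnit_iff_constantCoeff]
  exact isUnit_iff_ne_zero.2 h

theorem eq_const_add (g : BR k m) : ∃ (h : Fin m → BR k m) (g' : BR k m),
    g = C (MvPowerSeries.C (resk k m g)) + ∑ j, wv k m j * h j + X * g' := by
  obtain ⟨g', hgX⟩ : (X : BR k m) ∣ g - C (constantCoeff g) := by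
    rw [X_dvd_iff]; simp
  have h1 : constantCoeff g - MvPowerSeries.C (resk k m g) ∈ degGE m k 1 := by
    rw [mem_degGE_one]; simp [resk]
  refine ⟨fun j => C (part j (constantCoeff g -
    MvPowerSeries.C (resk k m g))), g', ?_⟩
  have h2 := congrArg (C (R := 𝒪 m k)) (sum_X_mul_part h1)
  simp only [map_sum, map_mul, map_sub] at h2
  simp only [wv]
  rw [h2, ← hgX]
  ring

/-- Division by a formal section. -/
theorem exists_sub_section {p : Fin m → PowerSeries k} (hp : ∀ j, constantCoeff (p j) = 0)
    (g : BR k m) : ∃ (r : PowerSeries k) (h : Fin m → BR k m),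
      g = iota k m r + ∑ j, (wv k m j - iota k m (p j)) * h j := by
  have hp' : ∀ j, ∃ q, p j = X * q := fun j => by
    have := hp j
    rwa [← X_dvd_iff] at this
  choose q hq using hp'
  obtain ⟨c, h, hc⟩ := exists_gen (ι := Unit) (MvPowerSeries.C (σ := Fin m) (R := k)) (fun _ => 1)
    (fun j => wv k m j - iota k m (p j)) (fun g => by
      obtain ⟨h, g', hg'⟩ := eq_const_add g
      refine ⟨fun _ => resk k m g, h, g' + ∑ j, iota k m (q j) * h j, ?_⟩
      nth_rewrite 1 [hg']
      simp only [Finset.univ_unique, Finset.sum_singleton, mul_one, sub_mul,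
        sum_sub_distrib, hq, map_mul, iota_X, mul_add, mul_sum, mul_assoc]
      ring) g
  exact ⟨c (), h, by simpa [iota] using hc⟩

end Ring

section Sections
variable {k : Type*} [Field k] {m : ℕ}

/-- Formal sections of the parameter map. -/
structure FSec (k : Type*) [Field k] (m : ℕ) where
  /-- Evaluation along the section. -/
  ev : BR k m →+* PowerSeries k
  ev_iota : ∀ r, ev (iota k m r) = r

namespace FSec
variable (e : FSec k m)

/-- The coordinates of the section. -/
noncomputable def p (j : Fin m) : PowerSeries k := e.ev (wv k m j)

/-- The coordinate functions centred at the section. -/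
noncomputable def x (j : Fin m) : BR k m := wv k m j - iota k m (e.p j)

@[simp] theorem ev_X : e.ev X = X := by
  rw [← iota_X, e.ev_iota]

@[simp] theorem ev_x (j : Fin m) : e.ev (e.x j) = 0 := by
  simp [x, p, e.ev_iota]

theorem p_const (j : Fin m) : constantCoeff (e.p j) = 0 := by
  by_contra h
  have h1 : IsUnit (e.x j) := isUnit_of_resk (by simpa [x] using h)
  have h2 := h1.map e.ev
  simp at h2

theorem exists_sub (g : BR k m) : ∃ h : Fin m → BR k m,
    g = iota k m (e.ev g) + ∑ j, e.x j * h j := by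
  obtain ⟨r, h, hr⟩ := exists_sub_section e.p_const g
  refine ⟨h, ?_⟩
  have : e.ev g = r := by
    rw [hr, map_add, e.ev_iota, map_sum]
    simp only [map_mul]
    rw [sum_eq_zero fun j _ => ?_, add_zero]
    change e.ev (e.x j) * _ = 0
    simp
  rw [this]
  exact hr

theorem constantCoeff_ev (g : BR k m) : constantCoeff (e.ev g) = resk k m g := by
  obtain ⟨h, hh⟩ := e.exists_sub g
  conv_rhs => rw [hh]
  simp [x, e.p_const]

theorem ext_p {e e' : FSec k m} (h : ∀ j, e.p j = e'.p j) : e = e' := by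
  have : e.ev = e'.ev := by
    ext1 g
    obtain ⟨a, ha⟩ := e.exists_sub g
    have h2 : e'.ev g = e.ev g := by
      conv_lhs => rw [ha]
      have h3 : ∀ j, e'.ev (e.x j) = 0 := fun j => by
        have := e'.ev_x j
        rwa [show e'.x j = e.x j by simp [x, h j]] at this
      simp [e'.ev_iota, h3]
    exact h2.symm
  cases e; cases e'
  simpa using this

/-- Chain rule along a section. -/
theorem derivative_ev [CharZero k] (g : BR k m) : derivative k (e.ev g) =
    e.ev (derivative _ g) +
      ∑ j, derivative k (e.p j) * e.ev (liftD (pderiv k j) g) := by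
  let Δ : BR k m → PowerSeries k := fun g => derivative k (e.ev g) -
    (e.ev (derivative _ g) +
      ∑ j, derivative k (e.p j) * e.ev (liftD (pderiv k j) g))
  have hadd : ∀ a b, Δ (a + b) = Δ a + Δ b := fun a b => by
    simp only [Δ, map_add, mul_add, sum_add_distrib]; ring
  have hmul : ∀ a b, Δ (a * b) = e.ev a * Δ b + e.ev b * Δ a := fun a b => by
    simp only [Δ, map_mul, map_add, leibniz, smul_eq_mul, mul_add, mul_sub,
      sum_add_distrib, mul_sum, mul_left_comm]
    ring
  have hiota : ∀ r, Δ (iota k m r) = 0 := fun r => by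
    have h1 : derivative _ (iota k m r) = iota k m (derivative k r) := by
      ext1 n
      simp [coeff_derivative, coeff_iota]
    have h2 : ∀ j, liftD (pderiv k j) (iota k m r) = 0 := fun j => by
      ext1 n
      rw [coeff_liftD, coeff_iota]
      simp
    simp only [Δ, h1, h2, e.ev_iota]
    simp
  have hw : ∀ i, Δ (wv k m i) = 0 := fun i => by
    have h2 : ∀ j, liftD (pderiv k j) (wv k m i) = if i = j then 1 else 0 := fun j => by
      rw [wv, liftD_C, MvPowerSeries.pderiv_X]
      simp only [Pi.single_apply]
      split_ifs <;> simp
    have h3 : derivative _ (wv k m i) = 0 := by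
      rw [wv, derivative_C]
    simp only [Δ, h2, h3]
    simp [p]
  have hx : ∀ i, Δ (e.x i) = 0 := fun i => by
    have := hadd (e.x i) (iota k m (e.p i))
    rw [hiota, add_zero] at this
    rw [← this, x, sub_add_cancel, hw]
  have hsum : ∀ h : Fin m → BR k m, Δ (∑ j, e.x j * h j) = 0 := fun h => by
    let Δ' : BR k m →+ PowerSeries k := AddMonoidHom.mk' Δ hadd
    change Δ' _ = 0
    rw [map_sum]
    refine sum_eq_zero fun j _ => ?_
    change Δ _ = 0
    rw [hmul, hx, e.ev_x]
    simp
  obtain ⟨h, hh⟩ := e.exists_sub g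
  have : Δ g = 0 := by rw [hh, hadd, hiota, hsum, add_zero]
  exact sub_eq_zero.1 this

end FSec
end Sections
end NonSplit

namespace NonSplit

open PowerSeries (C coeff coeff_C_mul coeff_derivative coeff_mk derivative mk)

theorem exists_derivation_fraction {A K : Type*} [CommRing A] [Field K] [Algebra A K]
    [IsFractionRing A K] (δ : Derivation ℤ A A) :
    ∃ δ' : Derivation ℤ K K, ∀ a, δ' (algebraMap A K a) = algebraMap A K (δ a) := by
  let φ : A →+* TrivSqZeroExt K K :=
    { toFun := fun a => (algebraMap A K a, algebraMap A K (δ a))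
      map_one' := Prod.ext (map_one _) (by
        change algebraMap A K (δ 1) = 0
        simp)
      map_zero' := Prod.ext (map_zero _) (by
        change algebraMap A K (δ 0) = 0
        simp)
      map_add' := fun a b => Prod.ext (map_add _ _ _) (by
        change algebraMap A K (δ (a + b)) = algebraMap A K (δ a) + algebraMap A K (δ b)
        simp)
      map_mul' := fun a b => Prod.ext (map_mul _ _ _) (by
        change algebraMap A K (δ (a * b)) = algebraMap A K a • algebraMap A K (δ b) +
          MulOpposite.op (algebraMap A K b) • algebraMap A K (δ a)
        simp only [leibniz, smul_eq_mul, map_add, map_mul, MulOpposite.smul_eq_mul_unop,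
          MulOpposite.unop_op]
        ring) }
  have hφ1 : ∀ a, (φ a).fst = algebraMap A K a := fun a => rfl
  have hφ2 : ∀ a, (φ a).snd = algebraMap A K (δ a) := fun a => rfl
  have hu : ∀ y : nonZeroDivisors A, IsUnit (φ y) := fun y => by
    rw [TrivSqZeroExt.isUnit_iff_isUnit_fst, hφ1]
    exact IsLocalization.map_units K y
  let ψ : K →+* TrivSqZeroExt K K := IsLocalization.lift hu
  have hψ : ∀ a, ψ (algebraMap A K a) = φ a := fun a => IsLocalization.lift_eq hu a
  have hfst : ∀ x, (ψ x).fst = x := by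
    intro x
    have : ((TrivSqZeroExt.fstHom K K K).toRingHom.comp ψ) = RingHom.id K := by
      refine IsLocalization.ringHom_ext (nonZeroDivisors A) ?_
      ext a
      change (ψ (algebraMap A K a)).fst = _
      rw [hψ, hφ1]
      rfl
    exact congrArg (fun f : K →+* K => f x) this
  refine ⟨Derivation.mk' (AddMonoidHom.toIntLinearMap
    ⟨⟨fun x => (ψ x).snd, by simp⟩, fun x y => by simp⟩) (fun a b => ?_), fun a => ?_⟩
  · change (ψ (a * b)).snd = a • (ψ b).snd + b • (ψ a).snd
    rw [map_mul, TrivSqZeroExt.snd_mul, hfst, hfst]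
    simp [mul_comm]
  · change (ψ (algebraMap A K a)).snd = _
    rw [hψ, hφ2]

section Hasse
variable {k : Type*} [Field k] {m : ℕ}

/-- Divided partial derivatives. -/
noncomputable def hasse (α : Fin m →₀ ℕ) (g : 𝒪 m k) : 𝒪 m k :=
  mvMk fun β => (∏ i, ((α i + β i).choose (α i) : k)) * MvPowerSeries.coeff (α + β) g

theorem coeff_hasse (α β : Fin m →₀ ℕ) (g : 𝒪 m k) :
    MvPowerSeries.coeff β (hasse α g) =
      (∏ i, ((α i + β i).choose (α i) : k)) * MvPowerSeries.coeff (α + β) g := coeff_mvMk _ _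

theorem hasse_zero (g : 𝒪 m k) : hasse 0 g = g := by
  ext β
  simp [coeff_hasse]

theorem hasse_add (α : Fin m →₀ ℕ) (g h : 𝒪 m k) :
    hasse α (g + h) = hasse α g + hasse α h := by
  ext β
  simp [coeff_hasse, mul_add]

theorem hasse_smul_const (α : Fin m →₀ ℕ) (c : k) (g : 𝒪 m k) :
    hasse α (MvPowerSeries.C c * g) = MvPowerSeries.C c * hasse α g := by
  ext β
  simp [coeff_hasse, mul_left_comm]

theorem succ_mul_hasse (α : Fin m →₀ ℕ) (i : Fin m) (g : 𝒪 m k) :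
    MvPowerSeries.C ((α i : k) + 1) * hasse (α + single i 1) g =
      hasse α (pderiv k i g) := by
  ext β
  rw [MvPowerSeries.coeff_C_mul, coeff_hasse, coeff_hasse, MvPowerSeries.coeff_pderiv,
    show α + single i 1 + β = α + β + single i 1 by abel, ← mul_assoc,
    mul_comm (MvPowerSeries.coeff _ g), ← mul_assoc]
  congr 1
  rw [← Finset.mul_prod_erase _ _ (mem_univ i),
    ← Finset.mul_prod_erase (a := i) _ (fun j => ((α j + β j).choose (α j) : k)) (mem_univ i)]
  have h1 : ∏ x ∈ Finset.univ.erase i, ((((α + single i 1 : Fin m →₀ ℕ) x + β x).choose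
      ((α + single i 1 : Fin m →₀ ℕ) x) : ℕ) : k) =
      ∏ x ∈ Finset.univ.erase i, ((α x + β x).choose (α x) : k) := by
    refine Finset.prod_congr rfl fun x hx => ?_
    have : x ≠ i := ne_of_mem_erase hx
    simp [this.symm]
  rw [h1]
  have h2 : ((α i : k) + 1) * (((α + single i 1 : Fin m →₀ ℕ) i + β i).choose
      ((α + single i 1 : Fin m →₀ ℕ) i) : ℕ) =
      ((α i + β i).choose (α i) : ℕ) * ((α i : k) + β i + 1) := by
    have := Nat.add_one_mul_choose_eq (α i + β i) (α i)
    simp only [Finsupp.add_apply, Finsupp.single_eq_same]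
    rw [add_right_comm]
    have h3 := congrArg (Nat.cast : ℕ → k) this
    push_cast at h3 ⊢
    linear_combination -h3
  simp only [Finsupp.add_apply, Finsupp.single_eq_same] at h2 ⊢
  push_cast at h2 ⊢
  rw [← mul_assoc, h2]
  ring

/-- Coefficientwise divided partial derivatives. -/
noncomputable def hasseL (α : Fin m →₀ ℕ) (g : BR k m) : BR k m :=
  mk fun n => hasse α (coeff n g)

theorem coeff_hasseL (α : Fin m →₀ ℕ) (g : BR k m) (n : ℕ) :
    coeff n (hasseL α g) = hasse α (coeff n g) := coeff_mk _ _

theorem hasseL_zero (g : BR k m) : hasseL 0 g = g := by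
  ext1 n; simp [coeff_hasseL, hasse_zero]

theorem hasseL_add (α : Fin m →₀ ℕ) (g h : BR k m) : hasseL α (g + h) = hasseL α g + hasseL α h := by
  ext1 n; simp [coeff_hasseL, hasse_add]

theorem succ_mul_hasseL (α : Fin m →₀ ℕ) (i : Fin m) (g : BR k m) :
    iota k m (C ((α i : k) + 1)) * hasseL (α + single i 1) g =
      hasseL α (liftD (pderiv k i) g) := by
  ext1 n
  rw [iota_C, coeff_C_mul, coeff_hasseL, coeff_hasseL, succ_mul_hasse, coeff_liftD]

theorem liftD_hasseL [CharZero k] (α : Fin m →₀ ℕ) (i : Fin m) (g : BR k m) :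
    liftD (pderiv k i) (hasseL α g) = hasseL α (liftD (pderiv k i) g) := by
  ext n β : 2
  rw [coeff_liftD, coeff_hasseL, MvPowerSeries.coeff_pderiv, coeff_hasse, coeff_hasseL,
    coeff_hasse, coeff_liftD, MvPowerSeries.coeff_pderiv, ← add_assoc,
    mul_right_comm, mul_comm (MvPowerSeries.coeff _ _), ← mul_assoc]
  congr 1
  rw [← Finset.prod_erase_mul _ _ (mem_univ i),
    ← Finset.prod_erase_mul (a := i) _ (fun j => ((α j + β j).choose (α j) : k)) (mem_univ i),
    mul_assoc, mul_assoc]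
  congr 1
  · refine Finset.prod_congr rfl fun x hx => ?_
    have : x ≠ i := ne_of_mem_erase hx
    simp [this.symm]
  · have h := Nat.choose_mul_succ_eq (α i + β i) (α i)
    have h4 : α i + β i + 1 - α i = β i + 1 := by omega
    rw [h4] at h
    have h3 := congrArg (Nat.cast : ℕ → k) h
    simp only [Finsupp.add_apply, Finsupp.single_eq_same]
    rw [← add_assoc]
    push_cast at h3 ⊢
    linear_combination -h3

theorem derivative_hasseL (α : Fin m →₀ ℕ) (g : BR k m) :
    derivative _ (hasseL α g) = hasseL α (derivative _ g) := by
  ext1 n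
  have : ((n : 𝒪 m k) + 1) = MvPowerSeries.C ((n : k) + 1) := by simp
  rw [coeff_derivative, coeff_hasseL, coeff_hasseL, coeff_derivative, this,
    mul_comm, mul_comm (coeff _ g), hasse_smul_const]

end Hasse

namespace FSec
variable {k : Type*} [Field k] [CharZero k] {m : ℕ} (K : Type*) [Field K] [Algebra (PowerSeries k) K]
  [IsFractionRing (PowerSeries k) K] (e : FSec k m)

/-- Taylor expansion along a section. -/
noncomputable def tayFun (g : BR k m) : 𝒪 m K :=
  mvMk fun α => algebraMap _ K (e.ev (hasseL α g))

theorem coeff_tayFun (α : Fin m →₀ ℕ) (g : BR k m) : MvPowerSeries.coeff α (e.tayFun K g) =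
    algebraMap _ K (e.ev (hasseL α g)) := coeff_mvMk _ _

theorem pderiv_tayFun (i : Fin m) (g : BR k m) : pderiv K i (e.tayFun K g) =
    e.tayFun K (liftD (pderiv k i) g) := by
  ext α
  rw [MvPowerSeries.coeff_pderiv, coeff_tayFun, coeff_tayFun, ← succ_mul_hasseL, map_mul, map_mul,
    e.ev_iota, mul_comm]
  simp

theorem tayFun_add (g h : BR k m) : e.tayFun K (g + h) = e.tayFun K g + e.tayFun K h := by
  ext α
  simp [coeff_tayFun, hasseL_add]

theorem constantCoeff_tayFun (g : BR k m) : MvPowerSeries.constantCoeff (e.tayFun K g) =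
    algebraMap _ K (e.ev g) := by
  rw [← MvPowerSeries.coeff_zero_eq_constantCoeff_apply, coeff_tayFun, hasseL_zero]

variable [CharZero K]

theorem eq_zero_of_pderiv {ι : Type*} {W : ι → 𝒪 m K}
    (h0 : ∀ a, MvPowerSeries.constantCoeff (W a) = 0)
    (h : ∀ a i, ∃ b c, pderiv K i (W a) = W b + W c) (a : ι) : W a = 0 := by
  have key : ∀ (n : ℕ) (α : Fin m →₀ ℕ), α.degree = n → ∀ a, MvPowerSeries.coeff α (W a) = 0 := by
    intro n
    induction n with
    | zero =>
      intro α hα a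
      rw [(Finsupp.degree_eq_zero_iff α).1 hα, MvPowerSeries.coeff_zero_eq_constantCoeff_apply, h0]
    | succ n ih =>
      intro α hα a
      obtain ⟨i, hi⟩ : ∃ i, α i ≠ 0 := by
        by_contra hc
        push Not at hc
        have : α = 0 := Finsupp.ext hc
        simp [this] at hα
      obtain ⟨β, rfl⟩ : ∃ β, α = β + single i 1 :=
        ⟨α - single i 1, (tsub_add_cancel_of_le (by
          rw [Finsupp.single_le_iff]; omega)).symm⟩
      have hβ : β.degree = n := by
        rw [map_add, Finsupp.degree_single] at hα; omega
      obtain ⟨b, c, hbc⟩ := h a i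
      have h1 := congrArg (MvPowerSeries.coeff β) hbc
      rw [MvPowerSeries.coeff_pderiv, map_add, ih β hβ, ih β hβ, add_zero] at h1
      refine (mul_eq_zero.1 h1).resolve_right ?_
      exact_mod_cast Nat.succ_ne_zero (β i)
  ext α
  exact key _ α rfl a

theorem tayFun_mul (g h : BR k m) : e.tayFun K (g * h) = e.tayFun K g * e.tayFun K h := by
  refine sub_eq_zero.1 (eq_zero_of_pderiv K (ι := BR k m × BR k m)
    (W := fun q => e.tayFun K (q.1 * q.2) - e.tayFun K q.1 * e.tayFun K q.2) (fun q => ?_)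
    (fun q i => ?_) (g, h))
  · simp only [map_sub, map_mul, constantCoeff_tayFun, sub_self]
  · refine ⟨(q.1, liftD (pderiv k i) q.2), (q.2, liftD (pderiv k i) q.1), ?_⟩
    simp only [map_sub, pderiv_tayFun, leibniz, smul_eq_mul, tayFun_add]
    ring

theorem tayFun_iota (r : PowerSeries k) : e.tayFun K (iota k m r) =
    MvPowerSeries.C (algebraMap _ K r) := by
  have hz : ∀ i, liftD (pderiv k i) (iota k m r) = 0 := fun j => by
    ext1 n
    rw [coeff_liftD, coeff_iota]
    simp
  have h0 : e.tayFun K 0 = 0 := by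
    have := e.tayFun_add K 0 0
    simpa using this
  refine sub_eq_zero.1 (eq_zero_of_pderiv K (ι := Bool)
    (W := fun b => if b then e.tayFun K (iota k m r) - MvPowerSeries.C (algebraMap _ K r) else 0)
    (fun b => ?_) (fun b i => ⟨false, false, ?_⟩) true)
  · cases b
    · simp
    · simp [constantCoeff_tayFun, e.ev_iota]
  · cases b
    · simp
    · simp [pderiv_tayFun, hz, h0]

/-- Taylor expansion along a section, as a ring homomorphism. -/
noncomputable def tay : BR k m →+* 𝒪 m K where
  toFun := e.tayFun K
  map_one' := by
    have := e.tayFun_iota K 1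
    simpa using this
  map_mul' := e.tayFun_mul K
  map_zero' := by
    have := e.tayFun_iota K 0
    simpa using this
  map_add' := e.tayFun_add K

theorem tay_iota (r : PowerSeries k) : e.tay K (iota k m r) =
    MvPowerSeries.C (algebraMap _ K r) := e.tayFun_iota K r

theorem pderiv_tay (i : Fin m) (g : BR k m) : pderiv K i (e.tay K g) =
    e.tay K (liftD (pderiv k i) g) := e.pderiv_tayFun K i g

theorem constantCoeff_tay (g : BR k m) : MvPowerSeries.constantCoeff (e.tay K g) =
    algebraMap _ K (e.ev g) := e.constantCoeff_tayFun K g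

theorem liftD_wv (i j : Fin m) : liftD (pderiv k j) (wv k m i) = if i = j then 1 else 0 := by
  rw [wv, liftD_C, MvPowerSeries.pderiv_X]
  simp only [Pi.single_apply]
  split_ifs <;> simp

theorem liftD_iota (j : Fin m) (r : PowerSeries k) :
    liftD (pderiv k j) (iota k m r) = 0 := by
  ext1 n
  rw [coeff_liftD, coeff_iota]
  simp

theorem tay_x (j : Fin m) : e.tay K (e.x j) = MvPowerSeries.X j := by
  refine sub_eq_zero.1 (eq_zero_of_pderiv K (ι := Bool)
    (W := fun b => if b then e.tay K (e.x j) - MvPowerSeries.X j else 0)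
    (fun b => ?_) (fun b i => ⟨false, false, ?_⟩) true)
  · cases b
    · simp
    · simp [constantCoeff_tay]
  · cases b
    · simp
    · have h1 : liftD (pderiv k i) (e.x j) = if j = i then 1 else 0 := by
        rw [x, map_sub, liftD_wv, liftD_iota, sub_zero]
      simp only [if_true, map_sub, pderiv_tay, h1, MvPowerSeries.pderiv_X, Pi.single_apply]
      split_ifs <;> simp_all

/-- Compatibility of Taylor expansion with the parameter derivation. -/
theorem coeffD_tay {δ : Derivation ℤ K K}
    (hδ : ∀ r : PowerSeries k, δ (algebraMap _ K r) = algebraMap _ K (derivative k r))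
    (g : BR k m) : coeffD δ (e.tay K g) = e.tay K (derivative _ g) +
      ∑ j, MvPowerSeries.C (algebraMap _ K (derivative k (e.p j))) *
        e.tay K (liftD (pderiv k j) g) := by
  ext α
  have h1 : ∀ g, MvPowerSeries.coeff α (e.tay K g) = algebraMap _ K (e.ev (hasseL α g)) :=
    fun g => e.coeff_tayFun K α g
  rw [coeff_coeffD, h1, hδ, e.derivative_ev, map_add, map_sum, map_add, map_sum, h1,
    derivative_hasseL]
  congr 1
  refine sum_congr rfl fun j _ => ?_
  rw [MvPowerSeries.coeff_C_mul, h1, liftD_hasseL, map_mul]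

end FSec
end NonSplit

namespace NonSplit

open PowerSeries (X constantCoeff)

theorem exists_X_pow_mul_unit {k : Type*} [Field k] {r : PowerSeries k} (hr : r ≠ 0) :
    ∃ (n : ℕ) (u v : PowerSeries k), u * v = 1 ∧ r = X ^ n * u := by
  obtain ⟨n, u, h⟩ := IsDiscreteValuationRing.eq_unit_mul_pow_irreducible hr PowerSeries.X_irreducible
  exact ⟨n, u, ↑u⁻¹, u.mul_inv, by rw [h, mul_comm]⟩

theorem exists_X_pow_smul {k K : Type*} [Field k] [Field K] [Algebra (PowerSeries k) K]
    [IsFractionRing (PowerSeries k) K] (c : K) : ∃ (n : ℕ) (a : PowerSeries k),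
      algebraMap (PowerSeries k) K X ^ n * c = algebraMap _ K a := by
  obtain ⟨a, b, hb, rfl⟩ := IsFractionRing.div_surjective (A := PowerSeries k) c
  obtain ⟨n, u, v, huv, rfl⟩ := exists_X_pow_mul_unit (nonZeroDivisors.ne_zero hb)
  refine ⟨n, a * v, ?_⟩
  have hb' : algebraMap (PowerSeries k) K (X ^ n * u) ≠ 0 := by
    rw [Ne, IsFractionRing.to_map_eq_zero_iff]
    exact nonZeroDivisors.ne_zero hb
  rw [← mul_div_assoc, div_eq_iff hb', ← map_pow, ← map_mul, ← map_mul]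
  congr 1
  linear_combination -(X ^ n * a) * huv

namespace FSec
variable {k : Type*} [Field k] [CharZero k] {m : ℕ} (K : Type*) [Field K] [Algebra (PowerSeries k) K]
  [IsFractionRing (PowerSeries k) K] [CharZero K] (e : FSec k m)

/-- The ideal of a section. -/
noncomputable def nId : Ideal (BR k m) := span (Set.range e.x)

theorem x_mem_nId (j : Fin m) : e.x j ∈ e.nId := subset_span ⟨j, rfl⟩

/-- Polynomials in the centred coordinates. -/
noncomputable def polyEval : MvPolynomial (Fin m) (PowerSeries k) →+* BR k m :=
  MvPolynomial.eval₂Hom (iota k m) e.x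

theorem exists_polyEval_sub (n : ℕ) (g : BR k m) : ∃ q, g - e.polyEval q ∈ e.nId ^ n := by
  induction n generalizing g with
  | zero => exact ⟨0, by simp⟩
  | succ n ih =>
    obtain ⟨h, hh⟩ := e.exists_sub g
    choose q hq using fun j => ih (h j)
    refine ⟨MvPolynomial.C (e.ev g) + ∑ j, MvPolynomial.X j * q j, ?_⟩
    have : g - e.polyEval (MvPolynomial.C (e.ev g) + ∑ j, MvPolynomial.X j * q j) =
        ∑ j, e.x j * (h j - e.polyEval (q j)) := by
      nth_rewrite 1 [hh]
      simp [polyEval, mul_sub]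
    rw [this, pow_succ']
    exact Ideal.sum_mem _ fun j _ => mul_mem_mul (e.x_mem_nId j) (hq j)

theorem tay_polyEval (q : MvPolynomial (Fin m) (PowerSeries k)) :
    e.tay K (e.polyEval q) = (MvPolynomial.map (algebraMap (PowerSeries k) K) q :
      𝒪 m K) := by
  have : (e.tay K).comp e.polyEval = (MvPolynomial.coeToMvPowerSeries.ringHom).comp
      (MvPolynomial.map (algebraMap (PowerSeries k) K)) := by
    refine MvPolynomial.ringHom_ext (fun r => ?_) (fun j => ?_)
    · simp [polyEval, tay_iota]
    · simp [polyEval, tay_x]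
  exact congrArg (fun f : _ →+* _ => f q) this

theorem map_tay_nId : e.nId.map (e.tay K) = maxId m K := by
  rw [nId, Ideal.map_span, maxId]
  congr 1
  ext a
  simp [tay_x]

theorem mem_nId_pow_of_tay {n : ℕ} {g : BR k m} (hg : e.tay K g ∈ degGE m K n) :
    g ∈ e.nId ^ n := by
  obtain ⟨q, hq⟩ := e.exists_polyEval_sub n g
  have h1 : e.tay K (e.polyEval q) ∈ degGE m K n := by
    have h2 : e.tay K (g - e.polyEval q) ∈ degGE m K n := by
      rw [← maxId_pow, ← map_tay_nId K e, ← Ideal.map_pow]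
      exact Ideal.mem_map_of_mem _ hq
    rw [map_sub] at h2
    simpa using sub_mem hg h2
  rw [tay_polyEval, mem_degGE] at h1
  have h3 : e.polyEval q ∈ e.nId ^ n := by
    rw [polyEval, MvPolynomial.coe_eval₂Hom, MvPolynomial.eval₂_eq']
    refine Ideal.sum_mem _ fun α hα => mul_mem_left _ _ ?_
    have hn : n ≤ α.degree := by
      by_contra hc
      have := h1 α (by omega)
      rw [MvPolynomial.coeff_coe, MvPolynomial.coeff_map] at this
      exact MvPolynomial.mem_support_iff.1 hα
        ((IsFractionRing.to_map_eq_zero_iff (R := PowerSeries k) (K := K)).1 this)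
    refine Ideal.pow_le_pow_right hn ?_
    rw [Finsupp.degree_eq_sum, ← Finset.prod_pow_eq_pow_sum]
    exact Ideal.prod_mem_prod fun i _ => Ideal.pow_mem_pow (e.x_mem_nId i) _
  simpa using add_mem hq h3

theorem exists_tay_sub (n : ℕ) (q : 𝒪 m K) : ∃ (N : ℕ) (Q : BR k m),
    e.tay K Q - MvPowerSeries.C (algebraMap (PowerSeries k) K X ^ N) * q ∈
      degGE m K n := by
  choose E a ha using fun α => exists_X_pow_smul (k := k) (MvPowerSeries.coeff α q)
  let S := (finite_degree_lt (m := m) n).toFinset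
  refine ⟨∑ α ∈ S, E α, e.polyEval (∑ α ∈ S, MvPolynomial.monomial α
    (X ^ (∑ β ∈ S, E β - E α) * a α)), ?_⟩
  rw [mem_degGE]
  intro α hα
  have hS : α ∈ S := by simpa [S] using hα
  rw [tay_polyEval, map_sub, MvPolynomial.coeff_coe, MvPolynomial.coeff_map,
    MvPolynomial.coeff_sum, MvPowerSeries.coeff_C_mul]
  simp only [MvPolynomial.coeff_monomial]
  rw [Finset.sum_ite_eq' S α, if_pos hS, map_mul, ← ha, map_pow, ← mul_assoc, ← pow_add,
    Nat.sub_add_cancel (single_le_sum (f := E) (fun _ _ => Nat.zero_le _) hS), sub_self]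

theorem exists_of_prime {f : Fin m → BR k m}
    (hP : ∀ j, ∃ S : Multiset (PowerSeries k),
      (S.map fun r => wv k m j - iota k m r).prod ∈ span (Set.range f))
    {q : Ideal (BR k m)} [hq : q.IsPrime] (hfq : span (Set.range f) ≤ q)
    (hX : X ∉ q) :
    ∃ e : FSec k m, (∀ j, e.ev (f j) = 0) ∧ ∀ g, e.ev g = 0 ↔ g ∈ q := by
  have h1 : ∀ j, ∃ r, wv k m j - iota k m r ∈ q := by
    intro j
    obtain ⟨S, hS⟩ := hP j
    obtain ⟨a, ha, hr⟩ := (hq.multiset_prod_mem_iff_exists_mem _).1 (hfq hS)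
    obtain ⟨r, -, rfl⟩ := Multiset.mem_map.1 ha
    exact ⟨r, hr⟩
  choose p hp using h1
  have hp0 : ∀ j, constantCoeff (p j) = 0 := by
    intro j
    by_contra h
    refine hq.ne_top (Ideal.eq_top_of_isUnit_mem _ (hp j) (isUnit_of_resk ?_))
    simpa using h
  let φ : PowerSeries k →+* BR k m ⧸ q := (Ideal.Quotient.mk q).comp (iota k m)
  have hφ : Function.Bijective φ := by
    constructor
    · rw [injective_iff_map_eq_zero]
      intro r hr
      by_contra h0
      obtain ⟨n, u, v, huv, rfl⟩ := exists_X_pow_mul_unit h0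
      have h2 : iota k m (X ^ n * u) ∈ q := Ideal.Quotient.eq_zero_iff_mem.1 hr
      have h3 : iota k m (X ^ n * u * v) ∈ q := by
        rw [map_mul]; exact mul_mem_right _ _ h2
      rw [mul_assoc, huv, mul_one, map_pow, iota_X] at h3
      exact hX (hq.mem_of_pow_mem _ h3)
    · intro b
      obtain ⟨g, rfl⟩ := Ideal.Quotient.mk_surjective b
      obtain ⟨r, h, hg⟩ := exists_sub_section hp0 g
      refine ⟨r, ?_⟩
      refine (Ideal.Quotient.eq.2 ?_)
      rw [hg, sub_add_cancel_left]
      exact neg_mem (Ideal.sum_mem _ fun j _ => mul_mem_right _ _ (hp j))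
  let E := RingEquiv.ofBijective φ hφ
  let e : FSec k m := ⟨(E.symm : _ →+* _).comp (Ideal.Quotient.mk q), fun r => E.symm_apply_apply r⟩
  have he : ∀ g, e.ev g = 0 ↔ g ∈ q := by
    intro g
    change E.symm (Ideal.Quotient.mk q g) = 0 ↔ _
    rw [map_eq_zero_iff _ E.symm.injective, Ideal.Quotient.eq_zero_iff_mem]
  exact ⟨e, fun j => (he _).2 (hfq (subset_span ⟨j, rfl⟩)), he⟩

/-- The sections contained in the zero locus. -/
def zeroSec (f : Fin m → BR k m) : Set (FSec k m) := {e | ∀ j, e.ev (f j) = 0}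

theorem ev_eq_zero_of_mem {f : Fin m → BR k m} {e : FSec k m} (he : e ∈ zeroSec f) {g : BR k m}
    (hg : g ∈ span (Set.range f)) : e.ev g = 0 := by
  have : span (Set.range f) ≤ RingHom.ker e.ev := by
    rw [Ideal.span_le]
    rintro _ ⟨j, rfl⟩
    exact he j
  exact this hg

theorem isUnit_tay {s : BR k m} (hs : e.ev s ≠ 0) : IsUnit (e.tay K s) := by
  rw [MvPowerSeries.isUnit_iff_constantCoeff, constantCoeff_tay]
  exact isUnit_iff_ne_zero.2 (by rwa [Ne, IsFractionRing.to_map_eq_zero_iff])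

section Zero
variable {f : Fin m → BR k m}
  (hP : ∀ j, ∃ S : Multiset (PowerSeries k),
      (S.map fun r => wv k m j - iota k m r).prod ∈ span (Set.range f))
  (hsat : ∀ g, X * g ∈ span (Set.range f) → g ∈ span (Set.range f))
include hP

theorem zeroSec_finite : (zeroSec f).Finite := by
  classical
  choose S hS using hP
  have h1 : ∀ e ∈ zeroSec f, e.p ∈ Set.pi Set.univ (fun j => ((S j).toFinset : Set (PowerSeries k))) := by
    intro e he j _
    have := ev_eq_zero_of_mem he (hS j)
    rw [map_multiset_prod, Multiset.prod_eq_zero_iff] at this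
    simp only [Multiset.map_map, Multiset.mem_map, Function.comp_apply, map_sub, e.ev_iota] at this
    obtain ⟨r, hr, h⟩ := this
    rw [sub_eq_zero] at h
    simpa [p, h] using hr
  exact Set.Finite.of_injOn h1 (fun e _ e' _ h => ext_p fun j => congrFun h j)
    (Set.Finite.pi fun j => Finset.finite_toSet _)

theorem exists_separating {e : FSec k m} : ∃ s, e.ev s ≠ 0 ∧ ∀ e' ∈ zeroSec f, e' ≠ e → e'.ev s = 0 := by
  classical
  have h1 : ∀ e' : FSec k m, ∃ t : BR k m, e' ≠ e → e.ev t ≠ 0 ∧ e'.ev t = 0 := by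
    intro e'
    by_cases h : e' = e
    · exact ⟨0, fun h' => absurd h h'⟩
    · obtain ⟨j, hj⟩ : ∃ j, e.p j ≠ e'.p j := by
        by_contra hc
        push Not at hc
        exact h (ext_p fun j => (hc j).symm)
      refine ⟨wv k m j - iota k m (e'.p j), fun _ => ⟨?_, ?_⟩⟩
      · rw [map_sub, e.ev_iota, sub_ne_zero]; exact hj
      · rw [map_sub, e'.ev_iota, sub_eq_zero]; rfl
  choose t ht using h1
  refine ⟨∏ e' ∈ (zeroSec_finite hP).toFinset.erase e, t e', ?_, fun e' he' hne => ?_⟩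
  · rw [map_prod, Finset.prod_ne_zero_iff]
    exact fun e' he' => (ht e' (ne_of_mem_erase he')).1
  · rw [map_prod]
    exact Finset.prod_eq_zero (Finset.mem_erase.2 ⟨hne, (zeroSec_finite hP).mem_toFinset.2 he'⟩)
      (ht e' hne).2

include hsat in
theorem mem_radical {g : BR k m} (hg : ∀ e ∈ zeroSec f, e.ev g = 0) :
    g ∈ (span (Set.range f)).radical := by
  have h1 : X * g ∈ (span (Set.range f)).radical := by
    rw [Ideal.radical_eq_sInf, Ideal.mem_sInf]
    rintro q ⟨hfq, hq⟩
    by_cases hX : X ∈ q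
    · exact mul_mem_right _ _ hX
    · obtain ⟨e, he, hq⟩ := exists_of_prime hP hfq hX
      exact mul_mem_left _ _ ((hq g).1 (hg e he))
  obtain ⟨n, hn⟩ := h1
  refine ⟨n, ?_⟩
  rw [mul_pow] at hn
  have h2 : ∀ n (a : BR k m), X ^ n * a ∈ span (Set.range f) →
      a ∈ span (Set.range f) := by
    intro n
    induction n with
    | zero => intro a ha; simpa using ha
    | succ n ih => intro a ha; exact ih a (hsat _ (by rwa [← mul_assoc, ← pow_succ']))
  exact h2 n _ hn

include hsat in
theorem exists_pow_le {e : FSec k m} {s : BR k m}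
    (hs : ∀ e' ∈ zeroSec f, e' ≠ e → e'.ev s = 0) :
    ∃ n, (span {s} * e.nId) ^ n ≤ span (Set.range f) := by
  refine Ideal.exists_pow_le_of_le_radical_of_fg ?_
    ((Submodule.fg_span_singleton s).mul (Submodule.fg_span (Set.finite_range _)))
  rw [nId, Ideal.span_mul_span', Ideal.span_le]
  rintro _ ⟨a, ha, b, ⟨j, rfl⟩, rfl⟩
  rw [Set.mem_singleton_iff] at ha
  subst ha
  refine mem_radical hP hsat fun e' he' => ?_
  change e'.ev (a * e.x j) = 0
  rw [map_mul]
  by_cases h : e' = e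
  · rw [h, ev_x, mul_zero]
  · rw [hs e' he' h, zero_mul]

include hsat in
theorem exists_maxId_pow_le (e : FSec k m) :
    ∃ n, maxId m K ^ n ≤ (span (Set.range f)).map (e.tay K) := by
  obtain ⟨s, hs1, hs2⟩ := exists_separating hP (e := e)
  obtain ⟨n, hn⟩ := exists_pow_le hP hsat hs2
  refine ⟨n, ?_⟩
  have := Ideal.map_mono (f := e.tay K) hn
  rw [Ideal.map_pow, Ideal.map_mul, map_tay_nId, Ideal.map_span, Set.image_singleton,
    Ideal.span_singleton_eq_top.2 (isUnit_tay K e hs1), Ideal.top_mul] at this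
  exact this

include hsat in
theorem mem_of_tay_mem {g : BR k m}
    (hg : ∀ e ∈ zeroSec f, e.tay K g ∈ (span (Set.range f)).map (e.tay K)) :
    g ∈ span (Set.range f) := by
  have h1 : (X : BR k m) ∈
      (Submodule.colon (span (Set.range f)) {g}).radical := by
    rw [Ideal.radical_eq_sInf, Ideal.mem_sInf]
    rintro q ⟨hfq, hq⟩
    by_contra hX
    have hle : span (Set.range f) ≤ q := by
      intro a ha
      apply hfq
      rw [Submodule.mem_colon_singleton, smul_eq_mul]
      exact mul_mem_right _ _ ha
    obtain ⟨e, he, hev⟩ := exists_of_prime hP hle hX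
    obtain ⟨s, hs1, hs2⟩ := exists_separating hP (e := e)
    obtain ⟨n, hn⟩ := exists_pow_le hP hsat hs2
    have h2 := hg e he
    rw [Ideal.map_span, ← Set.range_comp, mem_span_range_iff_exists_fun] at h2
    obtain ⟨c, hc⟩ := h2
    choose N Q hQ using fun j => e.exists_tay_sub K n (c j)
    have h3 : X ^ (∑ j, N j) * g -
        ∑ j, X ^ (∑ i, N i - N j) * Q j * f j ∈ e.nId ^ n := by
      apply e.mem_nId_pow_of_tay K
      have h4 : e.tay K (X : BR k m) = MvPowerSeries.C (algebraMap (PowerSeries k) K X) := by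
        rw [← iota_X, tay_iota]
      have h5 : e.tay K (X ^ (∑ j, N j) * g -
          ∑ j, X ^ (∑ i, N i - N j) * Q j * f j) =
          ∑ j, -(e.tay K (X : BR k m) ^ (∑ i, N i - N j) * e.tay K (f j)) *
            (e.tay K (Q j) - MvPowerSeries.C (algebraMap (PowerSeries k) K X ^ N j) * c j) := by
        rw [map_sub, map_mul, ← hc, map_sum, mul_sum, ← sum_sub_distrib]
        refine sum_congr rfl fun j _ => ?_
        have h6 : e.tay K (X : BR k m) ^ (∑ j, N j) = e.tay K (X : BR k m) ^ (∑ i, N i - N j) *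
            MvPowerSeries.C (algebraMap (PowerSeries k) K X ^ N j) := by
          rw [map_pow, ← h4, ← pow_add,
            Nat.sub_add_cancel (single_le_sum (f := N) (fun _ _ => Nat.zero_le _) (mem_univ j))]
        rw [map_mul, map_mul, map_pow, map_pow, h6, Function.comp_apply]
        ring
      rw [h5]
      exact Ideal.sum_mem _ fun j _ => mul_mem_left _ _ (hQ j)
    have h7 : s ^ n * (X ^ (∑ j, N j) * g -
        ∑ j, X ^ (∑ i, N i - N j) * Q j * f j) ∈ span (Set.range f) := by
      apply hn
      rw [mul_pow]
      exact mul_mem_mul (Ideal.pow_mem_pow (Ideal.mem_span_singleton_self s) n) h3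
    have h8 : s ^ n * X ^ (∑ j, N j) ∈ q := by
      apply hfq
      rw [Submodule.mem_colon_singleton, smul_eq_mul]
      have h9 : s ^ n * ∑ j, X ^ (∑ i, N i - N j) * Q j * f j ∈
          span (Set.range f) :=
        mul_mem_left _ _ (Ideal.sum_mem _ fun j _ => mul_mem_left _ _
          (subset_span ⟨j, rfl⟩))
      have := add_mem h7 h9
      rwa [mul_sub, sub_add_cancel, ← mul_assoc] at this
    rw [← hev, map_mul, map_pow, map_pow, ev_X, mul_eq_zero] at h8
    exact h8.elim (fun h => hs1 (eq_zero_of_pow_eq_zero h)) fun h => PowerSeries.X_ne_zero (eq_zero_of_pow_eq_zero h)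
  obtain ⟨n, hn⟩ := h1
  rw [Submodule.mem_colon_singleton, smul_eq_mul] at hn
  induction n with
  | zero => simpa using hn
  | succ n ih => exact ih (hsat _ (by rwa [← mul_assoc, ← pow_succ']))

end Zero
end FSec
end NonSplit

namespace NonSplit

open PowerSeries (C X coeff coeff_C_mul coeff_map derivative)
open Module (End)

/-- The pole argument modulo a submodule. -/
theorem pole_argument_mod {A : Type*} [AddCommGroup A] [Module ℚ A] (Q : Submodule ℚ A)
    (θ D y E : End ℚ A) (hQθ : ∀ x ∈ Q, θ x ∈ Q) (hQD : ∀ x ∈ Q, D x ∈ Q)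
    (hQy : ∀ x ∈ Q, y x ∈ Q) (hQE : ∀ x ∈ Q, E x ∈ Q) (hθ : ∀ x, θ x ∈ Q → x ∈ Q)
    (hDθ : ∀ x, D (θ x) = θ (D x)) (hD : ∀ x, D (y x) = y (D x) + θ x)
    (hθy : ∀ x, θ (y x) = y (θ x)) (hDE : ∀ x, D (E x) = E (D x))
    (hθE : ∀ x, θ (E x) = E (θ x)) (S : Submodule ℚ A) (hSθ : ∀ x ∈ S, θ x ∈ S)
    (hSD : ∀ x ∈ S, ∃ z ∈ S, D x - z ∈ Q)
    (hsat : ∀ x, ∀ g ∈ S, θ x - g ∈ Q → ∃ g' ∈ S, x - g' ∈ Q) (d : ℕ)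
    (hreg : ∀ n x, ∃ z, (D ^ n) ((θ ^ d) x) - (θ ^ n) z ∈ Q)
    (hdens : ∀ M : ℕ, ∃ ν : ℕ, ∀ x ∈ S, ∃ g ∈ S, ∃ l, (y ^ ν) (E x) - (g + (θ ^ M) l) ∈ Q)
    {x : A} (hx : x ∈ S) : ∃ g ∈ S, ∃ l, E x - (g + θ l) ∈ Q := by
  have hm : ∀ {a b : A}, Q.mkQ a = Q.mkQ b ↔ a - b ∈ Q := fun {a b} => by
    rw [mkQ_apply, mkQ_apply, Submodule.Quotient.eq]
  have hp : ∀ (T : End ℚ A) (hT : Q ≤ Q.comap T) (n : ℕ) (a : A),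
      ((Q.mapQ Q T hT : End ℚ (A ⧸ Q)) ^ n) (Q.mkQ a) = Q.mkQ ((T ^ n) a) := by
    intro T hT n
    induction n with
    | zero => intro a; rfl
    | succ n ih =>
      intro a
      rw [pow_succ', pow_succ', End.mul_apply, End.mul_apply, ih]
      rfl
  have hs : Function.Surjective Q.mkQ := Q.mkQ_surjective
  have key := pole_argument (θ := Q.mapQ Q θ hQθ) (D := Q.mapQ Q D hQD) (y := Q.mapQ Q y hQy)
    (E := Q.mapQ Q E hQE) (by
      rw [injective_iff_map_eq_zero]
      intro a ha
      obtain ⟨a, rfl⟩ := hs a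
      exact (Submodule.Quotient.mk_eq_zero Q).2 (hθ a ((Submodule.Quotient.mk_eq_zero Q).1 ha)))
    (fun a => by obtain ⟨a, rfl⟩ := hs a; exact congrArg Q.mkQ (hDθ a))
    (fun a => by obtain ⟨a, rfl⟩ := hs a; exact congrArg Q.mkQ (hD a))
    (fun a => by obtain ⟨a, rfl⟩ := hs a; exact congrArg Q.mkQ (hθy a))
    (fun a => by obtain ⟨a, rfl⟩ := hs a; exact congrArg Q.mkQ (hDE a))
    (fun a => by obtain ⟨a, rfl⟩ := hs a; exact congrArg Q.mkQ (hθE a))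
    (S.map Q.mkQ)
    (by rintro _ ⟨a, ha, rfl⟩; exact ⟨θ a, hSθ a ha, rfl⟩)
    (by
      rintro _ ⟨a, ha, rfl⟩
      obtain ⟨z, hz, h⟩ := hSD a ha
      exact ⟨z, hz, (hm.2 h).symm⟩)
    (by
      intro a ha
      obtain ⟨a, rfl⟩ := hs a
      obtain ⟨g, hg, h⟩ := ha
      obtain ⟨g', hg', h'⟩ := hsat a g hg (hm.1 h.symm)
      exact ⟨g', hg', (hm.2 h').symm⟩)
    d
    (by
      intro n a
      obtain ⟨a, rfl⟩ := hs a
      obtain ⟨z, hz⟩ := hreg n a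
      refine ⟨Q.mkQ z, ?_⟩
      rw [hp, hp, hp]
      exact hm.2 hz)
    (by
      intro M
      obtain ⟨ν, h⟩ := hdens M
      refine ⟨ν, ?_⟩
      rintro _ ⟨a, ha, rfl⟩
      obtain ⟨g, hg, l, hl⟩ := h a ha
      refine ⟨Q.mkQ g, ⟨g, hg, rfl⟩, Q.mkQ l, ?_⟩
      rw [hp, ← map_add]
      refine (hp y hQy ν (E a)).trans (hm.2 hl))
    (x := Q.mkQ x) ⟨x, hx, rfl⟩
  obtain ⟨_, ⟨g, hg, rfl⟩, l, hl⟩ := key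
  obtain ⟨l, rfl⟩ := hs l
  exact ⟨g, hg, l, hm.1 hl⟩

namespace FSec
variable {k : Type*} [Field k] [CharZero k] {m : ℕ} (K : Type*) [Field K] [Algebra (PowerSeries k) K]
  [IsFractionRing (PowerSeries k) K] [CharZero K]

/-- The relative gradient. -/
noncomputable def grad (F : BR k m) (j : Fin m) : BR k m := liftD (pderiv k j) F

/-- The Taylor expansion of `F` along a section, without its value. -/
noncomputable def Fh (F : BR k m) (e : FSec k m) : 𝒪 m K :=
  e.tay K F - MvPowerSeries.C (algebraMap _ K (e.ev F))

theorem pderiv_C_eq_zero {R : Type*} [CommRing R] (j : Fin m) (c : R) :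
    pderiv R j (MvPowerSeries.C c) = 0 := by
  classical
  ext α
  rw [MvPowerSeries.coeff_pderiv, MvPowerSeries.coeff_C, if_neg, zero_mul, map_zero]
  intro h
  have := congrArg (fun q : Fin m →₀ ℕ => q j) h
  simp at this

theorem pderiv_Fh (F : BR k m) (e : FSec k m) (j : Fin m) :
    pderiv K j (Fh K F e) = e.tay K (grad F j) := by
  rw [Fh, map_sub, pderiv_tay, pderiv_C_eq_zero, sub_zero, grad]

theorem constantCoeff_Fh (F : BR k m) (e : FSec k m) :
    MvPowerSeries.constantCoeff (Fh K F e) = 0 := by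
  rw [Fh, map_sub, constantCoeff_tay, MvPowerSeries.constantCoeff_C, sub_self]

theorem jac_Fh (F : BR k m) (e : FSec k m) :
    jac (Fh K F e) = (span (Set.range (grad F))).map (e.tay K) := by
  rw [jac, Ideal.map_span, ← Set.range_comp]
  congr 2
  ext1 j
  exact pderiv_Fh K F e j

/-- Coefficientwise Taylor expansion. -/
noncomputable def Tay (e : FSec k m) : PowerSeries (BR k m) →+* PowerSeries (𝒪 m K) :=
  PowerSeries.map (e.tay K)

theorem coeff_Tay (e : FSec k m) (g : PowerSeries (BR k m)) (n : ℕ) :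
    coeff n (Tay K e g) = e.tay K (coeff n g) := coeff_map _ _ _

/-- The connection on the total space. -/
theorem nabF_Tay {F : BR k m} {L : ℕ}
    (hφ : derivative _ F ^ L ∈ span (Set.range (grad F)))
    {e : FSec k m} (he : e ∈ zeroSec (grad F)) {δ : Derivation ℤ K K}
    (hδ : ∀ r : PowerSeries k, δ (algebraMap _ K r) = algebraMap _ K (derivative k r))
    (g : PowerSeries (BR k m)) :
    nabF δ (Fh K F e) (Tay K e g) - Tay K e (X *
      liftD ((derivative (𝒪 m k)).restrictScalars k) g +
        C (derivative _ F) * g) ∈ imF (Fh K F e) := by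
  have hev : e.ev (derivative _ F) = 0 := by
    have := ev_eq_zero_of_mem he hφ
    rw [map_pow] at this
    exact eq_zero_of_pow_eq_zero this
  have hevF : derivative k (e.ev F) = 0 := by
    rw [derivative_ev, hev, zero_add]
    exact sum_eq_zero fun j _ => by
      have := he j
      rw [grad] at this
      rw [this, mul_zero]
  let c : Fin m → PowerSeries (𝒪 m K) := fun j =>
    C (MvPowerSeries.C (algebraMap _ K (derivative k (e.p j))))
  have h1 : liftD (coeffD δ) (Tay K e g) = Tay K e (liftD
      ((derivative (𝒪 m k)).restrictScalars k) g) +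
      ∑ j, c j * liftD (pderiv K j) (Tay K e g) := by
    ext1 n
    rw [map_add, map_sum, coeff_liftD, coeff_Tay, coeff_Tay, coeff_liftD, coeffD_tay K e hδ]
    congr 1
    refine sum_congr rfl fun j _ => ?_
    rw [coeff_C_mul, coeff_liftD, coeff_Tay, pderiv_tay]
  have h2 : coeffD δ (Fh K F e) = e.tay K (derivative _ F) +
      ∑ j, MvPowerSeries.C (algebraMap _ K (derivative k (e.p j))) *
        pderiv K j (Fh K F e) := by
    have h3 : coeffD δ (MvPowerSeries.C (σ := Fin m) (algebraMap _ K (e.ev F))) = 0 := by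
      classical
      ext α
      rw [coeff_coeffD, MvPowerSeries.coeff_C]
      split_ifs
      · rw [hδ, hevF, map_zero, map_zero]
      · rw [map_zero, map_zero]
    rw [Fh, map_sub, h3, sub_zero, coeffD_tay K e hδ]
    congr 1
    refine sum_congr rfl fun j _ => ?_
    rw [← Fh, pderiv_Fh, grad]
  have h4 : nabF δ (Fh K F e) (Tay K e g) - Tay K e (X *
      liftD ((derivative (𝒪 m k)).restrictScalars k) g +
        C (derivative _ F) * g) =
      ∑ j, twF (Fh K F e) j (c j * Tay K e g) := by
    have h5 : ∀ j, twF (Fh K F e) j (c j * Tay K e g) = X * (c j *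
        liftD (pderiv K j) (Tay K e g)) +
        C (pderiv K j (Fh K F e)) * (c j * Tay K e g) := by
      intro j
      have : liftD (pderiv K j) (c j) = 0 := by
        rw [liftD_C, pderiv_C_eq_zero, map_zero]
      rw [twF, tw_apply, leibniz, this, smul_zero, add_zero, smul_eq_mul]
    have h6 : Tay K e (X : PowerSeries (BR k m)) = X := PowerSeries.map_X _
    have h7 : ∀ a : BR k m, Tay K e (C a) = C (e.tay K a) :=
      fun a => PowerSeries.map_C _ _
    simp only [h5]
    rw [sum_add_distrib, ← mul_sum, nabF_apply, h1, h2, map_add, map_add, map_mul,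
      map_mul, h6, h7, map_sum, add_mul, sum_mul]
    have h8 : ∀ j, C (MvPowerSeries.C (algebraMap _ K (derivative k (e.p j))) *
        pderiv K j (Fh K F e)) * Tay K e g =
        C (pderiv K j (Fh K F e)) * (c j * Tay K e g) := fun j => by
      rw [map_mul]; ring
    simp only [h8]
    ring
  rw [h4]
  exact Submodule.sum_mem _ fun j _ => tw_mem_imTw _ _ _ j _

end FSec
end NonSplit

namespace NonSplit

open PowerSeries (C X X_dvd_iff coeff_zero_eq_constantCoeff_apply constantCoeff constantCoeff_C constantCoeff_X)
namespace FSec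
variable {k : Type*} [Field k] [CharZero k] {m : ℕ}

theorem mem_imTw_zero {k A ι : Type*} [CommRing k] [CommRing A] [Algebra k A] [Fintype ι]
    {θ : A} {f : ι → A} {g : A} : g ∈ imTw (k := k) θ (fun _ => 0) f ↔ g ∈ span (Set.range f) := by
  rw [mem_imTw, mem_span_range_iff_exists_fun]
  refine exists_congr fun h => ?_
  simp [tw_apply, mul_comm]

omit [CharZero k] in
/-- The relative Jacobian algebra is torsion free over the parameter. -/
theorem grad_saturated {F : BR k m} {N : ℕ}
    (hN : ∀ i, (MvPowerSeries.X i : 𝒪 m k) ^ N ∈ jac (constantCoeff F))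
    {g : BR k m} (hg : X * g ∈ span (Set.range (grad F))) :
    g ∈ span (Set.range (grad F)) := by
  rw [← mem_imTw_zero (k := k) (θ := X)] at hg ⊢
  refine imTw_saturated (fun g hg => ?_) (fun j => rfl) (fun i j g => rfl) (fun i j => rfl)
    (fun h hh => ?_) hg
  · exact PowerSeries.X_mul_cancel (by rw [hg, mul_zero])
  · have h0 : ∀ j, constantCoeff (grad F j) =
        pderiv k j (constantCoeff F) := fun j => by
      rw [grad, ← coeff_zero_eq_constantCoeff_apply, coeff_liftD,
        coeff_zero_eq_constantCoeff_apply]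
    rw [X_dvd_iff] at hh
    simp only [map_sum, map_mul, h0] at hh
    obtain ⟨a, ha0, ha, hah⟩ := powerSeries_koszul hN hh
    refine ⟨fun i j => C (a i j), by simp [ha0], fun i j => by
      rw [← map_neg, ← ha], fun i => ?_⟩
    rw [X_dvd_iff]
    simp [hah i, h0]

theorem constantCoeff_mem_jac {L : Type*} [CommRing L] {G : 𝒪 m L}
    {g : PowerSeries (𝒪 m L)} (hg : g ∈ imF G) :
    constantCoeff g ∈ jac G := by
  obtain ⟨h, rfl⟩ := mem_imTw.1 hg
  rw [map_sum]
  refine Ideal.sum_mem _ fun j _ => ?_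
  rw [tw_apply, map_add, map_mul, map_mul, constantCoeff_X, zero_mul, zero_add,
    constantCoeff_C]
  exact mul_mem_right _ _ (subset_span ⟨j, rfl⟩)

theorem scalar_mul_mem_imF {L : Type*} [CommRing L] {G : 𝒪 m L}
    {g : PowerSeries (𝒪 m L)} (c : L) (hg : g ∈ imF G) :
    C (MvPowerSeries.C c) * g ∈ imF G :=
  mul_mem_imTw (fun j => by rw [liftD_C, pderiv_C_eq_zero, map_zero]) hg

theorem X_pow_mul_mem_imF {L : Type*} [CommRing L] {G : 𝒪 m L}
    {g : PowerSeries (𝒪 m L)} (n : ℕ) (hg : g ∈ imF G) :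
    X ^ n * g ∈ imF G := by
  induction n with
  | zero => simpa using hg
  | succ n ih => rw [pow_succ', mul_assoc]; exact X_mul_mem_imF ih

variable (K : Type*) [Field K] [Algebra (PowerSeries k) K]
  [IsFractionRing (PowerSeries k) K] [CharZero K]

variable (k) in
/-- Scalars of the parameter ring acting on the Taylor side. -/
noncomputable def scal (m : ℕ) : PowerSeries k →+* PowerSeries (𝒪 m K) :=
  (C).comp ((MvPowerSeries.C).comp (algebraMap (PowerSeries k) K))

variable {K}

theorem scal_mul_mem {G : 𝒪 m K} {g} (c : PowerSeries k) (hg : g ∈ imF G) :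
    scal k K m c * g ∈ imF G := scalar_mul_mem_imF _ hg

theorem Tay_scal (e : FSec k m) (c : PowerSeries k) :
    Tay K e (C (iota k m c)) = scal k K m c := by
  rw [Tay, PowerSeries.map_C, tay_iota]; rfl

theorem Tay_C (e : FSec k m) (a : BR k m) : Tay K e (C a) = C (e.tay K a) :=
  PowerSeries.map_C _ _

theorem Tay_X (e : FSec k m) : Tay K e X = X := PowerSeries.map_X _

variable (F : BR k m)

/-- A family of vectors is, up to a power of the parameter, approximated by the lattice. -/
def Dn (M ν : ℕ) (v : zeroSec (grad F) → PowerSeries (𝒪 m K)) : Prop :=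
  ∃ (h : PowerSeries (BR k m)) (l : zeroSec (grad F) → PowerSeries (𝒪 m K)),
    ∀ e : zeroSec (grad F), scal k K m X ^ ν * v e -
      (Tay K e.1 h + X ^ M * l e) ∈ imF (Fh K F e.1)

variable {F}

theorem Dn.smulR {M ν : ℕ} {v : zeroSec (grad F) → PowerSeries (𝒪 m K)}
    (hv : Dn F M ν v) (c : PowerSeries k) : Dn F M ν fun e => scal k K m c * v e := by
  obtain ⟨h, l, H⟩ := hv
  refine ⟨C (iota k m c) * h, fun e => scal k K m c * l e, fun e => ?_⟩
  rw [map_mul, Tay_scal]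
  convert scal_mul_mem c (H e) using 1
  ring

theorem Dn.mono {M ν ν' : ℕ} {v : zeroSec (grad F) → PowerSeries (𝒪 m K)}
    (hv : Dn F M ν v) (hν : ν ≤ ν') : Dn F M ν' v := by
  obtain ⟨h, l, H⟩ := hv.smulR (X ^ (ν' - ν))
  refine ⟨h, l, fun e => ?_⟩
  have := H e
  rwa [← mul_assoc, map_pow, ← pow_add, Nat.add_sub_cancel' hν] at this

theorem Dn.add {M ν : ℕ} {v w : zeroSec (grad F) → PowerSeries (𝒪 m K)}
    (hv : Dn F M ν v) (hw : Dn F M ν w) : Dn F M ν fun e => v e + w e := by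
  obtain ⟨h, l, H⟩ := hv
  obtain ⟨h', l', H'⟩ := hw
  refine ⟨h + h', fun e => l e + l' e, fun e => ?_⟩
  rw [map_add]
  convert add_mem (H e) (H' e) using 1
  ring

theorem Dn.sum {M ν : ℕ} {ι : Type*} (s : Finset ι)
    {v : ι → zeroSec (grad F) → PowerSeries (𝒪 m K)}
    (hv : ∀ a ∈ s, Dn F M ν (v a)) : Dn F M ν fun e => ∑ a ∈ s, v a e := by
  classical
  induction s using Finset.induction_on with
  | empty => exact ⟨0, 0, fun e => by simp⟩
  | insert a s ha ih =>
    simp only [sum_insert ha]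
    exact (hv a (Finset.mem_insert_self a s)).add
      (ih fun b hb => hv b (Finset.mem_insert_of_mem hb))

theorem Dn.congr {M ν : ℕ} {v w : zeroSec (grad F) → PowerSeries (𝒪 m K)}
    (hv : Dn F M ν v) (hw : ∀ e, w e - v e ∈ imF (Fh K F e.1)) : Dn F M ν w := by
  obtain ⟨h, l, H⟩ := hv
  refine ⟨h, l, fun e => ?_⟩
  have := scal_mul_mem ((X : PowerSeries k) ^ ν) (hw e)
  rw [map_pow] at this
  convert add_mem (H e) this using 1
  ring

theorem Dn.shift {M ν : ℕ} {v : zeroSec (grad F) → PowerSeries (𝒪 m K)}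
    (hv : Dn F M ν v) : Dn F (M + 1) ν fun e => X * v e := by
  obtain ⟨h, l, H⟩ := hv
  refine ⟨X * h, l, fun e => ?_⟩
  rw [map_mul, Tay_X]
  convert X_mul_mem_imF (H e) using 1
  ring

section Zero
variable (hP : ∀ j, ∃ S : Multiset (PowerSeries k),
      (S.map fun r => wv k m j - iota k m r).prod ∈ span (Set.range (grad F)))
  (hsat : ∀ g, X * g ∈ span (Set.range (grad F)) →
    g ∈ span (Set.range (grad F)))
include hP hsat

variable (K) in
theorem exists_maxId_pow_le_jac : ∃ n, ∀ e : zeroSec (grad F), maxId m K ^ n ≤ jac (Fh K F e.1) := by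
  have := (zeroSec_finite hP).to_subtype
  have := Fintype.ofFinite (zeroSec (grad F))
  choose n hn using fun e : zeroSec (grad F) => exists_maxId_pow_le K hP hsat e.1
  refine ⟨∑ e, n e, fun e => ?_⟩
  rw [jac_Fh]
  exact (Ideal.pow_le_pow_right (single_le_sum (f := n) (fun _ _ => Nat.zero_le _)
    (mem_univ e))).trans (hn e)

theorem exists_Dn_one (v : zeroSec (grad F) → PowerSeries (𝒪 m K)) :
    ∃ ν, Dn F 1 ν v := by
  have := (zeroSec_finite hP).to_subtype
  have := Fintype.ofFinite (zeroSec (grad F))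
  obtain ⟨n, hn⟩ := exists_maxId_pow_le_jac K hP hsat
  choose s hs1 hs2 using fun e : zeroSec (grad F) => exists_separating hP (e := e.1)
  choose u hu using fun e : zeroSec (grad F) => (isUnit_tay K e.1 (hs1 e)).exists_right_inv
  choose N Q hQ using fun e : zeroSec (grad F) => e.1.exists_tay_sub K n
    (constantCoeff (v e) * u e ^ n)
  let ν := ∑ e, N e
  have hν : ∀ e, N e ≤ ν := fun e => single_le_sum (f := N) (fun _ _ => Nat.zero_le _)
    (mem_univ e)
  let h0 : BR k m := ∑ e, X ^ (ν - N e) * Q e * s e ^ n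
  have hX : ∀ e : FSec k m, e.tay K X =
      MvPowerSeries.C (algebraMap (PowerSeries k) K X) := fun e => by
    rw [← iota_X, tay_iota]
  have key : ∀ e : zeroSec (grad F), MvPowerSeries.C (algebraMap (PowerSeries k) K X ^ ν) *
      constantCoeff (v e) - e.1.tay K h0 ∈ jac (Fh K F e.1) := by
    intro e
    classical
    have h1 : h0 = X ^ (ν - N e) * Q e * s e ^ n +
      ∑ e' ∈ Finset.univ.erase e, X ^ (ν - N e') * Q e' * s e' ^ n :=
      (Finset.add_sum_erase _ _ (mem_univ e)).symm
    have h2 : e.1.tay K (∑ e' ∈ Finset.univ.erase e, X ^ (ν - N e') * Q e' * s e' ^ n) ∈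
        jac (Fh K F e.1) := by
      rw [map_sum]
      refine Ideal.sum_mem _ fun e' he' => ?_
      rw [map_mul, map_pow]
      refine mul_mem_left _ _ (hn e (Ideal.pow_mem_pow ?_ n))
      have h3 : e.1.ev (s e') = 0 := hs2 e' e.1 e.2 fun h =>
        (ne_of_mem_erase he') (Subtype.ext h.symm)
      rw [← pow_one (maxId m K), maxId_pow, mem_degGE_one, constantCoeff_tay, h3, map_zero]
    rw [h1, map_add, ← sub_sub]
    refine sub_mem ?_ h2
    have h4 := hQ e
    rw [← maxId_pow] at h4
    have h5 := mul_mem_left _ (-(e.1.tay K X ^ (ν - N e) * e.1.tay K (s e) ^ n))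
      (hn e h4)
    convert h5 using 1
    have h6 : (MvPowerSeries.C (algebraMap (PowerSeries k) K X ^ ν) :
        𝒪 m K) = e.1.tay K X ^ (ν - N e) *
        MvPowerSeries.C (algebraMap (PowerSeries k) K X ^ N e) := by
      rw [hX, map_pow, map_pow, ← pow_add, Nat.sub_add_cancel (hν e)]
    have h7 : e.1.tay K (s e) ^ n * u e ^ n = 1 := by rw [← mul_pow, hu, one_pow]
    rw [h6, map_mul (e.1.tay K), map_mul (e.1.tay K), map_pow (e.1.tay K), map_pow (e.1.tay K)]
    linear_combination -(e.1.tay K X ^ (ν - N e) *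
      MvPowerSeries.C (algebraMap (PowerSeries k) K X ^ N e) *
      constantCoeff (v e)) * h7
  choose b hb using fun e => exists_sub_X_mul_mem_imF (key e)
  have hdiv : ∀ e, ∃ l, v e = C (constantCoeff (v e)) + X * l := by
    intro e
    obtain ⟨l, hl⟩ : (X : PowerSeries (𝒪 m K)) ∣
      v e - C (constantCoeff (v e)) := by
      rw [X_dvd_iff]; simp
    exact ⟨l, by rw [← hl]; ring⟩
  choose l hl using hdiv
  refine ⟨ν, C h0, fun e => b e + scal k K m X ^ ν * l e, fun e => ?_⟩
  have h8 : scal k K m X ^ ν = C (MvPowerSeries.C (σ := Fin m)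
    (algebraMap (PowerSeries k) K X ^ ν)) := by
    rw [map_pow, map_pow]; rfl
  convert hb e using 1
  rw [Tay_C, map_sub, map_mul]
  nth_rewrite 1 [hl e]
  rw [h8]
  ring

theorem exists_Dn (M : ℕ) (v : zeroSec (grad F) → PowerSeries (𝒪 m K)) :
    ∃ ν, Dn F M ν v := by
  induction M generalizing v with
  | zero => exact ⟨0, 0, v, fun e => by simp⟩
  | succ M ih =>
    obtain ⟨ν, h, l, H⟩ := ih v
    obtain ⟨ν', h', l', H'⟩ := exists_Dn_one hP hsat l
    refine ⟨ν' + ν, C (iota k m (X ^ ν')) * h + X ^ M * h', l',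
      fun e => ?_⟩
    have h1 := scal_mul_mem ((X : PowerSeries k) ^ ν') (H e)
    have h2 := X_pow_mul_mem_imF M (H' e)
    rw [map_pow] at h1
    convert add_mem h1 h2 using 1
    rw [map_add, map_mul, map_mul, Tay_scal, map_pow (Tay K e.1), Tay_X, map_pow (scal k K m)]
    ring

end Zero
end FSec
end NonSplit

namespace NonSplit

open PowerSeries (C X X_dvd_iff coeff_zero_eq_constantCoeff_apply constantCoeff constantCoeff_C)
namespace FSec
variable {k : Type*} [Field k] [CharZero k] {m : ℕ}

omit [CharZero k] in
theorem constantCoeff_grad (F : BR k m) (j : Fin m) : constantCoeff (grad F j) =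
    pderiv k j (constantCoeff F) := by
  rw [grad, ← coeff_zero_eq_constantCoeff_apply, coeff_liftD,
    coeff_zero_eq_constantCoeff_apply]

omit [CharZero k] in
theorem exists_generators {F : BR k m} {N : ℕ}
    (hN : maxId m k ^ N ≤ jac (constantCoeff F)) :
    ∃ (n : ℕ) (b : Fin n → BR k m), ∀ g, ∃ (c : Fin n → PowerSeries k) (h : Fin m → BR k m),
      g = ∑ a, iota k m (c a) * b a + ∑ j, grad F j * h j := by
  classical
  let S := (finite_degree_lt (m := m) N).toFinset
  let σ := S.equivFin
  refine ⟨S.card, fun a => C (MvPowerSeries.monomial (σ.symm a).1 1), fun g => ?_⟩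
  refine exists_gen (MvPowerSeries.C (σ := Fin m) (R := k)) _ (grad F) (fun g => ?_) g
  have h1 := sub_truncMv_mem N (constantCoeff g)
  rw [← maxId_pow] at h1
  obtain ⟨h, hh⟩ := Ideal.mem_span_range_iff_exists_fun.1 (hN h1)
  have h2 : truncMv N (constantCoeff g) = ∑ a : Fin S.card,
      MvPowerSeries.C (MvPowerSeries.coeff (σ.symm a).1 (constantCoeff g)) *
        MvPowerSeries.monomial (σ.symm a).1 1 := by
    rw [Equiv.sum_comp σ.symm (fun α => MvPowerSeries.C (MvPowerSeries.coeff α.1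
      (constantCoeff g)) * MvPowerSeries.monomial α.1 1), Finset.sum_coe_sort S
      (fun α => MvPowerSeries.C (MvPowerSeries.coeff α (constantCoeff g)) *
        MvPowerSeries.monomial α 1)]
    ext α
    rw [truncMv, coeff_mvMk, map_sum]
    simp only [MvPowerSeries.coeff_C_mul, MvPowerSeries.coeff_monomial, mul_ite, mul_one, mul_zero]
    rw [Finset.sum_ite_eq]
    simp [S]
  obtain ⟨g', hg'⟩ : (X : BR k m) ∣ g - (∑ a : Fin S.card, C
      (MvPowerSeries.C (MvPowerSeries.coeff (σ.symm a).1 (constantCoeff g))) *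
        C (MvPowerSeries.monomial (σ.symm a).1 1) +
        ∑ j, grad F j * C (h j)) := by
    rw [X_dvd_iff]
    simp only [map_sub, map_add, map_sum, map_mul, constantCoeff_C, constantCoeff_grad]
    rw [← h2, sub_eq_zero, ← sub_eq_iff_eq_add', ← hh]
    exact sum_congr rfl fun j _ => mul_comm _ _
  exact ⟨_, fun j => C (h j), g', sub_eq_iff_eq_add'.1 hg'⟩

variable (K : Type*) [Field K] [Algebra (PowerSeries k) K]
  [IsFractionRing (PowerSeries k) K] [CharZero K] {F : BR k m}

theorem Tay_grad_mul (e : FSec k m) (j : Fin m) (h : BR k m) :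
    Tay K e (C (grad F j * h) + X *
      C (liftD (pderiv k j) h)) ∈ imF (Fh K F e) := by
  have : Tay K e (C (grad F j * h) + X *
      C (liftD (pderiv k j) h)) =
      twF (Fh K F e) j (C (e.tay K h)) := by
    rw [map_add, map_mul (Tay K e) X, Tay_X, Tay_C, Tay_C, twF, tw_apply, liftD_C,
      pderiv_Fh, pderiv_tay, map_mul (e.tay K), map_mul, add_comm]
  rw [this]
  exact tw_mem_imTw _ _ _ j _

variable (hP : ∀ j, ∃ S : Multiset (PowerSeries k),
      (S.map fun r => wv k m j - iota k m r).prod ∈ span (Set.range (grad F)))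
  {N : ℕ} (hN : maxId m k ^ N ≤ jac (constantCoeff F))
include hP hN

omit hP in
omit [CharZero k] in
theorem grad_saturated' {g : BR k m} (hg : X * g ∈ span (Set.range (grad F))) :
    g ∈ span (Set.range (grad F)) :=
  grad_saturated (fun i => hN (Ideal.pow_mem_pow (X_mem_maxId i) N)) hg

theorem exists_Dn_uniform {ε : zeroSec (grad F) → PowerSeries (𝒪 m K)}
    (hε : ∀ e, ε e = 0 ∨ ε e = 1) (M : ℕ) :
    ∃ ν, ∀ g, Dn F M ν fun e => ε e * Tay K e.1 g := by
  have hsat := fun g => grad_saturated' (F := F) hN (g := g)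
  have hεm : ∀ e v, v ∈ imF (Fh K F e.1) → ε e * v ∈ imF (Fh K F e.1) := by
    intro e v hv
    rcases hε e with h | h
    · rw [h, zero_mul]; exact zero_mem _
    · rwa [h, one_mul]
  obtain ⟨n, b, hb⟩ := exists_generators hN
  induction M with
  | zero => exact ⟨0, fun g => ⟨0, fun e => ε e * Tay K e.1 g, fun e => by simp⟩⟩
  | succ M ih =>
    obtain ⟨ν₀, h₀⟩ := ih
    choose ν hν using fun a => exists_Dn (K := K) hP hsat (M + 1)
      (fun e => ε e * Tay K e.1 (C (b a)))
    refine ⟨ν₀ + ∑ a, ν a, fun g => ?_⟩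
    obtain ⟨g', hg'⟩ : (X : PowerSeries (BR k m)) ∣
        g - C (constantCoeff g) := by
      rw [X_dvd_iff]; simp
    obtain ⟨c, h, hg⟩ := hb (constantCoeff g)
    let g'' := g' - ∑ j, C (liftD (pderiv k j) (h j))
    have h1 : Dn F (M + 1) (ν₀ + ∑ a, ν a) fun e => ∑ a, scal k K m (c a) *
        (ε e * Tay K e.1 (C (b a))) :=
      Dn.sum _ fun a _ => ((hν a).smulR (c a)).mono (le_trans
        (single_le_sum (f := ν) (fun _ _ => Nat.zero_le _) (mem_univ a))
        (Nat.le_add_left _ _))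
    have h2 : Dn F (M + 1) (ν₀ + ∑ a, ν a) fun e => X * (ε e * Tay K e.1 g'') :=
      ((h₀ g'').shift).mono (Nat.le_add_right _ _)
    refine (h1.add h2).congr fun e => ?_
    have h3 : ∑ j, Tay K e.1 (C (grad F j * h j) + X *
      C (liftD (pderiv k j) (h j))) ∈ imF (Fh K F e.1) :=
      Submodule.sum_mem _ fun j _ => Tay_grad_mul K e.1 j (h j)
    convert hεm e _ h3 using 1
    have h4 : g = ∑ a, C (iota k m (c a)) * C (b a) +
        ∑ j, (C (grad F j * h j) + X *
          C (liftD (pderiv k j) (h j))) + X * g'' := by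
      rw [sum_add_distrib, ← mul_sum, mul_sub, ← hg']
      have hgC := congrArg C hg
      simp only [map_add, map_sum, map_mul] at hgC ⊢
      linear_combination hgC
    have h5 : Tay K e.1 g = ∑ a, scal k K m (c a) * Tay K e.1 (C (b a)) +
        ∑ j, Tay K e.1 (C (grad F j * h j) + X *
          C (liftD (pderiv k j) (h j))) + X * Tay K e.1 g'' := by
      conv_lhs => rw [h4]
      rw [map_add, map_add, map_sum, map_sum, map_mul, Tay_X]
      simp only [map_mul (Tay K e.1) (C (iota k m _)), Tay_scal]
    rw [h5, mul_add, mul_add, mul_sum]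
    simp only [mul_left_comm (ε e)]
    ring

end FSec
end NonSplit

namespace NonSplit

open PowerSeries (C X X_dvd_iff coeff_C_mul coeff_smul constantCoeff constantCoeff_X derivative derivative_X)
open Module (End)
namespace FSec
variable {k : Type*} [Field k] [CharZero k] {m : ℕ} {F : BR k m}

theorem exists_derivation_fraction' {A K : Type*} [CommRing A] [Field K] [Algebra A K]
    [IsFractionRing A K] (d : A →+ A) (hd : ∀ a b, d (a * b) = a * d b + b * d a) :
    ∃ δ' : Derivation ℤ K K, ∀ a, δ' (algebraMap A K a) = algebraMap A K (d a) :=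
  exists_derivation_fraction (Derivation.mk' d.toIntLinearMap hd)

theorem not_two_sections (K : Type*) [Field K] [Algebra (PowerSeries k) K]
    [IsFractionRing (PowerSeries k) K]
    (hP : ∀ j, ∃ S : Multiset (PowerSeries k),
      (S.map fun r => wv k m j - iota k m r).prod ∈ span (Set.range (grad F)))
    {N L : ℕ} (hN : maxId m k ^ N ≤ jac (constantCoeff F))
    (hφ : derivative _ F ^ L ∈ span (Set.range (grad F))) :
    (zeroSec (grad F)).Subsingleton := by
  classical
  intro e₁ he₁ e₂ he₂
  by_contra hne
  have : CharZero K := charZero_of_injective_ringHom (f := (algebraMap (PowerSeries k) K).comp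
    (C (R := k))) (RingHom.injective _)
  obtain ⟨δ, hδ'⟩ := exists_derivation_fraction' (K := K)
    (derivative k).toLinearMap.toAddMonoidHom fun a b => (derivative k).leibniz a b
  have hδ : ∀ r : PowerSeries k, δ (algebraMap _ K r) = algebraMap _ K (derivative k r) :=
    hδ'
  have hδX : δ (algebraMap (PowerSeries k) K X) = 1 := by
    rw [hδ, derivative_X, map_one]
  have hsat := fun g => grad_saturated' (F := F) hN (g := g)
  have := (zeroSec_finite hP).to_subtype
  have := Fintype.ofFinite (zeroSec (grad F))
  obtain ⟨n₀, hn₀⟩ := exists_maxId_pow_le_jac K hP hsat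
  choose B hC using fun e : zeroSec (grad F) =>
    nabF_pow_mem (constantCoeff_Fh K F e.1) (hn₀ e) δ
  have hX : ∀ (e : zeroSec (grad F)) g, X * g ∈ imF (Fh K F e.1) →
      g ∈ imF (Fh K F e.1) := fun e g hg =>
    imF_saturated (fun i => hn₀ e (Ideal.pow_mem_pow (X_mem_maxId i) n₀)) hg
  let A := (e : zeroSec (grad F)) → PowerSeries (𝒪 m K)
  let Q : Submodule ℚ A :=
    Submodule.pi Set.univ fun e => (imF (Fh K F e.1)).restrictScalars ℚ
  have hQ : ∀ v : A, v ∈ Q ↔ ∀ e, v e ∈ imF (Fh K F e.1) := fun v =>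
    ⟨fun h e => h e trivial, fun h e _ => h e⟩
  let ε : A := fun e => if e.1 = e₁ then 1 else 0
  have hε : ∀ e, ε e = 0 ∨ ε e = 1 := fun e => by by_cases h : e.1 = e₁ <;> simp [ε, h]
  let θ : End ℚ A := mulLeft ℚ (fun _ => X)
  let y : End ℚ A := mulLeft ℚ (fun _ => scal k K m X)
  let E : End ℚ A := mulLeft ℚ ε
  let D : End ℚ A := AddMonoidHom.toRatLinearMap
    { toFun := fun v e => nabF δ (Fh K F e.1) (v e)
      map_zero' := by ext1 e; exact map_zero _
      map_add' := fun v w => by ext1 e; exact map_add _ _ _ }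
  have hθa : ∀ v e, θ v e = X * v e := fun v e => rfl
  have hya : ∀ v e, y v e = scal k K m X * v e := fun v e => rfl
  have hEa : ∀ v e, E v e = ε e * v e := fun v e => rfl
  have hDa : ∀ v e, D v e = nabF δ (Fh K F e.1) (v e) := fun v e => rfl
  have hθn : ∀ (n : ℕ) v e, (θ ^ n) v e = X ^ n * v e := by
    intro n
    induction n with
    | zero => intro v e; simp
    | succ n ih => intro v e; rw [pow_succ', End.mul_apply, hθa, ih, pow_succ', mul_assoc]
  have hyn : ∀ (n : ℕ) v e, (y ^ n) v e = scal k K m X ^ n * v e := by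
    intro n
    induction n with
    | zero => intro v e; simp
    | succ n ih => intro v e; rw [pow_succ', End.mul_apply, hya, ih, pow_succ', mul_assoc]
  have hDn : ∀ (n : ℕ) v e, (D ^ n) v e = (nabF δ (Fh K F e.1))^[n] (v e) := by
    intro n
    induction n with
    | zero => intro v e; simp
    | succ n ih =>
      intro v e; rw [pow_succ', End.mul_apply, hDa, ih, iterate_succ_apply']
  have hεm : ∀ e v, v ∈ imF (Fh K F e.1) → ε e * v ∈ imF (Fh K F e.1) := by
    intro e v hv
    rcases hε e with h | h
    · rw [h, zero_mul]; exact zero_mem _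
    · rwa [h, one_mul]
  have hnX : ∀ e (n : ℕ) v, (nabF δ (Fh K F e))^[n] (X * v) =
      X * (nabF δ (Fh K F e))^[n] v := by
    intro e n
    induction n with
    | zero => intro v; rfl
    | succ n ih => intro v; rw [Function.iterate_succ_apply, nabF_X_mul, ih,
        Function.iterate_succ_apply]
  have hnXp : ∀ e (n d : ℕ) v, (nabF δ (Fh K F e))^[n] (X ^ d * v) =
      X ^ d * (nabF δ (Fh K F e))^[n] v := by
    intro e n d
    induction d with
    | zero => intro v; simp
    | succ d ih => intro v; rw [pow_succ', mul_assoc, hnX, ih, mul_assoc]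
  let ι : PowerSeries (BR k m) →+ A :=
    { toFun := fun g e => Tay K e.1 g
      map_zero' := by ext1 e; exact map_zero _
      map_add' := fun v w => by ext1 e; exact map_add _ _ _ }
  let S : Submodule ℚ A := range ι.toRatLinearMap
  have hS : ∀ g, (fun e : zeroSec (grad F) => Tay K e.1 g) ∈ S := fun g => ⟨g, rfl⟩
  have key := pole_argument_mod Q θ D y E
    (fun x hx => (hQ _).2 fun e => X_mul_mem_imF ((hQ _).1 hx e))
    (fun x hx => (hQ _).2 fun e => nabF_mem_imF ((hQ _).1 hx e))
    (fun x hx => (hQ _).2 fun e => scal_mul_mem _ ((hQ _).1 hx e))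
    (fun x hx => (hQ _).2 fun e => hεm e _ ((hQ _).1 hx e))
    (fun x hx => (hQ _).2 fun e => hX e _ ((hQ _).1 hx e))
    (fun x => funext fun e => nabF_X_mul _ _ _)
    (fun x => funext fun e => by
      have hs : ∀ (c : K) (v : PowerSeries (𝒪 m K)), c • v =
          PowerSeries.C (MvPowerSeries.C c) * v := fun c v => by
        ext1 n
        rw [coeff_C_mul, coeff_smul, MvPowerSeries.smul_eq_C_mul]
      have h := nabF_smul δ (Fh K F e.1) (algebraMap (PowerSeries k) K X) (x e)
      rw [hδX, one_smul, hs, hs] at h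
      exact h)
    (fun x => funext fun e => mul_left_comm _ _ _)
    (fun x => funext fun e => by
      rw [hDa, hEa, hEa, hDa]
      rcases hε e with h | h
      · rw [h, zero_mul, zero_mul, map_zero]
      · rw [h, one_mul, one_mul])
    (fun x => funext fun e => mul_left_comm _ _ _)
    S
    (by
      rintro _ ⟨g, rfl⟩
      refine ⟨X * g, funext fun e => ?_⟩
      change Tay K e.1 (X * g) = X * Tay K e.1 g
      rw [map_mul, Tay_X])
    (by
      rintro _ ⟨g, rfl⟩
      exact ⟨_, hS _, (hQ _).2 fun e => nabF_Tay K hφ e.2 hδ g⟩)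
    (by
      rintro x _ ⟨g, rfl⟩ hx
      rw [hQ] at hx
      have h1 : constantCoeff g ∈ span (Set.range (grad F)) := by
        refine mem_of_tay_mem K hP hsat fun e he => ?_
        have h := constantCoeff_mem_jac (hx ⟨e, he⟩)
        rw [jac_Fh] at h
        have h2 : constantCoeff ((θ x - ι g) ⟨e, he⟩) =
            - e.tay K (constantCoeff g) := by
          rw [Pi.sub_apply, hθa, map_sub, map_mul, constantCoeff_X, zero_mul, zero_sub]
          congr 1
        change constantCoeff ((θ x - ι g) ⟨e, he⟩) ∈ _ at h
        rw [h2] at h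
        exact neg_mem_iff.1 h
      obtain ⟨a, ha⟩ := Ideal.mem_span_range_iff_exists_fun.1 h1
      obtain ⟨g', hg'⟩ : (X : PowerSeries (BR k m)) ∣
          g - C (constantCoeff g) := by
        rw [X_dvd_iff]; simp
      let g'' := g' - ∑ j, C (liftD (pderiv k j) (a j))
      refine ⟨_, hS g'', (hQ _).2 fun e => hX e _ ?_⟩
      have h3 : ∑ j, Tay K e.1 (C (grad F j * a j) + X *
          C (liftD (pderiv k j) (a j))) ∈ imF (Fh K F e.1) :=
        Submodule.sum_mem _ fun j _ => Tay_grad_mul K e.1 j (a j)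
      have h4 : g = ∑ j, (C (grad F j * a j) + X *
            C (liftD (pderiv k j) (a j))) + X * g'' := by
        rw [sum_add_distrib, ← mul_sum, mul_sub, ← hg']
        have hgC := congrArg C ha
        simp only [map_sum, map_mul] at hgC ⊢
        simp only [mul_comm (C (grad F _))]
        linear_combination -hgC
      have h5 := congrArg (Tay K e.1) h4
      rw [map_add, map_sum, map_mul, Tay_X] at h5
      convert add_mem (hx e) h3 using 1
      rw [Pi.sub_apply, Pi.sub_apply, hθa]
      change _ = _ - Tay K e.1 g + _
      rw [h5]
      ring)
    (∑ e, B e)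
    (by
      intro n x
      choose z hz using fun e => hC e n (x e)
      refine ⟨fun e => X ^ (∑ e, B e + (n - B e) - n) * z e, (hQ _).2 fun e => ?_⟩
      rw [Pi.sub_apply, hDn, hθn, hθn, hnXp]
      have hle : B e ≤ ∑ e, B e := single_le_sum (f := B) (fun _ _ => Nat.zero_le _)
        (mem_univ e)
      have := X_pow_mul_mem_imF (∑ e, B e) (hz e)
      convert this using 1
      rw [← mul_assoc, ← pow_add, mul_sub, ← mul_assoc, ← pow_add,
        Nat.add_sub_cancel' (show n ≤ ∑ e, B e + (n - B e) by omega)])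
    (by
      intro M
      obtain ⟨ν, hν⟩ := exists_Dn_uniform (K := K) hP hN hε M
      refine ⟨ν, ?_⟩
      rintro _ ⟨g, rfl⟩
      obtain ⟨h, l, hl⟩ := hν g
      refine ⟨_, hS h, l, (hQ _).2 fun e => ?_⟩
      rw [Pi.sub_apply, Pi.add_apply, hyn, hEa, hθn]
      exact hl e)
    (hS 1)
  obtain ⟨_, ⟨g, rfl⟩, l, hl⟩ := key
  rw [hQ] at hl
  have hcc : ∀ e : zeroSec (grad F), ∀ v ∈ jac (Fh K F e.1), MvPowerSeries.constantCoeff v = 0 := by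
    intro e v hv
    have : jac (Fh K F e.1) ≤ RingHom.ker (MvPowerSeries.constantCoeff (σ := Fin m) (R := K)) := by
      rw [jac, Ideal.span_le]
      rintro _ ⟨j, rfl⟩
      change MvPowerSeries.constantCoeff (pderiv K j (Fh K F e.1)) = 0
      rw [pderiv_Fh, constantCoeff_tay, e.2 j, map_zero]
    exact this hv
  have hfin : ∀ e : zeroSec (grad F), MvPowerSeries.constantCoeff (constantCoeff (ε e)) =
      algebraMap _ K (e.1.ev (constantCoeff g)) := by
    intro e
    have h := hcc e _ (constantCoeff_mem_jac (hl e))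
    have h2 : (E (fun e => Tay K e.1 1) - (ι g + θ l)) e =
      ε e - (Tay K e.1 g + X * l e) := by
      rw [Pi.sub_apply, hEa, map_one, mul_one]; rfl
    change MvPowerSeries.constantCoeff (constantCoeff
      ((E (fun e => Tay K e.1 1) - (ι g + θ l)) e)) = 0 at h
    rw [h2, map_sub, map_add, map_mul, constantCoeff_X, zero_mul, add_zero, map_sub,
      sub_eq_zero] at h
    rw [h, ← constantCoeff_tay]
    congr 1
  have f1 := hfin ⟨e₁, he₁⟩
  have f2 := hfin ⟨e₂, he₂⟩
  have g1 : ε ⟨e₁, he₁⟩ = 1 := by simp [ε]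
  have g2 : ε ⟨e₂, he₂⟩ = 0 := by simp [ε, Ne.symm hne]
  rw [g1, map_one, map_one, eq_comm, ← map_one (algebraMap (PowerSeries k) K)] at f1
  rw [g2, map_zero, map_zero, eq_comm, ← map_zero (algebraMap (PowerSeries k) K)] at f2
  have hf1 := congrArg constantCoeff (IsFractionRing.injective _ K f1)
  have hf2 := congrArg constantCoeff (IsFractionRing.injective _ K f2)
  rw [constantCoeff_ev] at hf1 hf2
  rw [hf1] at hf2
  simp at hf2

/-- The formal non-splitting statement over a splitting parameter ring. -/
theorem exists_unique_section
    (hP : ∀ j, ∃ S : Multiset (PowerSeries k),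
      (S.map fun r => wv k m j - iota k m r).prod ∈ span (Set.range (grad F)))
    {N L : ℕ} (hN : maxId m k ^ N ≤ jac (constantCoeff F))
    (hφ : derivative _ F ^ L ∈ span (Set.range (grad F))) :
    ∃ p : Fin m → PowerSeries k, ∀ j, ∃ M : ℕ,
      (wv k m j - iota k m (p j)) ^ M ∈ span (Set.range (grad F)) := by
  have hsat := fun g => grad_saturated' (F := F) hN (g := g)
  by_cases h : ∃ e, e ∈ zeroSec (grad F)
  · obtain ⟨e, he⟩ := h
    refine ⟨e.p, fun j => mem_radical hP hsat fun e' he' => ?_⟩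
    rw [not_two_sections (FractionRing (PowerSeries k)) hP hN hφ he' he]
    exact e.ev_x j
  · push Not at h
    exact ⟨0, fun j => mem_radical hP hsat fun e' he' => absurd he' (h e')⟩

end FSec
end NonSplit

namespace NonSplit
open PowerSeries in
theorem hensel_split {k : Type*} [Field k] {P : Polynomial (PowerSeries k)} (hP : P.Monic)
    (h0 : constantCoeff (P.coeff 0) = 0)
    (hX : P.map (constantCoeff (R := k)) ≠ Polynomial.X ^ P.natDegree) :
    ∃ D q : Polynomial (PowerSeries k), D.Monic ∧ q.Monic ∧ P = D * q ∧
      D.natDegree < P.natDegree ∧ q.natDegree < P.natDegree := by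
  have hmem : ∀ c : PowerSeries k, c ∈ IsLocalRing.maximalIdeal (PowerSeries k) ↔
      constantCoeff c = 0 := by
    intro c
    rw [PowerSeries.maximalIdeal_eq_span_X, Ideal.mem_span_singleton, PowerSeries.X_dvd_iff]
  have : IsAdicComplete (IsLocalRing.maximalIdeal (PowerSeries k)) (PowerSeries k) := by
    rw [PowerSeries.maximalIdeal_eq_span_X]; infer_instance
  have hne : ((P : PowerSeries (PowerSeries k))).map
      (IsLocalRing.residue (PowerSeries k)) ≠ 0 := by
    rw [← Polynomial.polynomial_map_coe]
    exact_mod_cast P.map_monic_ne_zero (f := IsLocalRing.residue (PowerSeries k)) hP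
  obtain ⟨D, h, hD, hu, hDh⟩ := PowerSeries.exists_isWeierstrassFactorization hne
  have hDm := hD.monic
  have hdiv : P = D * (P /ₘ D) := by
    have h1 : P %ₘ D + D * (P /ₘ D) = P := Polynomial.modByMonic_add_div P D
    have hW := hD.isWeierstrassDivisorAt'
    have hord : D.natDegree =
        (((D : PowerSeries (PowerSeries k))).map (Ideal.Quotient.mk
          (IsLocalRing.maximalIdeal (PowerSeries k)))).order.toNat :=
      (ENat.toNat_natCast _).symm.trans (congrArg ENat.toNat
        (hD.coe_natDegree_eq_order_map (D : PowerSeries (PowerSeries k)) 1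
          (by rw [map_one, ← Ideal.ne_top_iff_one]; exact Ideal.IsMaximal.ne_top inferInstance)
        (by simp)))
    have h2 := hW.eq_of_mul_add_eq_mul_add (q := ((P /ₘ D : Polynomial (PowerSeries k)) :
        PowerSeries (PowerSeries k))) (q' := h) (r := P %ₘ D) (r' := 0)
      (by rw [← hord, ← Polynomial.degree_eq_natDegree hDm.ne_zero]
          exact Polynomial.degree_modByMonic_lt _ hDm)
      (by simp)
      (by
        rw [Polynomial.coe_zero, add_zero, ← hDh, ← Polynomial.coe_mul, ← Polynomial.coe_add,
          add_comm, h1])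
    rw [h2.2, zero_add] at h1
    exact h1.symm
  have hqm : (P /ₘ D).Monic := hDm.of_mul_monic_left (hdiv ▸ hP)
  have hdeg : P.natDegree = D.natDegree + (P /ₘ D).natDegree := by
    conv_lhs => rw [hdiv]
    exact hDm.natDegree_mul hqm
  refine ⟨D, P /ₘ D, hDm, hqm, hdiv, ?_, ?_⟩
  · rcases Nat.eq_zero_or_pos (P /ₘ D).natDegree with hq | hq
    · exfalso
      have hq1 : P /ₘ D = 1 := Polynomial.eq_one_of_monic_natDegree_zero hqm hq
      rw [hq1, mul_one] at hdiv
      apply hX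
      ext i
      rw [Polynomial.coeff_map, Polynomial.coeff_X_pow]
      split_ifs with hi
      · rw [hi, hP.coeff_natDegree, map_one]
      · rcases lt_or_gt_of_ne hi with hl | hg
        · exact (hmem _).mp (by rw [hdiv]; exact hD.mem (hdiv ▸ hl))
        · rw [Polynomial.coeff_eq_zero_of_natDegree_lt hg, map_zero]
    · omega
  · rcases Nat.eq_zero_or_pos D.natDegree with hq | hq
    · exfalso
      have hq1 : D = 1 := Polynomial.eq_one_of_monic_natDegree_zero hDm hq
      rw [hq1, Polynomial.coe_one, one_mul] at hDh
      rw [← hDh, PowerSeries.isUnit_iff_constantCoeff, PowerSeries.isUnit_iff_constantCoeff] at hu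
      rw [← PowerSeries.coeff_zero_eq_constantCoeff_apply
        (P : PowerSeries (PowerSeries k)), Polynomial.coeff_coe, h0] at hu
      exact not_isUnit_zero hu
    · omega

/-- The substitution of the `N`-th power of the variable, as a ring homomorphism. -/
noncomputable def expandHom (k : Type*) [Field k] (N : ℕ) (hN : N ≠ 0) :
    PowerSeries k →+* PowerSeries k := (PowerSeries.expand N hN).toRingHom

theorem expandHom_apply {k : Type*} [Field k] {N : ℕ} (hN : N ≠ 0) (x : PowerSeries k) :
    expandHom k N hN x = PowerSeries.expand N hN x := rfl

/-- The polynomial splits over the power series ring after extracting a root of the variable. -/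
def PuiseuxSplits {k : Type*} [Field k] (P : Polynomial (PowerSeries k)) : Prop :=
  ∃ (N : ℕ) (hN : N ≠ 0),
    (P.map (expandHom k N hN)).Splits

theorem Polynomial.Splits.map_expand_mul {k : Type*} [Field k] {P : Polynomial (PowerSeries k)}
    {N : ℕ} {hN : N ≠ 0}
    (h : (P.map (expandHom k N hN)).Splits)
    {L : ℕ} (hL : L ≠ 0) :
    (P.map (expandHom k (L * N) (mul_ne_zero hL hN))).Splits := by
  have := h.map (expandHom k L hL)
  rw [Polynomial.map_map] at this
  convert this using 2
  ext1 x
  exact PowerSeries.expand_mul L hL N hN x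

theorem PuiseuxSplits.mul {k : Type*} [Field k] {P Q : Polynomial (PowerSeries k)}
    (hP : PuiseuxSplits P) (hQ : PuiseuxSplits Q) : PuiseuxSplits (P * Q) := by
  obtain ⟨N, hN, h1⟩ := hP
  obtain ⟨M, hM, h2⟩ := hQ
  refine ⟨M * N, mul_ne_zero hM hN, ?_⟩
  rw [Polynomial.map_mul]
  refine (Polynomial.Splits.map_expand_mul h1 hM).mul ?_
  have := Polynomial.Splits.map_expand_mul h2 hN
  simpa only [mul_comm M N] using this

theorem PuiseuxSplits.comp_X_add_C {k : Type*} [Field k] {P : Polynomial (PowerSeries k)}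
    (hP : PuiseuxSplits P) (a : PowerSeries k) :
    PuiseuxSplits (P.comp (Polynomial.X + Polynomial.C a)) := by
  obtain ⟨N, hN, h1⟩ := hP
  refine ⟨N, hN, ?_⟩
  rw [Polynomial.map_comp, Polynomial.map_add, Polynomial.map_X, Polynomial.map_C]
  exact h1.comp_X_add_C _

theorem PuiseuxSplits.of_expand {k : Type*} [Field k] {P : Polynomial (PowerSeries k)}
    {L : ℕ} {hL : L ≠ 0}
    (hP : PuiseuxSplits (P.map (expandHom k L hL))) :
    PuiseuxSplits P := by
  obtain ⟨N, hN, h1⟩ := hP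
  refine ⟨N * L, mul_ne_zero hN hL, ?_⟩
  rw [Polynomial.map_map] at h1
  convert h1 using 2
  ext1 x
  exact PowerSeries.expand_mul N hN L hL x

theorem PuiseuxSplits.scaleRoots {k : Type*} [Field k] {P : Polynomial (PowerSeries k)}
    (hm : P.Monic) (hP : PuiseuxSplits P) (a : PowerSeries k) :
    PuiseuxSplits (P.scaleRoots a) := by
  obtain ⟨N, hN, h1⟩ := hP
  refine ⟨N, hN, ?_⟩
  rw [Polynomial.map_scaleRoots _ _ _ (by rw [hm.leadingCoeff, map_one]; exact one_ne_zero)]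
  exact h1.scaleRoots _

theorem Polynomial.Monic.coeff_comp_X_add_C {R : Type*} [CommRing R] [Nontrivial R]
    {P : Polynomial R}
    (hP : P.Monic) {n : ℕ} (hn : P.natDegree = n + 1) (a : R) :
    (P.comp (Polynomial.X + Polynomial.C a)).coeff n = P.coeff n + (n + 1) * a := by
  have : P.comp (Polynomial.X + Polynomial.C a) = Polynomial.taylor a P := rfl
  rw [this, Polynomial.taylor_coeff]
  have hd : Polynomial.hasseDeriv n P =
      Polynomial.C (P.coeff n) + Polynomial.C ((n : R) + 1) * Polynomial.X := by
    ext i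
    rw [Polynomial.hasseDeriv_coeff]
    rcases i with _ | _ | i
    · simp
    · have : P.coeff (1 + n) = 1 := by rw [add_comm, ← hn]; exact hP.coeff_natDegree
      rw [add_comm] at this
      simp [this, add_comm 1 n]
    · rw [Polynomial.coeff_eq_zero_of_natDegree_lt (by omega)]
      simp [Polynomial.coeff_one]
  rw [hd]; simp

end NonSplit

namespace NonSplit

open PowerSeries in
/-- Normalization at the slope of the Newton polygon. -/
theorem exists_newton_scaling {k : Type*} [Field k] {P : Polynomial (PowerSeries k)}
    (hP : P.Monic) {n : ℕ} (hn : P.natDegree = n) (hX : P ≠ Polynomial.X ^ n) :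
    ∃ (L : ℕ) (hL : L ≠ 0) (e : ℕ) (Q : Polynomial (PowerSeries k)), Q.Monic ∧
      Q.natDegree = n ∧ Q.scaleRoots (X ^ e) = P.map (expandHom k L hL) ∧
      (∃ i < n, constantCoeff (Q.coeff i) ≠ 0) ∧
      ∀ i < n, P.coeff i = 0 → Q.coeff i = 0 := by
  classical
  set I := (Finset.range n).filter fun i => P.coeff i ≠ 0 with hI
  have hIne : I.Nonempty := by
    by_contra hcon
    rw [Finset.not_nonempty_iff_eq_empty] at hcon
    apply hX
    ext1 i
    rw [Polynomial.coeff_X_pow]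
    split_ifs with hi
    · rw [hi, ← hn, hP.coeff_natDegree]
    · rcases lt_or_gt_of_ne hi with hl | hg
      · by_contra hc
        have : i ∈ I := by simp [hI, hl, hc]
        rw [hcon] at this
        simp at this
      · exact Polynomial.coeff_eq_zero_of_natDegree_lt (by omega)
  obtain ⟨i0, hi0, hmin⟩ := Finset.exists_min_image I
    (fun i => ((P.coeff i).order.toNat : ℚ) / (n - i : ℕ)) hIne
  simp only [hI, Finset.mem_filter, Finset.mem_range] at hi0 hmin
  obtain ⟨hi0n, hi0c⟩ := hi0
  have hL : n - i0 ≠ 0 := by omega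
  set e := (P.coeff i0).order.toNat with he
  have hdvd : ∀ i, i < n → X ^ (e * (n - i)) ∣ expandHom k (n - i0) hL (P.coeff i) := by
    intro i hi
    by_cases hc : P.coeff i = 0
    · rw [hc, map_zero]; exact dvd_zero _
    have h1 := hmin i ⟨hi, hc⟩
    rw [div_le_div_iff₀ (by exact_mod_cast Nat.pos_of_ne_zero hL)
      (by exact_mod_cast (by omega : 0 < n - i))] at h1
    have h2 : e * (n - i) ≤ (P.coeff i).order.toNat * (n - i0) := by exact_mod_cast h1
    rw [X_pow_dvd_iff]
    intro m hm
    rw [expandHom_apply]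
    apply coeff_of_lt_order
    rw [order_expand, ← coe_toNat_order hc]
    rw [nsmul_eq_mul]
    exact_mod_cast lt_of_lt_of_le hm (h2.trans_eq (mul_comm _ _))
  choose! d hd using hdvd
  set Q : Polynomial (PowerSeries k) :=
    Polynomial.X ^ n + ∑ i ∈ Finset.range n, Polynomial.C (d i) * Polynomial.X ^ i with hQ
  have hdeg : (∑ i ∈ Finset.range n, Polynomial.C (d i) * Polynomial.X ^ i).degree < (n : WithBot ℕ) := by
    rw [Polynomial.degree_lt_iff_coeff_zero]
    intro m hm
    simp only [Polynomial.finsetSum_coeff, Polynomial.coeff_C_mul_X_pow]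
    apply sum_eq_zero
    intro i hi
    rw [if_neg]
    have := Finset.mem_range.mp hi
    omega
  have hQm : Q.Monic := Polynomial.monic_X_pow_add hdeg
  have hQd : Q.natDegree = n := by
    rw [hQ, Polynomial.natDegree_add_eq_left_of_degree_lt
      (by rw [Polynomial.degree_X_pow]; exact hdeg), Polynomial.natDegree_X_pow]
  have hQc : ∀ i < n, Q.coeff i = d i := by
    intro i hi
    simp only [hQ, Polynomial.coeff_add, Polynomial.coeff_X_pow, Polynomial.finsetSum_coeff,
      Polynomial.coeff_C_mul_X_pow, hi.ne, if_false, zero_add]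
    rw [sum_eq_single i]
    · simp
    · intro b _ hb; rw [if_neg (Ne.symm hb)]
    · intro h; simp [hi] at h
  refine ⟨n - i0, hL, e, Q, hQm, hQd, ?_, ⟨i0, hi0n, ?_⟩, ?_⟩
  · ext1 i
    rw [Polynomial.coeff_scaleRoots, Polynomial.coeff_map, hQd]
    rcases lt_trichotomy i n with hi | hi | hi
    · rw [hQc i hi, hd i hi, ← pow_mul, mul_comm]
    · have h1 : Q.coeff i = 1 := by rw [hi, ← hQd]; exact hQm.coeff_natDegree
      have h2 : P.coeff i = 1 := by rw [hi, ← hn]; exact hP.coeff_natDegree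
      rw [h1, h2, hi]; simp
    · rw [Polynomial.coeff_eq_zero_of_natDegree_lt (by omega),
        Polynomial.coeff_eq_zero_of_natDegree_lt (by omega)]; simp
  · rw [hQc i0 hi0n]
    have h1 := congrArg (coeff (e * (n - i0))) (hd i0 hi0n)
    rw [coeff_X_pow_mul', if_pos le_rfl, Nat.sub_self, coeff_zero_eq_constantCoeff_apply,
      expandHom_apply, mul_comm e, coeff_expand_mul] at h1
    rw [← h1]
    exact coeff_order hi0c
  · intro i hi hc
    rw [hQc i hi]
    have h1 := hd i hi
    rw [hc, map_zero] at h1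
    exact (mul_eq_zero.mp h1.symm).resolve_left (pow_ne_zero _ X_ne_zero)

open PowerSeries in
/-- Newton-Puiseux: every monic polynomial over `k⟦X⟧` splits after extracting a root of `X`. -/
theorem puiseuxSplits_of_monic {k : Type*} [Field k] [IsAlgClosed k] [CharZero k] (n : ℕ) :
    ∀ P : Polynomial (PowerSeries k), P.Monic → P.natDegree = n → PuiseuxSplits P := by
  induction n using Nat.strong_induction_on with
  | _ n ih =>
  intro P hP hn
  rcases n with _ | n
  · exact ⟨1, one_ne_zero, Polynomial.Splits.of_natDegree_le_one_of_monic
      ((Polynomial.natDegree_map_le).trans (by omega)) (hP.map _)⟩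
  suffices H : ∀ P : Polynomial (PowerSeries k), P.Monic → P.natDegree = n + 1 →
      P.coeff n = 0 → PuiseuxSplits P by
    set a : PowerSeries k := C (-((n + 1 : k))⁻¹) * P.coeff n with ha
    have hn0 : ((n : k) + 1) ≠ 0 := by exact_mod_cast (Nat.succ_ne_zero n)
    have h1 := H (P.comp (Polynomial.X + Polynomial.C a)) (hP.comp_X_add_C a)
      (by rw [Polynomial.natDegree_comp, Polynomial.natDegree_X_add_C, mul_one, hn])
      (by
        rw [Polynomial.Monic.coeff_comp_X_add_C hP hn, ha]
        have : ((n : PowerSeries k) + 1) = C ((n : k) + 1) := by simp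
        rw [this, ← mul_assoc, ← map_mul]
        field_simp
        simp)
    have h2 := h1.comp_X_add_C (-a)
    rwa [Polynomial.comp_assoc, Polynomial.add_comp, Polynomial.X_comp, Polynomial.C_comp,
      add_assoc, ← Polynomial.C_add, neg_add_cancel, Polynomial.C_0, add_zero,
      Polynomial.comp_X] at h2
  clear hP hn P
  intro P hP hn hc
  by_cases hX : P = Polynomial.X ^ (n + 1)
  · refine ⟨1, one_ne_zero, ?_⟩
    rw [hX, Polynomial.map_pow, Polynomial.map_X]
    exact Polynomial.Splits.X_pow _
  obtain ⟨L, hL, e, Q, hQ, hQd, hQP, ⟨i0, hi0, hQi⟩, hQz⟩ := exists_newton_scaling hP hn hX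
  refine PuiseuxSplits.of_expand (hL := hL) ?_
  rw [← hQP]
  refine PuiseuxSplits.scaleRoots hQ ?_ _
  have hm0 : (Q.map (constantCoeff (R := k))).Monic := hQ.map _
  have hd0 : (Q.map (constantCoeff (R := k))).natDegree = n + 1 := by
    rw [hQ.natDegree_map, hQd]
  obtain ⟨a, ha⟩ := IsAlgClosed.exists_root (Q.map (constantCoeff (R := k)))
    (by rw [Polynomial.degree_eq_natDegree hm0.ne_zero, hd0]; exact_mod_cast Nat.succ_ne_zero n)
  suffices h : PuiseuxSplits (Q.comp (Polynomial.X + Polynomial.C (C a))) by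
    have h2 := h.comp_X_add_C (-(C a))
    rwa [Polynomial.comp_assoc, Polynomial.add_comp, Polynomial.X_comp, Polynomial.C_comp,
      add_assoc, ← Polynomial.C_add, neg_add_cancel, Polynomial.C_0, add_zero,
      Polynomial.comp_X] at h2
  set R := Q.comp (Polynomial.X + Polynomial.C (C a)) with hR
  have hRm : R.Monic := hQ.comp_X_add_C _
  have hRd : R.natDegree = n + 1 := by
    rw [hR, Polynomial.natDegree_comp, Polynomial.natDegree_X_add_C, mul_one, hQd]
  have hR0 : R.map (constantCoeff (R := k)) =
      (Q.map (constantCoeff (R := k))).comp (Polynomial.X + Polynomial.C a) := by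
    rw [hR, Polynomial.map_comp]; simp
  obtain ⟨D, q, hD, hq, hDq, hd1, hd2⟩ := hensel_split hRm
    (by
      rw [← Polynomial.coeff_map, hR0, Polynomial.coeff_zero_eq_eval_zero, Polynomial.eval_comp]
      simpa using ha)
    (by
      intro hcon
      rw [hR0, hRd] at hcon
      have h1 := congrArg (Polynomial.coeff · n) hcon
      simp only [Polynomial.coeff_X_pow] at h1
      rw [Polynomial.Monic.coeff_comp_X_add_C hm0 hd0, Polynomial.coeff_map,
        hQz n (by omega) hc, map_zero, zero_add, if_neg (by omega)] at h1
      have ha0 : a = 0 := (mul_eq_zero.mp h1).resolve_left (by exact_mod_cast Nat.succ_ne_zero n)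
      rw [ha0, Polynomial.C_0, add_zero, Polynomial.comp_X] at hcon
      have h2 := congrArg (Polynomial.coeff · i0) hcon
      simp only [Polynomial.coeff_X_pow, Polynomial.coeff_map] at h2
      rw [if_neg (by omega)] at h2
      exact hQi h2)
  rw [hDq]
  exact (ih _ (by omega) D hD rfl).mul (ih _ (by omega) q hq rfl)

theorem exists_puiseux_multiset {k : Type*} [Field k] [IsAlgClosed k] [CharZero k]
    {ι : Type*} [Fintype ι] (P : ι → Polynomial (PowerSeries k)) (hP : ∀ i, (P i).Monic) :
    ∃ (N : ℕ) (hN : N ≠ 0), ∀ i, ∃ S : Multiset (PowerSeries k),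
      (P i).map (expandHom k N hN) = (S.map fun r => Polynomial.X - Polynomial.C r).prod := by
  classical
  choose N hN h using fun i => puiseuxSplits_of_monic _ (P i) (hP i) rfl
  refine ⟨∏ i, N i, Finset.prod_ne_zero_iff.mpr fun i _ => hN i, fun i => ?_⟩
  have h1 := Polynomial.Splits.map_expand_mul (h i)
    (L := ∏ j ∈ Finset.univ.erase i, N j) (Finset.prod_ne_zero_iff.mpr fun i _ => hN i)
  simp only [Finset.prod_erase_mul Finset.univ N (mem_univ i)] at h1
  exact ⟨_, h1.eq_prod_roots_of_monic ((hP i).map _)⟩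

end NonSplit

namespace NonSplit

open MvPowerSeries
open scoped ENNReal NNReal

section Weighted

variable {σ : Type*}

/-- The value of the monomial with exponent `β` at `z`. -/
noncomputable def mono {R : Type*} [CommMonoid R] (z : σ → R) (β : σ →₀ ℕ) : R :=
  β.prod fun i n => z i ^ n

theorem mono_zero {R : Type*} [CommMonoid R] (z : σ → R) : mono z 0 = 1 := by simp [mono]

theorem mono_add {R : Type*} [CommMonoid R] (z : σ → R) (β γ : σ →₀ ℕ) :
    mono z (β + γ) = mono z β * mono z γ := by
  classical
  exact Finsupp.prod_add_index' (fun _ => pow_zero _) (fun _ _ _ => pow_add _ _ _)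

theorem mono_single {R : Type*} [CommMonoid R] (z : σ → R) (i : σ) (n : ℕ) :
    mono z (single i n) = z i ^ n :=
  Finsupp.prod_single_index (pow_zero _)

theorem mono_pos {r : σ → ℝ≥0} (hr : ∀ i, 0 < r i) (β : σ →₀ ℕ) : 0 < mono r β :=
  Finset.prod_pos fun i _ => pow_pos (hr i) _

theorem norm_mono_le {r : σ → ℝ≥0} {z : σ → ℂ} (hz : ∀ i, ‖z i‖₊ ≤ r i) (β : σ →₀ ℕ) :
    ‖mono z β‖₊ ≤ mono r β := by
  rw [mono, mono, Finsupp.prod, Finsupp.prod, nnnorm_prod]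
  exact Finset.prod_le_prod (fun _ _ => zero_le) fun i _ => by
    rw [nnnorm_pow]; exact pow_le_pow_left' (hz i) _

/-- The weighted `ℓ¹` norm of a formal power series. -/
noncomputable def nrm (r : σ → ℝ≥0) (g : MvPowerSeries σ ℂ) : ℝ≥0∞ :=
  ∑' β : σ →₀ ℕ, ‖coeff β g‖ₑ * ((mono r β : ℝ≥0) : ℝ≥0∞)

variable {r : σ → ℝ≥0}

theorem nrm_zero : nrm r 0 = 0 := by simp [nrm]

theorem nrm_neg (g : MvPowerSeries σ ℂ) : nrm r (-g) = nrm r g := by simp [nrm]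

theorem nrm_add_le (f g : MvPowerSeries σ ℂ) : nrm r (f + g) ≤ nrm r f + nrm r g := by
  rw [nrm, nrm, nrm, ← ENNReal.tsum_add]
  refine ENNReal.tsum_le_tsum fun β => ?_
  rw [← add_mul, map_add]
  gcongr
  exact enorm_add_le _ _

theorem nrm_sub_le (f g : MvPowerSeries σ ℂ) : nrm r (f - g) ≤ nrm r f + nrm r g := by
  rw [sub_eq_add_neg, ← nrm_neg g]; exact nrm_add_le _ _

theorem nrm_sum_le {ι : Type*} (s : Finset ι) (f : ι → MvPowerSeries σ ℂ) :
    nrm r (∑ i ∈ s, f i) ≤ ∑ i ∈ s, nrm r (f i) := by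
  classical
  induction s using Finset.induction_on with
  | empty => simp [nrm_zero]
  | insert a s ha ih =>
    rw [sum_insert ha, sum_insert ha]
    exact (nrm_add_le _ _).trans (by gcongr)

theorem nrm_monomial (β : σ →₀ ℕ) (a : ℂ) : nrm r (monomial β a) = ‖a‖ₑ * ((mono r β : ℝ≥0) : ℝ≥0∞) := by
  classical
  rw [nrm, tsum_eq_single β]
  · rw [coeff_monomial_same]
  · intro γ hγ
    rw [coeff_monomial, if_neg hγ]; simp

theorem nrm_C (a : ℂ) : nrm r (C a) = ‖a‖ₑ := by
  rw [← monomial_zero_eq_C_apply, nrm_monomial, mono_zero]; simp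

theorem nrm_X (i : σ) : nrm r (X i) = r i := by
  rw [X, nrm_monomial, mono_single]; simp

theorem enorm_coeff_mul_le_nrm (g : MvPowerSeries σ ℂ) (β : σ →₀ ℕ) :
    ‖coeff β g‖ₑ * ((mono r β : ℝ≥0) : ℝ≥0∞) ≤ nrm r g :=
  ENNReal.le_tsum (f := fun β : σ →₀ ℕ => ‖coeff β g‖ₑ * ((mono r β : ℝ≥0) : ℝ≥0∞)) β

theorem eq_zero_of_nrm_eq_zero (hr : ∀ i, 0 < r i) {g : MvPowerSeries σ ℂ} (h : nrm r g = 0) :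
    g = 0 := by
  ext β
  have h1 := (ENNReal.tsum_eq_zero.mp h) β
  rcases mul_eq_zero.mp h1 with h2 | h2
  · simpa using h2
  · exact absurd (by exact_mod_cast h2) (mono_pos hr β).ne'

theorem nrm_mul_le (f g : MvPowerSeries σ ℂ) : nrm r (f * g) ≤ nrm r f * nrm r g := by
  classical
  calc nrm r (f * g)
      ≤ ∑' β : σ →₀ ℕ, ∑ p ∈ Finset.HasAntidiagonal.antidiagonal β,
        (‖coeff p.1 f‖ₑ * ((mono r p.1 : ℝ≥0) : ℝ≥0∞)) * (‖coeff p.2 g‖ₑ * ((mono r p.2 : ℝ≥0) : ℝ≥0∞)) := by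
        refine ENNReal.tsum_le_tsum fun β => ?_
        rw [coeff_mul]
        calc _ ≤ (∑ p ∈ Finset.HasAntidiagonal.antidiagonal β, ‖coeff p.1 f * coeff p.2 g‖ₑ) *
              ((mono r β : ℝ≥0) : ℝ≥0∞) := by gcongr; exact enorm_sum_le _ _
          _ = _ := by
            rw [sum_mul]
            refine sum_congr rfl fun p hp => ?_
            rw [← Finset.HasAntidiagonal.mem_antidiagonal.mp hp, mono_add, enorm_mul]
            push_cast; ring
    _ = ∑' x : Σ β : σ →₀ ℕ, Finset.HasAntidiagonal.antidiagonal β,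
        (‖coeff x.2.1.1 f‖ₑ * ((mono r x.2.1.1 : ℝ≥0) : ℝ≥0∞)) *
          (‖coeff x.2.1.2 g‖ₑ * ((mono r x.2.1.2 : ℝ≥0) : ℝ≥0∞)) := by
        rw [ENNReal.tsum_sigma']
        refine tsum_congr fun β => ?_
        rw [tsum_fintype]
        exact (Finset.sum_coe_sort (Finset.HasAntidiagonal.antidiagonal β) (fun p : (σ →₀ ℕ) × (σ →₀ ℕ) =>
          (‖coeff p.1 f‖ₑ * ((mono r p.1 : ℝ≥0) : ℝ≥0∞)) * (‖coeff p.2 g‖ₑ * ((mono r p.2 : ℝ≥0) : ℝ≥0∞)))).symm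
    _ = ∑' p : (σ →₀ ℕ) × (σ →₀ ℕ),
        (‖coeff p.1 f‖ₑ * ((mono r p.1 : ℝ≥0) : ℝ≥0∞)) * (‖coeff p.2 g‖ₑ * ((mono r p.2 : ℝ≥0) : ℝ≥0∞)) :=
        Finset.HasAntidiagonal.sigmaAntidiagonalEquivProd.tsum_eq
          (fun p : (σ →₀ ℕ) × (σ →₀ ℕ) =>
          (‖coeff p.1 f‖ₑ * ((mono r p.1 : ℝ≥0) : ℝ≥0∞)) * (‖coeff p.2 g‖ₑ * ((mono r p.2 : ℝ≥0) : ℝ≥0∞)))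
    _ = nrm r f * nrm r g := by
        rw [ENNReal.tsum_prod', nrm, nrm, ← ENNReal.tsum_mul_right]
        refine tsum_congr fun a => ?_
        change ∑' b : σ →₀ ℕ, ‖coeff a f‖ₑ * ((mono r a : ℝ≥0) : ℝ≥0∞) *
          (‖coeff b g‖ₑ * ((mono r b : ℝ≥0) : ℝ≥0∞)) = _
        rw [ENNReal.tsum_mul_left]

variable (r) in
/-- The algebra of power series of finite weighted norm. -/
noncomputable def conv : Subalgebra ℂ (MvPowerSeries σ ℂ) where
  carrier := {g | nrm r g < ⊤}
  mul_mem' := fun {a b} ha hb => (nrm_mul_le a b).trans_lt (mul_lt_top ha hb)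
  add_mem' := fun {a b} ha hb => (nrm_add_le a b).trans_lt (ENNReal.add_lt_top.mpr ⟨ha, hb⟩)
  algebraMap_mem' := fun a => by
    change nrm r (algebraMap ℂ (MvPowerSeries σ ℂ) a) < ⊤
    rw [MvPowerSeries.algebraMap_apply]
    exact (nrm_C (r := r) (a : ℂ)).trans_lt enorm_lt_top

theorem mem_conv {g : MvPowerSeries σ ℂ} : g ∈ conv r ↔ nrm r g < ⊤ := Iff.rfl

theorem monomial_mem_conv (β : σ →₀ ℕ) (a : ℂ) : monomial β a ∈ conv r := by
  rw [mem_conv, nrm_monomial]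
  exact mul_lt_top enorm_lt_top coe_lt_top

theorem X_mem_conv (i : σ) : (X i : MvPowerSeries σ ℂ) ∈ conv r := monomial_mem_conv _ _

theorem C_mem_conv (a : ℂ) : (C a : MvPowerSeries σ ℂ) ∈ conv r := by
  rw [← monomial_zero_eq_C_apply]; exact monomial_mem_conv _ _

/-- Evaluation of a power series at a point. -/
noncomputable def ev (z : σ → ℂ) (g : MvPowerSeries σ ℂ) : ℂ :=
  ∑' β : σ →₀ ℕ, coeff β g * mono z β

theorem summable_ev {z : σ → ℂ} (hz : ∀ i, ‖z i‖₊ ≤ r i) {g : MvPowerSeries σ ℂ}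
    (hg : g ∈ conv r) : Summable fun β : σ →₀ ℕ => ‖coeff β g * mono z β‖ := by
  have h1 : Summable fun β : σ →₀ ℕ => ‖coeff β g‖₊ * mono r β := by
    rw [← ENNReal.tsum_coe_ne_top_iff_summable]
    refine ne_of_lt (lt_of_le_of_lt (le_of_eq ?_) hg)
    refine tsum_congr fun β => ?_
    push_cast; rfl
  have h2 : Summable fun β : σ →₀ ℕ => ‖coeff β g * mono z β‖₊ := by
    refine NNReal.summable_of_le (fun β => ?_) h1
    rw [nnnorm_mul]
    gcongr
    exact norm_mono_le hz β
  have h3 := NNReal.summable_coe.mpr h2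
  simpa only [coe_nnnorm] using h3

theorem ev_monomial (z : σ → ℂ) (β : σ →₀ ℕ) (a : ℂ) : ev z (monomial β a) = a * mono z β := by
  classical
  rw [ev, tsum_eq_single β]
  · rw [coeff_monomial_same]
  · intro γ hγ
    rw [coeff_monomial, if_neg hγ, zero_mul]

theorem ev_add {z : σ → ℂ} (hz : ∀ i, ‖z i‖₊ ≤ r i) {f g : MvPowerSeries σ ℂ}
    (hf : f ∈ conv r) (hg : g ∈ conv r) : ev z (f + g) = ev z f + ev z g := by
  rw [ev, ev, ev, ← (summable_ev hz hf).of_norm.tsum_add (summable_ev hz hg).of_norm]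
  refine tsum_congr fun β => ?_
  rw [map_add, add_mul]

theorem ev_mul {z : σ → ℂ} (hz : ∀ i, ‖z i‖₊ ≤ r i) {f g : MvPowerSeries σ ℂ}
    (hf : f ∈ conv r) (hg : g ∈ conv r) : ev z (f * g) = ev z f * ev z g := by
  classical
  have h0 : Summable fun x : (σ →₀ ℕ) × (σ →₀ ℕ) =>
      (coeff x.1 f * mono z x.1) * (coeff x.2 g * mono z x.2) :=
    summable_mul_of_summable_norm (f := fun β : σ →₀ ℕ => coeff β f * mono z β)
      (g := fun β : σ →₀ ℕ => coeff β g * mono z β) (summable_ev hz hf) (summable_ev hz hg)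
  have h := Summable.tsum_mul_tsum_eq_tsum_sum_antidiagonal
    (f := fun β : σ →₀ ℕ => coeff β f * mono z β) (g := fun β : σ →₀ ℕ => coeff β g * mono z β)
    (summable_ev hz hf).of_norm (summable_ev hz hg).of_norm h0
  rw [ev, ev, ev, h]
  refine tsum_congr fun β => ?_
  rw [coeff_mul, sum_mul]
  refine sum_congr rfl fun p hp => ?_
  rw [← Finset.HasAntidiagonal.mem_antidiagonal.mp hp, mono_add]
  ring

/-- Evaluation as an algebra homomorphism. -/
noncomputable def evHom (z : σ → ℂ) (hz : ∀ i, ‖z i‖₊ ≤ r i) : conv r →ₐ[ℂ] ℂ where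
  toFun g := ev z (g : MvPowerSeries σ ℂ)
  map_one' := by
    change ev z (1 : MvPowerSeries σ ℂ) = 1
    rw [← map_one (C (σ := σ) (R := ℂ)), ← monomial_zero_eq_C_apply, ev_monomial, mono_zero, mul_one]
  map_zero' := by
    change ev z (0 : MvPowerSeries σ ℂ) = 0
    simp [ev]
  map_mul' f g := ev_mul hz f.2 g.2
  map_add' f g := ev_add hz f.2 g.2
  commutes' a := by
    change ev z (algebraMap ℂ (MvPowerSeries σ ℂ) a) = a
    rw [MvPowerSeries.algebraMap_apply]
    change ev z (C (a : ℂ)) = a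
    rw [← monomial_zero_eq_C_apply, ev_monomial, mono_zero, mul_one]

theorem evHom_apply (z : σ → ℂ) (hz : ∀ i, ‖z i‖₊ ≤ r i) (g : conv r) :
    evHom z hz g = ev z (g : MvPowerSeries σ ℂ) := rfl

theorem enorm_ev_le {z : σ → ℂ} (hz : ∀ i, ‖z i‖₊ ≤ r i) (g : MvPowerSeries σ ℂ) : ‖ev z g‖ₑ ≤ nrm r g := by
  have h := enorm_tsum_le_tsum_enorm (f := fun β : σ →₀ ℕ => coeff β g * mono z β)
  refine h.trans (ENNReal.tsum_le_tsum fun β => ?_)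
  rw [enorm_mul]
  gcongr
  exact ENNReal.coe_le_coe.mpr (norm_mono_le hz β)

end Weighted

section Complete

variable {σ : Type*} {r : σ → ℝ≥0}

/-- The power series with given coefficients. -/
def ofCoeff (f : (σ →₀ ℕ) → ℂ) : MvPowerSeries σ ℂ := f

theorem coeff_ofCoeff (f : (σ →₀ ℕ) → ℂ) (β : σ →₀ ℕ) : coeff β (ofCoeff f) = f β := rfl

theorem nrm_sub_comm (f g : MvPowerSeries σ ℂ) : nrm r (f - g) = nrm r (g - f) := by
  rw [← nrm_neg, neg_sub]

theorem nrm_transfer {τ : Type*} {r' : τ → ℝ≥0} {f : (σ →₀ ℕ) → (τ →₀ ℕ)}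
    (hf : Injective f) {g : MvPowerSeries σ ℂ} {h : MvPowerSeries τ ℂ}
    (hgh : ∀ β, coeff (f β) h = coeff β g) (hh : ∀ γ, γ ∉ Set.range f → coeff γ h = 0)
    (hr : ∀ β, mono r' (f β) = mono r β) : nrm r' h = nrm r g := by
  rw [nrm, nrm, ← hf.tsum_eq]
  · exact tsum_congr fun β => by rw [hgh, hr]
  · intro γ hγ
    by_contra hc
    exact hγ (by simp [hh γ hc])

theorem ev_transfer {τ : Type*} {z : σ → ℂ} {z' : τ → ℂ} {f : (σ →₀ ℕ) → (τ →₀ ℕ)}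
    (hf : Injective f) {g : MvPowerSeries σ ℂ} {h : MvPowerSeries τ ℂ}
    (hgh : ∀ β, coeff (f β) h = coeff β g) (hh : ∀ γ, γ ∉ Set.range f → coeff γ h = 0)
    (hr : ∀ β, mono z' (f β) = mono z β) : ev z' h = ev z g := by
  rw [ev, ev, ← hf.tsum_eq]
  · exact tsum_congr fun β => by rw [hgh, hr]
  · intro γ hγ
    by_contra hc
    exact hγ (by simp [hh γ hc])

theorem nrm_monomial_mul (β : σ →₀ ℕ) (g : MvPowerSeries σ ℂ) :
    nrm r (monomial β 1 * g) = ((mono r β : ℝ≥0) : ℝ≥0∞) * nrm r g := by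
  classical
  rw [nrm, nrm, ← (add_right_injective β).tsum_eq, ← ENNReal.tsum_mul_left]
  · refine tsum_congr fun γ => ?_
    rw [coeff_add_monomial_mul, one_mul, mono_add]
    push_cast; ring
  · intro γ hγ
    by_contra hc
    apply hγ
    have h1 : ¬ β ≤ γ := fun hle => hc ⟨γ - β, add_tsub_cancel_of_le hle⟩
    simp [coeff_monomial_mul, h1]

theorem nrm_mono_weight {r' : σ → ℝ≥0} (h : ∀ i, r' i ≤ r i) (g : MvPowerSeries σ ℂ) :
    nrm r' g ≤ nrm r g := by
  refine ENNReal.tsum_le_tsum fun β => ?_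
  gcongr
  exact Finset.prod_le_prod (fun _ _ => zero_le) fun i _ => pow_le_pow_left' (h i) _

theorem nrm_C_mul (a : ℂ) (g : MvPowerSeries σ ℂ) : nrm r (C a * g) = ‖a‖ₑ * nrm r g := by
  rw [nrm, nrm, ← ENNReal.tsum_mul_left]
  refine tsum_congr fun β => ?_
  rw [coeff_C_mul, enorm_mul, mul_assoc]

/-- A normally convergent series of power series has a sum. -/
theorem exists_sum_of_nrm (hr : ∀ i, 0 < r i) (u : ℕ → MvPowerSeries σ ℂ)
    (hu : ∑' n, nrm r (u n) < ⊤) :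
    ∃ H : MvPowerSeries σ ℂ, ∀ K : ℕ,
      nrm r (H - ∑ n ∈ Finset.range K, u n) ≤ ∑' n, nrm r (u (n + K)) := by
  have hs : ∀ β : σ →₀ ℕ, Summable fun n => ‖coeff β (u n)‖ := by
    intro β
    have h1 : ∑' n, ‖coeff β (u n)‖ₑ * ((mono r β : ℝ≥0) : ℝ≥0∞) < ⊤ :=
      (ENNReal.tsum_le_tsum fun n => enorm_coeff_mul_le_nrm (u n) β).trans_lt hu
    rw [ENNReal.tsum_mul_right] at h1
    have h2 : ∑' n, ‖coeff β (u n)‖ₑ ≠ ⊤ := by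
      intro h
      rw [h, ENNReal.top_mul (by exact_mod_cast (mono_pos hr β).ne')] at h1
      exact lt_irrefl _ h1
    have h3 : Summable fun n => ‖coeff β (u n)‖₊ := ENNReal.tsum_coe_ne_top_iff_summable.mp h2
    simpa only [coe_nnnorm] using NNReal.summable_coe.mpr h3
  refine ⟨ofCoeff fun β => ∑' n, coeff β (u n), fun K => ?_⟩
  have hc : ∀ β : σ →₀ ℕ, coeff β (ofCoeff (fun β => ∑' n, coeff β (u n)) -
      ∑ n ∈ Finset.range K, u n) = ∑' n, coeff β (u (n + K)) := by
    intro β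
    rw [map_sub, map_sum]
    have h := (hs β).of_norm.sum_add_tsum_nat_add K
    rw [coeff_ofCoeff, ← h, add_sub_cancel_left]
  calc nrm r _ = ∑' β : σ →₀ ℕ, ‖∑' n, coeff β (u (n + K))‖ₑ * ((mono r β : ℝ≥0) : ℝ≥0∞) :=
        tsum_congr fun β => by rw [hc β]
    _ ≤ ∑' β : σ →₀ ℕ, ∑' n, ‖coeff β (u (n + K))‖ₑ * ((mono r β : ℝ≥0) : ℝ≥0∞) := by
        refine ENNReal.tsum_le_tsum fun β => ?_
        rw [ENNReal.tsum_mul_right]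
        gcongr
        exact enorm_tsum_le_tsum_enorm
    _ = ∑' n, nrm r (u (n + K)) := ENNReal.tsum_comm

theorem exists_neumann (hr : ∀ i, 0 < r i) (E : MvPowerSeries σ ℂ →+ MvPowerSeries σ ℂ)
    {q : ℝ≥0} (hq : q < 1) (hE : ∀ g, nrm r (E g) ≤ q * nrm r g) {g : MvPowerSeries σ ℂ}
    (hg : g ∈ conv r) : ∃ H ∈ conv r, H - E H = g := by
  have hb : ∀ n, nrm r (E^[n] g) ≤ (q : ℝ≥0∞) ^ n * nrm r g := by
    intro n
    induction n with
    | zero => simp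
    | succ n ih =>
      rw [iterate_succ_apply', pow_succ']
      refine (hE _).trans ?_
      rw [mul_assoc]
      gcongr
  have hq1 : (q : ℝ≥0∞) < 1 := by exact_mod_cast hq
  have hgs : ∑' n, (q : ℝ≥0∞) ^ n ≠ ⊤ := by
    rw [ENNReal.tsum_geometric]
    exact ENNReal.inv_ne_top.mpr (tsub_pos_of_lt hq1).ne'
  have hsum : ∑' n, nrm r (E^[n] g) < ⊤ := by
    refine (ENNReal.tsum_le_tsum hb).trans_lt ?_
    rw [ENNReal.tsum_mul_right]
    exact mul_lt_top hgs.lt_top hg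
  obtain ⟨H, hH⟩ := exists_sum_of_nrm hr (fun n => E^[n] g) hsum
  have hHc : H ∈ conv r := by
    have := hH 0
    simp only [Finset.range_zero, Finset.sum_empty, sub_zero, add_zero] at this
    exact this.trans_lt hsum
  refine ⟨H, hHc, ?_⟩
  rw [← sub_eq_zero]
  apply eq_zero_of_nrm_eq_zero hr
  have ht : Filter.Tendsto (fun K => ∑' n, nrm r (E^[n + K] g)) Filter.atTop (nhds 0) :=
    ENNReal.tendsto_sum_nat_add _ hsum.ne
  have hS : ∀ K, (∑ n ∈ Finset.range K, E^[n] g) - E (∑ n ∈ Finset.range K, E^[n] g) =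
      g - E^[K] g := by
    intro K
    rw [map_sum, ← sum_sub_distrib]
    have h := Finset.sum_range_sub' (fun n => E^[n] g) K
    simp only [iterate_succ_apply', Function.iterate_zero, id] at h
    exact h
  have hbound : ∀ K, nrm r (H - E H - g) ≤ 3 * ∑' n, nrm r (E^[n + K] g) := by
    intro K
    set S := ∑ n ∈ Finset.range K, E^[n] g with hSdef
    have e1 : H - E H - g = ((H - S) - E (H - S)) - E^[K] g := by
      have h2 : S - E S = g - E^[K] g := hS K
      rw [map_sub]
      linear_combination h2
    rw [e1]
    have h1 : nrm r (E^[K] g) ≤ ∑' n, nrm r (E^[n + K] g) := by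
      have := ENNReal.le_tsum (f := fun n => nrm r (E^[n + K] g)) 0
      simpa using this
    have h2 : nrm r (E (H - S)) ≤ ∑' n, nrm r (E^[n + K] g) := by
      refine (hE _).trans (le_trans ?_ (hH K))
      exact mul_le_of_le_one_left' hq1.le
    calc _ ≤ nrm r (H - S) + nrm r (E (H - S)) + nrm r (E^[K] g) :=
          (nrm_sub_le _ _).trans (by gcongr; exact nrm_sub_le _ _)
      _ ≤ _ := by
          have := add_le_add (add_le_add (hH K) h2) h1
          refine this.trans (le_of_eq ?_)
          ring
  have h3 : Filter.Tendsto (fun K => 3 * ∑' n, nrm r (E^[n + K] g)) Filter.atTop (nhds (3 * 0)) :=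
    ENNReal.Tendsto.const_mul ht (Or.inr (by simp))
  rw [mul_zero] at h3
  exact le_antisymm (ge_of_tendsto' h3 hbound) zero_le

end Complete

section Characters

variable {σ : Type*} {r : σ → ℝ≥0}

theorem enorm_character_le (hr : ∀ i, 0 < r i) (χ : conv r →ₐ[ℂ] ℂ) (g : conv r) :
    ‖χ g‖ₑ ≤ nrm r (g : MvPowerSeries σ ℂ) := by
  by_contra! hlt
  have ha : χ g ≠ 0 := by
    intro h
    rw [h, enorm_zero] at hlt
    exact not_lt_zero hlt
  have hnr : nrm r (C (χ g)⁻¹ * (g : MvPowerSeries σ ℂ)) < 1 := by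
    rw [nrm_C_mul, enorm_inv ha, mul_comm, ← div_eq_mul_inv]
    exact ENNReal.div_lt_of_lt_mul (by simpa using hlt)
  obtain ⟨q, hq⟩ : ∃ q : ℝ≥0, (q : ℝ≥0∞) = nrm r (C (χ g)⁻¹ * (g : MvPowerSeries σ ℂ)) :=
    ⟨_, ENNReal.coe_toNNReal hnr.ne_top⟩
  have hq1 : q < 1 := by rw [← hq] at hnr; exact_mod_cast hnr
  obtain ⟨H, hHc, hH⟩ := exists_neumann hr
    (AddMonoidHom.mulLeft (C (χ g)⁻¹ * (g : MvPowerSeries σ ℂ))) hq1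
    (fun h => by rw [hq]; exact nrm_mul_le _ _) (one_mem (conv r))
  have h1 : (⟨H, hHc⟩ : conv r) - algebraMap ℂ (conv r) (χ g)⁻¹ * g * ⟨H, hHc⟩ = 1 := by
    apply Subtype.ext
    change H - algebraMap ℂ (MvPowerSeries σ ℂ) (χ g)⁻¹ * (g : MvPowerSeries σ ℂ) * H = 1
    rw [MvPowerSeries.algebraMap_apply]
    exact hH
  have h2 := congrArg χ h1
  rw [map_sub, map_mul, map_mul, AlgHom.commutes, map_one, Algebra.algebraMap_self_apply,
    inv_mul_cancel₀ ha, one_mul, sub_self] at h2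
  exact zero_ne_one h2

theorem tendsto_nrm_sub_truncation {g : MvPowerSeries σ ℂ} (hg : g ∈ conv r) :
    Filter.Tendsto (fun s : Finset (σ →₀ ℕ) => nrm r (g - ∑ β ∈ s, monomial β (coeff β g)))
      Filter.atTop (nhds 0) := by
  classical
  have h := ENNReal.tendsto_tsum_compl_atTop_zero (ne_of_lt hg)
  refine h.congr fun s => ?_
  refine (tsum_subtype {x | x ∉ s}
    (fun β : σ →₀ ℕ => ‖coeff β g‖ₑ * ((mono r β : ℝ≥0) : ℝ≥0∞))).trans ?_
  refine tsum_congr fun β => ?_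
  rw [map_sub, map_sum]
  simp only [coeff_monomial, Finset.sum_ite_eq]
  by_cases hβ : β ∈ s <;> simp [hβ]

theorem coe_aeval_monomial (β : σ →₀ ℕ) (a : ℂ) :
    ((MvPolynomial.aeval (fun i => (⟨X i, X_mem_conv i⟩ : conv r)) (MvPolynomial.monomial β a) :
      conv r) : MvPowerSeries σ ℂ) = monomial β a := by
  have h : ((conv r).val.comp (MvPolynomial.aeval (fun i => (⟨X i, X_mem_conv i⟩ : conv r)))) =
      MvPolynomial.coeToMvPowerSeries.algHom ℂ := by
    apply MvPolynomial.algHom_ext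
    intro i
    simp [MvPolynomial.coeToMvPowerSeries.algHom_apply]
  have h2 := AlgHom.congr_fun h (MvPolynomial.monomial β a)
  simpa [MvPolynomial.coeToMvPowerSeries.algHom_apply] using h2

theorem character_eq_ev (hr : ∀ i, 0 < r i) (χ : conv r →ₐ[ℂ] ℂ) :
    ∃ z : σ → ℂ, ∃ hz : ∀ i, ‖z i‖₊ ≤ r i, χ = evHom z hz := by
  set z : σ → ℂ := fun i => χ ⟨X i, X_mem_conv i⟩ with hzdef
  have hz : ∀ i, ‖z i‖₊ ≤ r i := by
    intro i
    have h := enorm_character_le hr χ ⟨X i, X_mem_conv i⟩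
    rw [nrm_X] at h
    exact ENNReal.coe_le_coe.mp h
  refine ⟨z, hz, AlgHom.ext fun g => ?_⟩
  have hpoly : χ.comp (MvPolynomial.aeval (fun i => (⟨X i, X_mem_conv i⟩ : conv r))) =
      (evHom z hz).comp (MvPolynomial.aeval (fun i => (⟨X i, X_mem_conv i⟩ : conv r))) := by
    apply MvPolynomial.algHom_ext
    intro i
    simp only [AlgHom.comp_apply, MvPolynomial.aeval_X, evHom_apply]
    change χ _ = ev z (monomial (single i 1) 1)
    rw [ev_monomial, mono_single, pow_one, one_mul]
  have hmono : ∀ (β : σ →₀ ℕ) (a : ℂ), χ ⟨monomial β a, monomial_mem_conv β a⟩ =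
      evHom z hz ⟨monomial β a, monomial_mem_conv β a⟩ := by
    intro β a
    have h1 : (⟨monomial β a, monomial_mem_conv β a⟩ : conv r) =
      MvPolynomial.aeval (fun i => (⟨X i, X_mem_conv i⟩ : conv r)) (MvPolynomial.monomial β a) :=
      Subtype.ext (coe_aeval_monomial β a).symm
    rw [h1]
    exact AlgHom.congr_fun hpoly (MvPolynomial.monomial β a)
  have hb : ∀ s : Finset (σ →₀ ℕ), ‖χ g - evHom z hz g‖ₑ ≤
      2 * nrm r ((g : MvPowerSeries σ ℂ) - ∑ β ∈ s, monomial β (coeff β (g : MvPowerSeries σ ℂ))) := by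
    intro s
    set p : conv r := ∑ β ∈ s, ⟨monomial β (coeff β (g : MvPowerSeries σ ℂ)),
      monomial_mem_conv β _⟩ with hp
    have hpc : (p : MvPowerSeries σ ℂ) = ∑ β ∈ s, monomial β (coeff β (g : MvPowerSeries σ ℂ)) := by
      rw [hp, AddSubmonoidClass.coe_finsetSum]
    have hpp : χ p = evHom z hz p := by
      rw [hp, map_sum, map_sum]
      exact sum_congr rfl fun β _ => hmono _ _
    have e1 : χ g - evHom z hz g = χ (g - p) - evHom z hz (g - p) := by
      rw [map_sub, map_sub, hpp]; ring
    rw [e1, two_mul, ← hpc]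
    have h1 := enorm_character_le hr χ (g - p)
    have h2 := enorm_character_le hr (evHom z hz) (g - p)
    exact (enorm_sub_le).trans (add_le_add h1 h2)
  have ht := (ENNReal.Tendsto.const_mul (tendsto_nrm_sub_truncation g.2) (a := 2)
    (Or.inr (by simp)))
  rw [mul_zero] at ht
  have h0 : ‖χ g - evHom z hz g‖ₑ = 0 := le_antisymm (ge_of_tendsto' ht hb) zero_le
  exact sub_eq_zero.mp (enorm_eq_zero.mp h0)

/-- The Nullstellensatz for ideals of finite codimension. -/
theorem mem_radical_of_finite (hr : ∀ i, 0 < r i) (I : Ideal (conv r))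
    (hfin : Module.Finite ℂ (conv r ⧸ I)) {φ : conv r}
    (hφ : ∀ z : σ → ℂ, ∀ hz : ∀ i, ‖z i‖₊ ≤ r i, (∀ g ∈ I, evHom z hz g = 0) →
      evHom z hz φ = 0) : φ ∈ I.radical := by
  rw [Ideal.radical_eq_sInf, Ideal.mem_sInf]
  intro J hJ
  obtain ⟨hIJ, hJp⟩ := hJ
  have hsur : Function.Surjective (Ideal.Quotient.factorₐ ℂ hIJ) := Ideal.Quotient.factor_surjective hIJ
  have hfinJ : Module.Finite ℂ (conv r ⧸ J) :=
    Module.Finite.of_surjective (Ideal.Quotient.factorₐ ℂ hIJ).toLinearMap hsur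
  have hdom : IsDomain (conv r ⧸ J) := Ideal.Quotient.isDomain J
  have hint : Algebra.IsIntegral ℂ (conv r ⧸ J) := Algebra.IsIntegral.of_finite ℂ (conv r ⧸ J)
  have hbij := IsAlgClosed.algebraMap_bijective_of_isIntegral (k := ℂ) (K := conv r ⧸ J)
  set χ : conv r →ₐ[ℂ] ℂ :=
    ((AlgEquiv.ofBijective (Algebra.ofId ℂ (conv r ⧸ J)) hbij).symm : (conv r ⧸ J) →ₐ[ℂ] ℂ).comp
      (Ideal.Quotient.mkₐ ℂ J) with hχ
  have hker : ∀ g, χ g = 0 ↔ g ∈ J := by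
    intro g
    rw [hχ]
    simp only [AlgHom.comp_apply, Ideal.Quotient.mkₐ_eq_mk]
    rw [← Ideal.Quotient.eq_zero_iff_mem]
    exact map_eq_zero_iff _ (AlgEquiv.injective _)
  obtain ⟨z, hz, hχz⟩ := character_eq_ev hr χ
  rw [← hker, hχz]
  refine hφ z hz fun g hg => ?_
  rw [← hχz, hker]
  exact hIJ hg

end Characters

section OptionVar

variable {σ : Type*}

/-- The family on `Option σ` with given value at `none` and given restriction to `σ`. -/
def opt {R : Type*} (a : R) (z : σ → R) : Option σ → R := fun i => i.elim a z

theorem mono_opt {R : Type*} [CommMonoid R] (a : R) (z : σ → R) (β : Option σ →₀ ℕ) :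
    mono (opt a z) β = a ^ β none * mono z β.some := by
  classical
  rw [mono, Finsupp.prod_option_index]
  · rfl
  · intro o; exact pow_zero _
  · intro o m n; exact pow_add _ _ _

/-- Power series in `σ` regarded as constant in the variable `none`. -/
noncomputable def emb (σ : Type*) : MvPowerSeries σ ℂ →+* MvPowerSeries (Option σ) ℂ :=
  ((optionEquivLeft σ ℂ).symm : PowerSeries (MvPowerSeries σ ℂ) →+* _).comp PowerSeries.C

/-- Power series in the variable `none`. -/
noncomputable def iot (σ : Type*) : PowerSeries ℂ →+* MvPowerSeries (Option σ) ℂ :=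
  ((optionEquivLeft σ ℂ).symm : PowerSeries (MvPowerSeries σ ℂ) →+* _).comp
    (PowerSeries.map (C : ℂ →+* MvPowerSeries σ ℂ))

theorem optionEquivLeft_emb (g : MvPowerSeries σ ℂ) :
    optionEquivLeft σ ℂ (emb σ g) = PowerSeries.C g := by
  change optionEquivLeft σ ℂ ((optionEquivLeft σ ℂ).symm (PowerSeries.C g)) = _
  exact (optionEquivLeft σ ℂ).apply_symm_apply _

theorem optionEquivLeft_iot (c : PowerSeries ℂ) :
    optionEquivLeft σ ℂ (iot σ c) = PowerSeries.map (C : ℂ →+* MvPowerSeries σ ℂ) c := by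
  change optionEquivLeft σ ℂ ((optionEquivLeft σ ℂ).symm (PowerSeries.map C c)) = _
  exact (optionEquivLeft σ ℂ).apply_symm_apply _

theorem coeff_eq_coeff_optionEquivLeft (β : Option σ →₀ ℕ) (h : MvPowerSeries (Option σ) ℂ) :
    coeff β h = coeff β.some (PowerSeries.coeff (β none) (optionEquivLeft σ ℂ h)) := by
  rw [coeff_coeff_optionEquivLeft, Finsupp.optionElim_some]

theorem coeff_emb (β : Option σ →₀ ℕ) (g : MvPowerSeries σ ℂ) :
    coeff β (emb σ g) = if β none = 0 then coeff β.some g else 0 := by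
  rw [coeff_eq_coeff_optionEquivLeft, optionEquivLeft_emb, PowerSeries.coeff_C]
  split_ifs <;> simp

open Classical in
theorem coeff_iot (β : Option σ →₀ ℕ) (c : PowerSeries ℂ) :
    coeff β (iot σ c) = if β.some = 0 then PowerSeries.coeff (β none) c else 0 := by
  rw [coeff_eq_coeff_optionEquivLeft, optionEquivLeft_iot, PowerSeries.coeff_map, coeff_C]

theorem optionElim_injective_left : Injective fun β : σ →₀ ℕ => β.optionElim 0 := by
  intro a b h
  have := congrArg Finsupp.some h
  simpa using this

theorem optionElim_injective_right :
    Injective fun n : Unit →₀ ℕ => (0 : σ →₀ ℕ).optionElim (n ()) := by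
  intro a b h
  have := DFunLike.congr_fun h none
  ext
  simpa using this

theorem not_mem_range_left {γ : Option σ →₀ ℕ}
    (h : γ ∉ Set.range fun β : σ →₀ ℕ => β.optionElim 0) : γ none ≠ 0 := by
  intro h0
  refine h ⟨γ.some, ?_⟩
  change γ.some.optionElim 0 = γ
  rw [← h0, Finsupp.optionElim_some]

theorem not_mem_range_right {γ : Option σ →₀ ℕ}
    (h : γ ∉ Set.range fun n : Unit →₀ ℕ => (0 : σ →₀ ℕ).optionElim (n ())) : γ.some ≠ 0 := by
  intro h0
  refine h ⟨single () (γ none), ?_⟩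
  change (0 : σ →₀ ℕ).optionElim (single () (γ none) ()) = γ
  rw [← h0, Finsupp.single_eq_same, Finsupp.optionElim_some]

theorem mono_unit {R : Type*} [CommMonoid R] (a : R) (n : Unit →₀ ℕ) :
    mono (fun _ => a) n = a ^ n () := by
  have : n = single () (n ()) := by ext; simp
  rw [this, mono_single]; simp

theorem mono_optionElim_left {R : Type*} [CommMonoid R] (a : R) (z : σ → R) (β : σ →₀ ℕ) :
    mono (opt a z) (β.optionElim 0) = mono z β := by
  rw [mono_opt]; simp

theorem mono_optionElim_right {R : Type*} [CommMonoid R] (a : R) (z : σ → R) (n : Unit →₀ ℕ) :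
    mono (opt a z) ((0 : σ →₀ ℕ).optionElim (n ())) = mono (fun _ : Unit => a) n := by
  rw [mono_opt, mono_unit]; simp [mono_zero]

theorem coeff_unit (n : Unit →₀ ℕ) (c : PowerSeries ℂ) :
    PowerSeries.coeff (n ()) c = MvPowerSeries.coeff n c := by
  have : n = single () (n ()) := by ext; simp
  rw [PowerSeries.coeff, ← this]

theorem nrm_emb (η : ℝ≥0) (ρ : σ → ℝ≥0) (g : MvPowerSeries σ ℂ) :
    nrm (opt η ρ) (emb σ g) = nrm ρ g := by
  refine nrm_transfer optionElim_injective_left (fun β => ?_) (fun γ hγ => ?_)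
    (mono_optionElim_left _ _)
  · simp [coeff_emb]
  · rw [coeff_emb, if_neg (not_mem_range_left hγ)]

theorem ev_emb (τ : ℂ) (z : σ → ℂ) (g : MvPowerSeries σ ℂ) :
    ev (opt τ z) (emb σ g) = ev z g := by
  refine ev_transfer optionElim_injective_left (fun β => ?_) (fun γ hγ => ?_)
    (mono_optionElim_left _ _)
  · simp [coeff_emb]
  · rw [coeff_emb, if_neg (not_mem_range_left hγ)]

theorem nrm_iot (η : ℝ≥0) (ρ : σ → ℝ≥0) (c : PowerSeries ℂ) :
    nrm (opt η ρ) (iot σ c) = nrm (fun _ : Unit => η) c := by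
  refine nrm_transfer optionElim_injective_right (fun β => ?_) (fun γ hγ => ?_)
    (mono_optionElim_right _ _)
  · rw [coeff_iot, Finsupp.some_optionElim, if_pos rfl, Finsupp.optionElim_apply_none, coeff_unit]
  · exact (coeff_iot γ c).trans (if_neg (not_mem_range_right hγ))

theorem ev_iot (τ : ℂ) (z : σ → ℂ) (c : PowerSeries ℂ) :
    ev (opt τ z) (iot σ c) = ev (fun _ : Unit => τ) c := by
  refine ev_transfer optionElim_injective_right (fun β => ?_) (fun γ hγ => ?_)
    (mono_optionElim_right _ _)
  · rw [coeff_iot, Finsupp.some_optionElim, if_pos rfl, Finsupp.optionElim_apply_none, coeff_unit]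
  · exact (coeff_iot γ c).trans (if_neg (not_mem_range_right hγ))

/-- Setting the variable `none` to zero. -/
noncomputable def atZero (σ : Type*) : MvPowerSeries (Option σ) ℂ →+* MvPowerSeries σ ℂ :=
  (PowerSeries.constantCoeff (R := MvPowerSeries σ ℂ)).comp
    ((optionEquivLeft σ ℂ : _ →+* PowerSeries (MvPowerSeries σ ℂ)))

theorem atZero_apply (h : MvPowerSeries (Option σ) ℂ) :
    atZero σ h = PowerSeries.constantCoeff (optionEquivLeft σ ℂ h) := rfl

theorem coeff_atZero (β : σ →₀ ℕ) (h : MvPowerSeries (Option σ) ℂ) :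
    coeff β (atZero σ h) = coeff (β.optionElim 0) h := by
  rw [atZero_apply, ← PowerSeries.coeff_zero_eq_constantCoeff_apply, coeff_coeff_optionEquivLeft]

theorem coeff_sub_emb_atZero (β : Option σ →₀ ℕ) (h : MvPowerSeries (Option σ) ℂ) :
    coeff β (h - emb σ (atZero σ h)) = if β none = 0 then 0 else coeff β h := by
  rw [map_sub, coeff_emb, coeff_atZero]
  split_ifs with h0
  · rw [← h0, Finsupp.optionElim_some, sub_self]
  · rw [sub_zero]

theorem nrm_atZero_le (η : ℝ≥0) (ρ : σ → ℝ≥0) (h : MvPowerSeries (Option σ) ℂ) :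
    nrm ρ (atZero σ h) ≤ nrm (opt η ρ) h := by
  rw [← nrm_emb η]
  refine ENNReal.tsum_le_tsum fun β => ?_
  rw [coeff_emb, coeff_atZero]
  split_ifs with h0
  · rw [← h0, Finsupp.optionElim_some]
  · simp

theorem nrm_sub_emb_atZero_le {η η0 : ℝ≥0} (hη0 : 0 < η0) (hη : η ≤ η0) (ρ : σ → ℝ≥0)
    (h : MvPowerSeries (Option σ) ℂ) :
    nrm (opt η ρ) (h - emb σ (atZero σ h)) ≤ ((η / η0 : ℝ≥0) : ℝ≥0∞) * nrm (opt η0 ρ) h := by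
  rw [nrm, nrm, ← ENNReal.tsum_mul_left]
  refine ENNReal.tsum_le_tsum fun β => ?_
  rw [coeff_sub_emb_atZero]
  split_ifs with h0
  · simp
  · rw [mul_left_comm]
    gcongr
    rw [← ENNReal.coe_mul]
    refine ENNReal.coe_le_coe.mpr ?_
    rw [mono_opt, mono_opt, ← mul_assoc]
    gcongr
    obtain ⟨n, hn⟩ := Nat.exists_eq_succ_of_ne_zero h0
    rw [hn, pow_succ, pow_succ, mul_comm (η0 ^ n), ← mul_assoc, div_mul_cancel₀ _ hη0.ne',
      mul_comm]
    gcongr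

theorem ev_opt_zero (z : σ → ℂ) (h : MvPowerSeries (Option σ) ℂ) :
    ev (opt 0 z) h = ev z (atZero σ h) := by
  rw [← ev_emb 0 z (atZero σ h), ev, ev]
  refine tsum_congr fun β => ?_
  rw [coeff_emb, coeff_atZero]
  split_ifs with h0
  · rw [← h0, Finsupp.optionElim_some]
  · rw [mono_opt, zero_pow h0]; simp

theorem opt_pos {η : ℝ≥0} {ρ : σ → ℝ≥0} (hη : 0 < η) (hρ : ∀ i, 0 < ρ i) (i : Option σ) :
    0 < opt η ρ i := by
  cases i
  · exact hη
  · exact hρ _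

theorem opt_le {η : ℝ≥0} {ρ : σ → ℝ≥0} {τ : ℂ} {z : σ → ℂ} (hη : ‖τ‖₊ ≤ η)
    (hρ : ∀ i, ‖z i‖₊ ≤ ρ i) (i : Option σ) : ‖opt τ z i‖₊ ≤ opt η ρ i := by
  cases i
  · exact hη
  · exact hρ _

end OptionVar

section Fibre

/-- Removing the constant term and dividing by the variable. -/
noncomputable def shiftHom : MvPowerSeries Unit ℂ →+ MvPowerSeries Unit ℂ where
  toFun c := PowerSeries.mk fun n => PowerSeries.coeff (n + 1) c
  map_zero' := by ext1 n; simp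
  map_add' a b := by
    ext1 n
    change PowerSeries.coeff _ _ = PowerSeries.coeff _ (_ + _)
    simp

theorem X_mul_shiftHom (c : PowerSeries ℂ) :
    PowerSeries.X * (shiftHom c : PowerSeries ℂ) = c - PowerSeries.C (PowerSeries.constantCoeff c) := by
  rw [eq_sub_iff_add_eq, mul_comm]
  exact (PowerSeries.eq_shift_mul_X_add_const c).symm

theorem nrm_X_mul_unit (η : ℝ≥0) (c : PowerSeries ℂ) :
    nrm (fun _ : Unit => η) (PowerSeries.X * c : PowerSeries ℂ) = η * nrm (fun _ : Unit => η) c := by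
  have h := nrm_monomial_mul (r := fun _ : Unit => η) (single () 1) c
  rw [mono_single, pow_one] at h
  exact h

theorem nrm_shiftHom_le (η : ℝ≥0) (c : PowerSeries ℂ) :
    η * nrm (fun _ : Unit => η) (shiftHom c) ≤ nrm (fun _ : Unit => η) c := by
  have h := nrm_X_mul_unit η (shiftHom c)
  rw [← h, X_mul_shiftHom]
  refine ENNReal.tsum_le_tsum fun β => ?_
  gcongr
  rw [map_sub, ← coeff_unit β, ← coeff_unit β, PowerSeries.coeff_C]
  split_ifs with h0
  · rw [h0]; simp
  · simp

theorem nrm_shiftHom_le' {η : ℝ≥0} (hη : 0 < η) (c : PowerSeries ℂ) :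
    nrm (fun _ : Unit => η) (shiftHom c) ≤
      ((η⁻¹ : ℝ≥0) : ℝ≥0∞) * nrm (fun _ : Unit => η) c := by
  have h := nrm_shiftHom_le η c
  calc _ = ((η⁻¹ : ℝ≥0) : ℝ≥0∞) * (η * nrm (fun _ : Unit => η) (shiftHom c)) := by
          rw [← mul_assoc, ← ENNReal.coe_mul, inv_mul_cancel₀ hη.ne', ENNReal.coe_one, one_mul]
    _ ≤ _ := by gcongr

/-- The shift followed by multiplication by a constant. -/
noncomputable def shiftMul (τ : ℂ) : MvPowerSeries Unit ℂ →+ MvPowerSeries Unit ℂ :=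
  (AddMonoidHom.mulLeft (C τ)).comp shiftHom

theorem shiftMul_apply (τ : ℂ) (g : MvPowerSeries Unit ℂ) : shiftMul τ g = C τ * shiftHom g := rfl

theorem nrm_shiftMul_le {η : ℝ≥0} (hη : 0 < η) (τ : ℂ) (g : MvPowerSeries Unit ℂ) :
    nrm (fun _ : Unit => η) (shiftMul τ g) ≤
      ((‖τ‖₊ / η : ℝ≥0) : ℝ≥0∞) * nrm (fun _ : Unit => η) g := by
  rw [shiftMul_apply, nrm_C_mul, div_eq_mul_inv, ENNReal.coe_mul, mul_assoc]
  exact mul_le_mul' le_rfl (nrm_shiftHom_le' hη g)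

/-- A convergent power series in one variable minus its value at `τ` is divisible by `X - τ`. -/
theorem exists_sub_ev_eq_mul {η : ℝ≥0} {τ : ℂ} (hτ : ‖τ‖₊ < η) {c : PowerSeries ℂ}
    (hc : (c : MvPowerSeries Unit ℂ) ∈ conv (fun _ : Unit => η)) :
    ∃ c' : PowerSeries ℂ, (c' : MvPowerSeries Unit ℂ) ∈ conv (fun _ : Unit => η) ∧
      c - PowerSeries.C (ev (fun _ : Unit => τ) c) = (PowerSeries.X - PowerSeries.C τ) * c' := by
  have hη : 0 < η := lt_of_le_of_lt zero_le hτ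
  obtain ⟨c', hc', hE⟩ := exists_neumann (r := fun _ : Unit => η) (fun _ => hη)
    (shiftMul τ) ((div_lt_one hη).mpr hτ) (nrm_shiftMul_le hη τ) (g := shiftHom c)
    ((nrm_shiftHom_le' hη c).trans_lt (mul_lt_top coe_lt_top hc))
  have hE' : (c' : PowerSeries ℂ) - PowerSeries.C τ * (shiftHom c' : PowerSeries ℂ) = shiftHom c := hE
  have key : ∃ b : ℂ, c - PowerSeries.C b = (PowerSeries.X - PowerSeries.C τ) * (c' : PowerSeries ℂ) := by
    refine ⟨PowerSeries.constantCoeff c + τ * PowerSeries.constantCoeff (c' : PowerSeries ℂ), ?_⟩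
    have h1 := X_mul_shiftHom c
    have h2 := X_mul_shiftHom c'
    rw [← hE'] at h1
    rw [map_add, map_mul]
    linear_combination -h1 - PowerSeries.C τ * h2
  obtain ⟨b, hb⟩ := key
  refine ⟨c', hc', ?_⟩
  have hz : ∀ _ : Unit, ‖τ‖₊ ≤ η := fun _ => hτ.le
  have h3 : evHom (r := fun _ : Unit => η) (fun _ => τ) hz (⟨c, hc⟩ - algebraMap ℂ _ b) =
      evHom (r := fun _ : Unit => η) (fun _ => τ) hz
        ((⟨X (), X_mem_conv ()⟩ - algebraMap ℂ _ τ) * ⟨c', hc'⟩) := by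
    congr 1
    exact Subtype.ext hb
  have hX : evHom (r := fun _ : Unit => η) (fun _ => τ) hz ⟨X (), X_mem_conv ()⟩ = τ := by
    change ev _ (monomial (single () 1) 1) = τ
    rw [ev_monomial, mono_single]; simp
  rw [map_mul, map_sub, map_sub, AlgHom.commutes, AlgHom.commutes, hX] at h3
  simp only [Algebra.algebraMap_self_apply, sub_self, zero_mul, evHom_apply] at h3
  rw [sub_eq_zero.mp h3]
  exact hb

theorem ev_eq_add_mul_ev_shiftHom {η : ℝ≥0} (hη : 0 < η) {τ : ℂ} (hτ : ‖τ‖₊ < η)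
    {c : PowerSeries ℂ} (hc : (c : MvPowerSeries Unit ℂ) ∈ conv (fun _ : Unit => η)) :
    ev (fun _ : Unit => τ) c = PowerSeries.constantCoeff c + τ * ev (fun _ : Unit => τ) (shiftHom c) := by
  have hz : ∀ _ : Unit, ‖τ‖₊ ≤ η := fun _ => hτ.le
  have hs : shiftHom c ∈ conv (fun _ : Unit => η) :=
    (nrm_shiftHom_le' hη c).trans_lt (mul_lt_top coe_lt_top hc)
  have h : (⟨c, hc⟩ : conv (fun _ : Unit => η)) = algebraMap ℂ _ (PowerSeries.constantCoeff c) +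
      ⟨X (), X_mem_conv ()⟩ * ⟨shiftHom c, hs⟩ := by
    apply Subtype.ext
    have := X_mul_shiftHom c
    rw [eq_sub_iff_add_eq, add_comm] at this
    exact this.symm
  have h3 := congrArg (evHom (r := fun _ : Unit => η) (fun _ => τ) hz) h
  have hX : evHom (r := fun _ : Unit => η) (fun _ => τ) hz ⟨X (), X_mem_conv ()⟩ = τ := by
    change ev _ (monomial (single () 1) 1) = τ
    rw [ev_monomial, mono_single]; simp
  rw [map_add, map_mul, AlgHom.commutes, hX] at h3
  exact h3

theorem constantCoeff_eq_zero_of_ev_eq_zero {η : ℝ≥0} (hη : 0 < η) {c : PowerSeries ℂ}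
    (hc : (c : MvPowerSeries Unit ℂ) ∈ conv (fun _ : Unit => η))
    (h : ∀ τ : ℂ, τ ≠ 0 → ‖τ‖₊ < η → ev (fun _ : Unit => τ) c = 0) :
    PowerSeries.constantCoeff c = 0 := by
  have hs : nrm (fun _ : Unit => η) (shiftHom c) < ⊤ :=
    (nrm_shiftHom_le' hη c).trans_lt (mul_lt_top coe_lt_top hc)
  set K := (nrm (fun _ : Unit => η) (shiftHom c)).toReal with hK
  have hKnn : 0 ≤ K := ENNReal.toReal_nonneg
  have hb : ∀ x : ℝ, 0 < x → x < η → ‖PowerSeries.constantCoeff c‖ ≤ x * K := by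
    intro x hx hxη
    have hn : ‖(x : ℂ)‖₊ < η := by
      rw [← NNReal.coe_lt_coe, coe_nnnorm, Complex.norm_real, Real.norm_of_nonneg hx.le]
      exact hxη
    have h1 := ev_eq_add_mul_ev_shiftHom hη hn hc
    rw [h x (by exact_mod_cast hx.ne') hn] at h1
    have h2 : PowerSeries.constantCoeff c = -(x * ev (fun _ : Unit => (x : ℂ)) (shiftHom c)) := by
      linear_combination -h1
    have h4 : ‖ev (fun _ : Unit => (x : ℂ)) (shiftHom c)‖ ≤ K := by
      have h5 := enorm_ev_le (r := fun _ : Unit => η) (fun _ => hn.le) (shiftHom c)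
      rw [hK, ← toReal_enorm]
      exact ENNReal.toReal_mono hs.ne h5
    rw [h2, norm_neg, norm_mul, Complex.norm_real, Real.norm_of_nonneg hx.le]
    gcongr
  by_contra hne
  have hpos : 0 < ‖PowerSeries.constantCoeff c‖ := norm_pos_iff.mpr hne
  set x : ℝ := min ((η : ℝ) / 2) (‖PowerSeries.constantCoeff c‖ / (2 * (K + 1))) with hx
  have hη' : (0 : ℝ) < η := by exact_mod_cast hη
  have hx0 : 0 < x := lt_min (by positivity) (by positivity)
  have hx1 : x < η := (min_le_left _ _).trans_lt (by linarith)
  have hx2 : x ≤ ‖PowerSeries.constantCoeff c‖ / (2 * (K + 1)) := min_le_right _ _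
  have h6 := hb x hx0 hx1
  rw [le_div_iff₀ (by positivity)] at hx2
  nlinarith

/-- The identity theorem for convergent power series in one variable. -/
theorem eq_zero_of_ev_eq_zero {η : ℝ≥0} (hη : 0 < η) {c : PowerSeries ℂ}
    (hc : (c : MvPowerSeries Unit ℂ) ∈ conv (fun _ : Unit => η))
    (h : ∀ τ : ℂ, τ ≠ 0 → ‖τ‖₊ < η → ev (fun _ : Unit => τ) c = 0) : c = 0 := by
  ext1 n
  rw [map_zero]
  induction n generalizing c with
  | zero =>
    rw [PowerSeries.coeff_zero_eq_constantCoeff_apply]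
    exact constantCoeff_eq_zero_of_ev_eq_zero hη hc h
  | succ n ih =>
    have hs : nrm (fun _ : Unit => η) (shiftHom c) < ⊤ :=
      (nrm_shiftHom_le' hη c).trans_lt (mul_lt_top coe_lt_top hc)
    have h0 : PowerSeries.constantCoeff c = 0 :=
      constantCoeff_eq_zero_of_ev_eq_zero hη hc h
    have h1 := ih (c := shiftHom c) hs (fun τ hτ hτη => by
      have h2 := ev_eq_add_mul_ev_shiftHom hη hτη hc
      rw [h τ hτ hτη, h0, zero_add] at h2
      exact (mul_eq_zero.mp h2.symm).resolve_left hτ)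
    have h3 : PowerSeries.coeff n (shiftHom c : PowerSeries ℂ) = PowerSeries.coeff (n + 1) c :=
      PowerSeries.coeff_mk n fun n => PowerSeries.coeff (n + 1) c
    rw [← h3]; exact h1

end Fibre

section Parts

variable {σ : Type*} [Fintype σ]

/-- The exponent attached to an index. -/
noncomputable def cexp {N : ℕ} (c : σ → Fin (N + 1)) : σ →₀ ℕ :=
  Finsupp.equivFunOnFinite.symm fun i => (c i : ℕ)

theorem cexp_apply {N : ℕ} (c : σ → Fin (N + 1)) (i : σ) : cexp c i = c i := rfl

/-- The exponent attached to an index, in the ring with an additional variable. -/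
noncomputable def upExp {N : ℕ} (c : σ → Fin (N + 1)) : Option σ →₀ ℕ := (cexp c).optionElim 0

/-- Truncation of an exponent at `N` in each variable. -/
def clamp (N : ℕ) (γ : σ →₀ ℕ) : σ → Fin (N + 1) :=
  fun i => ⟨min (γ i) N, Nat.lt_succ_of_le (min_le_right _ _)⟩

theorem cexp_clamp_le (N : ℕ) (γ : σ →₀ ℕ) : cexp (clamp N γ) ≤ γ := fun i => min_le_left (γ i) N

theorem upExp_le_iff {N : ℕ} (c : σ → Fin (N + 1)) (β : Option σ →₀ ℕ) :
    upExp c ≤ β ↔ cexp c ≤ β.some := by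
  constructor
  · intro h i
    have := h (some i)
    rwa [upExp, Finsupp.optionElim_apply_some] at this
  · intro h i
    cases i with
    | none => rw [upExp, Finsupp.optionElim_apply_none]; exact Nat.zero_le _
    | some i => rw [upExp, Finsupp.optionElim_apply_some]; exact h i

open Classical in
/-- The part of a power series with exponents clamped to `c`, divided by the monomial of `c`. -/
noncomputable def partHom {N : ℕ} (c : σ → Fin (N + 1)) :
    MvPowerSeries (Option σ) ℂ →+ MvPowerSeries (Option σ) ℂ where
  toFun h := ofCoeff fun γ => if clamp N (γ + upExp c).some = c then coeff (γ + upExp c) h else 0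
  map_zero' := by ext γ; simp [coeff_ofCoeff]
  map_add' a b := by
    ext γ
    rw [map_add, coeff_ofCoeff, coeff_ofCoeff, coeff_ofCoeff]
    split_ifs <;> simp

open Classical in
theorem coeff_partHom {N : ℕ} (c : σ → Fin (N + 1)) (h : MvPowerSeries (Option σ) ℂ)
    (γ : Option σ →₀ ℕ) : coeff γ (partHom c h) =
      if clamp N (γ + upExp c).some = c then coeff (γ + upExp c) h else 0 := rfl

open Classical in
theorem coeff_monomial_mul_partHom {N : ℕ} (c : σ → Fin (N + 1)) (h : MvPowerSeries (Option σ) ℂ)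
    (β : Option σ →₀ ℕ) : coeff β (monomial (upExp c) 1 * partHom c h) =
      if clamp N β.some = c then coeff β h else 0 := by
  by_cases hle : upExp c ≤ β
  · obtain ⟨γ, rfl⟩ := exists_add_of_le hle
    rw [coeff_add_monomial_mul, one_mul, coeff_partHom, add_comm γ]
  · rw [coeff_monomial_mul, if_neg hle, if_neg]
    intro hc
    apply hle
    rw [upExp_le_iff, ← hc]
    exact cexp_clamp_le _ _

theorem sum_monomial_mul_partHom [DecidableEq σ] (N : ℕ) (h : MvPowerSeries (Option σ) ℂ) :
    ∑ c : σ → Fin (N + 1), monomial (upExp c) 1 * partHom c h = h := by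
  classical
  ext β
  rw [map_sum]
  simp only [coeff_monomial_mul_partHom]
  simp

theorem mono_upExp {R : Type*} [CommMonoid R] {N : ℕ} (a : R) (z : σ → R) (c : σ → Fin (N + 1)) :
    mono (opt a z) (upExp c) = mono z (cexp c) := mono_optionElim_left _ _ _

theorem sum_nrm_partHom [DecidableEq σ] (N : ℕ) (η : ℝ≥0) (ρ : σ → ℝ≥0)
    (h : MvPowerSeries (Option σ) ℂ) :
    ∑ c : σ → Fin (N + 1), ((mono ρ (cexp c) : ℝ≥0) : ℝ≥0∞) * nrm (opt η ρ) (partHom c h) =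
      nrm (opt η ρ) h := by
  classical
  simp_rw [← mono_upExp η ρ, ← nrm_monomial_mul]
  simp only [nrm, coeff_monomial_mul_partHom]
  rw [← Summable.tsum_finsetSum fun _ _ => ENNReal.summable]
  refine tsum_congr fun β => ?_
  rw [sum_eq_single (clamp N β.some)]
  · rw [if_pos rfl]
  · intro c _ hc
    rw [if_neg (Ne.symm hc)]; simp
  · simp

theorem partHom_eq_iot {N : ℕ} {c : σ → Fin (N + 1)} (hc : ∀ i, (c i : ℕ) < N)
    (h : MvPowerSeries (Option σ) ℂ) : ∃ p : PowerSeries ℂ, partHom c h = iot σ p := by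
  classical
  refine ⟨PowerSeries.mk fun n => coeff ((cexp c).optionElim n) h, ?_⟩
  ext γ
  rw [coeff_partHom, coeff_iot, PowerSeries.coeff_mk]
  have hs : ∀ i, (γ + upExp c).some i = γ.some i + c i := by
    intro i
    rw [Finsupp.some_apply, Finsupp.add_apply, upExp, Finsupp.optionElim_apply_some]
    rfl
  have hiff : clamp N (γ + upExp c).some = c ↔ γ.some = 0 := by
    constructor
    · intro h1
      ext i
      have h2 := congrArg Fin.val (congrFun h1 i)
      change min ((γ + upExp c).some i) N = c i at h2
      rw [hs] at h2
      have := hc i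
      change γ.some i = 0
      omega
    · intro h1
      funext i
      apply Fin.ext
      change min ((γ + upExp c).some i) N = c i
      have h2 := DFunLike.congr_fun h1 i
      have := hc i
      rw [hs, h2]
      change min (0 + (c i : ℕ)) N = c i
      omega
  by_cases h0 : γ.some = 0
  · rw [if_pos (hiff.mpr h0), if_pos h0]
    have hexp : γ + upExp c = (cexp c).optionElim (γ none) := by
      ext i
      cases i with
      | none => simp [upExp]
      | some i =>
        have h2 := DFunLike.congr_fun h0 i
        rw [Finsupp.some_apply] at h2
        simp [upExp, h2]
    rw [hexp]
  · rw [if_neg (fun h1 => h0 (hiff.mp h1)), if_neg h0]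

/-- Division with remainder in the ring of convergent power series. -/
theorem exists_division [DecidableEq σ] {N : ℕ} {η : ℝ≥0} {ρ : σ → ℝ≥0} (hη : 0 < η)
    (hρ : ∀ i, 0 < ρ i) {A K : Type*} [Fintype A] [Fintype K]
    (b : A → MvPowerSeries σ ℂ) (g : K → MvPowerSeries (Option σ) ℂ)
    (s : (σ → Fin (N + 1)) → A → ℂ) (q : (σ → Fin (N + 1)) → K → MvPowerSeries σ ℂ)
    (hq : ∀ c k, q c k ∈ conv ρ)
    (hs : ∀ c a, s c a ≠ 0 → ∀ i, (c i : ℕ) < N)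
    (he : ∀ c, nrm (opt η ρ) (monomial (upExp c) 1 - ∑ a, emb σ (C (s c a) * b a) -
      ∑ k, emb σ (q c k) * g k) ≤ ((2⁻¹ * mono ρ (cexp c) : ℝ≥0) : ℝ≥0∞))
    {h : MvPowerSeries (Option σ) ℂ} (hh : h ∈ conv (opt η ρ)) :
    ∃ (P : A → PowerSeries ℂ) (Q : K → MvPowerSeries (Option σ) ℂ),
      (∀ a, (P a : MvPowerSeries Unit ℂ) ∈ conv (fun _ : Unit => η)) ∧
      (∀ k, Q k ∈ conv (opt η ρ)) ∧
      h = ∑ a, iot σ (P a) * emb σ (b a) + ∑ k, Q k * g k := by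
  classical
  set e : (σ → Fin (N + 1)) → MvPowerSeries (Option σ) ℂ := fun c =>
    monomial (upExp c) 1 - ∑ a, emb σ (C (s c a) * b a) - ∑ k, emb σ (q c k) * g k with hedef
  set E : MvPowerSeries (Option σ) ℂ →+ MvPowerSeries (Option σ) ℂ :=
    ∑ c : σ → Fin (N + 1), (AddMonoidHom.mulLeft (e c)).comp (partHom c) with hE
  have hEa : ∀ x, E x = ∑ c : σ → Fin (N + 1), e c * partHom c x := by
    intro x
    rw [hE, AddMonoidHom.finsetSum_apply]
    rfl
  have hEn : ∀ x, nrm (opt η ρ) (E x) ≤ ((2⁻¹ : ℝ≥0) : ℝ≥0∞) * nrm (opt η ρ) x := by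
    intro x
    rw [hEa, ← sum_nrm_partHom N η ρ x, mul_sum]
    refine (nrm_sum_le _ _).trans (Finset.sum_le_sum fun c _ => ?_)
    refine (nrm_mul_le _ _).trans ?_
    rw [← mul_assoc, ← ENNReal.coe_mul]
    exact mul_le_mul' (he c) le_rfl
  obtain ⟨H, hHc, hH⟩ := exists_neumann (opt_pos hη hρ) E
    (by rw [← NNReal.coe_lt_coe]; norm_num) hEn hh
  have hpc : ∀ c : σ → Fin (N + 1), partHom c H ∈ conv (opt η ρ) := by
    intro c
    have h1 : ((mono ρ (cexp c) : ℝ≥0) : ℝ≥0∞) * nrm (opt η ρ) (partHom c H) ≤ nrm (opt η ρ) H := by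
      rw [← sum_nrm_partHom N η ρ H]
      exact single_le_sum (f := fun c : σ → Fin (N + 1) =>
        ((mono ρ (cexp c) : ℝ≥0) : ℝ≥0∞) * nrm (opt η ρ) (partHom c H)) (fun _ _ => zero_le)
        (mem_univ c)
    rw [mem_conv]
    by_contra htop
    rw [not_lt, top_le_iff] at htop
    rw [htop, ENNReal.mul_top (by exact_mod_cast (mono_pos hρ _).ne')] at h1
    exact absurd (lt_of_le_of_lt h1 hHc) (lt_irrefl _)
  have hp : ∀ c a, ∃ p : PowerSeries ℂ, (p : MvPowerSeries Unit ℂ) ∈ conv (fun _ : Unit => η) ∧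
      emb σ (C (s c a)) * partHom c H = iot σ p := by
    intro c a
    by_cases h0 : s c a = 0
    · refine ⟨0, zero_mem _, ?_⟩
      rw [h0, map_zero, map_zero, map_zero, zero_mul]
    · obtain ⟨p, hp⟩ := partHom_eq_iot (hs c a h0) H
      have hpc' := hpc c
      rw [hp, mem_conv, nrm_iot] at hpc'
      refine ⟨PowerSeries.C (s c a) * p, ?_, ?_⟩
      · exact mul_mem (C_mem_conv _) (mem_conv.mpr hpc')
      · rw [hp, map_mul]
        congr 1
        apply (optionEquivLeft σ ℂ).injective
        rw [optionEquivLeft_emb, optionEquivLeft_iot, PowerSeries.map_C]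
  choose p hpconv hpeq using hp
  refine ⟨fun a => ∑ c, p c a, fun k => ∑ c, emb σ (q c k) * partHom c H, fun a => ?_, fun k => ?_, ?_⟩
  · exact sum_mem (S := conv fun _ : Unit => η) fun c _ => hpconv c a
  · refine sum_mem fun c _ => mul_mem ?_ (hpc c)
    rw [mem_conv, nrm_emb]
    exact hq c k
  · have h1 : H = ∑ c : σ → Fin (N + 1), monomial (upExp c) 1 * partHom c H :=
      (sum_monomial_mul_partHom N H).symm
    have h2 : h = ∑ c : σ → Fin (N + 1), (∑ a, emb σ (C (s c a) * b a) +
        ∑ k, emb σ (q c k) * g k) * partHom c H := by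
      rw [← hH, hEa]
      nth_rewrite 1 [h1]
      rw [← sum_sub_distrib]
      refine sum_congr rfl fun c _ => ?_
      rw [hedef]; ring
    rw [h2]
    simp_rw [map_sum, add_mul, sum_add_distrib, sum_mul]
    congr 1
    · rw [sum_comm]
      refine sum_congr rfl fun a _ => sum_congr rfl fun c _ => ?_
      rw [← hpeq, map_mul]; ring
    · rw [sum_comm]
      refine sum_congr rfl fun k _ => sum_congr rfl fun c _ => ?_
      ring

end Parts

section DivisionData

variable {σ : Type*}

theorem mono_const (a : ℝ≥0) (β : σ →₀ ℕ) : mono (fun _ => a) β = a ^ β.degree := by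
  rw [mono, Finsupp.prod, Finset.prod_pow_eq_pow_sum]
  rfl

/-- The part of a power series of total degree less than `a`. -/
noncomputable def lowPart (a : ℕ) (g : MvPowerSeries σ ℂ) : MvPowerSeries σ ℂ :=
  ofCoeff fun β => if β.degree < a then coeff β g else 0

theorem lowPart_mem_conv [Finite σ] (a : ℕ) (g : MvPowerSeries σ ℂ) (r : σ → ℝ≥0) :
    lowPart a g ∈ conv r := by
  have hfin : {β : σ →₀ ℕ | β.degree < a}.Finite :=
    (Finsupp.finite_of_degree_le a).subset fun c (hc : c.degree < a) => hc.le
  rw [mem_conv, nrm, tsum_eq_sum (s := hfin.toFinset)]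
  · exact ENNReal.sum_lt_top.mpr fun β _ => mul_lt_top enorm_lt_top coe_lt_top
  · intro β hβ
    rw [lowPart, coeff_ofCoeff, if_neg]
    · simp
    · intro h; exact hβ (hfin.mem_toFinset.mpr h)

theorem coeff_mul_eq_zero_of_degree_lt {a : ℕ} {f g : MvPowerSeries σ ℂ}
    (hf : ∀ β : σ →₀ ℕ, β.degree < a → coeff β f = 0) {β : σ →₀ ℕ} (hβ : β.degree < a) :
    coeff β (f * g) = 0 := by
  classical
  rw [coeff_mul]
  refine sum_eq_zero fun p hp => ?_
  rw [Finset.HasAntidiagonal.mem_antidiagonal] at hp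
  rw [hf p.1, zero_mul]
  rw [← hp, map_add] at hβ
  omega

theorem nrm_le_of_coeff_eq_zero {a : ℕ} {ρ ρ0 : ℝ≥0} (hρ0 : 0 < ρ0) (hρ : ρ ≤ ρ0)
    {g : MvPowerSeries σ ℂ} (hg : ∀ β : σ →₀ ℕ, β.degree < a → coeff β g = 0) :
    nrm (fun _ => ρ) g ≤ (((ρ / ρ0) ^ a : ℝ≥0) : ℝ≥0∞) * nrm (fun _ => ρ0) g := by
  rw [nrm, nrm, ← ENNReal.tsum_mul_left]
  refine ENNReal.tsum_le_tsum fun β => ?_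
  by_cases hβ : β.degree < a
  · rw [hg β hβ]; simp
  · rw [mono_const, mono_const, mul_left_comm]
    gcongr
    rw [← ENNReal.coe_mul, coe_le_coe]
    have h1 : ρ ^ β.degree = (ρ / ρ0) ^ β.degree * ρ0 ^ β.degree := by
      rw [← mul_pow, div_mul_cancel₀ _ hρ0.ne']
    rw [h1]
    gcongr ?_ * _
    exact pow_le_pow_of_le_one zero_le (div_le_one_of_le₀ hρ zero_le) (not_lt.mp hβ)

theorem emb_monomial_cexp [Fintype σ] {N : ℕ} (c : σ → Fin (N + 1)) :
    emb σ (monomial (cexp c) 1) = monomial (upExp c) 1 := by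
  classical
  ext β
  rw [coeff_emb, coeff_monomial, coeff_monomial]
  have : β = upExp c ↔ β none = 0 ∧ β.some = cexp c := by
    constructor
    · rintro rfl
      simp [upExp]
    · rintro ⟨h1, h2⟩
      rw [upExp, ← h2, ← h1, Finsupp.optionElim_some]
  by_cases h1 : β none = 0
  · rw [if_pos h1]; simp [this, h1]
  · rw [if_neg h1]; simp [this, h1]

/-- A choice of monomials independent modulo an ideal and spanning the same space as all the
monomials with exponents less than `N`. -/
theorem exists_monomial_basis [Fintype σ] {I : Ideal (MvPowerSeries σ ℂ)} {N : ℕ}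
    (hN : ∀ i, (X i : MvPowerSeries σ ℂ) ^ N ∈ I) :
    ∃ (d : ℕ) (b : Fin d → σ →₀ ℕ) (s : (σ → Fin (N + 1)) → Fin d → ℂ),
      LinearIndependent ℂ (fun a => Ideal.Quotient.mk I (monomial (b a) (1 : ℂ))) ∧
      (∀ c a, s c a ≠ 0 → ∀ i, (c i : ℕ) < N) ∧
      ∀ c, monomial (cexp c) 1 - ∑ a, C (s c a) * monomial (b a) 1 ∈ I := by
  classical
  have hfinspan : Module.Finite ℂ (Submodule.span ℂ (Set.range
    fun c : {c : σ → Fin (N + 1) // ∀ i, (c i : ℕ) < N} =>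
      Ideal.Quotient.mk I (monomial (cexp c.1) (1 : ℂ)))) :=
    Module.Finite.span_of_finite ℂ (Set.finite_range _)
  obtain ⟨f, hf, hspan, hlin⟩ := Submodule.exists_fun_fin_finrank_span_eq ℂ (Set.range
    fun c : {c : σ → Fin (N + 1) // ∀ i, (c i : ℕ) < N} =>
      Ideal.Quotient.mk I (monomial (cexp c.1) (1 : ℂ)))
  choose b hb using hf
  have hf' : f = fun a => Ideal.Quotient.mk I (monomial (cexp (b a).1) (1 : ℂ)) := by
    funext a; exact (hb a).symm
  have hs : ∀ c : σ → Fin (N + 1), ∃ s : Fin _ → ℂ, (∀ a, s a ≠ 0 → ∀ i, (c i : ℕ) < N) ∧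
      monomial (cexp c) 1 - ∑ a, C (s a) * monomial (cexp (b a).1) 1 ∈ I := by
    intro c
    by_cases hc : ∀ i, (c i : ℕ) < N
    · have hmem : Ideal.Quotient.mk I (monomial (cexp c) (1 : ℂ)) ∈ Submodule.span ℂ (Set.range f) := by
        rw [hspan]
        exact Submodule.subset_span ⟨⟨c, hc⟩, rfl⟩
      obtain ⟨s, hs⟩ := (Submodule.mem_span_range_iff_exists_fun ℂ).mp hmem
      refine ⟨s, fun _ _ => hc, ?_⟩
      rw [← Ideal.Quotient.eq_zero_iff_mem, map_sub, map_sum, ← hs, sub_eq_zero]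
      refine sum_congr rfl fun a _ => ?_
      rw [hf', ← smul_eq_C_mul]
      rfl
    · refine ⟨0, fun a h => absurd rfl h, ?_⟩
      simp only [Pi.zero_apply, map_zero, zero_mul, Finset.sum_const_zero, sub_zero]
      push Not at hc
      obtain ⟨i, hi⟩ := hc
      have h1 : cexp c = (cexp c - single i N) + single i N := by
        rw [tsub_add_cancel_of_le]
        exact Finsupp.single_le_iff.mpr hi
      have h2 : monomial (cexp c) (1 : ℂ) =
          monomial (cexp c - single i N) 1 * (X i : MvPowerSeries σ ℂ) ^ N := by
        rw [X_pow_eq, monomial_mul_monomial, ← h1, one_mul]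
      rw [h2]
      exact I.mul_mem_left _ (hN i)
  choose s hs1 hs2 using hs
  refine ⟨_, fun a => cexp (b a).1, s, ?_, hs1, hs2⟩
  rw [hf'] at hlin
  exact hlin

theorem exists_division_data [Fintype σ] {K : Type*} [Fintype K]
    {g0 : K → MvPowerSeries σ ℂ} {ρ0 : ℝ≥0} (hρ0 : 0 < ρ0) (hg0 : ∀ k, g0 k ∈ conv fun _ => ρ0)
    {N : ℕ} (hN : ∀ i, (X i : MvPowerSeries σ ℂ) ^ N ∈ span (Set.range g0)) :
    ∃ (d : ℕ) (b : Fin d → σ →₀ ℕ),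
      LinearIndependent ℂ
        (fun a => Ideal.Quotient.mk (span (Set.range g0)) (monomial (b a) (1 : ℂ))) ∧
      ∃ R : ℝ≥0, 0 < R ∧ ∀ ρ, 0 < ρ → ρ ≤ R → ∃ ε : ℝ≥0, 0 < ε ∧ ∀ η, 0 < η →
        ∀ g : K → MvPowerSeries (Option σ) ℂ,
          (∀ k, nrm (opt η fun _ => ρ) (emb σ (g0 k) - g k) ≤ ε) →
          ∀ h ∈ conv (opt η fun _ => ρ),
            ∃ (P : Fin d → PowerSeries ℂ) (Q : K → MvPowerSeries (Option σ) ℂ),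
              (∀ a, (P a : MvPowerSeries Unit ℂ) ∈ conv (fun _ : Unit => η)) ∧
              (∀ k, Q k ∈ conv (opt η fun _ => ρ)) ∧
              h = ∑ a, iot σ (P a) * emb σ (monomial (b a) 1) + ∑ k, Q k * g k := by
  classical
  obtain ⟨d, b, s, hlin, hs, hmem⟩ := exists_monomial_basis hN
  refine ⟨d, b, hlin, ?_⟩
  have hq : ∀ c, ∃ q : K → MvPowerSeries σ ℂ,
      ∑ k, q k * g0 k = monomial (cexp c) 1 - ∑ a, C (s c a) * monomial (b a) 1 :=
    fun c => Ideal.mem_span_range_iff_exists_fun.mp (hmem c)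
  choose qf hqf using hq
  set D : ℕ := N * Fintype.card σ with hD
  have hdeg : ∀ c : σ → Fin (N + 1), (cexp c).degree ≤ D := by
    intro c
    rw [Finsupp.degree_eq_sum]
    refine (Finset.sum_le_card_nsmul _ _ N fun i _ => ?_).trans ?_
    · rw [cexp_apply]; exact Nat.lt_succ_iff.mp (c i).2
    · rw [Finset.card_univ, smul_eq_mul, mul_comm]
  set q : (σ → Fin (N + 1)) → K → MvPowerSeries σ ℂ := fun c k => lowPart (D + 1) (qf c k) with hq
  set e : (σ → Fin (N + 1)) → MvPowerSeries σ ℂ := fun c =>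
    monomial (cexp c) 1 - ∑ a, C (s c a) * monomial (b a) 1 - ∑ k, q c k * g0 k with he
  have hqc : ∀ c k r, q c k ∈ conv r := fun c k r => lowPart_mem_conv _ _ _
  have hec : ∀ c, e c ∈ conv fun _ => ρ0 := fun c =>
    sub_mem (sub_mem (monomial_mem_conv _ _) (sum_mem fun a _ =>
      mul_mem (C_mem_conv _) (monomial_mem_conv _ _)))
      (sum_mem fun k _ => mul_mem (hqc c k _) (hg0 k))
  have he0 : ∀ c, ∀ β : σ →₀ ℕ, β.degree < D + 1 → coeff β (e c) = 0 := by
    intro c β hβ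
    have h1 : e c = ∑ k, (qf c k - q c k) * g0 k := by
      simp only [he, ← hqf, sub_mul, sum_sub_distrib]
    rw [h1, map_sum]
    refine sum_eq_zero fun k _ => coeff_mul_eq_zero_of_degree_lt (fun γ hγ => ?_) hβ
    rw [map_sub, show q c k = lowPart (D + 1) (qf c k) from rfl, lowPart, coeff_ofCoeff, if_pos hγ,
      sub_self]
  set T : ℝ≥0 := ∑ c, (nrm (fun _ => ρ0) (e c)).toNNReal with hT
  have hTc : ∀ c, nrm (fun _ => ρ0) (e c) ≤ T := by
    intro c
    rw [← ENNReal.coe_toNNReal (hec c).ne, coe_le_coe]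
    exact single_le_sum (f := fun c => (nrm (fun _ => ρ0) (e c)).toNNReal)
      (fun _ _ => zero_le) (mem_univ c)
  refine ⟨min (min 1 ρ0) (ρ0 ^ (D + 1) / (4 * (T + 1))), by positivity, fun ρ hρ hρR => ?_⟩
  have hρ1 : ρ ≤ 1 := hρR.trans ((min_le_left _ _).trans (min_le_left _ _))
  have hρρ0 : ρ ≤ ρ0 := hρR.trans ((min_le_left _ _).trans (min_le_right _ _))
  have hρT : ρ ≤ ρ0 ^ (D + 1) / (4 * (T + 1)) := hρR.trans (min_le_right _ _)
  have hm : ∀ c : σ → Fin (N + 1), ρ ^ D ≤ mono (fun _ => ρ) (cexp c) := by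
    intro c
    rw [mono_const]
    exact pow_le_pow_of_le_one zero_le hρ1 (hdeg c)
  have hen : ∀ c, nrm (fun _ => ρ) (e c) ≤ ((4⁻¹ * ρ ^ D : ℝ≥0) : ℝ≥0∞) := by
    intro c
    refine (nrm_le_of_coeff_eq_zero hρ0 hρρ0 (he0 c)).trans ?_
    refine (mul_le_mul' le_rfl (hTc c)).trans ?_
    rw [← ENNReal.coe_mul, coe_le_coe, div_pow]
    rw [le_div_iff₀ (by positivity)] at hρT
    have hpos : (0 : ℝ≥0) < ρ0 ^ (D + 1) := by positivity
    rw [div_mul_eq_mul_div, div_le_iff₀ hpos]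
    calc ρ ^ (D + 1) * T ≤ ρ ^ D * 4⁻¹ * (ρ * (4 * (T + 1))) := by
          rw [pow_succ]
          have : ρ ^ D * 4⁻¹ * (ρ * (4 * (T + 1))) = ρ ^ D * ρ * (T + 1) := by
            field_simp
          rw [this]
          gcongr
          exact le_self_add
      _ ≤ ρ ^ D * 4⁻¹ * ρ0 ^ (D + 1) := by gcongr
      _ = _ := by ring
  set T' : ℝ≥0 := ∑ c, ∑ k, (nrm (fun _ => ρ) (q c k)).toNNReal with hT'
  have hTc' : ∀ c, ∑ k, nrm (fun _ => ρ) (q c k) ≤ T' := by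
    intro c
    rw [sum_congr rfl fun k _ => (ENNReal.coe_toNNReal (hqc c k fun _ => ρ).ne).symm,
      ← ENNReal.ofNNReal_finsetSum, coe_le_coe]
    exact single_le_sum (f := fun c => ∑ k, (nrm (fun _ => ρ) (q c k)).toNNReal)
      (fun _ _ => zero_le) (mem_univ c)
  refine ⟨4⁻¹ * ρ ^ D / (T' + 1), by positivity, fun η hη g hg h hh => ?_⟩
  refine exists_division hη (fun _ => hρ) (fun a => monomial (b a) 1) g s q
    (fun c k => hqc c k _) hs (fun c => ?_) hh
  have h1 : monomial (upExp c) 1 - ∑ a, emb σ (C (s c a) * monomial (b a) 1) -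
      ∑ k, emb σ (q c k) * g k = emb σ (e c) + ∑ k, emb σ (q c k) * (emb σ (g0 k) - g k) := by
    simp only [he, map_sub, map_sum, emb_monomial_cexp, mul_sub, sum_sub_distrib, map_mul]
    ring
  rw [h1]
  refine (nrm_add_le _ _).trans ?_
  rw [nrm_emb]
  have h2 : nrm (opt η fun _ => ρ) (∑ k, emb σ (q c k) * (emb σ (g0 k) - g k)) ≤
      ((4⁻¹ * ρ ^ D : ℝ≥0) : ℝ≥0∞) := by
    calc _ ≤ ∑ k, nrm (fun _ => ρ) (q c k) * ((4⁻¹ * ρ ^ D / (T' + 1) : ℝ≥0) : ℝ≥0∞) := by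
          refine (nrm_sum_le _ _).trans (Finset.sum_le_sum fun k _ => ?_)
          refine (nrm_mul_le _ _).trans ?_
          rw [nrm_emb]
          exact mul_le_mul' le_rfl (hg k)
      _ ≤ T' * ((4⁻¹ * ρ ^ D / (T' + 1) : ℝ≥0) : ℝ≥0∞) := by
          rw [← sum_mul]
          exact mul_le_mul' (hTc' c) le_rfl
      _ ≤ _ := by
          rw [← ENNReal.coe_mul, coe_le_coe, mul_div_assoc', div_le_iff₀ (by positivity),
            mul_comm]
          gcongr
          exact le_self_add
  refine (add_le_add (hen c) h2).trans ?_
  rw [← ENNReal.coe_add, coe_le_coe]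
  calc 4⁻¹ * ρ ^ D + 4⁻¹ * ρ ^ D = 2⁻¹ * ρ ^ D := by
        rw [← add_mul]; congr 1; rw [← NNReal.coe_inj]; push_cast; norm_num
    _ ≤ _ := by gcongr; exact hm c

end DivisionData

theorem pow_card_eq_zero_of_isNilpotent {A R : Type*} [Fintype A] [CommRing R] [Algebra ℂ R]
    (v : A → R) (hv : ∀ x, ∃ s : A → ℂ, x = ∑ a, s a • v a) {x : R} (hx : IsNilpotent x) :
    x ^ Fintype.card A = 0 := by
  have htop : Submodule.span ℂ (Set.range v) = ⊤ := by
    refine eq_top_iff.mpr fun y _ => ?_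
    obtain ⟨s, hs⟩ := hv y
    exact (Submodule.mem_span_range_iff_exists_fun ℂ).mpr ⟨s, hs.symm⟩
  have hfin : Module.Finite ℂ R := ⟨⟨(Set.finite_range v).toFinset, by simpa using htop⟩⟩
  have hrank : Module.finrank ℂ R ≤ Fintype.card A := by
    have := finrank_range_le_card (R := ℂ) v
    rwa [Set.finrank, htop, finrank_top] at this
  obtain ⟨n, hn⟩ := hx
  have h1 : (1 : R) ∈ LinearMap.ker (Algebra.lmul ℂ R x ^ n) := by
    rw [mem_ker, ← map_pow, hn]; simp
  have h2 := LinearMap.mem_ker.mp (Module.End.ker_pow_le_ker_pow_finrank _ n h1)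
  rw [← map_pow] at h2
  have h3 : x ^ Module.finrank ℂ R = 0 := by simpa using h2
  exact pow_eq_zero_of_le hrank h3

theorem finite_quotient_and_pow_mem {A S : Type*} [Fintype A] [CommRing S] [Algebra ℂ S]
    {I : Ideal S} (v : A → S) (hv : ∀ x, ∃ s : A → ℂ, x - ∑ a, s a • v a ∈ I) :
    Module.Finite ℂ (S ⧸ I) ∧ ∀ x ∈ I.radical, x ^ Fintype.card A ∈ I := by
  have hspan : ∀ x : S ⧸ I, ∃ s : A → ℂ, x = ∑ a, s a • Ideal.Quotient.mk I (v a) := by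
    intro x
    obtain ⟨h, rfl⟩ := Ideal.Quotient.mk_surjective x
    obtain ⟨s, hs⟩ := hv h
    refine ⟨s, ?_⟩
    rw [← Ideal.Quotient.eq_zero_iff_mem, map_sub, sub_eq_zero] at hs
    rw [hs, map_sum]
    rfl
  refine ⟨⟨⟨(Set.finite_range fun a => Ideal.Quotient.mk I (v a)).toFinset, ?_⟩⟩, ?_⟩
  · rw [Set.Finite.coe_toFinset]
    refine eq_top_iff.mpr fun y _ => ?_
    obtain ⟨s, hs⟩ := hspan y
    exact (Submodule.mem_span_range_iff_exists_fun ℂ).mpr ⟨s, hs.symm⟩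
  · rintro x ⟨n, hn⟩
    rw [← Ideal.Quotient.eq_zero_iff_mem, map_pow] at hn ⊢
    exact pow_card_eq_zero_of_isNilpotent _ hspan ⟨n, hn⟩

section Fibre

variable {σ A K : Type*} [Fintype σ] [Fintype A] [Fintype K]

/-- Division with remainder by the family `g`, the remainders being combinations of the family `b`
with coefficients in the distinguished variable. -/
def HasDivision (η : ℝ≥0) (ρ : σ → ℝ≥0) (b : A → MvPowerSeries σ ℂ)
    (g : K → MvPowerSeries (Option σ) ℂ) : Prop :=
  ∀ h ∈ conv (opt η ρ), ∃ (P : A → PowerSeries ℂ) (Q : K → MvPowerSeries (Option σ) ℂ),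
    (∀ a, (P a : MvPowerSeries Unit ℂ) ∈ conv (fun _ : Unit => η)) ∧
    (∀ k, Q k ∈ conv (opt η ρ)) ∧ h = ∑ a, iot σ (P a) * emb σ (b a) + ∑ k, Q k * g k

theorem iot_C (a : ℂ) : iot σ (PowerSeries.C a) = C a := by
  classical
  ext β
  rw [coeff_iot, PowerSeries.coeff_C, coeff_C]
  by_cases h : β = 0
  · subst h; simp
  · rw [if_neg h]
    by_cases h1 : β.some = 0
    · rw [if_pos h1, if_neg]
      intro h2
      apply h
      ext i
      cases i with
      | none => exact h2
      | some i => exact DFunLike.congr_fun h1 i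
    · rw [if_neg h1]

theorem iot_X : iot σ PowerSeries.X = X none := by
  classical
  ext β
  rw [coeff_iot, PowerSeries.coeff_X, coeff_X]
  by_cases h1 : β.some = 0
  · rw [if_pos h1]
    congr 1
    apply propext
    constructor
    · intro h2
      ext i
      cases i with
      | none => simp [h2]
      | some i =>
        have := DFunLike.congr_fun h1 i
        simpa using this
    · rintro rfl; simp
  · rw [if_neg h1, if_neg]
    rintro rfl
    apply h1
    ext i; simp

theorem iot_mem_conv {η : ℝ≥0} {ρ : σ → ℝ≥0} {c : PowerSeries ℂ}
    (hc : (c : MvPowerSeries Unit ℂ) ∈ conv (fun _ : Unit => η)) : iot σ c ∈ conv (opt η ρ) := by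
  rw [mem_conv, nrm_iot]; exact hc

theorem emb_mem_conv {η : ℝ≥0} {ρ : σ → ℝ≥0} {c : MvPowerSeries σ ℂ}
    (hc : c ∈ conv ρ) : emb σ c ∈ conv (opt η ρ) := by
  rw [mem_conv, nrm_emb]; exact hc

variable {η : ℝ≥0} {ρ : σ → ℝ≥0} {b : A → MvPowerSeries σ ℂ}
  {g : K → MvPowerSeries (Option σ) ℂ}

/-- Division with remainder on the fibre over `τ`. -/
theorem HasDivision.fibre (hdiv : HasDivision η ρ b g) (hb : ∀ a, b a ∈ conv ρ) {τ : ℂ}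
    (hτ : ‖τ‖₊ < η) {h : MvPowerSeries (Option σ) ℂ} (hh : h ∈ conv (opt η ρ)) :
    ∃ (s : A → ℂ) (Q : K → MvPowerSeries (Option σ) ℂ) (R : MvPowerSeries (Option σ) ℂ),
      (∀ k, Q k ∈ conv (opt η ρ)) ∧ R ∈ conv (opt η ρ) ∧
      h = ∑ a, C (s a) * emb σ (b a) + (∑ k, Q k * g k + (X none - C τ) * R) := by
  obtain ⟨P, Q, hP, hQ, hPQ⟩ := hdiv h hh
  choose P' hP' hPP' using fun a => exists_sub_ev_eq_mul hτ (hP a)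
  refine ⟨fun a => ev (fun _ : Unit => τ) (P a), Q, ∑ a, iot σ (P' a) * emb σ (b a), hQ,
    sum_mem fun a _ => mul_mem (iot_mem_conv (hP' a)) (emb_mem_conv (hb a)), ?_⟩
  have h1 : ∀ a, iot σ (P a) = C (ev (fun _ : Unit => τ) (P a)) + (X none - C τ) * iot σ (P' a) := by
    intro a
    have := congrArg (iot σ) (hPP' a)
    rw [map_sub, map_mul, map_sub, iot_C, iot_C, iot_X, sub_eq_iff_eq_add'] at this
    exact this
  have h2 : ∑ a, iot σ (P a) * emb σ (b a) = ∑ a, C (ev (fun _ : Unit => τ) (P a)) * emb σ (b a) +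
      (X none - C τ) * ∑ a, iot σ (P' a) * emb σ (b a) := by
    rw [mul_sum, ← sum_add_distrib]
    refine sum_congr rfl fun a _ => ?_
    rw [h1]; ring
  rw [hPQ, h2]
  ring

/-- A function vanishing on the zeros in the fibre over `τ` has a power in the ideal of the
fibre. -/
theorem HasDivision.exists_pow_fibre (hdiv : HasDivision η ρ b g) (hρ : ∀ i, 0 < ρ i)
    (hb : ∀ a, b a ∈ conv ρ) (hg : ∀ k, g k ∈ conv (opt η ρ)) {τ : ℂ} (hτ : ‖τ‖₊ < η)
    {φ : MvPowerSeries (Option σ) ℂ} (hφ : φ ∈ conv (opt η ρ))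
    (hzero : ∀ z : σ → ℂ, (∀ i, ‖z i‖₊ ≤ ρ i) → (∀ k, ev (opt τ z) (g k) = 0) →
      ev (opt τ z) φ = 0) :
    ∃ (Q : K → MvPowerSeries (Option σ) ℂ) (R : MvPowerSeries (Option σ) ℂ),
      (∀ k, Q k ∈ conv (opt η ρ)) ∧ R ∈ conv (opt η ρ) ∧
      φ ^ Fintype.card A = ∑ k, Q k * g k + (X none - C τ) * R := by
  classical
  have hη : 0 < η := lt_of_le_of_lt zero_le hτ
  set T : conv (opt η ρ) := ⟨X none - C τ, sub_mem (X_mem_conv _) (C_mem_conv _)⟩ with hT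
  set G : Option K → conv (opt η ρ) := opt T fun k => ⟨g k, hg k⟩ with hG
  set I : Ideal (conv (opt η ρ)) := span (Set.range G) with hI
  obtain ⟨hfin, hpowmem⟩ := finite_quotient_and_pow_mem (S := conv (opt η ρ)) (I := I)
    (fun a => ⟨emb σ (b a), emb_mem_conv (hb a)⟩) (fun x => by
      obtain ⟨s, Q, R, hQ, hR, he⟩ := hdiv.fibre hb hτ x.2
      refine ⟨s, ?_⟩
      rw [hI, mem_span_range_iff_exists_fun]
      refine ⟨opt ⟨R, hR⟩ fun k => ⟨Q k, hQ k⟩, ?_⟩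
      apply Subtype.ext
      rw [Fintype.sum_option]
      have h1 : ((⟨R, hR⟩ * T + ∑ k, (⟨Q k, hQ k⟩ : conv (opt η ρ)) * ⟨g k, hg k⟩ :
          conv (opt η ρ)) : MvPowerSeries (Option σ) ℂ) = R * (X none - C τ) + ∑ k, Q k * g k := by
        rw [hT]; push_cast; rfl
      have h2 : ((x - ∑ a, s a • (⟨emb σ (b a), emb_mem_conv (hb a)⟩ : conv (opt η ρ)) :
          conv (opt η ρ)) : MvPowerSeries (Option σ) ℂ) = x - ∑ a, C (s a) * emb σ (b a) := by
        push_cast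
        simp only [smul_eq_C_mul]
      refine h1.trans (Eq.trans ?_ h2.symm)
      rw [he]
      ring)
  have hrad : (⟨φ, hφ⟩ : conv (opt η ρ)) ∈ I.radical := by
    refine mem_radical_of_finite (opt_pos hη hρ) I hfin fun z hz h0 => ?_
    have hzT := h0 T (subset_span ⟨none, rfl⟩)
    have hz0 : z none = τ := by
      have h1 : T = ⟨X none, X_mem_conv _⟩ - algebraMap ℂ (conv (opt η ρ)) τ := rfl
      rw [h1, map_sub, AlgHom.commutes, evHom_apply, sub_eq_zero] at hzT
      change ev z (monomial (single none 1) 1) = τ at hzT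
      rw [ev_monomial, mono_single, pow_one, one_mul] at hzT
      exact hzT
    have hzz : z = opt τ fun i => z (some i) := by
      funext i
      cases i with
      | none => exact hz0
      | some i => rfl
    rw [evHom_apply, hzz]
    refine hzero _ (fun i => hz (some i)) fun k => ?_
    rw [← hzz]
    exact h0 (G (some k)) (subset_span ⟨some k, rfl⟩)
  have hpow := hpowmem _ hrad
  rw [hI, mem_span_range_iff_exists_fun] at hpow
  obtain ⟨c, hc⟩ := hpow
  refine ⟨fun k => c (some k), c none, fun k => (c (some k)).2, (c none).2, ?_⟩
  have h1 := congrArg Subtype.val hc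
  rw [Fintype.sum_option] at h1
  have h2 : φ ^ Fintype.card A = ((c none * T + ∑ k, c (some k) * ⟨g k, hg k⟩ : conv (opt η ρ)) :
      MvPowerSeries (Option σ) ℂ) := h1.symm
  rw [h2]
  push_cast
  rw [hT]
  ring

/-- A function vanishing on all zeros has a power in the ideal, provided the remainders of the
division are unique. -/
theorem HasDivision.pow_mem_span (hdiv : HasDivision η ρ b g) (hρ : ∀ i, 0 < ρ i) (hη : 0 < η)
    (hb : ∀ a, b a ∈ conv ρ) (hg : ∀ k, g k ∈ conv (opt η ρ))
    (hind : ∀ P : A → PowerSeries ℂ, ∑ a, iot σ (P a) * emb σ (b a) ∈ span (Set.range g) →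
      ∀ a, P a = 0)
    {φ : MvPowerSeries (Option σ) ℂ} (hφ : φ ∈ conv (opt η ρ))
    (hzero : ∀ (τ : ℂ) (z : σ → ℂ), ‖τ‖₊ < η → (∀ i, ‖z i‖₊ ≤ ρ i) →
      (∀ k, ev (opt τ z) (g k) = 0) → ev (opt τ z) φ = 0) :
    φ ^ Fintype.card A ∈ span (Set.range g) := by
  obtain ⟨P, Q, hP, hQ, hPQ⟩ := hdiv _ (pow_mem hφ (Fintype.card A))
  have hP0 : ∀ a, P a = 0 := by
    intro a
    refine eq_zero_of_ev_eq_zero hη (hP a) fun τ _ hτ => ?_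
    obtain ⟨Q', R, hQ', hR, he⟩ := hdiv.exists_pow_fibre hρ hb hg hτ hφ (fun z => hzero τ z hτ)
    obtain ⟨D, Q'', hD, hQ'', hDQ⟩ := hdiv R hR
    have hmem : ∀ q : K → MvPowerSeries (Option σ) ℂ, ∑ k, q k * g k ∈ span (Set.range g) :=
      fun q => Ideal.mem_span_range_iff_exists_fun.mpr ⟨q, rfl⟩
    have h1 := hind (fun a => P a - (PowerSeries.X - PowerSeries.C τ) * D a) (by
      have h2 : ∑ a, iot σ (P a - (PowerSeries.X - PowerSeries.C τ) * D a) * emb σ (b a) =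
          ∑ k, (Q' k - Q k + (X none - C τ) * Q'' k) * g k := by
        have h3 : ∑ a, iot σ (P a - (PowerSeries.X - PowerSeries.C τ) * D a) * emb σ (b a) =
            ∑ a, iot σ (P a) * emb σ (b a) - (X none - C τ) * ∑ a, iot σ (D a) * emb σ (b a) := by
          rw [mul_sum, ← sum_sub_distrib]
          refine sum_congr rfl fun a _ => ?_
          rw [map_sub, map_mul, map_sub, iot_X, iot_C]; ring
        have h5 : ∑ k, (Q' k - Q k + (X none - C τ) * Q'' k) * g k =
            ∑ k, Q' k * g k - ∑ k, Q k * g k + (X none - C τ) * ∑ k, Q'' k * g k := by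
          rw [mul_sum, ← sum_sub_distrib, ← sum_add_distrib]
          exact sum_congr rfl fun k _ => by ring
        rw [h3, h5]
        have h4 : ∑ a, iot σ (P a) * emb σ (b a) + ∑ k, Q k * g k =
          ∑ k, Q' k * g k + (X none - C τ) * (∑ a, iot σ (D a) * emb σ (b a) + ∑ k, Q'' k * g k) := by
          rw [← hPQ, ← hDQ]; exact he
        linear_combination h4
      rw [h2]; exact hmem _) a
    have hz : ∀ _ : Unit, ‖τ‖₊ ≤ η := fun _ => hτ.le
    set X' : conv (fun _ : Unit => η) := ⟨X () - C τ, sub_mem (X_mem_conv _) (C_mem_conv _)⟩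
    have h2 : (⟨P a, hP a⟩ : conv (fun _ : Unit => η)) = X' * ⟨D a, hD a⟩ := by
      apply Subtype.ext
      exact sub_eq_zero.mp h1
    have h3 := congrArg (evHom (fun _ : Unit => τ) hz) h2
    have h4 : evHom (fun _ : Unit => τ) hz X' = 0 := by
      have h5 : X' = ⟨X (), X_mem_conv _⟩ - algebraMap ℂ (conv (fun _ : Unit => η)) τ := rfl
      rw [h5, map_sub, AlgHom.commutes, evHom_apply, sub_eq_zero]
      change ev (fun _ : Unit => τ) (monomial (single () 1) 1) = τ
      rw [ev_monomial, mono_single, pow_one, one_mul]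
    rw [map_mul, h4, zero_mul] at h3
    exact h3
  rw [hPQ]
  simp only [hP0, map_zero, zero_mul, Finset.sum_const_zero, zero_add]
  exact Ideal.mem_span_range_iff_exists_fun.mpr ⟨Q, rfl⟩

end Fibre

/-- A relation matrix acting by zero has its determinant acting by zero. -/
theorem map_det_mul_eq_zero {A S Q : Type*} [Fintype A] [DecidableEq A] [CommRing S] [CommRing Q]
    (ψ : S →+* Q) (M : Matrix A A S) (β : A → Q) (h : ∀ a, ∑ c, ψ (M a c) * β c = 0) (a : A) :
    ψ M.det * β a = 0 := by
  have h1 : (M.map ψ).mulVec β = 0 := funext fun a => h a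
  have h2 : ((M.map ψ).adjugate * M.map ψ).mulVec β = 0 := by
    rw [← Matrix.mulVec_mulVec, h1, Matrix.mulVec_zero]
  rw [Matrix.adjugate_mul, Matrix.smul_mulVec, Matrix.one_mulVec] at h2
  have h3 := congrFun h2 a
  rw [RingHom.map_det]
  exact h3

theorem exists_X_pow_dvd {c : PowerSeries ℂ} (hc : c ≠ 0) : ∃ L : ℕ, c ∣ PowerSeries.X ^ L := by
  refine ⟨c.order.toNat, ?_⟩
  obtain ⟨u, hu⟩ := PowerSeries.isUnit_divided_by_X_pow_order hc
  refine ⟨((u⁻¹ : (PowerSeries ℂ)ˣ) : PowerSeries ℂ), ?_⟩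
  conv_rhs => rw [← PowerSeries.X_pow_order_mul_divXPowOrder (f := c), ← hu, mul_assoc]
  rw [Units.mul_inv, mul_one]

section Isolated

variable {σ A K : Type*} [Fintype σ] [Fintype A] [Fintype K]

variable {η : ℝ≥0} {ρ : σ → ℝ≥0} {b : A → MvPowerSeries σ ℂ}
  {g : K → MvPowerSeries (Option σ) ℂ}

/-- If some fibre has no zeros, then a power of the distinguished variable is in the ideal. -/
theorem HasDivision.exists_X_pow_mem (hdiv : HasDivision η ρ b g) (hρ : ∀ i, 0 < ρ i)
    (hb : ∀ a, b a ∈ conv ρ) (hg : ∀ k, g k ∈ conv (opt η ρ)) {τ : ℂ} (hτ : ‖τ‖₊ < η)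
    (hzero : ∀ z : σ → ℂ, (∀ i, ‖z i‖₊ ≤ ρ i) → ¬ ∀ k, ev (opt τ z) (g k) = 0) :
    ∃ L : ℕ, (X none : MvPowerSeries (Option σ) ℂ) ^ L ∈ span (Set.range g) := by
  classical
  obtain ⟨Q, R, hQ, hR, he⟩ := hdiv.exists_pow_fibre hρ hb hg hτ (φ := 1) (one_mem _)
    fun z hz h0 => absurd h0 (hzero z hz)
  rw [one_pow] at he
  set I := span (Set.range g) with hI
  have hmem : ∀ q : K → MvPowerSeries (Option σ) ℂ, ∑ k, q k * g k ∈ I :=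
    fun q => Ideal.mem_span_range_iff_exists_fun.mpr ⟨q, rfl⟩
  choose D Q' hD hQ' hDQ using fun a => hdiv (R * emb σ (b a)) (mul_mem hR (emb_mem_conv (hb a)))
  obtain ⟨E, Q'', hE, hQ'', hEQ⟩ := hdiv 1 (one_mem _)
  set S := conv (fun _ : Unit => η)
  set T : S := ⟨X () - C τ, sub_mem (X_mem_conv _) (C_mem_conv _)⟩ with hT
  set M : Matrix A A S := 1 - T • Matrix.of fun a c => ⟨D a c, hD a c⟩ with hM
  set ι : S →+* MvPowerSeries (Option σ) ℂ := (iot σ).comp (S.val : S →+* MvPowerSeries Unit ℂ)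
    with hι
  have hιT : ι T = X none - C τ := by
    have : iot σ (PowerSeries.X - PowerSeries.C τ) = X none - C τ := by rw [map_sub, iot_X, iot_C]
    exact this
  set ψ : S →+* _ := (Ideal.Quotient.mk I).comp ι with hψ
  have hrel : ∀ a, ∑ c, ψ (M a c) * Ideal.Quotient.mk I (emb σ (b c)) = 0 := by
    intro a
    have h1 : ∀ c, M a c = (if a = c then 1 else 0) - T * ⟨D a c, hD a c⟩ := by
      intro c; rw [hM, Matrix.sub_apply, Matrix.one_apply]; rfl
    have h2 : ∀ c, ι (M a c) * emb σ (b c) = (if a = c then emb σ (b c) else 0) -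
        (X none - C τ) * (iot σ (D a c) * emb σ (b c)) := by
      intro c
      rw [h1, map_sub, map_mul, hιT, sub_mul, mul_assoc]
      congr 1
      split_ifs
      · rw [map_one, one_mul]
      · rw [map_zero, zero_mul]
    have h3 : ∑ c, ι (M a c) * emb σ (b c) =
        emb σ (b a) - (X none - C τ) * ∑ c, iot σ (D a c) * emb σ (b c) := by
      rw [sum_congr rfl fun c _ => h2 c, sum_sub_distrib, mul_sum]
      simp
    have h4 : ∑ c, ι (M a c) * emb σ (b c) ∈ I := by
      have h5 : ∑ c, ι (M a c) * emb σ (b c) = emb σ (b a) * ∑ k, Q k * g k +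
          (X none - C τ) * ∑ k, Q' a k * g k := by
        rw [h3]
        linear_combination emb σ (b a) * he + (X none - C τ) * hDQ a
      rw [h5]
      exact add_mem (I.mul_mem_left _ (hmem _)) (I.mul_mem_left _ (hmem _))
    rw [← Ideal.Quotient.eq_zero_iff_mem, map_sum] at h4
    rw [← h4]
    exact sum_congr rfl fun c _ =>
      (map_mul (Ideal.Quotient.mk I) (ι (M a c)) (emb σ (b c))).symm
  have hdet := map_det_mul_eq_zero ψ M _ hrel
  have hdet1 : ι M.det ∈ I := by
    have h1 : ι M.det = ∑ a, iot σ (E a) * (ι M.det * emb σ (b a)) + ι M.det * ∑ k, Q'' k * g k := by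
      have h2 : ∑ a, iot σ (E a) * (ι M.det * emb σ (b a)) =
          ι M.det * ∑ a, iot σ (E a) * emb σ (b a) := by
        rw [mul_sum]
        exact sum_congr rfl fun a _ => by ring
      rw [h2]
      linear_combination ι M.det * hEQ
    rw [h1]
    refine add_mem (sum_mem fun a _ => I.mul_mem_left _ ?_) (I.mul_mem_left _ (hmem _))
    rw [← Ideal.Quotient.eq_zero_iff_mem, map_mul]
    exact hdet a
  have hz : ∀ _ : Unit, ‖τ‖₊ ≤ η := fun _ => hτ.le
  have hne : (M.det : MvPowerSeries Unit ℂ) ≠ 0 := by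
    intro h0
    have h1 : M.det = 0 := Subtype.ext h0
    have h2 := congrArg (evHom (fun _ : Unit => τ) hz : S →+* ℂ) h1
    rw [RingHom.map_det, map_zero] at h2
    have h4 : evHom (fun _ : Unit => τ) hz T = 0 := by
      have h5 : T = ⟨X (), X_mem_conv _⟩ - algebraMap ℂ S τ := rfl
      rw [h5, map_sub, AlgHom.commutes, evHom_apply, sub_eq_zero]
      change ev (fun _ : Unit => τ) (monomial (single () 1) 1) = τ
      rw [ev_monomial, mono_single, pow_one, one_mul]
    have h3 : (evHom (fun _ : Unit => τ) hz : S →+* ℂ).mapMatrix M = 1 := by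
      ext a c
      have h1 : M a c = (1 : Matrix A A S) a c - T * ⟨D a c, hD a c⟩ := by
        rw [hM, Matrix.sub_apply]; rfl
      change evHom (fun _ : Unit => τ) hz (M a c) = _
      rw [h1, map_sub, map_mul, h4, zero_mul, sub_zero, Matrix.one_apply, Matrix.one_apply]
      split_ifs <;> simp
    rw [h3, Matrix.det_one] at h2
    exact one_ne_zero h2
  obtain ⟨L, c, hc⟩ := exists_X_pow_dvd (c := (M.det : MvPowerSeries Unit ℂ)) hne
  refine ⟨L, ?_⟩
  rw [← iot_X, ← map_pow, hc, map_mul]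
  exact I.mul_mem_right _ hdet1

end Isolated

theorem X_none_dvd_sub_emb_atZero {σ : Type*} (h : MvPowerSeries (Option σ) ℂ) :
    X none ∣ h - emb σ (atZero σ h) := by
  rw [X_dvd_iff]
  intro β hβ
  rw [coeff_sub_emb_atZero, if_pos hβ]

theorem emb_X {σ : Type*} (i : σ) : emb σ (X i) = X (some i) := by
  classical
  ext β
  rw [coeff_emb, coeff_X, coeff_X]
  have h : β = single (some i) 1 ↔ β none = 0 ∧ β.some = single i 1 := by
    constructor
    · rintro rfl
      refine ⟨by simp, ?_⟩
      ext j; simp [Finsupp.single_apply]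
    · rintro ⟨h1, h2⟩
      ext j
      cases j with
      | none => simp [h1]
      | some j =>
        have := DFunLike.congr_fun h2 j
        rw [Finsupp.some_apply] at this
        simp [this, Finsupp.single_apply]
  by_cases h1 : β none = 0
  · rw [if_pos h1]; simp [h, h1]
  · rw [if_neg h1]; simp [h, h1]

theorem nrm_rename {α β : Type*} (e : α ≃ β) (r : ℝ≥0) (g : MvPowerSeries α ℂ) :
    nrm (fun _ => r) (rename e g) = nrm (fun _ => r) g := by
  refine nrm_transfer (Finsupp.embDomain_injective e.toEmbedding)
    (fun γ => coeff_embDomain_rename e.toEmbedding g γ) (fun γ hγ => ?_) (fun γ => ?_)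
  · exact coeff_rename_eq_zero e g (by
      rintro ⟨δ, rfl⟩
      exact hγ ⟨δ, Finsupp.embDomain_eq_mapDomain e.toEmbedding δ⟩)
  · rw [mono, Finsupp.prod_embDomain]; rfl

theorem ev_rename {α β : Type*} (e : α ≃ β) (z : β → ℂ) (g : MvPowerSeries α ℂ) :
    ev z (rename e g) = ev (z ∘ e) g := by
  refine ev_transfer (Finsupp.embDomain_injective e.toEmbedding)
    (fun γ => coeff_embDomain_rename e.toEmbedding g γ) (fun γ hγ => ?_) (fun γ => ?_)
  · exact coeff_rename_eq_zero e g (by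
      rintro ⟨δ, rfl⟩
      exact hγ ⟨δ, Finsupp.embDomain_eq_mapDomain e.toEmbedding δ⟩)
  · rw [mono, Finsupp.prod_embDomain]; rfl

theorem exists_pow_mem_of_mem_radical {ι R : Type*} [Finite ι] [CommRing R] {I : Ideal R}
    {x : ι → R} (h : ∀ i, x i ∈ I.radical) : ∃ N : ℕ, ∀ i, x i ^ N ∈ I := by
  have := Fintype.ofFinite ι
  choose n hn using h
  exact ⟨∑ i, n i, fun i => I.pow_mem_of_pow_mem (hn i)
    (single_le_sum (f := n) (fun _ _ => zero_le) (mem_univ i))⟩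

theorem nrm_opt_le_const {σ : Type*} {η ρ r : ℝ≥0} (hη : η ≤ r) (hρ : ρ ≤ r)
    (h : MvPowerSeries (Option σ) ℂ) : nrm (opt η fun _ => ρ) h ≤ nrm (fun _ => r) h :=
  nrm_mono_weight (fun i => by
    cases i with
    | none => exact hη
    | some i => exact hρ) _

/-- Uniform division for all bounded families with a given zero-dimensional special fibre. -/
theorem exists_hasDivision {σ K : Type*} [Fintype σ] [Fintype K] {g0 : K → MvPowerSeries σ ℂ}
    {r : ℝ≥0} (hr : 0 < r) (hg0 : ∀ k, g0 k ∈ conv fun _ => r) {N : ℕ}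
    (hN : ∀ i, X i ^ N ∈ span (Set.range g0)) (T : ℝ≥0) :
    ∃ (d : ℕ) (b : Fin d → σ →₀ ℕ),
      LinearIndependent ℂ (fun a =>
        Ideal.Quotient.mk (span (Set.range g0)) (monomial (b a) (1 : ℂ))) ∧
      ∃ η ρ : ℝ≥0, 0 < η ∧ η ≤ r ∧ 0 < ρ ∧ ρ ≤ r ∧ ∀ g : K → MvPowerSeries (Option σ) ℂ,
        (∀ k, atZero σ (g k) = g0 k) → (∀ k, nrm (fun _ => r) (g k) ≤ T) →
        HasDivision η (fun _ => ρ) (fun a => monomial (b a) 1) g := by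
  obtain ⟨d, b, hb, R, hR, hdata⟩ := exists_division_data hr hg0 hN
  set ρ := min R r with hρ
  have hρ0 : 0 < ρ := lt_min hR hr
  obtain ⟨ε, hε, hdata⟩ := hdata ρ hρ0 (min_le_left _ _)
  set η : ℝ≥0 := min r (ε * r / (T + 1)) with hη
  have hη0 : 0 < η := lt_min hr (by positivity)
  have hηr : η ≤ r := min_le_left _ _
  refine ⟨d, b, hb, η, ρ, hη0, hηr, hρ0, min_le_right _ _, fun g hg hT => ?_⟩
  refine hdata η hη0 g fun k => ?_
  rw [nrm_sub_comm, ← hg]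
  refine (nrm_sub_emb_atZero_le hr hηr _ _).trans ((mul_le_mul' le_rfl
    ((nrm_opt_le_const le_rfl (min_le_right R r) _).trans (hT k))).trans ?_)
  rw [← ENNReal.coe_mul, coe_le_coe, div_mul_eq_mul_div, div_le_iff₀ hr]
  have h1 : η * (T + 1) ≤ ε * r := by
    rw [← le_div_iff₀ (by positivity)]; exact min_le_right _ _
  refine le_trans ?_ h1
  gcongr
  exact le_self_add

/-- The Nullstellensatz at an isolated zero of convergent power series. -/
theorem X_mem_radical_of_isolated {K : Type*} [Fintype K] (σ : Type*) [Fintype σ] :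
    ∀ (g : K → MvPowerSeries σ ℂ) (r : ℝ≥0), 0 < r → (∀ k, g k ∈ conv fun _ => r) →
      (∀ z : σ → ℂ, (∀ i, ‖z i‖₊ ≤ r) → (∀ k, ev z (g k) = 0) → z = 0) →
      ∀ i, X i ∈ (span (Set.range g)).radical := by
  classical
  refine Fintype.induction_empty_option (P := fun (σ : Type _) _ =>
    ∀ (g : K → MvPowerSeries σ ℂ) (r : ℝ≥0), 0 < r → (∀ k, g k ∈ conv fun _ => r) →
      (∀ z : σ → ℂ, (∀ i, ‖z i‖₊ ≤ r) → (∀ k, ev z (g k) = 0) → z = 0) →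
      ∀ i, X i ∈ (span (Set.range g)).radical) ?_ ?_ ?_ σ
  · intro α β _ e ih g r hr hg hz i
    have h1 := ih (fun k => rename e.symm (g k)) r hr
      (fun k => by rw [mem_conv, nrm_rename]; exact hg k) (fun z hzr h0 => by
        have h2 := hz (z ∘ e.symm) (fun i => hzr _) (fun k => by
          rw [← ev_rename]; exact h0 k)
        funext a
        have := congrFun h2 (e a)
        simpa using this) (e.symm i)
    obtain ⟨n, hn⟩ := h1
    refine ⟨n, ?_⟩
    obtain ⟨c, hc⟩ := Ideal.mem_span_range_iff_exists_fun.mp hn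
    rw [mem_span_range_iff_exists_fun]
    refine ⟨fun k => rename e (c k), ?_⟩
    have := congrArg (rename (R := ℂ) e) hc
    simpa [map_sum, map_mul, map_pow, rename_rename] using this
  · intro g r hr hg hz i; exact i.elim
  · intro α _ ih g r hr hg hz
    set g0 : K → MvPowerSeries α ℂ := fun k => atZero α (g k) with hg0
    have hro : (fun _ : Option α => r) = opt r fun _ => r := by
      funext i; cases i <;> rfl
    have hg0c : ∀ k, g0 k ∈ conv fun _ => r := by
      intro k
      refine (nrm_atZero_le r (fun _ => r) (g k)).trans_lt ?_
      rw [← hro]; exact hg k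
    have hrad := ih g0 r hr hg0c (fun z hzr h0 => by
      have h1 := hz (opt 0 z) (fun i => by
        cases i with
        | none => simp [opt]
        | some i => exact hzr i) (fun k => by rw [ev_opt_zero]; exact h0 k)
      funext a
      exact congrFun h1 (some a))
    obtain ⟨N, hN⟩ := exists_pow_mem_of_mem_radical hrad
    obtain ⟨d, b, -, η, ρ, hη0, hηr, hρ0, hρr, hdata⟩ := exists_hasDivision hr hg0c hN
      (∑ k, (nrm (fun _ => r) (g k)).toNNReal)
    have hdiv := hdata g (fun _ => rfl) fun k => by
      rw [← ENNReal.coe_toNNReal (hg k).ne, coe_le_coe]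
      exact single_le_sum (f := fun k => (nrm (fun _ => r) (g k)).toNNReal)
        (fun _ _ => zero_le) (mem_univ k)
    have hgc : ∀ k, g k ∈ conv (opt η fun _ => ρ) := fun k =>
      (nrm_opt_le_const hηr hρr _).trans_lt (hg k)
    set τ : ℂ := (((η / 2 : ℝ≥0) : ℝ) : ℂ) with hτ
    have hτn : ‖τ‖₊ = η / 2 := by
      rw [hτ]
      apply NNReal.eq
      rw [coe_nnnorm, Complex.norm_real, Real.norm_eq_abs, NNReal.abs_eq]
    have hτη : ‖τ‖₊ < η := by
      rw [hτn]; exact half_lt_self hη0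
    have hτ0 : τ ≠ 0 := by
      rw [← nnnorm_ne_zero_iff, hτn]; exact (half_pos hη0).ne'
    obtain ⟨L, hL⟩ := hdiv.exists_X_pow_mem (fun _ => hρ0) (fun a => monomial_mem_conv _ _) hgc hτη
      (fun z hzr h0 => by
        have h1 := hz (opt τ z) (fun i => by
          cases i with
          | none => exact hτη.le.trans hηr
          | some i => exact (hzr i).trans hρr) h0
        exact hτ0 (congrFun h1 none))
    have hnone : X none ∈ (span (Set.range g)).radical := ⟨L, hL⟩
    intro i
    cases i with
    | none => exact hnone
    | some i =>
      have h1 : (X (some i) : MvPowerSeries (Option α) ℂ) ^ N ∈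
          (span (Set.range g)).radical := by
        obtain ⟨c, hc⟩ := Ideal.mem_span_range_iff_exists_fun.mp (hN i)
        rw [← emb_X, ← map_pow, ← hc, map_sum]
        refine sum_mem fun k _ => ?_
        rw [map_mul]
        refine mul_mem_left _ _ ?_
        have h2 : emb α (g0 k) = g k - (g k - emb α (atZero α (g k))) := by
          rw [sub_sub_cancel]
        rw [h2]
        refine sub_mem (Ideal.le_radical (subset_span ⟨k, rfl⟩)) ?_
        obtain ⟨c', hc'⟩ := X_none_dvd_sub_emb_atZero (g k)
        rw [hc']
        exact mul_mem_right _ _ hnone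
      exact (Ideal.radical_isRadical _) ⟨N, h1⟩

end NonSplit

namespace NonSplit

open PowerSeries (C X X_dvd_iff coeff coeff_C_mul coeff_X_pow_mul' coeff_derivative coeff_expand coeff_expand_mul coeff_succ_X_mul coeff_zero_eq_constantCoeff_apply constantCoeff constantCoeff_C constantCoeff_expand derivative expand)

namespace FSec

section Line

variable {k : Type*} [Field k] {m : ℕ} {F : BR k m}

/-- Independence modulo the special fibre gives independence over the parameter ring. -/
theorem eq_zero_of_sum_mem {A : Type*} [Fintype A] {b : A → 𝒪 m k} {N : ℕ}
    (hN : maxId m k ^ N ≤ jac (constantCoeff F))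
    (hb : LinearIndependent k fun a =>
      Ideal.Quotient.mk (jac (constantCoeff F)) (b a)) {P : A → PowerSeries k}
    (h : ∑ a, iota k m (P a) * C (b a) ∈ span (Set.range (grad F))) (a : A) :
    P a = 0 := by
  have key : ∀ (P : A → PowerSeries k),
      ∑ a, iota k m (P a) * C (b a) ∈ span (Set.range (grad F)) →
      ∀ a, coeff 0 (P a) = 0 := by
    intro P h
    obtain ⟨c, hc⟩ := Ideal.mem_span_range_iff_exists_fun.1 h
    have h1 := congrArg (constantCoeff (R := 𝒪 m k)) hc
    rw [map_sum, map_sum] at h1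
    have h2 : ∑ a, coeff 0 (P a) • b a ∈ jac (constantCoeff F) := by
      have h3 : ∑ a, coeff 0 (P a) • b a =
          ∑ j, constantCoeff (c j * grad F j) := by
        rw [h1]
        refine sum_congr rfl fun a _ => ?_
        rw [map_mul, constantCoeff_C, ← coeff_zero_eq_constantCoeff_apply,
          coeff_iota, MvPowerSeries.smul_eq_C_mul]
      rw [h3]
      refine sum_mem fun j _ => ?_
      rw [map_mul]
      refine mul_mem_left _ _ (subset_span ⟨j, ?_⟩)
      rw [← coeff_zero_eq_constantCoeff_apply,
        ← coeff_zero_eq_constantCoeff_apply]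
      exact (coeff_liftD _ _ _).symm
    refine Fintype.linearIndependent_iff.1 hb _ ?_
    rw [← Ideal.Quotient.eq_zero_iff_mem, map_sum] at h2
    exact h2
  have key2 : ∀ (n : ℕ) (P : A → PowerSeries k),
      ∑ a, iota k m (P a) * C (b a) ∈ span (Set.range (grad F)) →
      ∀ a, coeff n (P a) = 0 := by
    intro n
    induction n with
    | zero => exact key
    | succ n ih =>
      intro P h a
      have h0 : ∀ a, X ∣ P a := fun a => by
        rw [X_dvd_iff, ← coeff_zero_eq_constantCoeff_apply]
        exact key P h a
      choose P' hP' using h0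
      rw [hP', coeff_succ_X_mul]
      refine ih P' (grad_saturated' hN ?_) a
      have h3 : (X : BR k m) * ∑ a, iota k m (P' a) * C (b a) =
          ∑ a, iota k m (P a) * C (b a) := by
        rw [mul_sum]
        refine sum_congr rfl fun a _ => ?_
        have h4 : iota k m X = X := PowerSeries.map_X _
        rw [hP' a, map_mul, h4, mul_assoc]
      rw [h3]
      exact h
  ext n
  rw [key2 n P h a, map_zero]

theorem expand_grad (L : ℕ) (hL : L ≠ 0) (j : Fin m) :
    expand L hL (grad F j) = grad (expand L hL F) j := by
  ext1 n
  have h1 : ∀ (G : BR k m) (n : ℕ), coeff n (grad G j) =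
      pderiv k j (coeff n G) := fun G n => coeff_liftD _ _ _
  rw [h1, coeff_expand, coeff_expand]
  split_ifs
  · rw [h1]
  · rw [map_zero]

theorem expand_iota (L : ℕ) (hL : L ≠ 0) (c : PowerSeries k) :
    expand L hL (iota k m c) = iota k m (expandHom k L hL c) :=
  (PowerSeries.map_expand _ _ _ _).symm

theorem derivative_expand {O : Type*} [CommRing O] (L : ℕ) (hL : L ≠ 0) (G : PowerSeries O) :
    derivative O (expand L hL G) =
      X ^ (L - 1) * (C (L : O) *
        expand L hL (derivative O G)) := by
  ext n
  rw [coeff_derivative, coeff_X_pow_mul', coeff_expand]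
  split_ifs with h1 h2 h2
  · obtain ⟨q, hq⟩ := h1
    obtain ⟨q', rfl⟩ : ∃ q', q = q' + 1 := Nat.exists_eq_succ_of_ne_zero (by rintro rfl; omega)
    have h3 : n - (L - 1) = L * q' := by rw [mul_add] at hq; omega
    rw [h3, coeff_C_mul, coeff_expand_mul, coeff_derivative, hq,
      Nat.mul_div_cancel_left _ (Nat.pos_of_ne_zero hL)]
    have h4 : (n : O) + 1 = L * (q' + 1) := by exact_mod_cast congrArg (Nat.cast (R := O)) hq
    rw [h4]; ring
  · obtain ⟨q, hq⟩ := h1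
    exact absurd (Nat.le_of_dvd (Nat.succ_pos n) ⟨q, hq⟩) (by omega)
  · rw [coeff_C_mul, coeff_expand, if_neg, mul_zero, zero_mul]
    rintro ⟨q, hq⟩
    exact h1 ⟨q + 1, by rw [mul_add]; omega⟩
  · rw [zero_mul]

theorem mapMatrix_smul_sub_trace {A S R : Type*} [Fintype A] [DecidableEq A] [CommRing S]
    [CommRing R] (f : S →+* R) (d : ℕ) (M : Matrix A A S) :
    f.mapMatrix ((d : S) • M - M.trace • 1) =
      (d : R) • f.mapMatrix M - (f.mapMatrix M).trace • 1 := by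
  have htr : f M.trace = (f.mapMatrix M).trace := by
    rw [Matrix.trace, Matrix.trace, map_sum]; rfl
  rw [map_sub, ← htr]
  congr 1
  · ext1 a c; simp
  · ext1 a c; simp [Matrix.one_apply, apply_ite f]

theorem isNilpotent_smul_sub_trace {A S R T : Type*} [Fintype A] [DecidableEq A] [CommRing S]
    [CommRing R] [CommRing T] {f : S →+* R} (hf : Injective f) (g : S →+* T) {d : ℕ}
    {M : Matrix A A S}
    (h : IsNilpotent ((d : R) • f.mapMatrix M - (f.mapMatrix M).trace • (1 : Matrix A A R))) :
    IsNilpotent ((d : T) • g.mapMatrix M - (g.mapMatrix M).trace • (1 : Matrix A A T)) := by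
  rw [← mapMatrix_smul_sub_trace] at h ⊢
  exact ((IsNilpotent.map_iff (f := f.mapMatrix) (Matrix.map_injective hf)).1 h).map _

theorem pow_smul_eq_mulVec {A S Q : Type*} [Fintype A] [DecidableEq A] [CommRing S] [CommRing Q]
    {ψ : S →+* Q} {M : Matrix A A S} {β : A → Q} {x : Q}
    (h : x • β = (ψ.mapMatrix M).mulVec β) (n : ℕ) :
    x ^ n • β = (ψ.mapMatrix (M ^ n)).mulVec β := by
  induction n with
  | zero => rw [pow_zero, pow_zero, map_one, Matrix.one_mulVec, one_smul]
  | succ n ih =>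
    rw [pow_succ', mul_smul, ih, ← Matrix.mulVec_smul, h, Matrix.mulVec_mulVec, ← map_mul, pow_succ]

/-- The multiplication matrices of the coordinates have a single eigenvalue. -/
theorem isNilpotent_card_smul_sub_trace [IsAlgClosed k] [CharZero k] {N L : ℕ}
    (hN : maxId m k ^ N ≤ jac (constantCoeff F))
    (hφ : derivative _ F ^ L ∈ span (Set.range (grad F)))
    {A : Type*} [Fintype A] [DecidableEq A] {b : A → 𝒪 m k}
    (hb : LinearIndependent k fun a =>
      Ideal.Quotient.mk (jac (constantCoeff F)) (b a))
    {E : A → PowerSeries k}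
    (hE : 1 - ∑ a, iota k m (E a) * C (b a) ∈ span (Set.range (grad F)))
    {M : Fin m → Matrix A A (PowerSeries k)}
    (hM : ∀ j a, wv k m j * C (b a) - ∑ c, iota k m (M j a c) * C (b c) ∈
      span (Set.range (grad F))) (j : Fin m) :
    IsNilpotent ((Fintype.card A : PowerSeries k) • M j - (M j).trace • 1) := by
  have hchar : ∀ j, (M j).charpoly.eval₂ (iota k m) (wv k m j) ∈
      span (Set.range (grad F)) := by
    intro j
    set I := span (Set.range (grad F)) with hI
    set ψ : Polynomial (PowerSeries k) →+* BR k m ⧸ I :=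
      (Ideal.Quotient.mk I).comp (Polynomial.eval₂RingHom (iota k m) (wv k m j)) with hψ
    set β : A → BR k m ⧸ I := fun a => Ideal.Quotient.mk I (C (b a)) with hβ
    have h1 := map_det_mul_eq_zero ψ (M j).charmatrix β fun a => by
      have h2 := hM j a
      rw [← Ideal.Quotient.eq_zero_iff_mem] at h2
      rw [← h2, map_sub, map_mul, map_sum]
      have h3 : ∀ c, ψ ((M j).charmatrix a c) * β c =
          (if a = c then Ideal.Quotient.mk I (wv k m j) * β c else 0) -
            Ideal.Quotient.mk I (iota k m (M j a c) * C (b c)) := by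
        intro c
        rw [Matrix.charmatrix_apply, Matrix.diagonal_apply, map_sub, sub_mul, map_mul]
        have h4 : ∀ r, ψ (Polynomial.C r) = Ideal.Quotient.mk I (iota k m r) := fun r => by
          simp [hψ]
        rw [h4]
        split_ifs
        · simp [hψ, hβ]
        · simp [hβ]
      rw [sum_congr rfl fun c _ => h3 c, sum_sub_distrib]
      simp [hβ]
    rw [← Ideal.Quotient.eq_zero_iff_mem, map_sub, sub_eq_zero, map_one, map_sum] at hE
    rw [← Ideal.Quotient.eq_zero_iff_mem]
    change ψ (M j).charpoly = 0
    rw [← mul_one (ψ _), hE, mul_sum]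
    refine sum_eq_zero fun a _ => ?_
    rw [map_mul, mul_left_comm]
    exact (congrArg _ (h1 a)).trans (mul_zero _)
  obtain ⟨s, hs, hS⟩ := exists_puiseux_multiset (fun j => (M j).charpoly)
    fun j => (M j).charpoly_monic
  set F' := expand s hs F with hF'
  have hmap : ∀ x ∈ span (Set.range (grad F)),
      expand s hs x ∈ span (Set.range (grad F')) := by
    intro x hx
    obtain ⟨c, rfl⟩ := Ideal.mem_span_range_iff_exists_fun.1 hx
    rw [map_sum]
    refine sum_mem fun j _ => ?_
    rw [map_mul, expand_grad]
    exact mul_mem_left _ _ (subset_span ⟨j, rfl⟩)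
  have hc0 : constantCoeff F' = constantCoeff F :=
    constantCoeff_expand _ _ _
  have hN' : maxId m k ^ N ≤ jac (constantCoeff F') := by rwa [hc0]
  have hw : ∀ j, expand s hs (wv k m j) = wv k m j := fun j =>
    PowerSeries.expand_C _ _ _
  obtain ⟨p, hp⟩ := exists_unique_section (F := F') (fun j => by
    obtain ⟨S, hSj⟩ := hS j
    refine ⟨S, ?_⟩
    have h1 := hmap _ (hchar j)
    have h2 : expand s hs ((M j).charpoly.eval₂ (iota k m) (wv k m j)) =
        (((M j).charpoly).map (expandHom k s hs)).eval₂ (iota k m) (wv k m j) := by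
      rw [Polynomial.eval₂_map]
      have h3 := Polynomial.hom_eval₂ (M j).charpoly (iota k m)
        (expand (R := 𝒪 m k) s hs).toRingHom (wv k m j)
      refine h3.trans ?_
      have h4 : (expand (R := 𝒪 m k) s hs).toRingHom.comp (iota k m) =
          (iota k m).comp (expandHom k s hs) := RingHom.ext fun c => expand_iota s hs c
      rw [h4]
      exact congrArg (fun w => (M j).charpoly.eval₂ ((iota k m).comp (expandHom k s hs)) w) (hw j)
    rw [h2, hSj, ← Polynomial.coe_eval₂RingHom, map_multiset_prod, Multiset.map_map] at h1
    convert h1 using 4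
    simp) hN' (L := L) (by
    rw [derivative_expand, mul_pow, mul_pow, ← map_pow (expand s hs)]
    exact mul_mem_left _ _ (mul_mem_left _ _ (hmap _ hφ)))
  set M' := (expandHom k s hs).mapMatrix (M j) with hM'
  obtain ⟨n, hn⟩ := hp j
  have hnil : (M' - p j • (1 : Matrix A A (PowerSeries k))) ^ n = 0 := by
    set I := span (Set.range (grad F')) with hI
    set ψ : PowerSeries k →+* BR k m ⧸ I := (Ideal.Quotient.mk I).comp (iota k m) with hψ
    set β : A → BR k m ⧸ I := fun a => Ideal.Quotient.mk I (C (b a)) with hβ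
    have h1 : Ideal.Quotient.mk I (wv k m j - iota k m (p j)) • β =
        (ψ.mapMatrix (M' - p j • (1 : Matrix A A (PowerSeries k)))).mulVec β := by
      have h2 : ψ.mapMatrix (p j • (1 : Matrix A A (PowerSeries k))) =
          ψ (p j) • (1 : Matrix A A (BR k m ⧸ I)) := by
        ext a c
        simp [Matrix.one_apply, apply_ite ψ]
      rw [map_sub, map_sub, sub_smul, Matrix.sub_mulVec, h2, Matrix.smul_mulVec, Matrix.one_mulVec]
      congr 1
      funext a
      have h3 := hmap _ (hM j a)
      rw [← Ideal.Quotient.eq_zero_iff_mem, map_sub, map_sub, sub_eq_zero, map_mul, hw,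
        PowerSeries.expand_C, map_mul, map_sum, map_sum] at h3
      refine h3.trans (sum_congr rfl fun c _ => ?_)
      rw [map_mul, expand_iota, PowerSeries.expand_C, map_mul]
      rfl
    have h2 := pow_smul_eq_mulVec h1 n
    rw [← map_pow, Ideal.Quotient.eq_zero_iff_mem.2 hn] at h2
    replace h2 := h2.symm.trans (funext fun a => zero_mul (β a))
    ext1 a c
    refine eq_zero_of_sum_mem hN' (b := b) (by rwa [hc0])
      (P := ((M' - p j • (1 : Matrix A A (PowerSeries k))) ^ n) a) ?_ c
    rw [← Ideal.Quotient.eq_zero_iff_mem, map_sum]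
    refine Eq.trans (sum_congr rfl fun c _ => ?_) (congrFun h2 a)
    rw [map_mul]
    rfl
  have htr : M'.trace = Fintype.card A * p j := by
    have h1 := (Matrix.isNilpotent_trace_of_isNilpotent ⟨n, hnil⟩).eq_zero
    rw [Matrix.trace_sub, Matrix.trace_smul, Matrix.trace_one, sub_eq_zero] at h1
    rw [h1, smul_eq_mul, mul_comm]
  have hinj : Injective (expandHom k s hs) := by
    intro x y h
    ext i
    rw [← coeff_expand_mul s hs x i, ← coeff_expand_mul s hs y i]
    exact congrArg _ h
  have hid : (RingHom.id (PowerSeries k)).mapMatrix (M j) = M j := rfl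
  rw [← hid]
  refine isNilpotent_smul_sub_trace hinj _ ⟨n, ?_⟩
  rw [← hM', htr, mul_smul, ← smul_sub, smul_pow, hnil, smul_zero]

end Line

end FSec

end NonSplit

namespace NonSplit

open MvPowerSeries
open scoped ENNReal NNReal Topology

section LineZeros

variable {m : ℕ} {h : MvPowerSeries (Option (Fin m)) ℂ}

theorem optionEquivLeft_pderiv_some (j : Fin m) :
    optionEquivLeft (Fin m) ℂ (pderiv ℂ (some j) h) =
      FSec.grad (optionEquivLeft (Fin m) ℂ h) j := by
  ext n β
  have h1 : PowerSeries.coeff n (FSec.grad (optionEquivLeft (Fin m) ℂ h) j) =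
      pderiv ℂ j (PowerSeries.coeff n (optionEquivLeft (Fin m) ℂ h)) := coeff_liftD _ _ _
  rw [h1, coeff_coeff_optionEquivLeft, coeff_pderiv, coeff_pderiv, coeff_coeff_optionEquivLeft]
  have h2 : β.optionElim n + single (some j) 1 = (β + single j 1).optionElim n := by
    ext i
    cases i <;> simp [Finsupp.single_apply]
  rw [h2, Finsupp.optionElim_apply_some]

theorem optionEquivLeft_pderiv_none :
    optionEquivLeft (Fin m) ℂ (pderiv ℂ none h) =
      PowerSeries.derivative _ (optionEquivLeft (Fin m) ℂ h) := by
  ext n β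
  rw [PowerSeries.coeff_derivative, coeff_coeff_optionEquivLeft, coeff_pderiv]
  have h1 : ((n : 𝒪 m ℂ) + 1) = C ((n : ℂ) + 1) := by
    rw [map_add, map_natCast, map_one]
  rw [h1, coeff_mul_C, coeff_coeff_optionEquivLeft]
  have h2 : β.optionElim n + single none 1 = β.optionElim (n + 1) := by
    ext i
    cases i <;> simp
  rw [h2, Finsupp.optionElim_apply_none]

theorem optionEquivLeft_mem_span_iff {x : MvPowerSeries (Option (Fin m)) ℂ} :
    optionEquivLeft (Fin m) ℂ x ∈
        span (Set.range (FSec.grad (optionEquivLeft (Fin m) ℂ h))) ↔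
      x ∈ span (Set.range fun j => pderiv ℂ (some j) h) := by
  rw [mem_span_range_iff_exists_fun, mem_span_range_iff_exists_fun]
  constructor
  · rintro ⟨c, hc⟩
    refine ⟨fun j => (optionEquivLeft (Fin m) ℂ).symm (c j), ?_⟩
    apply (optionEquivLeft (Fin m) ℂ).injective
    rw [← hc, map_sum]
    exact sum_congr rfl fun j _ => by
      rw [map_mul, AlgEquiv.apply_symm_apply, optionEquivLeft_pderiv_some]
  · rintro ⟨c, hc⟩
    refine ⟨fun j => optionEquivLeft (Fin m) ℂ (c j), ?_⟩
    rw [← hc, map_sum]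
    exact sum_congr rfl fun j _ => by rw [map_mul, optionEquivLeft_pderiv_some]

/-- If the gradient in the fibre directions controls the full gradient, then every fibre near the
central one has at most one critical point. -/
theorem HasDivision.exists_forall_eq_of_ev_eq_zero {η ρ : ℝ≥0} (hη : 0 < η) (hρ : 0 < ρ) {d : ℕ}
    {b : Fin d → Fin m →₀ ℕ}
    (hb : LinearIndependent ℂ fun a => Ideal.Quotient.mk (jac (atZero (Fin m) h))
      (monomial (b a) (1 : ℂ)))
    {N : ℕ} (hN : maxId m ℂ ^ N ≤ jac (atZero (Fin m) h))
    (hdiv : HasDivision η (fun _ => ρ) (fun a => monomial (b a) 1) fun j => pderiv ℂ (some j) h)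
    (hg : ∀ j, pderiv ℂ (some j) h ∈ conv (opt η fun _ : Fin m => ρ))
    (hφ : pderiv ℂ none h ∈ conv (opt η fun _ : Fin m => ρ))
    (hzero : ∀ (τ : ℂ) (z : Fin m → ℂ), ‖τ‖₊ < η → (∀ i, ‖z i‖₊ ≤ ρ) →
      (∀ j, ev (opt τ z) (pderiv ℂ (some j) h) = 0) → ev (opt τ z) (pderiv ℂ none h) = 0)
    {τ : ℂ} (hτ : ‖τ‖₊ < η) :
    ∃ c : Fin m → ℂ, ∀ z : Fin m → ℂ, (∀ i, ‖z i‖₊ ≤ ρ) →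
      (∀ j, ev (opt τ z) (pderiv ℂ (some j) h) = 0) → z = c := by
  classical
  set F := optionEquivLeft (Fin m) ℂ h with hF
  have hsum : ∀ P : Fin d → PowerSeries ℂ, optionEquivLeft (Fin m) ℂ
      (∑ a, iot (Fin m) (P a) * emb (Fin m) (monomial (b a) 1)) =
      ∑ a, iota ℂ m (P a) * PowerSeries.C (monomial (b a) 1) := by
    intro P
    rw [map_sum]
    exact sum_congr rfl fun a _ => by
      rw [map_mul, optionEquivLeft_iot, optionEquivLeft_emb]; rfl
  have hind : ∀ P : Fin d → PowerSeries ℂ,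
      ∑ a, iot (Fin m) (P a) * emb (Fin m) (monomial (b a) 1) ∈
        span (Set.range fun j => pderiv ℂ (some j) h) → ∀ a, P a = 0 := by
    intro P hP
    rw [← optionEquivLeft_mem_span_iff, hsum] at hP
    exact FSec.eq_zero_of_sum_mem hN hb hP
  have hpow := hdiv.pow_mem_span (fun _ => hρ) hη (fun a => monomial_mem_conv _ _) hg hind hφ hzero
  rw [← optionEquivLeft_mem_span_iff, map_pow, optionEquivLeft_pderiv_none] at hpow
  have hemb : ∀ a, emb (Fin m) (monomial (b a) 1) ∈ conv (opt η fun _ : Fin m => ρ) :=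
    fun a => emb_mem_conv (monomial_mem_conv _ _)
  obtain ⟨E, Q0, hE, hQ0, hEQ⟩ := hdiv 1 (one_mem _)
  choose M Q hM hQ hMQ using fun (j : Fin m) (a : Fin d) =>
    hdiv (X (some j) * emb (Fin m) (monomial (b a) 1)) (mul_mem (X_mem_conv _) (hemb a))
  have hmem : ∀ Q : Fin m → MvPowerSeries (Option (Fin m)) ℂ, ∑ j, Q j * pderiv ℂ (some j) h ∈
      span (Set.range fun j => pderiv ℂ (some j) h) :=
    fun q => Ideal.mem_span_range_iff_exists_fun.mpr ⟨q, rfl⟩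
  have hnil := FSec.isNilpotent_card_smul_sub_trace (F := F) hN hpow hb (E := E)
    (M := fun j => Matrix.of (M j)) (by
    have h1 := hmem Q0
    rw [← optionEquivLeft_mem_span_iff, ← sub_eq_of_eq_add' hEQ, map_sub, map_one, hsum] at h1
    exact h1) (fun j a => by
    have h1 := hmem (Q j a)
    rw [← optionEquivLeft_mem_span_iff, ← sub_eq_of_eq_add' (hMQ j a), map_sub, hsum, map_mul,
      optionEquivLeft_emb, ← emb_X, optionEquivLeft_emb] at h1
    exact h1)
  set S := conv (fun _ : Unit => η)
  set MS : Fin m → Matrix (Fin d) (Fin d) S := fun j => Matrix.of fun a c => ⟨M j a c, hM j a c⟩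
  have hz : ∀ _ : Unit, ‖τ‖₊ ≤ η := fun _ => hτ.le
  set χ : S →+* ℂ := (evHom (fun _ : Unit => τ) hz : S →+* ℂ) with hχ
  have hnil' : ∀ j, IsNilpotent ((d : ℂ) • χ.mapMatrix (MS j) -
      (χ.mapMatrix (MS j)).trace • (1 : Matrix (Fin d) (Fin d) ℂ)) := by
    intro j
    have h1 := hnil j
    rw [Fintype.card_fin] at h1
    exact FSec.isNilpotent_smul_sub_trace (f := (S.val : S →+* MvPowerSeries Unit ℂ))
      Subtype.val_injective χ (M := MS j) h1
  refine ⟨fun j => (χ.mapMatrix (MS j)).trace / d, fun z hzr h0 => ?_⟩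
  have hzz : ∀ i, ‖opt τ z i‖₊ ≤ opt η (fun _ => ρ) i := opt_le hτ.le hzr
  set β : Fin d → ℂ := fun a => ev z (monomial (b a) 1) with hβ
  have hev : ∀ (P : Fin d → PowerSeries ℂ) (Q : Fin m → MvPowerSeries (Option (Fin m)) ℂ)
      (hP : ∀ a, (P a : MvPowerSeries Unit ℂ) ∈ S), (∀ j, Q j ∈ conv (opt η fun _ => ρ)) →
      ev (opt τ z) (∑ a, iot (Fin m) (P a) * emb (Fin m) (monomial (b a) 1) +
        ∑ j, Q j * pderiv ℂ (some j) h) = ∑ a, χ ⟨P a, hP a⟩ * β a := by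
    intro P Q hP hQ
    have h1 : ∑ a, iot (Fin m) (P a) * emb (Fin m) (monomial (b a) 1) ∈
        conv (opt η fun _ : Fin m => ρ) :=
      sum_mem fun a _ => mul_mem (iot_mem_conv (hP a)) (hemb a)
    have h2 : ∑ j, Q j * pderiv ℂ (some j) h ∈ conv (opt η fun _ : Fin m => ρ) :=
      sum_mem fun j _ => mul_mem (hQ j) (hg j)
    have hes : ∀ {ι : Type} [Fintype ι] (u v : ι → MvPowerSeries (Option (Fin m)) ℂ),
        (∀ i, u i ∈ conv (opt η fun _ : Fin m => ρ)) →
        (∀ i, v i ∈ conv (opt η fun _ : Fin m => ρ)) →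
        ev (opt τ z) (∑ i, u i * v i) = ∑ i, ev (opt τ z) (u i) * ev (opt τ z) (v i) := by
      intro ι _ u v hu hv
      have h3 := map_sum (evHom (opt τ z) hzz)
        (fun i => (⟨u i, hu i⟩ * ⟨v i, hv i⟩ : conv (opt η fun _ : Fin m => ρ))) Finset.univ
      rw [evHom_apply, AddSubmonoidClass.coe_finsetSum] at h3
      exact h3.trans (sum_congr rfl fun i _ => ev_mul hzz (hu i) (hv i))
    rw [ev_add hzz h1 h2, hes _ _ (fun a => iot_mem_conv (hP a)) hemb, hes _ _ hQ hg]
    have h3 : ∑ j, ev (opt τ z) (Q j) * ev (opt τ z) (pderiv ℂ (some j) h) = 0 :=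
      sum_eq_zero fun j _ => by rw [h0, mul_zero]
    rw [h3, add_zero]
    exact sum_congr rfl fun a _ => by rw [ev_iot, ev_emb]; rfl
  have hβ0 : β ≠ 0 := by
    intro h1
    have h2 := hev E Q0 hE hQ0
    rw [← hEQ, h1] at h2
    have h3 : ev (opt τ z) 1 = 1 := by
      rw [← map_one C, ← monomial_zero_eq_C_apply, ev_monomial, mono_zero, mul_one]
    rw [h3] at h2
    simp at h2
  have hd : (d : ℂ) ≠ 0 := by
    intro h1
    have h2 : d = 0 := by exact_mod_cast h1
    subst h2
    exact hβ0 (Subsingleton.elim _ _)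
  funext j
  have hMβ : (χ.mapMatrix (MS j)).mulVec β = z j • β := by
    funext a
    have h1 := hev (M j a) (Q j a) (hM j a) (hQ j a)
    rw [← hMQ, ev_mul hzz (X_mem_conv _) (hemb a), ev_emb, X, ev_monomial, mono_single, pow_one,
      one_mul] at h1
    exact h1.symm
  rw [eq_div_iff hd, mul_comm]
  obtain ⟨n, hn⟩ := hnil' j
  have h1 : (d * z j - (χ.mapMatrix (MS j)).trace) • β = ((RingHom.id ℂ).mapMatrix
      ((d : ℂ) • χ.mapMatrix (MS j) -
        (χ.mapMatrix (MS j)).trace • (1 : Matrix (Fin d) (Fin d) ℂ))).mulVec β := by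
    have h2 : ∀ Y : Matrix (Fin d) (Fin d) ℂ, (RingHom.id ℂ).mapMatrix Y = Y := fun Y => rfl
    rw [h2, Matrix.sub_mulVec, Matrix.smul_mulVec, Matrix.smul_mulVec, Matrix.one_mulVec, hMβ,
      sub_smul, mul_smul]
  have h2 := FSec.pow_smul_eq_mulVec h1 n
  rw [hn, map_zero, Matrix.zero_mulVec, smul_eq_zero, or_iff_left hβ0] at h2
  exact sub_eq_zero.mp (eq_zero_of_pow_eq_zero h2)

end LineZeros

section Taylor

variable {ι E : Type*} [Fintype ι] [NormedAddCommGroup E] [NormedSpace ℂ E]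

/-- The exponent of the monomial attached to a word in the variables. -/
noncomputable def key (x : Σ n, (Fin n → ι)) : ι →₀ ℕ := ∑ k, single (x.2 k) 1

omit [Fintype ι] in
theorem mono_key {R : Type*} [CommMonoid R] (z : ι → R) (x : Σ n, (Fin n → ι)) :
    mono z (key x) = ∏ k, z (x.2 k) := by
  classical
  have h : ∀ s : Finset (Fin x.1), mono z (∑ k ∈ s, single (x.2 k) 1) =
      ∏ k ∈ s, z (x.2 k) := fun s => by
    induction s using Finset.induction_on with
    | empty => simp [mono_zero]
    | insert a s ha ih =>
      rw [sum_insert ha, Finset.prod_insert ha, mono_add, mono_single, pow_one, ih]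
  exact h _

/-- The Taylor series of `p` in the coordinates given by the vectors `e`. -/
noncomputable def taylor (p : FormalMultilinearSeries ℂ E ℂ) (e : ι → E) : MvPowerSeries ι ℂ :=
  ofCoeff fun β => ∑' x : {x : Σ n, (Fin n → ι) // key x = β}, p x.1.1 (e ∘ x.1.2)

variable {p : FormalMultilinearSeries ℂ E ℂ} {e : ι → E}

theorem tsum_word_le (he : ∀ i, ‖e i‖ ≤ 1) (r : ℝ≥0) :
    ∑' x : Σ n, (Fin n → ι), ‖p x.1 (e ∘ x.2)‖ₑ * ((mono (fun _ => r) (key x) : ℝ≥0) : ℝ≥0∞) ≤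
      ∑' n, ‖p n‖ₑ * ((Fintype.card ι * r : ℝ≥0) : ℝ≥0∞) ^ n := by
  rw [ENNReal.tsum_sigma']
  refine ENNReal.tsum_le_tsum fun n => ?_
  calc ∑' φ : Fin n → ι, ‖p n (e ∘ φ)‖ₑ * ((mono (fun _ => r) (key ⟨n, φ⟩) : ℝ≥0) : ℝ≥0∞)
      ≤ ∑' _ : Fin n → ι, ‖p n‖ₑ * (r : ℝ≥0∞) ^ n := by
        refine ENNReal.tsum_le_tsum fun φ => ?_
        rw [mono_key, Finset.prod_const, Finset.card_univ, Fintype.card_fin, ENNReal.coe_pow]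
        gcongr
        refine enorm_le_iff_norm_le.mpr (((p n).le_opNorm _).trans ?_)
        exact mul_le_of_le_one_right (norm_nonneg _)
          (Finset.prod_le_one (fun _ _ => norm_nonneg _) fun k _ => he _)
    _ = _ := by
        rw [tsum_fintype, Finset.sum_const, Finset.card_univ, Fintype.card_fun, Fintype.card_fin,
          nsmul_eq_mul]
        push_cast
        ring

theorem nrm_taylor_le (he : ∀ i, ‖e i‖ ≤ 1) (r : ℝ≥0) :
    nrm (fun _ => r) (taylor p e) ≤ ∑' n, ‖p n‖ₑ * ((Fintype.card ι * r : ℝ≥0) : ℝ≥0∞) ^ n := by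
  refine le_trans ?_ (tsum_word_le he r)
  rw [← (Equiv.sigmaFiberEquiv (key (ι := ι))).tsum_eq, ENNReal.tsum_sigma', nrm]
  refine ENNReal.tsum_le_tsum fun β => ?_
  rw [taylor, coeff_ofCoeff]
  calc _ ≤ (∑' x : {x : Σ n, (Fin n → ι) // key x = β}, ‖p x.1.1 (e ∘ x.1.2)‖ₑ) *
        ((mono (fun _ => r) β : ℝ≥0) : ℝ≥0∞) := by gcongr; exact enorm_tsum_le_tsum_enorm
    _ = _ := by
      rw [← ENNReal.tsum_mul_right]
      refine tsum_congr fun x => ?_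
      obtain ⟨x, rfl⟩ := x
      rfl

theorem ev_taylor (he : ∀ i, ‖e i‖ ≤ 1) {r : ℝ≥0}
    (hr : ∑' n, ‖p n‖ₑ * ((Fintype.card ι * r : ℝ≥0) : ℝ≥0∞) ^ n < ⊤) {z : ι → ℂ}
    (hz : ∀ i, ‖z i‖₊ ≤ r) : ev z (taylor p e) = ∑' n, p n fun _ => ∑ i, z i • e i := by
  have hs : Summable fun x : Σ n, (Fin n → ι) => p x.1 (e ∘ x.2) * mono z (key x) := by
    refine Summable.of_enorm (ne_top_of_le_ne_top hr.ne ((ENNReal.tsum_le_tsum fun x => ?_).trans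
      (tsum_word_le he r)))
    rw [enorm_mul]
    gcongr
    exact_mod_cast norm_mono_le hz _
  have h1 : ∑' x : Σ n, (Fin n → ι), p x.1 (e ∘ x.2) * mono z (key x) =
      ∑' n, p n fun _ => ∑ i, z i • e i := by
    rw [hs.tsum_sigma]
    refine tsum_congr fun n => ?_
    classical
    rw [tsum_fintype, (p n).map_sum]
    refine sum_congr rfl fun φ _ => ?_
    rw [(p n).map_smul_univ, mono_key, smul_eq_mul, mul_comm]
    rfl
  rw [← h1, ← (Equiv.sigmaFiberEquiv (key (ι := ι))).tsum_eq]
  refine Eq.trans ?_ ((Equiv.sigmaFiberEquiv (key (ι := ι))).summable_iff.mpr hs).tsum_sigma.symm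
  refine tsum_congr fun β => ?_
  rw [taylor, coeff_ofCoeff, ← tsum_mul_right]
  refine tsum_congr fun x => ?_
  obtain ⟨x, rfl⟩ := x
  rfl

end Taylor

section Pderiv

variable {σ : Type*}

theorem mono_eq_mul_erase {R : Type*} [CommMonoid R] (z : σ → R) (i : σ) (β : σ →₀ ℕ) :
    mono z β = z i ^ β i * mono z (β.erase i) := by
  rw [← mono_single, ← mono_add, Finsupp.single_add_erase]

theorem mono_update_erase {R : Type*} [CommMonoid R] [DecidableEq σ] (z : σ → R) (i : σ) (w : R)
    (β : σ →₀ ℕ) : mono (Function.update z i w) (β.erase i) = mono z (β.erase i) :=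
  Finsupp.prod_congr fun j hj => by
    rw [Finsupp.support_erase] at hj
    rw [Function.update_of_ne (ne_of_mem_erase hj)]

theorem nrm_pderiv_mul_le (i : σ) (r : ℝ≥0) (h : MvPowerSeries σ ℂ) :
    nrm (fun _ => r / 2) (pderiv ℂ i h) * r ≤ nrm (fun _ => r) h := by
  rw [nrm, ← ENNReal.tsum_mul_right]
  refine le_trans (ENNReal.tsum_le_tsum fun γ => ?_)
    (ENNReal.tsum_comp_le_tsum_of_injective (add_left_injective (single i 1)) _)
  have h1 : ((γ i + 1 : ℕ) : ℝ≥0) * mono (fun _ => r / 2) γ ≤ mono (fun _ => r) γ := by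
    rw [mono_eq_mul_erase _ i, mono_eq_mul_erase (fun _ => r) i, ← mul_assoc]
    gcongr ?_ * ?_
    · rw [div_pow, mul_div_assoc', div_le_iff₀ (by positivity), mul_comm]
      gcongr
      exact_mod_cast Nat.lt_two_pow_self (n := γ i)
    · exact Finset.prod_le_prod (fun _ _ => zero_le) fun j _ =>
        pow_le_pow_left' (half_le_self zero_le) _
  have h2 : ‖((γ i : ℂ) + 1)‖ₑ = ((γ i + 1 : ℕ) : ℝ≥0∞) := by
    rw [← Nat.cast_succ, enorm_eq_nnnorm, Complex.nnnorm_natCast]; rfl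
  rw [coeff_pderiv, enorm_mul, h2, mono_add, mono_single, pow_one, ENNReal.coe_mul, ← mul_assoc,
    mul_assoc ‖_‖ₑ]
  gcongr
  exact_mod_cast h1

theorem ev_pderiv [DecidableEq σ] {r : ℝ≥0} {h : MvPowerSeries σ ℂ} (hh : h ∈ conv fun _ => r) {z : σ → ℂ}
    (hz : ∀ i, ‖z i‖₊ < r) (i : σ) :
    ev z (pderiv ℂ i h) = deriv (fun w => ev (Function.update z i w) h) (z i) := by
  have hsum : Summable fun β => ‖coeff β h‖ * ((mono (fun _ => r) β : ℝ≥0) : ℝ) := by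
    have := ENNReal.tsum_coe_ne_top_iff_summable (f := fun β : σ →₀ ℕ => ‖coeff β h‖₊ * mono (fun _ => r) β) |>.mp
      (by simpa [nrm, enorm_eq_nnnorm] using (mem_conv.mp hh).ne)
    simpa using NNReal.summable_coe.mpr this
  have hd : ∀ β : σ →₀ ℕ, ∀ w, HasDerivAt (fun w => coeff β h * mono (Function.update z i w) β)
      (coeff β h * (β i * w ^ (β i - 1) * mono z (β.erase i))) w := fun β w => by
    have h1 : (fun w => coeff β h * mono (Function.update z i w) β) =
        fun w => coeff β h * (w ^ β i * mono z (β.erase i)) := funext fun w => by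
      rw [mono_eq_mul_erase _ i, mono_update_erase, Function.update_self]
    rw [h1]
    exact ((hasDerivAt_pow _ _).mul_const _).const_mul _
  have key := Complex.hasSum_deriv_of_summable_norm hsum
    (fun β => fun w _ => (hd β w).differentiableAt.differentiableWithinAt)
    (Metric.isOpen_ball (x := (0 : ℂ)) (ε := r)) (fun β w hw => by
      rw [norm_mul]
      gcongr
      refine norm_mono_le (r := fun _ => r) (fun j => ?_) β
      by_cases hj : j = i
      · subst hj
        rw [Function.update_self]
        exact (by simpa using hw : ‖w‖ < r).le
      · rw [Function.update_of_ne hj]; exact (hz j).le)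
    (show z i ∈ Metric.ball (0 : ℂ) r by
      rw [mem_ball_zero_iff]; exact hz i)
  change _ = deriv (fun w => ∑' β, coeff β h * mono (Function.update z i w) β) (z i)
  rw [← key.tsum_eq]
  refine Eq.trans ?_ ((add_left_injective (single i 1)).tsum_eq ?_)
  · refine tsum_congr fun γ => ?_
    rw [(hd _ _).deriv, coeff_pderiv, mono_eq_mul_erase z i γ]
    have : (γ + single i 1).erase i = γ.erase i := by
      rw [Finsupp.erase_add, Finsupp.erase_single, add_zero]
    rw [this]
    simp
    ring
  · intro β hβ
    rw [Function.mem_support, (hd _ _).deriv] at hβ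
    have : β i ≠ 0 := fun h0 => hβ (by simp [h0])
    exact ⟨β - single i 1, tsub_add_cancel_of_le
      (Finsupp.single_le_iff.mpr (Nat.one_le_iff_ne_zero.mpr this))⟩

end Pderiv

section Taylor

variable {E : Type*} [NormedAddCommGroup E] [NormedSpace ℂ E]
  {p : FormalMultilinearSeries ℂ E ℂ} {f : E → ℂ} {R : ℝ≥0∞}

theorem ev_pderiv_taylor {ι : Type*} [Fintype ι] (hf : HasFPowerSeriesOnBall f p 0 R) {e : ι → E}
    (he : ∀ i, ‖e i‖ ≤ 1) {r : ℝ≥0} (hrR : ((Fintype.card ι * r : ℝ≥0) : ℝ≥0∞) < R)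
    (hr : ∑' n, ‖p n‖ₑ * ((Fintype.card ι * r : ℝ≥0) : ℝ≥0∞) ^ n < ⊤) {z : ι → ℂ}
    (hz : ∀ i, ‖z i‖₊ < r) (i : ι) :
    ev z (pderiv ℂ i (taylor p e)) = fderiv ℂ f (∑ j, z j • e j) (e i) := by
  classical
  have hball : ∀ z : ι → ℂ, (∀ i, ‖z i‖₊ ≤ r) → ∑ j, z j • e j ∈ Metric.eball (0 : E) R := by
    intro z hz
    rw [Metric.mem_eball, edist_zero_right]
    refine lt_of_le_of_lt ?_ hrR
    rw [enorm_eq_nnnorm, coe_le_coe]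
    refine (nnnorm_sum_le _ _).trans ((Finset.sum_le_card_nsmul _ _ r fun j _ => ?_).trans_eq ?_)
    · rw [nnnorm_smul]
      exact (mul_le_of_le_one_right zero_le (show ‖e j‖₊ ≤ 1 from he j)).trans (hz j)
    · rw [nsmul_eq_mul, Finset.card_univ]
  have hupd : ∀ w, ∑ j, Function.update z i w j • e j = ∑ j, z j • e j + (w - z i) • e i := by
    intro w
    rw [← sub_eq_iff_eq_add', ← sum_sub_distrib, sum_eq_single i]
    · rw [Function.update_self, sub_smul]
    · intro j _ hj
      rw [Function.update_of_ne hj, sub_self]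
    · simp
  rw [ev_pderiv ((nrm_taylor_le he r).trans_lt hr) hz]
  have h1 : (fun w => ev (Function.update z i w) (taylor p e)) =ᶠ[𝓝 (z i)]
      fun w => f (∑ j, z j • e j + (w - z i) • e i) := by
    filter_upwards [(isOpen_lt continuous_nnnorm continuous_const).mem_nhds (hz i)] with w hw
    have hw' : ∀ j, ‖Function.update z i w j‖₊ ≤ r := fun j => by
      by_cases hj : j = i
      · subst hj; rw [Function.update_self]; exact le_of_lt hw
      · rw [Function.update_of_ne hj]; exact (hz j).le
    rw [ev_taylor he hr hw', ← hupd, (hf.hasSum (hball _ hw')).tsum_eq, zero_add]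
  have h2 : HasFDerivAt f (fderiv ℂ f (∑ j, z j • e j)) (∑ j, z j • e j + (z i - z i) • e i) := by
    rw [sub_self, zero_smul, add_zero]
    exact (hf.analyticAt_of_mem (hball z fun j => (hz j).le)).differentiableAt.hasFDerivAt
  have h3 : HasDerivAt (fun w => ∑ j, z j • e j + (w - z i) • e i) (e i) (z i) := by
    simpa using (((hasDerivAt_id (z i)).sub_const (z i)).smul_const (e i)).const_add
      (∑ j, z j • e j)
  rw [h1.deriv_eq]
  exact (h2.comp_hasDerivAt (z i) h3).deriv

theorem atZero_taylor {σ : Type*} [Fintype σ] {e e' : Option σ → E}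
    (h : ∀ j, e (some j) = e' (some j)) : atZero σ (taylor p e) = atZero σ (taylor p e') := by
  ext1 β
  rw [coeff_atZero, coeff_atZero, taylor, taylor, coeff_ofCoeff, coeff_ofCoeff]
  refine tsum_congr fun x => ?_
  congr 1
  funext k
  rcases hk : x.1.2 k with _ | j
  · have h1 : (∑ k, single (x.1.2 k) 1 : Option σ →₀ ℕ) none = 0 :=
      (DFunLike.congr_fun x.2 none).trans (Finsupp.optionElim_apply_none _ _)
    rw [Finsupp.finsetSum_apply, Finset.sum_eq_zero_iff] at h1
    simpa [hk] using h1 k (mem_univ k)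
  · simp only [Function.comp_apply, hk, h]

theorem atZero_pderiv {σ : Type*} (j : σ) (h : MvPowerSeries (Option σ) ℂ) :
    atZero σ (pderiv ℂ (some j) h) = pderiv ℂ j (atZero σ h) := by
  ext1 β
  have : (β + single j 1).optionElim 0 = β.optionElim 0 + single (some j) 1 := by
    classical
    ext i
    cases i <;> simp [Finsupp.single_apply]
  rw [coeff_atZero, coeff_pderiv, coeff_pderiv, coeff_atZero, this, Finsupp.optionElim_apply_some]

end Taylor

/-- If the critical points of the slices of `f` are critical points of `f` and the critical point
of the central slice is isolated, then nearby slices have at most one critical point. -/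
theorem exists_forall_slice_critical_eq {A : Type*} [NormedAddCommGroup A] [NormedSpace ℂ A] {m : ℕ}
    {f : A × (Fin m → ℂ) → ℂ} (hf : AnalyticAt ℂ f 0)
    (hiso : ∀ᶠ z in 𝓝 (0 : A × (Fin m → ℂ)), z.1 = 0 →
      (∀ j, fderiv ℂ f z (0, Pi.single j 1) = 0) → z = 0)
    (hjac : ∀ᶠ z in 𝓝 (0 : A × (Fin m → ℂ)),
      (∀ j, fderiv ℂ f z (0, Pi.single j 1) = 0) → fderiv ℂ f z = 0) :
    ∃ ε > 0, ∀ x : A, ‖x‖ < ε → ∃ c, ∀ w, ‖w‖ < ε →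
      (∀ j, fderiv ℂ f (x, w) (0, Pi.single j 1) = 0) → w = c := by
  obtain ⟨p, R, hp⟩ := hf
  obtain ⟨δ, hδ, hball⟩ := Metric.eventually_nhds_iff.mp (hiso.and hjac)
  obtain ⟨r₁, hr₁, hr₁R⟩ := ENNReal.lt_iff_exists_nnreal_btwn.mp (lt_min hp.r_pos
    (ENNReal.ofReal_pos.mpr hδ))
  obtain ⟨hR, hr₁δ⟩ := lt_min_iff.mp hr₁R
  have hr₁0 : 0 < r₁ := ENNReal.coe_pos.mp hr₁
  replace hr₁δ : (r₁ : ℝ) < δ := by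
    rw [← ENNReal.ofReal_coe_nnreal] at hr₁δ
    exact (ENNReal.ofReal_lt_ofReal_iff hδ).mp hr₁δ
  have hcard : (0 : ℝ≥0) < Fintype.card (Option (Fin m)) := by exact_mod_cast Fintype.card_pos
  obtain ⟨r₀, hr₀⟩ : ∃ r₀ : ℝ≥0, Fintype.card (Option (Fin m)) * r₀ = r₁ :=
    ⟨r₁ / Fintype.card (Option (Fin m)), mul_div_cancel₀ _ hcard.ne'⟩
  have hr₀0 : 0 < r₀ := pos_of_mul_pos_right (hr₀ ▸ hr₁0) zero_le
  have hr₀₁ : r₀ ≤ r₁ := hr₀ ▸ le_mul_of_one_le_left zero_le (by exact_mod_cast Fintype.card_pos)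
  have hT : ∑' n, ‖p n‖ₑ * ((Fintype.card (Option (Fin m)) * r₀ : ℝ≥0) : ℝ≥0∞) ^ n < ⊤ := by
    rw [hr₀]
    have h1 := p.summable_nnnorm_mul_pow (hR.trans_le hp.r_le)
    have h2 := ENNReal.tsum_coe_ne_top_iff_summable.mpr h1
    exact lt_top_iff_ne_top.mpr (by simpa [enorm_eq_nnnorm] using h2)
  let e : A → Option (Fin m) → A × (Fin m → ℂ) := fun a => opt (a, 0) fun j => (0, Pi.single j 1)
  have he : ∀ a, ‖a‖ ≤ 1 → ∀ i, ‖e a i‖ ≤ 1 := fun a ha i => by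
    rcases i with _ | j
    · simpa [e, opt] using ha
    · simp [e, opt, Pi.norm_single]
  have hsum : ∀ a τ z, ∑ i, opt τ z i • e a i = (τ • a, z) := fun a τ z => by
    rw [Fintype.sum_option]
    simp only [e, opt, Option.elim_none, Option.elim_some]
    ext i
    · simp [Prod.fst_sum]
    · simp [Prod.snd_sum, Finset.sum_apply, Pi.single_apply]
  let h : A → MvPowerSeries (Option (Fin m)) ℂ := fun a => taylor p (e a)
  have hr : 0 < r₀ / 2 := half_pos hr₀0
  have hlt : r₀ / 2 < r₀ := half_lt_self hr₀0
  have hev : ∀ a, ‖a‖ ≤ 1 → ∀ (τ : ℂ) (z : Fin m → ℂ), ‖τ‖₊ ≤ r₀ / 2 →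
      (∀ i, ‖z i‖₊ ≤ r₀ / 2) → ∀ i,
      ev (opt τ z) (pderiv ℂ i (h a)) = fderiv ℂ f (τ • a, z) (e a i) := by
    intro a ha τ z hτ hz i
    rw [← hsum a τ z]
    refine ev_pderiv_taylor hp (he a ha) (by rwa [hr₀]) hT (fun i => ?_) i
    rcases i with _ | j
    · exact hτ.trans_lt hlt
    · exact (hz j).trans_lt hlt
  have hmem : ∀ a, ‖a‖ ≤ 1 → ∀ (τ : ℂ) (z : Fin m → ℂ), ‖τ‖₊ ≤ r₀ / 2 →
      (∀ i, ‖z i‖₊ ≤ r₀ / 2) → dist ((τ • a, z) : A × (Fin m → ℂ)) 0 < δ := by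
    intro a ha τ z hτ hz
    rw [dist_zero_right]
    refine lt_of_le_of_lt ?_ ((NNReal.coe_le_coe.mpr (hlt.le.trans hr₀₁)).trans_lt hr₁δ)
    refine max_le ?_ ((pi_norm_le_iff_of_nonneg (NNReal.coe_nonneg _)).mpr hz)
    rw [norm_smul]
    exact (mul_le_of_le_one_right (norm_nonneg _) ha).trans hτ
  set T₀ : ℝ≥0∞ := ∑' n, ‖p n‖ₑ * ((Fintype.card (Option (Fin m)) * r₀ : ℝ≥0) : ℝ≥0∞) ^ n with hT₀
  have hnrm : ∀ a, ‖a‖ ≤ 1 → ∀ i,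
      nrm (fun _ => r₀ / 2) (pderiv ℂ i (h a)) ≤ ((T₀.toNNReal / r₀ : ℝ≥0) : ℝ≥0∞) := by
    intro a ha i
    rw [ENNReal.coe_div hr₀0.ne', ENNReal.coe_toNNReal hT.ne, ENNReal.le_div_iff_mul_le
      (Or.inl (ENNReal.coe_pos.mpr hr₀0).ne') (Or.inl ENNReal.coe_ne_top)]
    exact (nrm_pderiv_mul_le i r₀ _).trans (nrm_taylor_le (he a ha) r₀)
  have hconst : ∀ s : ℝ≥0, (opt s fun _ : Fin m => s) = fun _ => s :=
    fun s => funext fun i => by cases i <;> rfl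
  have hat : ∀ a j, atZero (Fin m) (pderiv ℂ (some j) (h a)) =
      pderiv ℂ j (atZero (Fin m) (h 0)) := fun a j => by
    rw [atZero_pderiv]
    exact congrArg _ (atZero_taylor fun _ => rfl)
  have h01 : ‖(0 : A)‖ ≤ 1 := by simp
  have hg0 : ∀ j, pderiv ℂ j (atZero (Fin m) (h 0)) ∈ conv fun _ => r₀ / 2 := fun j => by
    rw [← hat 0, mem_conv]
    refine (nrm_atZero_le (r₀ / 2) _ _).trans_lt ?_
    rw [hconst]
    exact (hnrm 0 h01 _).trans_lt coe_lt_top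
  have hrad := X_mem_radical_of_isolated (Fin m) (fun j => pderiv ℂ j (atZero (Fin m) (h 0)))
    (r₀ / 2) hr hg0 fun z hz hk => by
      have h0 : ‖(0 : ℂ)‖₊ ≤ r₀ / 2 := by simp
      have := (hball (hmem 0 h01 0 z h0 hz)).1 (smul_zero _) fun j => by
        refine (hev 0 h01 0 z h0 hz (some j)).symm.trans ?_
        rw [ev_opt_zero, hat]
        exact hk j
      exact congrArg Prod.snd this
  obtain ⟨N, hN⟩ := exists_pow_mem_of_mem_radical hrad
  obtain ⟨N', hN'⟩ := Ideal.exists_pow_le_of_le_radical_of_fg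
    (I := maxId m ℂ) (J := jac (atZero (Fin m) (h 0)))
    (Ideal.span_le.mpr (Set.range_subset_iff.mpr hrad)) 
    (Submodule.fg_span (Set.finite_range _))
  obtain ⟨d, b, hb, η, ρ, hη, hηr, hρ, hρr, hdiv⟩ := exists_hasDivision hr hg0 hN (T₀.toNNReal / r₀)
  refine ⟨min (η / 2) ρ, lt_min (half_pos hη) hρ, fun x hx => ?_⟩
  set τ : ℂ := (((η / 2 : ℝ≥0) : ℝ) : ℂ) with hτ
  have hτn : ‖τ‖₊ = η / 2 := by
    rw [hτ]; ext; simp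
  have hη2 : (0 : ℝ≥0) < η / 2 := half_pos hη
  have hτ0 : τ ≠ 0 := fun h0 => hη2.ne' (by rw [← hτn, h0, nnnorm_zero])
  have ha : ‖τ⁻¹ • x‖ ≤ 1 := by
    rw [norm_smul, norm_inv, ← coe_nnnorm τ, hτn, inv_mul_le_one₀ (NNReal.coe_pos.mpr hη2)]
    exact (hx.trans_le (min_le_left _ _)).le
  set a := τ⁻¹ • x with hadef
  have hτa : τ • a = x := smul_inv_smul₀ hτ0 x
  have hatz : atZero (Fin m) (h a) = atZero (Fin m) (h 0) := atZero_taylor fun _ => rfl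
  have hconv : ∀ i, pderiv ℂ i (h a) ∈ conv (opt η fun _ : Fin m => ρ) := fun i =>
    (nrm_opt_le_const hηr hρr _).trans_lt ((hnrm a ha i).trans_lt coe_lt_top)
  obtain ⟨c, hc⟩ := HasDivision.exists_forall_eq_of_ev_eq_zero (h := h a) hη hρ
    (hatz ▸ hb) (hatz ▸ hN') (hdiv _ (hat a) fun k => hnrm a ha _) (fun _ => hconv _) (hconv _)
    (fun τ z hτ hz hk => by
      have hτ' := hτ.le.trans hηr
      have hz' := fun i => (hz i).trans hρr
      rw [hev a ha τ z hτ' hz', (hball (hmem a ha τ z hτ' hz')).2 fun j =>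
        (hev a ha τ z hτ' hz' (some j)).symm.trans (hk j)]
      rfl) (τ := τ) (hτn.trans_lt (half_lt_self hη))
  refine ⟨c, fun w hw hcrit => ?_⟩
  have hwρ : ∀ i, ‖w i‖₊ ≤ ρ := fun i =>
    (norm_le_pi_norm w i).trans (hw.trans_le (min_le_right _ _)).le
  refine hc w hwρ fun j => ?_
  rw [hev a ha τ w (hτn.trans_le ((half_le_self zero_le).trans hηr)) fun i => (hwρ i).trans hρr, hτa]
  exact hcrit j

end NonSplit

/- STATEMENT 6: under central isolation and the Jacobian set equality near 0,
there is an open neighborhood W ⊆ U of 0 such that each p ∈ Σf ∩ W is the unique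
point z ∈ W with z' = p' and ∂f/∂z_j(z) = 0 for all s ≤ j ≤ n; i.e., each nearby
slice function has exactly one critical point in W, and it lies on Σf. -/
theorem stmt_6 (n s : ℕ) (hn : 1 ≤ n) (hs : s ≤ n)
    (U : Set (Csp n s)) (hU : IsOpen U) (h0U : (0 : Csp n s) ∈ U)
    (f : Csp n s → ℂ) (hf : ∀ z ∈ U, AnalyticAt ℂ f z)
    (h0crit : (0 : Csp n s) ∈ SigmaF n s f U)
    (hiso : CentralIsolation n s f U)
    (hjac : JacobianEq n s f U) :
    ∃ W : Set (Csp n s), IsOpen W ∧ (0 : Csp n s) ∈ W ∧ W ⊆ U ∧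
      ∀ p ∈ SigmaF n s f U ∩ W,
        PartialsVanish n s f p ∧
        ∀ z ∈ W, z.1 = p.1 → PartialsVanish n s f z → z = p := by
  obtain ⟨V, hV, h0V, hVz⟩ := hiso
  obtain ⟨V', hV', h0V', hV'U, hVeq⟩ := hjac
  obtain ⟨ε, hε, H⟩ := NonSplit.exists_forall_slice_critical_eq (hf 0 h0U)
    (by
      filter_upwards [hU.mem_nhds h0U, hV.mem_nhds h0V] with z h1 h2 h3 h4
      exact hVz z ⟨h1, h2⟩ h3 h4)
    (by
      filter_upwards [hV'.mem_nhds h0V'] with z h1 h2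
      have h3 : z ∈ SigmaF n s f U ∩ V' := hVeq ▸ ⟨h1, h2⟩
      exact h3.1.2)
  refine ⟨U ∩ Metric.ball 0 ε, hU.inter Metric.isOpen_ball, ⟨h0U, Metric.mem_ball_self hε⟩,
    Set.inter_subset_left, ?_⟩
  rintro p ⟨hp, -, hpε⟩
  have hpv : PartialsVanish n s f p := fun j => by rw [hp.2]; rfl
  refine ⟨hpv, ?_⟩
  rintro z ⟨-, hzε⟩ hz hzv
  rw [mem_ball_zero_iff] at hpε hzε
  obtain ⟨c, hc⟩ := H p.1 ((norm_fst_le p).trans_lt hpε)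
  have h1 := hc p.2 ((norm_snd_le p).trans_lt hpε) hpv
  have h2 := hc z.2 ((norm_snd_le z).trans_lt hzε) fun j => hz ▸ hzv j
  exact Prod.ext hz (h2.trans h1.symm)
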